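/- For every prime p with p ≥ 5, the gap to the next prime satisfies g(p) < p/(log p - 1.1), where g(p) = q - p and q is the next prime after p. -/

import Mathlib

namespace PrimeGap

section

open Filter Topology Complex Metric

/-! ### The Hadamard factorisation of entire functions of order one -/

/-- Divide out a zero of an entire function. -/
theorem exists_eq_pow_mul {f : ℂ → ℂ} (hf : Differentiable ℂ f) (h0 : ∃ w, f w ≠ 0) (a : ℂ) :
    ∃ g : ℂ → ℂ, Differentiable ℂ g ∧ g a ≠ 0 ∧
      ∀ w, f w = (w - a) ^ analyticOrderNatAt f a * g w := by
  have hA : AnalyticAt ℂ f a := hf.analyticAt a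
  have htop : analyticOrderAt f a ≠ ⊤ := by
    obtain ⟨w, hw⟩ := h0
    refine AnalyticOnNhd.analyticOrderAt_ne_top_of_isPreconnected (x := w) (U := Set.univ)
      (fun z _ => hf.analyticAt z) isPreconnected_univ (Set.mem_univ _) (Set.mem_univ _) ?_
    rw [(hf.analyticAt w).analyticOrderAt_eq_zero.2 hw]
    simp
  obtain ⟨g, hg, hga, hfg⟩ := (hA.analyticOrderNatAt_eq_iff htop).1 rfl
  set n := analyticOrderNatAt f a
  classical
  set G : ℂ → ℂ := fun w => if w = a then g a else f w / (w - a) ^ n with hG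
  have hGg : G =ᶠ[𝓝 a] g := by
    filter_upwards [hfg] with w hw
    by_cases hwa : w = a
    · simp [hG, hwa]
    · have : w - a ≠ 0 := sub_ne_zero.2 hwa
      simp only [hG, hwa, if_false, hw, smul_eq_mul]
      field_simp
  refine ⟨G, fun w => ?_, by simpa [hG] using hga, fun w => ?_⟩
  · by_cases hwa : w = a
    · subst hwa
      exact hg.differentiableAt.congr_of_eventuallyEq hGg
    · have : w - a ≠ 0 := sub_ne_zero.2 hwa
      have h1 : DifferentiableAt ℂ (fun w => f w / (w - a) ^ n) w :=
        (hf w).div (by fun_prop) (pow_ne_zero _ this)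
      refine h1.congr_of_eventuallyEq ?_
      filter_upwards [isOpen_ne.mem_nhds hwa] with z hz
      simp [hG, hz]
  · by_cases hwa : w = a
    · subst hwa
      have := hfg.self_of_nhds
      simpa [hG] using this
    · have : w - a ≠ 0 := sub_ne_zero.2 hwa
      simp only [hG, hwa, if_false]
      field_simp

/-- Divide out finitely many zeros of an entire function. -/
theorem exists_eq_prod_mul {f : ℂ → ℂ} (hf : Differentiable ℂ f) (h0 : ∃ w, f w ≠ 0)
    (S : Finset ℂ) : ∃ g : ℂ → ℂ, Differentiable ℂ g ∧ (∀ a ∈ S, g a ≠ 0) ∧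
      ∀ w, f w = (∏ a ∈ S, (w - a) ^ analyticOrderNatAt f a) * g w := by
  classical
  induction S using Finset.induction_on with
  | empty => exact ⟨f, hf, by simp, by simp⟩
  | insert b S hb ih =>
    obtain ⟨g, hg, hgS, hfg⟩ := ih
    have hg0 : ∃ w, g w ≠ 0 := by
      obtain ⟨w, hw⟩ := h0
      exact ⟨w, fun h => hw (by rw [hfg, h, mul_zero])⟩
    obtain ⟨k, hk, hkb, hgk⟩ := exists_eq_pow_mul hg hg0 b
    have hP : Differentiable ℂ fun w : ℂ => ∏ a ∈ S, (w - a) ^ analyticOrderNatAt f a := by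
      fun_prop
    have hPb : ∏ a ∈ S, (b - a) ^ analyticOrderNatAt f a ≠ 0 :=
      Finset.prod_ne_zero_iff.2 fun a ha => pow_ne_zero _ (sub_ne_zero.2 fun h => hb (h ▸ ha))
    have hord : analyticOrderNatAt f b = analyticOrderNatAt g b := by
      have e : f = (fun w : ℂ => ∏ a ∈ S, (w - a) ^ analyticOrderNatAt f a) * g := funext hfg
      unfold analyticOrderNatAt
      conv_lhs => rw [e]
      rw [analyticOrderAt_mul (hP.analyticAt b) (hg.analyticAt b),
        (hP.analyticAt b).analyticOrderAt_eq_zero.2 hPb, zero_add]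
    refine ⟨k, hk, fun a ha => ?_, fun w => ?_⟩
    · rcases Finset.mem_insert.1 ha with rfl | ha
      · exact hkb
      · intro h
        exact hgS a ha (by rw [hgk, h, mul_zero])
    · rw [Finset.prod_insert hb, hfg w, hgk w, hord]
      ring

theorem finite_zeros {f : ℂ → ℂ} (hf : Differentiable ℂ f) (h0 : ∃ w, f w ≠ 0) (r : ℝ) :
    (closedBall (0 : ℂ) r ∩ {w | f w = 0}).Finite := by
  obtain ⟨w, hw⟩ := h0
  have h := AnalyticOnNhd.preimage_zero_mem_codiscrete (x := w)
    (fun z (_ : z ∈ Set.univ) => hf.analyticAt z) hw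
  have h2 := mem_codiscrete'.1 h
  have : {w | f w = 0} = (f ⁻¹' {0}ᶜ)ᶜ := by ext; simp
  rw [this]
  exact ((isCompact_closedBall 0 r).inter_right h2.1.isClosed_compl).finite
    (h2.2.mono Set.inter_subset_right)

open Classical in
/-- The zeros of an entire function in a closed ball around the origin. -/
noncomputable def zerosIn (f : ℂ → ℂ) (r : ℝ) : Finset ℂ :=
  if h : (closedBall (0 : ℂ) r ∩ {w | f w = 0}).Finite then h.toFinset else ∅

theorem mem_zerosIn {f : ℂ → ℂ} (hf : Differentiable ℂ f) (h0 : ∃ w, f w ≠ 0) {r : ℝ} {w : ℂ} :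
    w ∈ zerosIn f r ↔ ‖w‖ ≤ r ∧ f w = 0 := by
  simp [zerosIn, finite_zeros hf h0 r]

theorem logDeriv_sub_sum_bound {f : ℂ → ℂ} (hf : Differentiable ℂ f) (heven : ∀ w, f (-w) = f w)
    {w₀ : ℂ} {r M : ℝ} (hr : 0 < r) (hw₀ : ‖w₀‖ ≤ r / 16) (hf0 : f w₀ ≠ 0) (hM : 0 < M)
    (hb : ∀ w, ‖w‖ = 4 * r → ‖f w‖ ≤ ‖f w₀‖ * Real.exp M) :
    (∑ a ∈ zerosIn f r, (analyticOrderNatAt f a : ℝ)) ≤ 2 * M ∧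
    ∀ w, ‖w‖ < r / 16 → f w ≠ 0 →
      ‖logDeriv f w - ∑ a ∈ zerosIn f r, (analyticOrderNatAt f a : ℂ) / (w - a)‖
        ≤ 256 * M * ‖w‖ / r ^ 2 := by
  have h0 : ∃ w, f w ≠ 0 := ⟨w₀, hf0⟩
  obtain ⟨F, hF, hFz, hfF⟩ := exists_eq_prod_mul hf h0 (zerosIn f r)
  set Z := zerosIn f r with hZ
  set m := analyticOrderNatAt f with hm
  set P : ℂ → ℂ := fun w => ∏ a ∈ Z, (w - a) ^ m a with hP
  have hfP : ∀ w, f w = P w * F w := hfF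
  have hZr : ∀ a ∈ Z, ‖a‖ ≤ r := fun a ha => ((mem_zerosIn hf h0).1 ha).1
  have hPw₀ : P w₀ ≠ 0 := fun h => hf0 (by rw [hfP, h, zero_mul])
  have hFw₀ : F w₀ ≠ 0 := fun h => hf0 (by rw [hfP, h, mul_zero])
  have hFne : ∀ w, ‖w‖ ≤ r → F w ≠ 0 := by
    intro w hw h
    have : f w = 0 := by rw [hfP, h, mul_zero]
    exact hFz w ((mem_zerosIn hf h0).2 ⟨hw, this⟩) h
  set N := ∑ a ∈ Z, m a with hN
  have hPlow : ∀ w, ‖w‖ = 4 * r → 2 ^ N * ‖P w₀‖ ≤ ‖P w‖ := by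
    intro w hw
    rw [hN, ← Finset.prod_pow_eq_pow_sum]
    simp only [hP, norm_prod, norm_pow]
    rw [← Finset.prod_mul_distrib]
    refine Finset.prod_le_prod (fun a _ => by positivity) fun a ha => ?_
    rw [← mul_pow]
    refine pow_le_pow_left₀ (by positivity) ?_ _
    have h1 := norm_sub_le w₀ a
    have h2 := norm_sub_norm_le w a
    have h3 := hZr a ha
    linarith
  have hFs : ∀ w, ‖w‖ = 4 * r → ‖F w‖ ≤ ‖F w₀‖ * Real.exp M / 2 ^ N := by
    intro w hw
    have h1 := hPlow w hw
    have h2 := hb w hw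
    rw [hfP, hfP, norm_mul, norm_mul] at h2
    have h3 : 0 < ‖P w₀‖ := norm_pos_iff.2 hPw₀
    rw [le_div_iff₀ (by positivity)]
    have h4 : 2 ^ N * ‖P w₀‖ * ‖F w‖ ≤ ‖P w₀‖ * ‖F w₀‖ * Real.exp M :=
      (mul_le_mul_of_nonneg_right h1 (norm_nonneg _)).trans h2
    have h5 : ‖P w₀‖ * (‖F w‖ * 2 ^ N) ≤ ‖P w₀‖ * (‖F w₀‖ * Real.exp M) := by linarith
    exact le_of_mul_le_mul_left h5 h3
  have hFb : ∀ w, ‖w‖ ≤ 4 * r → ‖F w‖ ≤ ‖F w₀‖ * Real.exp M / 2 ^ N := by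
    intro w hw
    refine Complex.norm_le_of_forall_mem_frontier_norm_le (U := ball 0 (4 * r)) isBounded_ball
      hF.diffContOnCl (fun z hz => hFs z ?_) ?_
    · rw [frontier_ball _ (by positivity)] at hz
      simpa using hz
    · rw [closure_ball _ (by positivity)]
      simpa using hw
  have h2N : (1 : ℝ) ≤ 2 ^ N := one_le_pow₀ (by norm_num)
  have hcount : (N : ℝ) ≤ 2 * M := by
    have h1 := hFb w₀ (by linarith)
    have h3 : 0 < ‖F w₀‖ := norm_pos_iff.2 hFw₀
    rw [le_div_iff₀ (by positivity)] at h1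
    have h2 : (2 : ℝ) ^ N ≤ Real.exp M := le_of_mul_le_mul_left h1 h3
    have h4 := Real.log_le_log (by positivity) h2
    rw [Real.log_pow, Real.log_exp] at h4
    have := Real.log_two_gt_d9
    nlinarith [(Nat.cast_nonneg N : (0 : ℝ) ≤ N)]
  refine ⟨by simpa [hN] using hcount, ?_⟩
  have hFb' : ∀ w, ‖w‖ ≤ 4 * r → ‖F w‖ ≤ ‖F w₀‖ * Real.exp M := fun w hw =>
    (hFb w hw).trans (div_le_self (by positivity) h2N)
  -- a logarithm of `F`
  have hLd : DifferentiableOn ℂ (logDeriv F) (ball 0 r) := by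
    intro w hw
    have : ‖w‖ ≤ r := by simpa using (mem_ball.1 hw).le
    exact ((hF.deriv w).div (hF w) (hFne w this)).differentiableWithinAt
  obtain ⟨G, hG⟩ := hLd.isExactOn_ball.with_val_at w₀ 0
  have hG0 := hG.1
  have hGd := hG.2
  have hw₀r : w₀ ∈ ball (0 : ℂ) r := by simp; linarith
  have hexp : ∀ w ∈ ball (0 : ℂ) r, F w = F w₀ * Complex.exp (G w) := by
    intro w hw
    have hc : ∀ z ∈ ball (0 : ℂ) r, HasDerivAt (fun z => F z * Complex.exp (-G z)) 0 z := by
      intro z hz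
      have h1 := (hF z).hasDerivAt.mul (hGd z hz).neg.cexp
      have h2 : F z ≠ 0 := hFne z (by simpa using (mem_ball.1 hz).le)
      have h3 : deriv F z * cexp ((-G) z) + F z * (cexp ((-G) z) * -logDeriv F z) = 0 := by
        rw [logDeriv_apply]
        field_simp
        ring
      rw [h3] at h1
      exact h1
    have := (convex_ball (0 : ℂ) r).is_const_of_fderivWithin_eq_zero (𝕜 := ℂ)
      (f := fun z => F z * Complex.exp (-G z))
      (fun z hz => (hc z hz).differentiableAt.differentiableWithinAt) (fun z hz => by
        rw [fderivWithin_of_isOpen isOpen_ball hz]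
        have := (hc z hz).hasFDerivAt.fderiv
        rw [this]
        ext
        simp) hw hw₀r
    simp only [hG0, neg_zero, Complex.exp_zero, mul_one] at this
    rw [← this, mul_assoc, ← Complex.exp_add]
    simp
  have hre : ∀ w ∈ ball (0 : ℂ) r, (G w).re ≤ M := by
    intro w hw
    have h1 := hFb' w (by have := mem_ball_zero_iff.1 hw; linarith)
    rw [hexp w hw, norm_mul, Complex.norm_exp] at h1
    have h3 : 0 < ‖F w₀‖ := norm_pos_iff.2 hFw₀
    exact Real.exp_le_exp.1 (le_of_mul_le_mul_left h1 h3)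
  have hsub : ∀ z : ℂ, ‖z‖ < r / 2 → w₀ + z ∈ ball (0 : ℂ) r := by
    intro z hz
    rw [mem_ball_zero_iff]
    have := norm_add_le w₀ z
    linarith
  have hGbound : ∀ z : ℂ, ‖z‖ ≤ r / 4 → ‖G (w₀ + z)‖ ≤ 2 * M := by
    intro z hz
    have h1 := Complex.borelCaratheodory_zero (f := fun z => G (w₀ + z)) (R := r / 2) (M := M)
      (z := z) hM (fun y hy => by
        have hy' := hsub y (by simpa using hy)
        exact ((hGd _ hy').differentiableAt.comp y (by fun_prop)).differentiableWithinAt)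
      (fun y hy => hre _ (hsub y (by simpa using hy))) (by positivity)
      (by simp; linarith) (by simpa using hG0)
    refine h1.trans ?_
    rw [div_le_iff₀ (by linarith)]
    nlinarith [norm_nonneg z]
  have hderiv : ∀ w : ℂ, ‖w‖ < r / 16 → ‖logDeriv F w‖ ≤ 16 * M / r := by
    intro w hw
    have hw2 : ‖w - w₀‖ ≤ r / 8 := by
      have := norm_sub_le w w₀
      linarith
    have hwb : w ∈ ball (0 : ℂ) r := by simp; linarith
    rw [← (hGd w hwb).deriv]
    have hcl : closedBall w (r / 8) ⊆ ball (0 : ℂ) r := by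
      intro z hz
      rw [mem_ball_zero_iff]
      have h1 : ‖z - w‖ ≤ r / 8 := by simpa [dist_eq_norm] using hz
      have h2 := norm_add_le (z - w) w
      simp only [sub_add_cancel] at h2
      linarith
    have h1 := Complex.norm_deriv_le_of_forall_mem_sphere_norm_le (c := w) (R := r / 8)
      (C := 2 * M) (f := G) (by positivity) ?_ ?_
    · refine h1.trans (le_of_eq ?_)
      field_simp
      ring
    · refine DifferentiableOn.diffContOnCl fun z hz => ?_
      rw [closure_ball _ (by positivity)] at hz
      exact (hGd z (hcl hz)).differentiableAt.differentiableWithinAt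
    · intro z hz
      have h2 : ‖z - w‖ = r / 8 := by simpa [dist_eq_norm] using hz
      have := hGbound (z - w₀) (by
        have := norm_add_le (z - w) (w - w₀)
        simp only [sub_add_sub_cancel] at this
        linarith)
      simpa using this
  have hZsymm : ∀ w, f w ≠ 0 → ‖w‖ ≤ r →
      logDeriv F w = logDeriv f w - ∑ a ∈ Z, (m a : ℂ) / (w - a) := by
    intro w hw hwr
    have hPw : P w ≠ 0 := fun h => hw (by rw [hfP, h, zero_mul])
    have hne : ∀ a ∈ Z, w - a ≠ 0 := by
      intro a ha h
      apply hw
      rw [sub_eq_zero.1 h]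
      exact ((mem_zerosIn hf h0).1 ha).2
    have e : f = fun w => P w * F w := funext hfP
    have h1 : logDeriv f w = logDeriv P w + logDeriv F w := by
      rw [e]
      exact logDeriv_mul w hPw (hFne w hwr) (by simp only [hP]; fun_prop) (hF w)
    have h2 : logDeriv P w = ∑ a ∈ Z, (m a : ℂ) / (w - a) := by
      simp only [hP]
      have := logDeriv_prod (𝕜 := ℂ) (𝕜' := ℂ) (s := Z) (f := fun a w => (w - a) ^ m a) (x := w)
        (fun a ha => pow_ne_zero _ (hne a ha)) (fun a _ => by fun_prop)
      rw [show (fun w : ℂ => ∏ a ∈ Z, (w - a) ^ m a) = fun w => ∏ a ∈ Z, (fun a w =>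
          (w - a) ^ m a) a w from rfl]
      rw [this]
      refine Finset.sum_congr rfl fun a ha => ?_
      rw [logDeriv_fun_pow (by fun_prop)]
      simp [logDeriv_apply, div_eq_mul_inv]
    rw [h1, h2]
    ring
  have hmneg : ∀ a, m (-a) = m a := by
    intro a
    have h1 : analyticOrderAt (f ∘ fun w => -w) a = analyticOrderAt f (-a) :=
      analyticOrderAt_comp_of_deriv_ne_zero (by fun_prop) (by simp)
    have h2 : (f ∘ fun w => -w) = f := funext heven
    rw [h2] at h1
    simp [hm, analyticOrderNatAt, h1]
  have hfodd : ∀ w, logDeriv f (-w) = - logDeriv f w := by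
    intro w
    have h2 : f = fun w => f (-w) := funext fun w => (heven w).symm
    have h3 : deriv f (-w) = - deriv f w := by
      conv_rhs => rw [h2]
      rw [deriv_comp_neg]
      simp
    rw [logDeriv_apply, logDeriv_apply, h3, heven, neg_div]
  have hLodd : ∀ w, f w ≠ 0 → ‖w‖ ≤ r → logDeriv F (-w) = - logDeriv F w := by
    intro w hw hwr
    rw [hZsymm w hw hwr, hZsymm (-w) (by rwa [heven]) (by rwa [norm_neg]), hfodd]
    have : ∑ a ∈ Z, (m a : ℂ) / (-w - a) = - ∑ a ∈ Z, (m a : ℂ) / (w - a) := by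
      rw [← Finset.sum_neg_distrib]
      refine Finset.sum_nbij' (fun a => -a) (fun a => -a) ?_ ?_ (by simp) (by simp) ?_
      · intro a ha
        rw [hZ, mem_zerosIn hf h0] at ha ⊢
        simpa [heven] using ha
      · intro a ha
        rw [hZ, mem_zerosIn hf h0] at ha ⊢
        simpa [heven] using ha
      · intro a _
        rw [hmneg, ← div_neg]
        congr 1
        ring
    rw [this]
    ring
  have hL0 : logDeriv F 0 = 0 := by
    have hc : ContinuousAt (logDeriv F) 0 :=
      (hLd.differentiableAt (isOpen_ball.mem_nhds (by simp [hr]))).continuousAt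
    have hev : ∀ᶠ w in 𝓝[≠] (0 : ℂ), f w ≠ 0 := by
      rcases (hf.analyticAt 0).eventually_eq_zero_or_eventually_ne_zero with h | h
      · exfalso
        have := AnalyticOnNhd.eq_of_eventuallyEq (f := f) (g := fun _ => 0)
          (fun z _ => hf.analyticAt z) (fun z _ => analyticAt_const) (z₀ := 0) h
        exact hf0 (congrFun this w₀)
      · exact h
    have hev2 : ∀ᶠ w in 𝓝[≠] (0 : ℂ), ‖w‖ ≤ r :=
      nhdsWithin_le_nhds (by
        filter_upwards [closedBall_mem_nhds (0 : ℂ) hr] with w hw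
        simpa using hw)
    have t1 : Tendsto (fun w => logDeriv F w) (𝓝[≠] 0) (𝓝 (logDeriv F 0)) :=
      hc.tendsto.mono_left nhdsWithin_le_nhds
    have t2 : Tendsto (fun w : ℂ => logDeriv F (-w)) (𝓝[≠] 0) (𝓝 (logDeriv F 0)) := by
      have : ContinuousAt (fun w : ℂ => logDeriv F (-w)) 0 := by
        refine ContinuousAt.comp (g := logDeriv F) (f := fun w : ℂ => -w) ?_ (by fun_prop)
        simpa using hc
      simpa using this.tendsto.mono_left nhdsWithin_le_nhds
    have t3 := t2.congr' (by filter_upwards [hev, hev2] with w h1 h2 using hLodd w h1 h2)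
    have := tendsto_nhds_unique t3 t1.neg
    have h4 : (2 : ℂ) * logDeriv F 0 = 0 := by linear_combination this
    simpa using h4
  intro w hw hfw
  rw [← hZsymm w hfw (by linarith)]
  have hsubset : ball (0 : ℂ) (r / 16) ⊆ ball 0 r := ball_subset_ball (by linarith)
  have h1 := Complex.dist_le_div_mul_dist_of_mapsTo_ball (f := logDeriv F) (c := 0) (R₁ := r / 16)
    (R₂ := 16 * M / r) (z := w) (hLd.mono hsubset) (fun z hz => by
      rw [hL0, mem_closedBall_zero_iff]
      exact hderiv z (by simpa using hz)) (by simpa using hw)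
  rw [hL0, dist_zero_right, dist_zero_right] at h1
  refine h1.trans (le_of_eq ?_)
  field_simp
  ring

end

section

open Filter Topology Complex MeasureTheory Set

/-! ### The completed zeta function recentred at the critical line -/

theorem norm_mellin_le_of_re_mem {f : ℝ → ℂ} (hc : ∀ s, MellinConvergent f s) (a b : ℝ) :
    ∃ C, ∀ s : ℂ, a ≤ s.re → s.re ≤ b → ‖mellin f s‖ ≤ C := by
  have hn : ∀ s : ℂ, IntegrableOn (fun t : ℝ => t ^ (s.re - 1) * ‖f t‖) (Ioi 0) := fun s => by
    have h : IntegrableOn (fun t : ℝ => ‖(t : ℂ) ^ (s - 1) • f t‖) (Ioi 0) := (hc s).norm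
    refine h.congr_fun (fun t ht => ?_) measurableSet_Ioi
    simp only [norm_smul]
    rw [norm_cpow_eq_rpow_re_of_pos ht]; simp
  refine ⟨∫ t in Ioi (0 : ℝ), (t ^ (a - 1) * ‖f t‖ + t ^ (b - 1) * ‖f t‖), fun s ha hb => ?_⟩
  have h1 := hn (a : ℂ)
  have h2 := hn (b : ℂ)
  simp only [ofReal_re] at h1 h2
  rw [mellin]
  refine norm_integral_le_of_norm_le (h1.add h2) ?_
  refine (ae_restrict_iff' measurableSet_Ioi).2 (Eventually.of_forall fun t (ht : 0 < t) => ?_)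
  rw [norm_smul, norm_cpow_eq_rpow_re_of_pos ht, ← add_mul]
  refine mul_le_mul_of_nonneg_right ?_ (norm_nonneg _)
  have p1 : 0 < t ^ (a - 1) := Real.rpow_pos_of_pos ht _
  have p2 : 0 < t ^ (b - 1) := Real.rpow_pos_of_pos ht _
  simp only [sub_re, one_re]
  rcases le_total t 1 with h | h
  · have := Real.rpow_le_rpow_of_exponent_ge ht h (sub_le_sub_right ha 1)
    linarith
  · have := Real.rpow_le_rpow_of_exponent_le h (sub_le_sub_right hb 1)
    linarith

theorem norm_completedRiemannZeta₀_le_of_re_mem (a b : ℝ) :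
    ∃ C, ∀ s : ℂ, a ≤ s.re → s.re ≤ b → ‖completedRiemannZeta₀ s‖ ≤ C := by
  let P := HurwitzZeta.hurwitzEvenFEPair 0
  have hc : ∀ s, MellinConvergent P.f_modif s := fun s =>
    mellinConvergent_of_isBigO_rpow P.hf_modif_int
      (P.isStrongFEPair_toStrongFEPair.hf_top (-(s.re + 1))) (by linarith)
      (P.isStrongFEPair_toStrongFEPair.hf_zero (-(s.re - 1))) (by linarith)
  obtain ⟨C, hC⟩ := norm_mellin_le_of_re_mem hc (a / 2) (b / 2)
  refine ⟨C / 2, fun s h1 h2 => ?_⟩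
  have : completedRiemannZeta₀ s = mellin P.f_modif (s / 2) / 2 := rfl
  rw [this, norm_div]
  have h3 : (s / 2).re = s.re / 2 := by simp
  have := hC (s / 2) (by rw [h3]; linarith) (by rw [h3]; linarith)
  simpa using div_le_div_of_nonneg_right this (by norm_num : (0:ℝ) ≤ 2)

theorem norm_Gamma_le_Gamma_re {s : ℂ} (hs : 0 < s.re) : ‖Gamma s‖ ≤ Real.Gamma s.re := by
  rw [Gamma_eq_integral hs, GammaIntegral, Real.Gamma_eq_integral hs]
  refine norm_integral_le_of_norm_le (Real.GammaIntegral_convergent hs) ?_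
  refine (ae_restrict_iff' measurableSet_Ioi).2 (Eventually.of_forall fun t (ht : 0 < t) => ?_)
  rw [norm_mul, norm_cpow_eq_rpow_re_of_pos ht]
  simp [norm_exp]

theorem Gamma_le_exp {x : ℝ} (hx : 1 ≤ x) : Real.Gamma x ≤ Real.exp (8 * (x * √x)) := by
  have hx0 : 0 < x := by linarith
  set n := ⌈x⌉₊ with hn
  have hxn : x ≤ n := Nat.le_ceil x
  have hn0 : (0 : ℝ) < n := by linarith
  have hnx : (n : ℝ) ≤ 2 * x := by linarith [Nat.ceil_lt_add_one hx0.le]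
  have hG : 0 < Real.Gamma x := Real.Gamma_pos_of_pos hx0
  have h1 : Real.Gamma x ≤ n.factorial := by
    have h2 : Real.Gamma x ≤ Real.Gamma (x + 1) := by
      rw [Real.Gamma_add_one hx0.ne']; nlinarith
    refine h2.trans ?_
    rw [← Real.Gamma_nat_eq_factorial]
    exact Real.Gamma_strictMonoOn_Ici.monotoneOn (by simp; linarith) (by simp; linarith)
      (by linarith)
  have h3 : (n.factorial : ℝ) ≤ (n : ℝ) ^ n := by exact_mod_cast Nat.factorial_le_pow n
  have h4 : (n : ℝ) ^ n = Real.exp (n * Real.log n) := by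
    rw [mul_comm, ← Real.rpow_def_of_pos hn0, Real.rpow_natCast]
  refine (h1.trans h3).trans ?_
  rw [h4]
  refine Real.exp_le_exp.2 ?_
  have hs : 0 < √x := Real.sqrt_pos.2 hx0
  have h5 : Real.log n ≤ 4 * √x := by
    have : Real.log n ≤ Real.log ((2 * √x) ^ 2) := by
      refine Real.log_le_log hn0 ?_
      rw [mul_pow, Real.sq_sqrt hx0.le]; linarith
    rw [Real.log_pow] at this
    have h6 := Real.log_le_sub_one_of_pos (show 0 < 2 * √x by positivity)
    push_cast at this
    linarith
  calc (n : ℝ) * Real.log n ≤ 2 * x * (4 * √x) :=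
        mul_le_mul hnx h5 (Real.log_nonneg (by linarith)) (by linarith)
    _ = _ := by ring

theorem norm_tsum_one_div_cpow_le {s : ℂ} (hs : 2 ≤ s.re) :
    ‖∑' n : ℕ, 1 / (n : ℂ) ^ s‖ ≤ ∑' n : ℕ, 1 / (n : ℝ) ^ 2 := by
  have hsum : Summable fun n : ℕ => 1 / (n : ℝ) ^ 2 := Real.summable_one_div_nat_pow.2 (by norm_num)
  refine tsum_of_norm_bounded hsum.hasSum fun n => ?_
  rcases Nat.eq_zero_or_pos n with rfl | hn
  · have : s ≠ 0 := fun h => by norm_num [h] at hs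
    simp [this]
  · rw [norm_div, norm_one, norm_natCast_cpow_of_pos hn]
    refine one_div_le_one_div_of_le (by positivity) ?_
    rw [← Real.rpow_natCast]
    exact Real.rpow_le_rpow_of_exponent_le (by exact_mod_cast hn) (by simpa using hs)

/-- The entire function `s (s - 1) Λ(s)`, recentred at the point `1 / 2`. -/
noncomputable def xiHalf (w : ℂ) : ℂ := (w ^ 2 - 1 / 4) * completedRiemannZeta₀ (1 / 2 + w) + 1

theorem differentiable_xiHalf : Differentiable ℂ xiHalf := by
  have := differentiable_completedZeta₀
  unfold xiHalf
  fun_prop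

theorem xiHalf_neg (w : ℂ) : xiHalf (-w) = xiHalf w := by
  unfold xiHalf
  rw [← completedRiemannZeta₀_one_sub (1 / 2 + w)]
  ring_nf

theorem xiHalf_half : xiHalf (1 / 2) = 1 := by
  unfold xiHalf; norm_num

theorem xiHalf_eq {w : ℂ} (h1 : w ≠ 1 / 2) (h2 : w ≠ -1 / 2) :
    xiHalf w = (w ^ 2 - 1 / 4) * completedRiemannZeta (1 / 2 + w) := by
  have h3 : w - 1 / 2 ≠ 0 := sub_ne_zero.2 h1
  have h4 : 1 / 2 + w ≠ 0 := fun h => h2 (by linear_combination h)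
  have h5 : 1 - (1 / 2 + w) ≠ 0 := fun h => h1 (by linear_combination -h)
  have h6 : (w ^ 2 - 1 / 4) = -(1 / 2 + w) * (1 - (1 / 2 + w)) := by ring
  rw [completedRiemannZeta_eq, xiHalf, h6]
  generalize 1 / 2 + w = s at h4 h5
  linear_combination -(1 - s) * mul_inv_cancel₀ h4 - s * mul_inv_cancel₀ h5

theorem exists_norm_xiHalf_le :
    ∃ C > 0, ∀ w : ℂ, 1 ≤ ‖w‖ → ‖xiHalf w‖ ≤ Real.exp (C * (‖w‖ * √‖w‖)) := by
  obtain ⟨A, hA⟩ := norm_completedRiemannZeta₀_le_of_re_mem (1 / 2) 2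
  set B := ∑' n : ℕ, 1 / (n : ℝ) ^ 2 with hB
  have hB0 : 0 ≤ B := tsum_nonneg fun n => by positivity
  set D := max A 0 + B + 2 with hD
  have hD2 : 2 ≤ D := by have := le_max_right A 0; linarith
  have key : ∀ s : ℂ, 1 / 2 ≤ s.re →
      ‖completedRiemannZeta₀ s‖ ≤ D * Real.exp (8 * ((‖s‖) * √(‖s‖))) := by
    intro s hs
    have hE : 1 ≤ Real.exp (8 * (‖s‖ * √‖s‖)) := Real.one_le_exp (by positivity)
    rcases le_total s.re 2 with h2 | h2
    · calc ‖completedRiemannZeta₀ s‖ ≤ A := hA s hs h2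
        _ ≤ D := by have := le_max_left A 0; linarith
        _ ≤ _ := le_mul_of_one_le_right (by linarith) hE
    · have hsn : 2 ≤ ‖s‖ := h2.trans (re_le_norm s)
      have e1 : completedRiemannZeta₀ s = completedRiemannZeta s + 1 / s + 1 / (1 - s) := by
        rw [completedRiemannZeta_eq]; ring
      have e2 : ‖1 / s‖ ≤ 1 := by
        rw [norm_div, norm_one]; exact (div_le_one (by linarith)).2 (by linarith)
      have e3 : ‖1 / (1 - s)‖ ≤ 1 := by
        rw [norm_div, norm_one]
        have : 1 ≤ ‖1 - s‖ := by
          rw [norm_sub_rev]; have := norm_sub_norm_le s 1; rw [norm_one] at this; linarith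
        exact (div_le_one (by linarith)).2 this
      have e4 : ‖completedRiemannZeta s‖ ≤ Real.exp (8 * (‖s‖ * √‖s‖)) * B := by
        rw [completedZeta_eq_tsum_of_one_lt_re (by linarith)]
        rw [norm_mul, norm_mul]
        refine mul_le_mul ?_ (norm_tsum_one_div_cpow_le h2) (norm_nonneg _) (by positivity)
        have r2 : (s / 2).re = s.re / 2 := by simp
        have f1 : ‖(Real.pi : ℂ) ^ (-s / 2)‖ ≤ 1 := by
          rw [norm_cpow_eq_rpow_re_of_pos Real.pi_pos]
          refine Real.rpow_le_one_of_one_le_of_nonpos (by linarith [Real.pi_gt_three]) ?_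
          simp; linarith
        have f2 : ‖Gamma (s / 2)‖ ≤ Real.exp (8 * (‖s‖ * √‖s‖)) := by
          refine (norm_Gamma_le_Gamma_re (by rw [r2]; linarith)).trans ?_
          refine (Gamma_le_exp (by rw [r2]; linarith)).trans ?_
          rw [r2]
          have : s.re / 2 ≤ ‖s‖ := by have := re_le_norm s; linarith
          gcongr
        calc _ ≤ 1 * Real.exp (8 * (‖s‖ * √‖s‖)) :=
              mul_le_mul f1 f2 (norm_nonneg _) zero_le_one
          _ = _ := one_mul _
      rw [e1]
      have := (norm_add_le (completedRiemannZeta s + 1 / s) (1 / (1 - s)))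
      have := norm_add_le (completedRiemannZeta s) (1 / s)
      have : 0 ≤ max A 0 := le_max_right _ _
      nlinarith
  have key2 : ∀ w : ℂ, 0 ≤ w.re → 1 ≤ ‖w‖ →
      ‖xiHalf w‖ ≤ Real.exp ((2 * D + 2 + 32) * (‖w‖ * √‖w‖)) := by
    intro w hw h1
    have n0 : ‖(1 / 2 + w)‖ ≤ 2 * ‖w‖ := by
      have := norm_add_le (1 / 2 : ℂ) w
      norm_num at this; norm_num; linarith
    have k1 := key (1 / 2 + w) (by simp; linarith)
    have s1 : 1 ≤ √‖w‖ := Real.one_le_sqrt.2 h1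
    have s2 : √(‖1 / 2 + w‖) ≤ 2 * √‖w‖ := by
      refine Real.sqrt_le_iff.2 ⟨by positivity, ?_⟩
      rw [mul_pow, Real.sq_sqrt (norm_nonneg _)]; linarith
    have k2 : ‖completedRiemannZeta₀ (1 / 2 + w)‖ ≤ D * Real.exp (32 * (‖w‖ * √‖w‖)) := by
      refine k1.trans ?_
      refine mul_le_mul_of_nonneg_left (Real.exp_le_exp.2 ?_) (by linarith)
      have : ‖1 / 2 + w‖ * √‖1 / 2 + w‖ ≤ 2 * ‖w‖ * (2 * √‖w‖) :=
        mul_le_mul n0 s2 (by positivity) (by positivity)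
      linarith
    have k3 : ‖w ^ 2 - 1 / 4‖ ≤ 2 * ‖w‖ ^ 2 := by
      have := norm_sub_le (w ^ 2) (1 / 4)
      rw [norm_pow] at this; norm_num at this; norm_num; nlinarith
    have hE : 1 ≤ Real.exp (32 * (‖w‖ * √‖w‖)) := Real.one_le_exp (by positivity)
    have k4 : ‖xiHalf w‖ ≤ (2 * D + 1) * ‖w‖ ^ 2 * Real.exp (32 * (‖w‖ * √‖w‖)) := by
      unfold xiHalf
      refine (norm_add_le _ _).trans ?_
      rw [norm_mul, norm_one]
      have := mul_le_mul k3 k2 (norm_nonneg _) (by positivity)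
      have : 1 ≤ ‖w‖ ^ 2 * Real.exp (32 * (‖w‖ * √‖w‖)) := one_le_mul_of_one_le_of_one_le
          (by nlinarith) hE
      nlinarith
    refine k4.trans ?_
    have l1 : (2 * D + 1) ≤ Real.exp (2 * D) := Real.add_one_le_exp _
    have l2 : ‖w‖ ^ 2 ≤ Real.exp (2 * ‖w‖) := by
      have : ‖w‖ ≤ Real.exp ‖w‖ := by linarith [Real.add_one_le_exp ‖w‖]
      calc ‖w‖ ^ 2 ≤ (Real.exp ‖w‖) ^ 2 := by gcongr
        _ = _ := by rw [← Real.exp_nat_mul]; norm_num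
    have l3 : 2 * D + 2 * ‖w‖ ≤ (2 * D + 2) * (‖w‖ * √‖w‖) := by
      have : ‖w‖ ≤ ‖w‖ * √‖w‖ := le_mul_of_one_le_right (by linarith) s1
      nlinarith
    calc _ ≤ Real.exp (2 * D) * Real.exp (2 * ‖w‖) * Real.exp (32 * (‖w‖ * √‖w‖)) := by gcongr
      _ = Real.exp (2 * D + 2 * ‖w‖ + 32 * (‖w‖ * √‖w‖)) := by rw [Real.exp_add, Real.exp_add]
      _ ≤ _ := Real.exp_le_exp.2 (by linarith)
  refine ⟨2 * D + 2 + 32, by linarith, fun w hw => ?_⟩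
  rcases le_total 0 w.re with h | h
  · exact key2 w h hw
  · have := key2 (-w) (by simpa using h) (by simpa using hw)
    rwa [xiHalf_neg, norm_neg] at this

end

section

open Filter Topology Complex MeasureTheory Set ComplexConjugate

theorem Gammaℝ_conj (s : ℂ) : Gammaℝ (conj s) = conj (Gammaℝ s) := by
  have h1 : (-conj s / 2 : ℂ) = conj (-s / 2) := by simp [map_ofNat]
  have h2 : (conj s / 2 : ℂ) = conj (s / 2) := by simp [map_ofNat]
  rw [Gammaℝ_def, Gammaℝ_def, h1, h2, Gamma_conj, map_mul, cpow_conj _ _ ?_, conj_ofReal]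
  rw [arg_ofReal_of_nonneg Real.pi_pos.le]
  exact Real.pi_pos.ne

theorem xiHalf_eq_mul_riemannZeta {w : ℂ} (hw : -1 / 2 < w.re) (h1 : w ≠ 1 / 2) :
    xiHalf w = (w ^ 2 - 1 / 4) * (Gammaℝ (1 / 2 + w) * riemannZeta (1 / 2 + w)) := by
  have hre : 0 < (1 / 2 + w).re := by simp; linarith
  rw [xiHalf_eq h1 (fun h => by norm_num [h] at hw),
    riemannZeta_def_of_ne_zero (fun h => by rw [h] at hre; simp at hre),
    mul_div_cancel₀ _ (Gammaℝ_ne_zero_of_re_pos hre)]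

theorem xiHalf_conj (w : ℂ) : xiHalf (conj w) = conj (xiHalf w) := by
  have hd : Differentiable ℂ fun w => conj (xiHalf (conj w)) := fun z =>
    differentiableAt_conj_conj_iff.2 (differentiable_xiHalf _)
  have key : (fun w => conj (xiHalf (conj w))) = xiHalf := by
    refine AnalyticOnNhd.eq_of_eventuallyEq (z₀ := 1) (fun z _ => hd.analyticAt z)
      (fun z _ => differentiable_xiHalf.analyticAt z) ?_
    have : {w : ℂ | 1 / 2 < w.re} ∈ 𝓝 (1 : ℂ) :=
      (isOpen_lt continuous_const continuous_re).mem_nhds (by norm_num)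
    filter_upwards [this] with w (hw : 1 / 2 < w.re)
    have hne : ∀ z : ℂ, 1 / 2 < z.re → z ≠ 1 / 2 := fun z hz h => by norm_num [h] at hz
    have hw' : 1 / 2 < (conj w).re := by simpa using hw
    rw [xiHalf_eq_mul_riemannZeta (by linarith) (hne w hw),
      xiHalf_eq_mul_riemannZeta (by linarith) (hne _ hw')]
    have : (1 / 2 + conj w : ℂ) = conj (1 / 2 + w) := by simp [map_ofNat]
    rw [this, Gammaℝ_conj, riemannZeta_conj]
    simp [map_ofNat]
  have := congrFun key (conj w)
  simpa using this.symm

theorem abs_re_lt_of_xiHalf_eq_zero {a : ℂ} (ha : xiHalf a = 0) : |a.re| < 1 / 2 := by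
  have key : ∀ w : ℂ, 1 / 2 ≤ w.re → xiHalf w ≠ 0 := by
    intro w hw
    by_cases h : w = 1 / 2
    · rw [h, xiHalf_half]; exact one_ne_zero
    · rw [xiHalf_eq_mul_riemannZeta (by linarith) h]
      refine mul_ne_zero ?_ (mul_ne_zero (Gammaℝ_ne_zero_of_re_pos ?_)
        (riemannZeta_ne_zero_of_one_le_re ?_))
      · have h2 : w ≠ -1 / 2 := fun h2 => by norm_num [h2] at hw
        have h3 : w ^ 2 - 1 / 4 = (w - 1 / 2) * (w - -1 / 2) := by ring
        rw [h3]
        exact mul_ne_zero (sub_ne_zero.2 h) (sub_ne_zero.2 h2)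
      · simp; linarith
      · simp; linarith
  rw [abs_lt]
  constructor
  · by_contra! h
    exact key (-a) (by simp; linarith) (by rw [xiHalf_neg, ha])
  · by_contra! h
    exact key a h ha

theorem exists_xiHalf_ne_zero : ∃ w, xiHalf w ≠ 0 := ⟨1 / 2, by rw [xiHalf_half]; exact one_ne_zero⟩

/-- The multiplicity of a zero of `xiHalf`. -/
noncomputable def xiMult (a : ℂ) : ℕ := analyticOrderNatAt xiHalf a

/-- The zeros of `xiHalf` of modulus at most `r`. -/
noncomputable def xiZeros (r : ℝ) : Finset ℂ := zerosIn xiHalf r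

theorem mem_xiZeros {w : ℂ} {r : ℝ} : w ∈ xiZeros r ↔ ‖w‖ ≤ r ∧ xiHalf w = 0 :=
  mem_zerosIn differentiable_xiHalf exists_xiHalf_ne_zero

theorem xiMult_pos {a : ℂ} (ha : xiHalf a = 0) : 1 ≤ xiMult a := by
  obtain ⟨g, -, hga, h⟩ := exists_eq_pow_mul differentiable_xiHalf exists_xiHalf_ne_zero a
  by_contra! h0
  have h0' : analyticOrderNatAt xiHalf a = 0 := by
    have : xiMult a = 0 := by omega
    exact this
  rw [h, h0', pow_zero, one_mul] at ha
  exact hga ha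

theorem xiMult_eq_of_eq_pow_mul {g : ℂ → ℂ} {a : ℂ} {n : ℕ} (hg : Differentiable ℂ g)
    (hga : g a ≠ 0)
    (h : ∀ w, xiHalf w = (w - a) ^ n * g w) : xiMult a = n := by
  have : analyticOrderAt xiHalf a = n :=
    (differentiable_xiHalf.analyticAt a).analyticOrderAt_eq_natCast.2
      ⟨g, hg.analyticAt a, hga, Eventually.of_forall h⟩
  rw [xiMult, analyticOrderNatAt, this, ENat.toNat_natCast]

theorem xiMult_conj (a : ℂ) : xiMult (conj a) = xiMult a := by
  obtain ⟨g, hg, hga, h⟩ := exists_eq_pow_mul differentiable_xiHalf exists_xiHalf_ne_zero a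
  refine xiMult_eq_of_eq_pow_mul (g := fun w => conj (g (conj w)))
    (fun z => differentiableAt_conj_conj_iff.2 (hg _)) ?_ fun w => ?_
  · simpa using hga
  · have := xiHalf_conj (conj w)
    rw [conj_conj] at this
    rw [this, h]
    simp [xiMult]

theorem xiMult_neg (a : ℂ) : xiMult (-a) = xiMult a := by
  obtain ⟨g, hg, hga, h⟩ := exists_eq_pow_mul differentiable_xiHalf exists_xiHalf_ne_zero a
  refine xiMult_eq_of_eq_pow_mul (g := fun w => (-1) ^ (xiMult a) * (g (-w)))
    (by fun_prop) ?_ fun w => ?_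
  · simpa using hga
  · rw [← xiHalf_neg, h, ← mul_assoc, ← mul_pow]
    congr 2
    ring

theorem sum_xiZeros_conj (φ : ℂ → ℝ) (r : ℝ) :
    ∑ a ∈ xiZeros r, (xiMult a : ℝ) * φ (conj a) = ∑ a ∈ xiZeros r, (xiMult a : ℝ) * φ a := by
  refine Finset.sum_nbij' (fun a => conj a) (fun a => conj a) ?_ ?_ ?_ ?_ ?_
  · intro a ha
    rw [mem_xiZeros] at ha ⊢
    exact ⟨by simpa using ha.1, by rw [xiHalf_conj, ha.2, map_zero]⟩
  · intro a ha
    rw [mem_xiZeros] at ha ⊢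
    exact ⟨by simpa using ha.1, by rw [xiHalf_conj, ha.2, map_zero]⟩
  · simp
  · simp
  · intro a _
    rw [xiMult_conj]

theorem sum_xiZeros_neg (φ : ℂ → ℝ) (r : ℝ) :
    ∑ a ∈ xiZeros r, (xiMult a : ℝ) * φ (-a) = ∑ a ∈ xiZeros r, (xiMult a : ℝ) * φ a := by
  refine Finset.sum_nbij' (fun a => -a) (fun a => -a) ?_ ?_ ?_ ?_ ?_
  · intro a ha
    rw [mem_xiZeros] at ha ⊢
    exact ⟨by simpa using ha.1, by rw [xiHalf_neg, ha.2]⟩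
  · intro a ha
    rw [mem_xiZeros] at ha ⊢
    exact ⟨by simpa using ha.1, by rw [xiHalf_neg, ha.2]⟩
  · simp
  · simp
  · intro a _
    rw [xiMult_neg]

theorem exists_logDeriv_xiHalf_bound : ∃ C > 0, ∃ r₀ ≥ 1, ∀ r ≥ r₀,
    (∑ a ∈ xiZeros r, (xiMult a : ℝ)) ≤ C * (r * √r) ∧
    ∀ w, ‖w‖ < r / 16 → xiHalf w ≠ 0 →
      ‖logDeriv xiHalf w - ∑ a ∈ xiZeros r, (xiMult a : ℂ) / (w - a)‖ ≤ C * ‖w‖ / √r := by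
  obtain ⟨C, hC, h⟩ := exists_norm_xiHalf_le
  refine ⟨2048 * C, by positivity, 8, by norm_num, fun r hr => ?_⟩
  have hr0 : (0 : ℝ) < r := by linarith
  have hs : 0 < √r := Real.sqrt_pos.2 hr0
  have h4 : √(4 * r) = 2 * √r := by
    rw [Real.sqrt_mul (by norm_num)]
    congr 1
    rw [Real.sqrt_eq_iff_mul_self_eq] <;> norm_num
  obtain ⟨h1, h2⟩ := logDeriv_sub_sum_bound differentiable_xiHalf xiHalf_neg (w₀ := 1 / 2) (r := r)
    (M := 8 * C * (r * √r)) hr0 (by norm_num; linarith) (by rw [xiHalf_half]; exact one_ne_zero)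
    (by positivity) (fun w hw => by
      rw [xiHalf_half, norm_one, one_mul]
      refine (h w (by linarith)).trans (Real.exp_le_exp.2 (le_of_eq ?_))
      rw [hw, h4]; ring)
  refine ⟨h1.trans ?_, fun w hw hw0 => (h2 w hw hw0).trans (le_of_eq ?_)⟩
  · have : 0 < C * (r * √r) := by positivity
    nlinarith
  · have : √r ^ 2 = r := Real.sq_sqrt hr0.le
    rw [div_eq_div_iff (by positivity) (by positivity)]
    linear_combination (2048 * C * r * ‖w‖) * this

theorem tendsto_sum_xiZeros {w : ℂ} (hw : xiHalf w ≠ 0) :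
    Tendsto (fun r : ℝ => ∑ a ∈ xiZeros r, (xiMult a : ℂ) / (w - a)) atTop
      (𝓝 (logDeriv xiHalf w)) := by
  obtain ⟨C, hC, r₀, hr₀, h⟩ := exists_logDeriv_xiHalf_bound
  rw [tendsto_iff_norm_sub_tendsto_zero]
  have h0 : Tendsto (fun r : ℝ => C * ‖w‖ / √r) atTop (𝓝 0) :=
    Tendsto.const_div_atTop Real.tendsto_sqrt_atTop _
  refine squeeze_zero' (Eventually.of_forall fun _ => norm_nonneg _) ?_ h0
  filter_upwards [eventually_ge_atTop r₀, eventually_gt_atTop (16 * ‖w‖)] with r h1 h2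
  rw [norm_sub_rev]
  exact (h r h1).2 w (by linarith) hw

end

section

open Filter Topology Complex Set

/-! ### The digamma function -/

theorem digamma_ofReal (x : ℝ) (hx : 0 < x) :
    digamma (x : ℂ) = ((deriv (Real.log ∘ Real.Gamma) x : ℝ) : ℂ) := by
  have h1 : ∀ m : ℕ, x ≠ -m := fun m h => by
    have : (0 : ℝ) ≤ m := m.cast_nonneg
    linarith
  have hG := Real.differentiableAt_Gamma h1
  have h2 : deriv (Real.log ∘ Real.Gamma) x = deriv Real.Gamma x / Real.Gamma x :=
    Real.deriv_log_comp_eq_logDeriv hG (Real.Gamma_pos_of_pos hx).ne'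
  have h3 : HasDerivAt Gamma (deriv Gamma (x : ℂ)) (x : ℂ) :=
    (differentiableAt_Gamma x fun m => by exact_mod_cast h1 m).hasDerivAt
  have h4 := h3.comp_ofReal
  have h5 : HasDerivAt (fun y : ℝ => (Real.Gamma y : ℂ)) ((deriv Real.Gamma x : ℝ) : ℂ) x :=
    hG.hasDerivAt.ofReal_comp
  have h6 : deriv Gamma (x : ℂ) = ((deriv Real.Gamma x : ℝ) : ℂ) := by
    refine h4.unique ?_
    simpa only [Gamma_ofReal] using h5
  rw [digamma_def, logDeriv_apply, h6, h2, Gamma_ofReal, ofReal_div]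

theorem differentiableAt_log_Gamma {x : ℝ} (hx : 0 < x) :
    DifferentiableAt ℝ (Real.log ∘ Real.Gamma) x :=
  (Real.differentiableAt_Gamma fun m h => by
    have : (0 : ℝ) ≤ m := m.cast_nonneg
    linarith).log (Real.Gamma_pos_of_pos hx).ne'

theorem slope_log_Gamma {x : ℝ} (hx : 0 < x) :
    slope (Real.log ∘ Real.Gamma) x (x + 1) = Real.log x := by
  rw [slope_def_field, Function.comp_apply, Function.comp_apply, Real.Gamma_add_one hx.ne',
    Real.log_mul hx.ne' (Real.Gamma_pos_of_pos hx).ne']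
  ring

theorem deriv_log_Gamma_le_log {x : ℝ} (hx : 0 < x) :
    deriv (Real.log ∘ Real.Gamma) x ≤ Real.log x := by
  rw [← slope_log_Gamma hx]
  exact Real.convexOn_log_Gamma.deriv_le_slope (mem_Ioi.2 hx) (mem_Ioi.2 (by linarith))
    (by linarith) (differentiableAt_log_Gamma hx)

theorem log_le_deriv_log_Gamma {x : ℝ} (hx : 0 < x) :
    Real.log x ≤ deriv (Real.log ∘ Real.Gamma) (x + 1) := by
  rw [← slope_log_Gamma hx]
  exact Real.convexOn_log_Gamma.slope_le_deriv (mem_Ioi.2 hx) (mem_Ioi.2 (by linarith))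
    (by linarith) (differentiableAt_log_Gamma (by linarith))

theorem digamma_add_natCast {z : ℂ} (hz : 0 < z.re) (N : ℕ) :
    digamma (z + N) = digamma z + ∑ k ∈ Finset.range N, 1 / (z + k) := by
  induction N with
  | zero => simp
  | succ N ih =>
    rw [Finset.sum_range_succ, ← add_assoc, ← ih, Nat.cast_succ, ← add_assoc,
      digamma_apply_add_one, one_div]
    intro m h
    have := congrArg re h
    simp at this
    have h1 : (0 : ℝ) ≤ m := m.cast_nonneg
    have h2 : (0 : ℝ) ≤ N := N.cast_nonneg
    linarith

/-- The general term of the partial fraction series of the digamma function. -/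
noncomputable def digammaTerm (z : ℂ) (k : ℕ) : ℂ := 1 / ((k : ℂ) + 1) - 1 / (z + k)

theorem add_natCast_ne_zero {z : ℂ} (hz : 0 < z.re) (k : ℕ) : z + k ≠ 0 := by
  intro h
  have := congrArg re h
  simp at this
  have h1 : (0 : ℝ) ≤ k := k.cast_nonneg
  linarith

theorem natCast_add_re_le_norm {z : ℂ} (k : ℕ) : k + z.re ≤ ‖z + k‖ := by
  refine le_trans (le_of_eq ?_) (re_le_norm _)
  simp [add_comm]

theorem norm_digammaTerm {z : ℂ} (hz : 0 < z.re) (k : ℕ) :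
    ‖digammaTerm z k‖ = ‖z - 1‖ / ((k + 1) * ‖z + k‖) := by
  have h1 := add_natCast_ne_zero hz k
  have h2 : ((k : ℂ) + 1) ≠ 0 := by exact_mod_cast k.succ_ne_zero
  have h3 : digammaTerm z k = (z - 1) / ((k + 1) * (z + k)) := by
    rw [digammaTerm]; field_simp; ring
  rw [h3, norm_div, norm_mul]
  congr 2
  exact_mod_cast norm_natCast (k + 1)

theorem summable_one_div_add_one_sq : Summable fun k : ℕ => 1 / ((k : ℝ) + 1) ^ 2 := by
  have := (summable_nat_add_iff 1).2 (Real.summable_one_div_nat_pow.2 (by norm_num : 1 < 2))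
  simpa using this

theorem norm_digammaTerm_le {z : ℂ} {ε B : ℝ} (hε : 0 < ε) (hε1 : ε ≤ 1) (hz : ε < z.re)
    (hB : ‖z‖ < B) (k : ℕ) : ‖digammaTerm z k‖ ≤ (B + 1) / ε * (1 / ((k : ℝ) + 1) ^ 2) := by
  rw [norm_digammaTerm (by linarith)]
  have h1 : ‖z - 1‖ ≤ B + 1 := by
    have := norm_sub_le z 1
    rw [norm_one] at this; linarith
  have h2 : ε * ((k : ℝ) + 1) ≤ ‖z + k‖ := by
    have := natCast_add_re_le_norm (z := z) k
    have h0 : (0 : ℝ) ≤ k := k.cast_nonneg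
    nlinarith
  calc ‖z - 1‖ / ((k + 1) * ‖z + k‖) ≤ (B + 1) / ((k + 1) * (ε * (k + 1))) := by
        have := norm_nonneg z
        gcongr
        linarith
    _ = _ := by field_simp

theorem summable_digammaTerm {z : ℂ} (hz : 0 < z.re) : Summable (digammaTerm z) := by
  refine Summable.of_norm_bounded (summable_one_div_add_one_sq.mul_left
    ((‖z‖ + 1 + 1) / min 1 (z.re / 2))) fun k => norm_digammaTerm_le (by positivity)
        (min_le_left _ _)
    (lt_of_le_of_lt (min_le_right _ _) (by linarith)) (by linarith) k

theorem differentiableOn_tsum_digammaTerm :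
    DifferentiableOn ℂ (fun z => ∑' k, digammaTerm z k) {z | 0 < z.re} := by
  intro z (hz : 0 < z.re)
  set ε := min 1 (z.re / 2) with hε
  have hε0 : 0 < ε := by positivity
  have hεz : ε < z.re := lt_of_le_of_lt (min_le_right _ _) (by linarith)
  have hU : IsOpen {w : ℂ | ε < w.re ∧ ‖w‖ < ‖z‖ + 1} :=
    (isOpen_lt continuous_const continuous_re).inter (isOpen_lt continuous_norm continuous_const)
  have := differentiableOn_tsum_of_summable_norm (F := fun k w => digammaTerm w k)
    (summable_one_div_add_one_sq.mul_left ((‖z‖ + 1 + 1) / ε)) (fun k w hw => ?_) hU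
    (fun k w hw => norm_digammaTerm_le hε0 (min_le_left _ _) hw.1 hw.2 k)
  · exact (this.differentiableAt (hU.mem_nhds ⟨hεz, by linarith⟩)).differentiableWithinAt
  · refine DifferentiableAt.differentiableWithinAt ?_
    have := add_natCast_ne_zero (hε0.trans hw.1) k
    unfold digammaTerm
    fun_prop (disch := assumption)

theorem digamma_eq_tsum_ofReal {x : ℝ} (hx : 0 < x) :
    digamma (x : ℂ) = -Real.eulerMascheroniConstant + ∑' k, digammaTerm x k := by
  set d := deriv (Real.log ∘ Real.Gamma) with hd
  have hlim : Tendsto (fun N : ℕ => d (x + N) - Real.log N) atTop (𝓝 0) := by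
    have l1 : Tendsto (fun N : ℕ => Real.log (x + N) - Real.log N) atTop (𝓝 0) := by
      have := (Real.tendsto_log_comp_add_sub_log x).comp tendsto_natCast_atTop_atTop
      refine this.congr fun N => ?_
      simp [add_comm]
    have l2 : Tendsto (fun N : ℕ => Real.log (x - 1 + N) - Real.log N) atTop (𝓝 0) := by
      have := (Real.tendsto_log_comp_add_sub_log (x - 1)).comp tendsto_natCast_atTop_atTop
      refine this.congr fun N => ?_
      simp [add_comm]
    refine tendsto_of_tendsto_of_tendsto_of_le_of_le' l2 l1 ?_ ?_
    · filter_upwards [eventually_ge_atTop 1] with N hN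
      have hN' : (1 : ℝ) ≤ N := by exact_mod_cast hN
      have := log_le_deriv_log_Gamma (x := x - 1 + N) (by linarith)
      rw [show x - 1 + (N : ℝ) + 1 = x + N by ring] at this
      linarith
    · refine Eventually.of_forall fun N => ?_
      have h0 : (0 : ℝ) ≤ N := N.cast_nonneg
      have := deriv_log_Gamma_le_log (x := x + N) (by linarith)
      linarith
  have hH := Real.tendsto_harmonic_sub_log
  have h1 : Tendsto (fun N : ℕ => ((d x + ((harmonic N : ℝ) - Real.log N) -
      (d (x + N) - Real.log N) : ℝ) : ℂ)) atTop
      (𝓝 ((d x + Real.eulerMascheroniConstant - 0 : ℝ) : ℂ)) :=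
    (continuous_ofReal.tendsto _).comp ((hH.const_add (d x)).sub hlim)
  have h2 := (summable_digammaTerm (z := x) (by simpa using hx)).hasSum.tendsto_sum_nat
  have h3 := tendsto_nhds_unique h2 (h1.congr fun N => ?_)
  · rw [h3, digamma_ofReal x hx]
    push_cast
    ring
  · have e1 := digamma_add_natCast (z := x) (by simpa using hx) N
    have h0 : (0 : ℝ) ≤ N := N.cast_nonneg
    rw [show (x : ℂ) + N = ((x + N : ℝ) : ℂ) by push_cast; ring, digamma_ofReal x hx,
      digamma_ofReal _ (by linarith)] at e1
    simp only [digammaTerm]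
    rw [Finset.sum_sub_distrib]
    have e2 : ((harmonic N : ℝ) : ℂ) = ∑ k ∈ Finset.range N, 1 / ((k : ℂ) + 1) := by
      rw [harmonic]; push_cast; simp
    rw [← e2]
    push_cast
    rw [e1]
    ring

theorem digamma_eq_tsum {z : ℂ} (hz : 0 < z.re) :
    digamma z = -Real.eulerMascheroniConstant + ∑' k, digammaTerm z k := by
  have hopen : IsOpen {z : ℂ | 0 < z.re} := isOpen_lt continuous_const continuous_re
  have hA : AnalyticOnNhd ℂ digamma {z | 0 < z.re} := by
    refine DifferentiableOn.analyticOnNhd (fun w hw => ?_) hopen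
    have hGd : DifferentiableOn ℂ Gamma {z : ℂ | 0 < z.re} := fun w (hw : 0 < w.re) =>
      (differentiableAt_Gamma w fun m h => by
        rw [h] at hw
        simp at hw
        have h1 : (0 : ℝ) ≤ m := m.cast_nonneg
        linarith).differentiableWithinAt
    rw [digamma_def]
    exact (((hGd.analyticOnNhd hopen w hw).deriv.differentiableAt).div
      (hGd.analyticOnNhd hopen w hw).differentiableAt
      (Gamma_ne_zero_of_re_pos hw)).differentiableWithinAt
  have hB : AnalyticOnNhd ℂ (fun z => -(Real.eulerMascheroniConstant : ℂ) + ∑' k, digammaTerm z k)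
      {z | 0 < z.re} :=
    (differentiableOn_tsum_digammaTerm.const_add _).analyticOnNhd hopen
  refine hA.eqOn_of_preconnected_of_frequently_eq hB (convex_halfSpace_re_gt 0).isPreconnected
    (z₀ := 1) (by simp) ?_ hz
  have hseq : Tendsto (fun n : ℕ => ((1 + 1 / ((n : ℝ) + 1) : ℝ) : ℂ)) atTop (𝓝[≠] 1) := by
    refine tendsto_nhdsWithin_iff.2 ⟨?_, Eventually.of_forall fun n => ?_⟩
    · have := (tendsto_one_div_add_atTop_nhds_zero_nat (𝕜 := ℝ)).const_add 1
      rw [add_zero] at this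
      exact (continuous_ofReal.tendsto _).comp this
    · have : (0 : ℝ) < 1 / ((n : ℝ) + 1) := by positivity
      simp only [mem_compl_iff, mem_singleton_iff]
      intro h
      have h' : (1 + 1 / ((n : ℝ) + 1) : ℝ) = 1 := by exact_mod_cast h
      linarith
  exact hseq.frequently (Frequently.of_forall fun n => digamma_eq_tsum_ofReal (by positivity))

theorem norm_digamma_sub_sum_le {z : ℂ} (hz : 0 < z.re) {N : ℕ} (hN : 0 < N) :
    ‖digamma z + Real.eulerMascheroniConstant - ∑ k ∈ Finset.range N, digammaTerm z k‖
      ≤ ‖z - 1‖ / N := by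
  rw [digamma_eq_tsum hz, ← (summable_digammaTerm hz).sum_add_tsum_nat_add N]
  have : ∀ a b c : ℂ, -a + (b + c) + a - b = c := fun a b c => by ring
  rw [this]
  have hs : HasSum (fun k : ℕ => ‖z - 1‖ * (1 / ((k : ℝ) + N) - 1 / (((k + 1 : ℕ) : ℝ) + N)))
      (‖z - 1‖ * (1 / N)) := by
    refine HasSum.mul_left _ ?_
    have h1 : Tendsto (fun k : ℕ => 1 / ((k : ℝ) + N)) atTop (𝓝 0) := by
      have := (tendsto_natCast_atTop_atTop (R := ℝ)).comp (tendsto_add_atTop_nat N)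
      have := this.inv_tendsto_atTop
      refine this.congr fun k => ?_
      simp
    rw [hasSum_iff_tendsto_nat_of_nonneg]
    · have h2 : ∀ n : ℕ, ∑ k ∈ Finset.range n, (1 / ((k : ℝ) + N) - 1 / (((k + 1 : ℕ) : ℝ) + N)) =
          1 / N - 1 / ((n : ℝ) + N) := fun n => by
        rw [Finset.sum_range_sub' (fun k : ℕ => 1 / ((k : ℝ) + N))]; simp
      simp only [h2]
      simpa using h1.const_sub (1 / (N : ℝ))
    · intro k
      have : (0 : ℝ) < N := by exact_mod_cast hN
      rw [sub_nonneg]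
      refine one_div_le_one_div_of_le (by positivity) ?_
      push_cast; linarith
  rw [show ‖z - 1‖ / N = ‖z - 1‖ * (1 / N) by ring]
  refine tsum_of_norm_bounded hs fun k => ?_
  rw [norm_digammaTerm hz]
  have hN' : (0 : ℝ) < N := by exact_mod_cast hN
  have h0 : (0 : ℝ) ≤ k := k.cast_nonneg
  have h3 : (k : ℝ) + N ≤ ‖z + (k + N : ℕ)‖ := by
    have := natCast_add_re_le_norm (z := z) (k + N)
    push_cast at this ⊢
    linarith
  have h4 : 1 / ((k : ℝ) + N) - 1 / (((k + 1 : ℕ) : ℝ) + N) =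
      1 / (((k + N : ℕ) + 1) * ((k : ℝ) + N)) := by
    push_cast; field_simp; ring
  rw [h4, div_eq_mul_one_div]
  gcongr

theorem tendsto_log_sub_sum_digamma {z : ℂ} (hz : 0 < z.re) :
    Tendsto (fun N : ℕ => Real.log N - (∑ k ∈ Finset.range N, 1 / (z + k)).re) atTop
      (𝓝 (digamma z).re) := by
  have h1 := (continuous_re.tendsto _).comp (summable_digammaTerm hz).hasSum.tendsto_sum_nat
  have h2 := h1.sub Real.tendsto_harmonic_sub_log
  have h3 : (∑' k, digammaTerm z k).re - Real.eulerMascheroniConstant = (digamma z).re := by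
    rw [digamma_eq_tsum hz]
    simp; ring
  rw [h3] at h2
  refine h2.congr fun N => ?_
  simp only [Function.comp_apply, digammaTerm, Finset.sum_sub_distrib, sub_re]
  have e2 : ((harmonic N : ℝ) : ℂ) = ∑ k ∈ Finset.range N, 1 / ((k : ℂ) + 1) := by
    rw [harmonic]; push_cast; simp
  rw [← e2, ofReal_re]
  ring

/-- The digamma function is close to the logarithm away from the real axis. -/
theorem abs_re_digamma_sub_log_le {z : ℂ} (hz : 1 ≤ z.re) (hy : 2 ≤ |z.im|) :
    |(digamma z).re - Real.log ‖z‖| ≤ 2 / |z.im| := by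
  have hz0 : 0 < z.re := by linarith
  set Y := |z.im| with hY
  have h1 : Tendsto (fun N : ℕ => Real.log ‖z + N‖ - Real.log N) atTop (𝓝 0) := by
    have l : Tendsto (fun N : ℕ => ‖1 + z / N‖) atTop (𝓝 1) := by
      have h0 : Tendsto (fun N : ℕ => z / (N : ℂ)) atTop (𝓝 0) := by
        refine tendsto_zero_iff_norm_tendsto_zero.2 ?_
        simp only [norm_div, norm_natCast]
        exact tendsto_const_div_atTop_nhds_zero_nat _
      simpa using (h0.const_add 1).norm
    have l2 := (Real.continuousAt_log one_ne_zero).tendsto.comp l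
    rw [Real.log_one] at l2
    refine l2.congr' ?_
    filter_upwards [eventually_ge_atTop 1] with N hN
    have hN' : (N : ℂ) ≠ 0 := by exact_mod_cast (by omega : N ≠ 0)
    have hN'' : (N : ℝ) ≠ 0 := by exact_mod_cast (by omega : N ≠ 0)
    rw [Function.comp_apply, ← Real.log_div (norm_ne_zero_iff.2 (add_natCast_ne_zero hz0 N)) hN'',
      ← Complex.norm_natCast N, ← norm_div]
    congr 2
    field_simp
    ring
  have h2 := (tendsto_log_sub_sum_digamma hz0).add (h1.sub_const (Real.log ‖z‖))
  rw [zero_sub, ← sub_eq_add_neg] at h2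
  have hterm : ∀ k : ℕ, |Real.log ‖z + (k + 1 : ℕ)‖ - Real.log ‖z + k‖ - (1 / (z + k)).re| ≤
      2 / (k + Y) - 2 / ((k + 1 : ℕ) + Y) := by
    intro k
    set w := z + k with hw
    have hw0 : w ≠ 0 := add_natCast_ne_zero hz0 k
    have hk : (0 : ℝ) ≤ k := k.cast_nonneg
    have hsq : ((k : ℝ) + 1) ^ 2 + Y ^ 2 ≤ ‖w‖ ^ 2 := by
      rw [Complex.sq_norm, normSq_apply, hY, sq_abs]
      have e1 : w.re = z.re + k := by simp [hw]
      have e2 : w.im = z.im := by simp [hw]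
      rw [e1, e2]; nlinarith
    have hw2 : 2 ≤ ‖w‖ := by
      have := norm_nonneg w
      nlinarith
    have hinv : ‖w⁻¹‖ ≤ 1 / 2 := by
      rw [norm_inv]; exact inv_le_of_inv_le₀ (by norm_num) (by simpa using hw2)
    have e1 : Real.log ‖z + (k + 1 : ℕ)‖ - Real.log ‖w‖ = (Complex.log (1 + w⁻¹)).re := by
      rw [Complex.log_re, ← Real.log_div ?_ (norm_ne_zero_iff.2 hw0), ← norm_div]
      · congr 2
        rw [show z + ((k + 1 : ℕ) : ℂ) = w + 1 by push_cast; rw [hw]; ring]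
        field_simp
      · exact norm_ne_zero_iff.2 (add_natCast_ne_zero hz0 _)
    rw [e1, one_div, ← sub_re]
    refine (abs_re_le_norm _).trans ?_
    refine (norm_log_one_add_sub_self_le (by linarith)).trans ?_
    have e2 : (1 - ‖w⁻¹‖)⁻¹ ≤ 2 := inv_le_of_inv_le₀ (by norm_num) (by linarith)
    have e3 : ‖w⁻¹‖ ^ 2 ≤ 2 / ((k + Y) * (k + 1 + Y)) := by
      rw [norm_inv, inv_pow, inv_eq_one_div, div_le_div_iff₀ (by positivity) (by positivity)]
      nlinarith [sq_nonneg ((k : ℝ) + 1 - Y)]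
    have e4 : 2 / (k + Y) - 2 / ((k + 1 : ℕ) + Y) = 2 / ((k + Y) * (k + 1 + Y)) := by
      have : (0 : ℝ) < k + Y := by linarith
      push_cast; field_simp; ring
    rw [e4]
    have := sq_nonneg ‖w⁻¹‖
    nlinarith
  have hY0 : 0 < Y := by linarith
  have h3 : ∀ N : ℕ, |Real.log N - (∑ k ∈ Finset.range N, 1 / (z + k)).re +
      (Real.log ‖z + N‖ - Real.log N - Real.log ‖z‖)| ≤ 2 / Y := by
    intro N
    have e1 : Real.log N - (∑ k ∈ Finset.range N, 1 / (z + k)).re +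
      (Real.log ‖z + N‖ - Real.log N - Real.log ‖z‖) = ∑ k ∈ Finset.range N,
        (Real.log ‖z + (k + 1 : ℕ)‖ - Real.log ‖z + k‖ - (1 / (z + k)).re) := by
      rw [Finset.sum_sub_distrib, Finset.sum_range_sub (fun k : ℕ => Real.log ‖z + k‖), re_sum]
      simp only [Nat.cast_zero, add_zero]
      ring
    rw [e1]
    refine (Finset.abs_sum_le_sum_abs _ _).trans ?_
    refine (Finset.sum_le_sum fun k _ => hterm k).trans ?_
    rw [Finset.sum_range_sub' (fun k : ℕ => 2 / ((k : ℝ) + Y))]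
    have : 0 ≤ 2 / ((N : ℝ) + Y) := by positivity
    simp only [Nat.cast_zero, zero_add]
    linarith
  exact le_of_tendsto h2.abs (Eventually.of_forall h3)

end

section

open Filter Topology Complex Set ComplexConjugate ArithmeticFunction

/-! ### The real part of the logarithmic derivative of the completed zeta function -/

/-- The real part of the logarithmic derivative of `xiHalf` at `s - 1 / 2`. -/
noncomputable def xiReal (s : ℂ) : ℝ := (logDeriv xiHalf (s - 1 / 2)).re

theorem logDeriv_Gammaℝ {s : ℂ} (hs : 0 < s.re) :
    logDeriv Gammaℝ s = -(Real.log Real.pi : ℂ) / 2 + digamma (s / 2) / 2 := by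
  have hs2 : 0 < (s / 2).re := by simp; linarith
  have hG : DifferentiableAt ℂ Gamma (s / 2) := differentiableAt_Gamma _ fun m h => by
    rw [h] at hs2
    simp at hs2
    have h1 : (0 : ℝ) ≤ m := m.cast_nonneg
    linarith
  have h1 : HasDerivAt (fun s : ℂ => (Real.pi : ℂ) ^ (-s / 2))
      ((Real.pi : ℂ) ^ (-s / 2) * Complex.log Real.pi * (-1 / 2)) s := by
    have := ((hasDerivAt_id s).neg.div_const 2).const_cpow (c := (Real.pi : ℂ))
      (Or.inl (by exact_mod_cast Real.pi_ne_zero))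
    simpa using this
  have h2 : HasDerivAt (fun s : ℂ => Gamma (s / 2)) (deriv Gamma (s / 2) * (1 / 2)) s :=
    hG.hasDerivAt.comp s ((hasDerivAt_id s).div_const 2)
  have h3 := (h1.mul h2).deriv
  have hp : (Real.pi : ℂ) ^ (-s / 2) ≠ 0 := by
    rw [Ne, cpow_eq_zero_iff]; simp [Real.pi_ne_zero]
  have hg := Gamma_ne_zero_of_re_pos hs2
  have h4 : Gammaℝ = (fun s : ℂ => (Real.pi : ℂ) ^ (-s / 2)) * fun s : ℂ => Gamma (s / 2) := by
    ext s; rw [Gammaℝ_def]; rfl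
  rw [logDeriv_apply, h4, h3, digamma_def, logDeriv_apply, ofReal_log Real.pi_pos.le, Pi.mul_apply]
  field_simp

theorem logDeriv_xiHalf {s : ℂ} (hs : 1 < s.re) :
    logDeriv xiHalf (s - 1 / 2) = 1 / (s - 1) + digamma (s / 2 + 1) / 2 -
      (Real.log Real.pi : ℂ) / 2 - LSeries (fun n => (vonMangoldt n : ℂ)) s := by
  have hs0 : s ≠ 0 := fun h => by norm_num [h] at hs
  have hs1 : s - 1 ≠ 0 := fun h => by rw [sub_eq_zero.1 h] at hs; norm_num at hs
  have hz : riemannZeta s ≠ 0 := riemannZeta_ne_zero_of_one_le_re hs.le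
  have hGR := Gammaℝ_ne_zero_of_re_pos (s := s) (by linarith)
  have e : (fun w => xiHalf (w - 1 / 2)) =ᶠ[𝓝 s]
      fun w => (w * (w - 1)) * (Gammaℝ w * riemannZeta w) := by
    filter_upwards [(isOpen_lt continuous_const continuous_re).mem_nhds hs] with w (hw : 1 < w.re)
    rw [xiHalf_eq_mul_riemannZeta (by simp; linarith) (fun h => by
      have : w = 1 := by linear_combination h
      rw [this] at hw; norm_num at hw)]
    ring_nf
  have e1 : logDeriv xiHalf (s - 1 / 2) = logDeriv (fun w => xiHalf (w - 1 / 2)) s := by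
    rw [logDeriv_apply, logDeriv_apply, deriv_comp_sub_const]
  have dG : DifferentiableAt ℂ Gammaℝ s := by
    have h1 := differentiable_Gammaℝ_inv s
    refine (h1.inv (inv_ne_zero hGR)).congr_of_eventuallyEq (Eventually.of_forall fun w => ?_)
    simp
  have dz : DifferentiableAt ℂ riemannZeta s := differentiableAt_riemannZeta (sub_ne_zero.1 hs1)
  rw [e1, logDeriv_apply, e.deriv_eq, e.eq_of_nhds, ← logDeriv_apply
    (fun w => (w * (w - 1)) * (Gammaℝ w * riemannZeta w)),
    logDeriv_mul (f := fun w => w * (w - 1)) (g := fun w => Gammaℝ w * riemannZeta w)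
      s (mul_ne_zero hs0 hs1) (mul_ne_zero hGR hz) (by fun_prop) (dG.mul dz),
    logDeriv_mul (f := Gammaℝ) (g := riemannZeta) s hGR hz dG dz,
    logDeriv_mul (f := fun w => w) (g := fun w => w - 1) s hs0 hs1 (by fun_prop) (by fun_prop),
    logDeriv_Gammaℝ (by linarith), LSeries_vonMangoldt_eq_deriv_riemannZeta_div hs,
    digamma_apply_add_one (s / 2)]
  · simp only [logDeriv_apply]
    simp only [deriv_id'', deriv_sub_const]
    field_simp
    ring
  · intro m h
    have := congrArg re h
    simp at this
    have h1 : (0 : ℝ) ≤ m := m.cast_nonneg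
    linarith

/-- The contribution of a zero `a` and its reflection in the imaginary axis to `xiReal`. -/
noncomputable def zeroPair (w a : ℂ) : ℝ := (1 / (w - a)).re + (1 / (w + conj a)).re

theorem tendsto_sum_zeroPair {s : ℂ} (hs : 1 ≤ s.re) :
    Tendsto (fun r : ℝ => ∑ a ∈ xiZeros r, (xiMult a : ℝ) * (zeroPair (s - 1 / 2) a / 2)) atTop
      (𝓝 (xiReal s)) := by
  have hne : xiHalf (s - 1 / 2) ≠ 0 := fun h => by
    have := (abs_lt.1 (abs_re_lt_of_xiHalf_eq_zero h)).2
    norm_num at this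
    linarith
  have h1 := (continuous_re.tendsto _).comp (tendsto_sum_xiZeros hne)
  refine h1.congr fun r => ?_
  simp only [Function.comp_apply, re_sum]
  set φ : ℂ → ℝ := fun a => (1 / (s - 1 / 2 - a)).re with hφ
  have e1 : ∀ a, ((xiMult a : ℂ) / (s - 1 / 2 - a)).re = (xiMult a : ℝ) * φ a := fun a => by
    rw [hφ, div_eq_mul_one_div, ← ofReal_natCast, re_ofReal_mul]
  have e2 : ∀ a, (xiMult a : ℝ) * (zeroPair (s - 1 / 2) a / 2) =
      (xiMult a : ℝ) * φ a / 2 + (xiMult a : ℝ) * φ (-conj a) / 2 := fun a => by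
    simp only [zeroPair, hφ, sub_neg_eq_add]; ring
  simp only [e1, e2]
  rw [Finset.sum_add_distrib, ← Finset.sum_div, ← Finset.sum_div,
    sum_xiZeros_conj (fun a => φ (-a)), sum_xiZeros_neg φ]
  ring

theorem sum_le_xiReal_sub {s s₁ : ℂ} {κ : ℝ} (hs : 1 ≤ s.re) (hs₁ : 1 ≤ s₁.re)
    (h : ∀ a, xiHalf a = 0 → 0 ≤ zeroPair (s - 1 / 2) a - κ * zeroPair (s₁ - 1 / 2) a)
    (S : Finset ℂ) (hS : ∀ a ∈ S, xiHalf a = 0) :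
    ∑ a ∈ S, (xiMult a : ℝ) * ((zeroPair (s - 1 / 2) a - κ * zeroPair (s₁ - 1 / 2) a) / 2) ≤
      xiReal s - κ * xiReal s₁ := by
  have h1 := (tendsto_sum_zeroPair hs).sub ((tendsto_sum_zeroPair hs₁).const_mul κ)
  refine ge_of_tendsto h1 ?_
  filter_upwards [eventually_ge_atTop (∑ a ∈ S, ‖a‖)] with r hr
  have hsub : S ⊆ xiZeros r := fun a ha => mem_xiZeros.2
    ⟨(Finset.single_le_sum (f := fun a => ‖a‖) (fun b _ => norm_nonneg b) ha).trans hr, hS a ha⟩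
  rw [Finset.mul_sum, ← Finset.sum_sub_distrib]
  refine (Finset.sum_le_sum_of_subset_of_nonneg hsub fun a ha _ => ?_).trans (le_of_eq ?_)
  · have := h a (mem_xiZeros.1 ha).2
    positivity
  · exact Finset.sum_congr rfl fun a _ => by ring

theorem zeroPair_nonneg {w a : ℂ} (hw : 1 / 2 ≤ w.re) (ha : |a.re| < 1 / 2) : 0 ≤ zeroPair w a := by
  have h := abs_lt.1 ha
  unfold zeroPair
  rw [one_div, one_div, inv_re, inv_re]
  refine add_nonneg (div_nonneg ?_ (normSq_nonneg _)) (div_nonneg ?_ (normSq_nonneg _))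
  · simp; linarith
  · simp; linarith

theorem sum_le_xiReal {s : ℂ} (hs : 1 ≤ s.re) (S : Finset ℂ) (hS : ∀ a ∈ S, xiHalf a = 0) :
    ∑ a ∈ S, (xiMult a : ℝ) * (zeroPair (s - 1 / 2) a / 2) ≤ xiReal s := by
  have := sum_le_xiReal_sub (s := s) (s₁ := s) (κ := 0) hs hs (fun a ha => by
    rw [zero_mul, sub_zero]
    refine zeroPair_nonneg ?_ (abs_re_lt_of_xiHalf_eq_zero ha)
    norm_num; linarith) S hS
  simpa using this

/-! ### A zero-free region -/

theorem zeroPair_eq {w a : ℂ} (h1 : |a.re| < w.re) :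
    zeroPair w a = 2 * w.re * (w.re ^ 2 - a.re ^ 2 + (w.im - a.im) ^ 2) /
      (((w.re - a.re) ^ 2 + (w.im - a.im) ^ 2) * ((w.re + a.re) ^ 2 + (w.im - a.im) ^ 2)) := by
  obtain ⟨h2, h3⟩ := abs_lt.1 h1
  have h4 : 0 < w.re - a.re := by linarith
  have h5 : 0 < w.re + a.re := by linarith
  have h6 : (w.re - a.re) ^ 2 + (w.im - a.im) ^ 2 ≠ 0 := by positivity
  have h7 : (w.re + a.re) ^ 2 + (w.im - a.im) ^ 2 ≠ 0 := by positivity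
  unfold zeroPair
  rw [one_div, one_div, inv_re, inv_re, normSq_apply, normSq_apply]
  simp only [sub_re, sub_im, add_re, add_im, conj_re, conj_im, ← sub_eq_add_neg, ← sq]
  rw [div_add_div _ _ h6 h7]
  congr 1
  ring

theorem zeroPair_eq_of_im_eq {w a : ℂ} (h : w.im = a.im) :
    zeroPair w a = 1 / (w.re - a.re) + 1 / (w.re + a.re) := by
  have h1 : w - a = (w.re - a.re : ℝ) := by apply Complex.ext <;> simp [h]
  have h2 : w + conj a = (w.re + a.re : ℝ) := by apply Complex.ext <;> simp [h]
  rw [zeroPair, h1, h2, ← ofReal_one, ← ofReal_div, ← ofReal_div, ofReal_re, ofReal_re]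

theorem stechkin_poly {e b u : ℝ} (he : 0 ≤ e) (hb : 0 ≤ b) (hb' : b ≤ 1 / 4) (hu : 0 ≤ u) :
    (1 + e) * ((1 + e) ^ 2 + b + u) * (((1 + e) ^ 2 - (1 + e) + b - u) ^ 2 + u * (1 + 2 * e) ^ 2) ≤
      (1 + 2 * e) * ((1 + e) ^ 2 - (1 + e) + b + u) *
        (((1 + e) ^ 2 + b - u) ^ 2 + u * (1 + 4 * (1 + e) ^ 2)) := by
  have h1 : 0 ≤ (e + 6 * e ^ 2 + 15 * e ^ 3 + 20 * e ^ 4 + 15 * e ^ 5 + 6 * e ^ 6 + e ^ 7) +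
      b * (1 + 6 * e + 15 * e ^ 2 + 19 * e ^ 3 + 12 * e ^ 4 + 3 * e ^ 5) +
      b ^ 2 * (1 + 4 * e + 6 * e ^ 2 + 3 * e ^ 3) +
      b ^ 3 * (e) +
      u * (4 * e + 15 * e ^ 2 + 20 * e ^ 3 + 12 * e ^ 4 + 3 * e ^ 5) +
      b * u * (6 + 16 * e + 12 * e ^ 2 + 2 * e ^ 3) +
      u ^ 2 * (1 + 4 * e + 6 * e ^ 2 + 3 * e ^ 3) +
      u ^ 3 * (e) := by
    positivity
  have h2 : 0 ≤ e * b * u * (1 - b) := by have : 0 ≤ 1 - b := by linarith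
                                          positivity
  have h3 : 0 ≤ e * u ^ 2 * (1 - b) := by have : 0 ≤ 1 - b := by linarith
                                          positivity
  linear_combination h1 + h2 + h3

/-- The abscissa `σ₁` attached to `σ` in Stechkin's trick. -/
noncomputable def stechkinAbscissa (σ : ℝ) : ℝ := (1 + √(1 + 4 * σ ^ 2)) / 2

theorem stechkin_kappa {σ : ℝ} (hσ : 1 ≤ σ) : 1 / √5 * √(1 + 4 * σ ^ 2) ≤ σ := by
  rw [one_div_mul_eq_div, div_le_iff₀ (by positivity)]
  refine Real.sqrt_le_iff.2 ⟨by positivity, ?_⟩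
  rw [mul_pow, Real.sq_sqrt (by norm_num)]
  nlinarith

theorem zeroPair_sub_nonneg {σ t : ℝ} (hσ : 1 ≤ σ) {a : ℂ} (ha : |a.re| < 1 / 2) :
    0 ≤ zeroPair (σ + t * I - 1 / 2) a -
      1 / √5 * zeroPair (stechkinAbscissa σ + t * I - 1 / 2) a := by
  set τ := √(1 + 4 * σ ^ 2) with hτ
  have hτ2 : τ ^ 2 = 1 + 4 * σ ^ 2 := Real.sq_sqrt (by positivity)
  have hτ1 : 1 ≤ τ := Real.one_le_sqrt.2 (by nlinarith)
  have e1 : (σ + t * I - 1 / 2 : ℂ).re = σ - 1 / 2 := by simp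
  have e2 : (σ + t * I - 1 / 2 : ℂ).im = t := by simp
  have e3 : (stechkinAbscissa σ + t * I - 1 / 2 : ℂ).re = τ / 2 := by
    simp [stechkinAbscissa, ← hτ]; ring
  have e4 : (stechkinAbscissa σ + t * I - 1 / 2 : ℂ).im = t := by simp
  have ha' := abs_lt.1 ha
  rw [zeroPair_eq (by rw [e1]; linarith), zeroPair_eq (by rw [e3]; linarith), e1, e2, e3, e4,
    sub_nonneg]
  set u := (t - a.im) ^ 2 with hu
  have hu0 : 0 ≤ u := sq_nonneg _
  set c := a.re with hc
  have hp := stechkin_poly (e := σ - 1) (b := 1 / 4 - c ^ 2) (u := u) (by linarith)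
    (by nlinarith) (by nlinarith [sq_nonneg c]) hu0
  have hκ := stechkin_kappa hσ
  rw [← hτ] at hκ
  clear_value u c τ
  have hD1 : 0 < ((τ / 2 - c) ^ 2 + u) * ((τ / 2 + c) ^ 2 + u) := by
    have h1 : 0 < τ / 2 - c := by linarith
    have h2 : 0 < τ / 2 + c := by linarith
    positivity
  have hD : 0 < ((σ - 1 / 2 - c) ^ 2 + u) * ((σ - 1 / 2 + c) ^ 2 + u) := by
    have h1 : 0 < σ - 1 / 2 - c := by linarith
    have h2 : 0 < σ - 1 / 2 + c := by linarith
    positivity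
  rw [mul_div_assoc', div_le_div_iff₀ hD1 hD]
  have hN : 0 ≤ ((τ / 2) ^ 2 - c ^ 2 + u) *
      (((σ - 1 / 2 - c) ^ 2 + u) * ((σ - 1 / 2 + c) ^ 2 + u)) := by
    have : 0 ≤ (τ / 2) ^ 2 - c ^ 2 := by
      nlinarith only [mul_pos (sub_pos.2 ha'.1) (sub_pos.2 ha'.2), hτ2, sq_nonneg σ]
    positivity
  have h1 := mul_le_mul_of_nonneg_right hκ hN
  have e5 : ((τ / 2 - c) ^ 2 + u) * ((τ / 2 + c) ^ 2 + u) =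
      (σ ^ 2 + (1 / 4 - c ^ 2) - u) ^ 2 + u * (1 + 4 * σ ^ 2) := by
    have : (τ / 2) ^ 2 = 1 / 4 + σ ^ 2 := by linear_combination hτ2 / 4
    linear_combination ((τ / 2) ^ 2 + 1 / 4 + σ ^ 2 - 2 * c ^ 2 + 2 * u) * this
  have e6 : (τ / 2) ^ 2 = 1 / 4 + σ ^ 2 := by linear_combination hτ2 / 4
  rw [e5, e6]
  rw [e6] at h1
  linear_combination h1 + hp

theorem le_zeroPair_sub {σ t β : ℝ} (hσ : 1 < σ) (hβ : 1 / 2 < β) (hβ1 : β < 1) :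
    1 / (σ - β) ≤ zeroPair (σ + t * I - 1 / 2) (β - 1 / 2 + t * I) -
      1 / √5 * zeroPair (stechkinAbscissa σ + t * I - 1 / 2) (β - 1 / 2 + t * I) := by
  have hκ := stechkin_kappa hσ.le
  set τ := √(1 + 4 * σ ^ 2) with hτ
  have hτ2 : τ ^ 2 = 1 + 4 * σ ^ 2 := Real.sq_sqrt (by positivity)
  have hτ1 : 1 ≤ τ := Real.one_le_sqrt.2 (by nlinarith)
  have e1 : zeroPair (σ + t * I - 1 / 2) (β - 1 / 2 + t * I) = 1 / (σ - β) + 1 / (σ - 1 + β) := by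
    rw [zeroPair_eq_of_im_eq (by simp)]
    simp only [sub_re, add_re, ofReal_re, mul_re, I_re, I_im, ofReal_im]
    norm_num
    ring_nf
  have e2 : zeroPair (stechkinAbscissa σ + t * I - 1 / 2) (β - 1 / 2 + t * I) =
      τ / (σ ^ 2 + β * (1 - β)) := by
    have h1 : stechkinAbscissa σ = τ / 2 + 1 / 2 := by simp only [stechkinAbscissa, ← hτ]; ring
    have h2 : 0 < τ / 2 - (β - 1 / 2) := by linarith
    have h3 : 0 < τ / 2 + (β - 1 / 2) := by linarith
    have h4 : σ ^ 2 + β * (1 - β) = (τ / 2 - (β - 1 / 2)) * (τ / 2 + (β - 1 / 2)) := by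
      linear_combination -hτ2 / 4
    rw [zeroPair_eq_of_im_eq (by simp), h4, h1]
    simp only [sub_re, add_re, ofReal_re, mul_re, I_re, I_im, ofReal_im, div_ofNat_re, one_re,
      mul_zero, mul_one, sub_zero, add_zero, zero_mul, add_sub_cancel_right]
    rw [one_div_add_one_div h2.ne' h3.ne']
    ring
  have h3 : 0 < σ ^ 2 + β * (1 - β) := by nlinarith
  have h4 : 1 / √5 * (τ / (σ ^ 2 + β * (1 - β))) ≤ 1 / (σ - 1 + β) := by
    rw [← mul_div_assoc, div_le_div_iff₀ h3 (by linarith)]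
    nlinarith [mul_le_mul_of_nonneg_right hκ (by linarith : 0 ≤ σ - 1 + β)]
  rw [e1, e2]
  linarith

theorem xiReal_eq {s : ℂ} (hs : 1 < s.re) :
    xiReal s = (1 / (s - 1)).re + (digamma (s / 2 + 1)).re / 2 - Real.log Real.pi / 2 -
      (LSeries (fun n => (vonMangoldt n : ℂ)) s).re := by
  have e : (Real.log Real.pi : ℂ) / 2 = (Real.log Real.pi / 2 : ℝ) := by push_cast; rfl
  rw [xiReal, logDeriv_xiHalf hs, e, sub_re, sub_re, add_re, ofReal_re, div_ofNat_re]

theorem hasSum_re_LSeries_vonMangoldt {σ : ℝ} (hσ : 1 < σ) (t : ℝ) :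
    HasSum (fun n : ℕ => vonMangoldt n * (n : ℝ) ^ (-σ) * Real.cos (t * Real.log n))
      (LSeries (fun n => (vonMangoldt n : ℂ)) (σ + t * I)).re := by
  have h := LSeriesSummable_vonMangoldt (s := σ + t * I) (by simpa)
  have h2 := hasSum_re h.hasSum
  rw [LSeries]
  convert h2 using 2 with n
  rcases Nat.eq_zero_or_pos n with rfl | hn
  · simp
  have hn0 : (n : ℂ) ≠ 0 := by exact_mod_cast hn.ne'
  have hn1 : (0 : ℝ) < n := by exact_mod_cast hn
  have e : -(σ + t * I) * Complex.log n = ((-σ * Real.log n : ℝ) : ℂ) +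
      (-(t * Real.log n) : ℝ) * I := by
    rw [← natCast_log]; push_cast; ring
  rw [LSeries.term_of_ne_zero hn.ne', div_eq_mul_inv, ← cpow_neg, cpow_def_of_ne_zero hn0,
      mul_comm (Complex.log n), e,
    re_ofReal_mul, exp_re, Real.rpow_def_of_pos hn1]
  simp only [add_re, add_im, ofReal_re, ofReal_im, re_ofReal_mul, im_ofReal_mul, I_re, I_im,
      Real.cos_neg,
    mul_zero, mul_one, add_zero, zero_add, Real.cos_neg]
  ring_nf

theorem trig_nonneg (θ : ℝ) : 0 ≤ 10.91692658 + 18.63362 * Real.cos θ +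
    11.4517 * Real.cos (2 * θ) + 4.7 * Real.cos (3 * θ) + Real.cos (4 * θ) := by
  have h4 : Real.cos (4 * θ) = 2 * Real.cos (2 * θ) ^ 2 - 1 := by
    rw [← Real.cos_two_mul]; ring_nf
  rw [h4, Real.cos_three_mul, Real.cos_two_mul]
  set c := Real.cos θ
  have : 0 ≤ 8 * ((c + 0.91) * (c + 0.265)) ^ 2 := by positivity
  linear_combination this

theorem stechkin_trig_sum_nonneg {σ σ₁ κ : ℝ} (hσ : 1 < σ) (h1 : σ ≤ σ₁) (hκ : κ ≤ 1) (t : ℝ) 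
    (D : ℝ → ℝ) (hD : ∀ t : ℝ, D t = (LSeries (fun n => (vonMangoldt n : ℂ)) (σ + t * I)).re - 
      κ * (LSeries (fun n => (vonMangoldt n : ℂ)) (σ₁ + t * I)).re) :
    0 ≤ 10.91692658 * D 0 + 18.63362 * D t + 11.4517 * D (2 * t) + 4.7 * D (3 * t) + D (4 * t) := by
  have key : ∀ t, HasSum (fun n : ℕ => vonMangoldt n * ((n : ℝ) ^ (-σ) - κ * (n : ℝ) ^ (-σ₁)) *
      Real.cos (t * Real.log n)) (D t) := fun t => by
    rw [hD]
    refine ((hasSum_re_LSeries_vonMangoldt hσ t).sub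
      ((hasSum_re_LSeries_vonMangoldt (hσ.trans_le h1) t).mul_left κ)).congr_fun fun n => ?_
    ring
  have := (((((key 0).mul_left 10.91692658).add ((key t).mul_left 18.63362)).add
    ((key (2 * t)).mul_left 11.4517)).add ((key (3 * t)).mul_left 4.7)).add (key (4 * t))
  refine this.nonneg fun n => ?_
  rcases Nat.eq_zero_or_pos n with rfl | hn
  · simp
  have hn1 : (1 : ℝ) ≤ n := by exact_mod_cast hn
  have h2 : κ * (n : ℝ) ^ (-σ₁) ≤ (n : ℝ) ^ (-σ) := by
    have h3 := Real.rpow_le_rpow_of_exponent_le hn1 (neg_le_neg h1)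
    have h4 : 0 ≤ (n : ℝ) ^ (-σ₁) := by positivity
    nlinarith
  have h5 := mul_nonneg (mul_nonneg (vonMangoldt_nonneg (n := n)) (sub_nonneg.2 h2))
    (trig_nonneg (t * Real.log n))
  convert h5 using 1
  rw [zero_mul, Real.cos_zero]
  ring_nf

theorem hasSum_re_digamma {x : ℝ} (hx : 0 < x) :
    HasSum (fun k : ℕ => 1 / ((k : ℝ) + 1) - 1 / (x + k))
      ((digamma x).re + Real.eulerMascheroniConstant) := by
  have h := digamma_eq_tsum (z := x) (by simpa)
  have h1 := hasSum_re (summable_digammaTerm (z := x) (by simpa)).hasSum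
  rw [h]
  convert h1 using 1
  · ext k
    have : digammaTerm x k = ((1 / ((k : ℝ) + 1) - 1 / (x + k) : ℝ) : ℂ) := by
      simp [digammaTerm]
    rw [this, ofReal_re]
  · simp

theorem digamma_sub_le {x y c : ℝ} (hx : 0 < x) (hc : 0 < c) (hxy : x ≤ y)
    (h1 : 2 * c + 1 ≤ x + y) (h2 : c * (c + 1) ≤ x * y) :
    (digamma y).re - (digamma x).re ≤ (y - x) / c := by
  have e : (digamma (c + 1 : ℝ)).re = (digamma c).re + 1 / c := by
    have := digamma_apply_add_one (c : ℂ) fun m h => by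
      have h3 := congrArg re h
      simp at h3
      have h4 : (0 : ℝ) ≤ m := m.cast_nonneg
      linarith
    push_cast
    rw [this, add_re, ← ofReal_inv, ofReal_re, one_div]
  have s1 := (hasSum_re_digamma (hx.trans_le hxy)).sub (hasSum_re_digamma hx)
  have s2 := ((hasSum_re_digamma (by positivity : 0 < c + 1)).sub
    (hasSum_re_digamma hc)).mul_left (y - x)
  have := hasSum_le (fun k => ?_) s1 s2
  · rw [e] at this
    rw [div_eq_mul_one_div]
    linarith
  have hk : (0 : ℝ) ≤ k := k.cast_nonneg
  have e1 : 1 / ((k : ℝ) + 1) - 1 / (y + k) - (1 / (k + 1) - 1 / (x + k)) =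
      (y - x) * (1 / ((x + k) * (y + k))) := by
    have : x + k ≠ 0 := by positivity
    have : y + k ≠ 0 := by linarith
    field_simp
    ring
  have e2 : 1 / ((k : ℝ) + 1) - 1 / (c + 1 + k) - (1 / (k + 1) - 1 / (c + k)) =
      1 / ((c + k) * (c + 1 + k)) := by
    field_simp
    ring
  simp only [e1, e2]
  refine mul_le_mul_of_nonneg_left ?_ (by linarith)
  refine one_div_le_one_div_of_le (by positivity) ?_
  nlinarith

theorem one_div_sqrt_five_bounds : 0.447213 < 1 / √5 ∧ 1 / √5 < 0.447214 := by
  have h : √5 < 2.236068 := (Real.sqrt_lt' (by norm_num)).2 (by norm_num)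
  have h' : 2.236067 < √5 := Real.lt_sqrt_of_sq_lt (by norm_num)
  constructor
  · rw [lt_div_iff₀ (by positivity)]; nlinarith
  · rw [div_lt_iff₀ (by positivity)]; nlinarith

theorem stechkinAbscissa_bounds {σ : ℝ} (h1 : 1 ≤ σ) (h2 : σ ≤ 1.2) :
    1.618 ≤ stechkinAbscissa σ ∧ stechkinAbscissa σ ≤ 1.618034 + 0.92 * (σ - 1) := by
  unfold stechkinAbscissa
  constructor
  · have : 2.236 ≤ √(1 + 4 * σ ^ 2) := Real.le_sqrt_of_sq_le (by nlinarith)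
    linarith
  · have : √(1 + 4 * σ ^ 2) ≤ 2.236068 + 1.84 * (σ - 1) :=
      Real.sqrt_le_iff.2 ⟨by linarith, by nlinarith⟩
    linarith

theorem log_pi_ge : 1.1436 ≤ Real.log Real.pi := by
  have h : Real.log (2 ^ 33) ≤ Real.log (Real.pi ^ 20) := by
    refine Real.log_le_log (by norm_num) ?_
    calc (2 : ℝ) ^ 33 ≤ 3.1415 ^ 20 := by norm_num
      _ ≤ _ := by gcongr; exact Real.pi_gt_d4.le
  rw [Real.log_pow, Real.log_pow] at h
  push_cast at h
  linarith [Real.log_two_gt_d9]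

theorem eulerMascheroniConstant_ge : 0.5615 ≤ Real.eulerMascheroniConstant := by
  have h := Real.eulerMascheroniSeq_lt_eulerMascheroniConstant 31
  have e : Real.log (31 + 1) = 5 * Real.log 2 := by
    rw [show (31 + 1 : ℝ) = 2 ^ 5 by norm_num, Real.log_pow]; norm_num
  rw [Real.eulerMascheroniSeq] at h
  push_cast at h
  rw [e] at h
  norm_num [harmonic, Finset.sum_range_succ] at h
  linarith [Real.log_two_lt_d9]

theorem re_digamma_two : (digamma 2).re = 1 - Real.eulerMascheroniConstant := by
  have h := digamma_apply_add_one 1 fun m h => by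
    have := congrArg re h
    simp at this
    linarith [(m.cast_nonneg : (0 : ℝ) ≤ m)]
  rw [one_add_one_eq_two, digamma_one] at h
  rw [h]
  simp
  ring

theorem re_digamma_three_half :
    (digamma (3 / 2 : ℝ)).re = 2 - Real.eulerMascheroniConstant - 2 * Real.log 2 := by
  have h := digamma_apply_add_one (1 / 2) fun m h => by
    have := congrArg re h
    simp at this
    linarith [(m.cast_nonneg : (0 : ℝ) ≤ m)]
  rw [digamma_one_half] at h
  have e : ((3 / 2 : ℝ) : ℂ) = 1 / 2 + 1 := by norm_num
  rw [e, h]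
  simp [log_re]
  ring

section

variable {σ : ℝ}

theorem stechkin_zero_le (h1 : 1 < σ) (h2 : σ ≤ 1.2) :
    (LSeries (fun n => (vonMangoldt n : ℂ)) (σ + (0 : ℝ) * I)).re -
      1 / √5 * (LSeries (fun n => (vonMangoldt n : ℂ)) (stechkinAbscissa σ + (0 : ℝ) * I)).re ≤
      1 / (σ - 1) - 1.075 + 1.33 * (σ - 1) := by
  obtain ⟨k1, k2⟩ := one_div_sqrt_five_bounds
  obtain ⟨b1, b2⟩ := stechkinAbscissa_bounds h1.le h2
  have hF := sum_le_xiReal_sub (s := σ + (0 : ℝ) * I) (s₁ := stechkinAbscissa σ + (0 : ℝ) * I)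
    (κ := 1 / √5) (by simp; linarith) (by simp; linarith)
    (fun a ha => zeroPair_sub_nonneg h1.le (abs_re_lt_of_xiHalf_eq_zero ha)) ∅ (by simp)
  rw [xiReal_eq (by simpa), xiReal_eq (by simp; linarith), Finset.sum_empty] at hF
  set κ := 1 / √5 with hκ
  set τ := stechkinAbscissa σ with hτ
  have r1 : ∀ x : ℝ, (1 / ((x : ℂ) + (0 : ℝ) * I - 1)).re = 1 / (x - 1) := fun x => by
    have : ((x : ℂ) + (0 : ℝ) * I - 1) = (x - 1 : ℝ) := by push_cast; ring
    rw [this, one_div, ← ofReal_inv, ofReal_re, one_div]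
  have r2 : ∀ x : ℝ, ((x : ℂ) + (0 : ℝ) * I) / 2 + 1 = (x / 2 + 1 : ℝ) := fun x => by
    push_cast; ring
  rw [r1, r1, r2, r2] at hF
  have d1 := digamma_sub_le (x := 3 / 2) (y := σ / 2 + 1) (c := 1) (by norm_num) (by norm_num)
    (by linarith) (by linarith) (by linarith)
  have d2 := digamma_sub_le (x := τ / 2 + 1) (y := 2) (c := 1.4) (by linarith) (by norm_num)
    (by linarith) (by linarith) (by linarith)
  rw [re_digamma_three_half] at d1
  rw [ofReal_ofNat, re_digamma_two] at d2
  have hη : 0 < τ - 1 := by linarith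
  have g1 : 0.7236 - 1.078 * (σ - 1) ≤ κ * (1 / (τ - 1)) := by
    rw [mul_one_div, le_div_iff₀ hη]
    by_cases h : 0 ≤ 0.7236 - 1.078 * (σ - 1)
    · nlinarith only [h, b2, h1, h2, k1]
    · nlinarith only [h, k1, hη]
  have hπ := log_pi_ge
  have hγ := eulerMascheroniConstant_ge
  have hl := Real.log_two_gt_d9
  set G := Real.eulerMascheroniConstant
  set P := Real.log Real.pi
  set A := (digamma (σ / 2 + 1 : ℝ)).re
  set B := (digamma (τ / 2 + 1 : ℝ)).re
  have g2 : κ * B ≥ κ * (1 - G - 0.1365) := by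
    have h3 : (2 - (τ / 2 + 1)) / 1.4 ≤ 0.1365 := by
      rw [div_le_iff₀ (by norm_num)]; linarith
    have : B ≥ 1 - G - 0.1365 := by linarith
    gcongr
  have g3 : (1 - κ) * P ≥ (1 - 0.447214) * 1.1436 := by
    have : 0 ≤ 1 - κ := by linarith
    gcongr
  have g4 : (1 - κ) * G ≥ (1 - 0.447214) * 0.5615 := by
    have : 0 ≤ 1 - κ := by linarith
    gcongr
  linarith

theorem stechkin_le {t : ℝ} (h1 : 1 < σ) (h2 : σ ≤ 1.2) (ht : 5 ≤ t) :
    (LSeries (fun n => (vonMangoldt n : ℂ)) (σ + t * I)).re -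
      1 / √5 * (LSeries (fun n => (vonMangoldt n : ℂ)) (stechkinAbscissa σ + t * I)).re ≤
      (1 - 1 / √5) / 2 * (Real.log t - Real.log 2 - Real.log Real.pi) + 3.5 / t -
        (xiReal (σ + t * I) - 1 / √5 * xiReal (stechkinAbscissa σ + t * I)) := by
  obtain ⟨k1, k2⟩ := one_div_sqrt_five_bounds
  obtain ⟨b1, b2⟩ := stechkinAbscissa_bounds h1.le h2
  rw [xiReal_eq (by simpa), xiReal_eq (by simp; linarith)]
  set κ := 1 / √5 with hκ
  set τ := stechkinAbscissa σ with hτ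
  have r1 : ∀ x : ℝ, (1 / ((x : ℂ) + t * I - 1)).re = (x - 1) / ((x - 1) ^ 2 + t ^ 2) := fun x => by
    rw [one_div, inv_re, normSq_apply]; simp; ring
  have r2 : ∀ x : ℝ, 1 ≤ x → |(digamma ((x + t * I) / 2 + 1)).re -
      Real.log ‖((x + t * I) / 2 + 1 : ℂ)‖| ≤ 4 / t := fun x hx => by
    have e : ((x + t * I) / 2 + 1 : ℂ).im = t / 2 := by simp
    have := abs_re_digamma_sub_log_le (z := (x + t * I) / 2 + 1) (by simp; linarith)
      (by rw [e, abs_of_pos] <;> linarith)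
    rw [e, abs_of_pos (by linarith : 0 < t / 2)] at this
    convert this using 1
    field_simp
    norm_num
  have r3 : ∀ x : ℝ, ‖((x + t * I) / 2 + 1 : ℂ)‖ ^ 2 = (t / 2) ^ 2 * (1 + ((x + 2) / t) ^ 2) :=
    fun x => by
      rw [← normSq_eq_norm_sq, normSq_apply]
      simp
      field_simp
      ring
  have r4 : ∀ x : ℝ, 2 * Real.log ‖((x + t * I) / 2 + 1 : ℂ)‖ =
      2 * (Real.log t - Real.log 2) + Real.log (1 + ((x + 2) / t) ^ 2) := fun x => by
    have := congrArg Real.log (r3 x)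
    rw [Real.log_pow, Real.log_mul (by positivity) (by positivity), Real.log_pow,
      Real.log_div (by positivity) (by norm_num)] at this
    exact_mod_cast this
  have u1 : Real.log (1 + ((σ + 2) / t) ^ 2) ≤ 10.24 / t ^ 2 := by
    refine (Real.log_le_sub_one_of_pos (by positivity)).trans ?_
    rw [add_sub_cancel_left, div_pow]
    gcongr
    nlinarith
  have u2 : 0 ≤ Real.log (1 + ((τ + 2) / t) ^ 2) := Real.log_nonneg (by
    have := sq_nonneg ((τ + 2) / t)
    linarith)
  have u3 : (σ - 1) / ((σ - 1) ^ 2 + t ^ 2) ≤ 0.2 / t ^ 2 := by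
    gcongr
    · linarith
    · nlinarith
  have u4 : 0 ≤ κ * ((τ - 1) / ((τ - 1) ^ 2 + t ^ 2)) := by
    have : 0 ≤ τ - 1 := by linarith
    have : 0 ≤ κ := by linarith
    positivity
  have v1 := (abs_le.1 (r2 σ h1.le)).2
  have v2 := (abs_le.1 (r2 τ (by linarith))).1
  have w1 := r4 σ
  have w2 := r4 τ
  rw [r1, r1]
  set A := (digamma ((σ + t * I) / 2 + 1)).re
  set B := (digamma ((τ + t * I) / 2 + 1)).re
  have v3 : κ * B ≥ κ * (Real.log t - Real.log 2 - 4 / t) := by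
    have : B ≥ Real.log t - Real.log 2 - 4 / t := by linarith
    have : 0 ≤ κ := by linarith
    gcongr
  have v4 : κ * (4 / t) ≤ 0.447214 * (4 / t) := by gcongr
  have x1 : 1 / t ^ 2 ≤ 0.2 / t := by
    rw [div_le_div_iff₀ (by positivity) (by positivity)]; nlinarith only [ht]
  have x2 : 10.24 / t ^ 2 = 10.24 * (1 / t ^ 2) := by ring
  have x3 : 0.2 / t ^ 2 = 0.2 * (1 / t ^ 2) := by ring
  have x4 : 0.2 / t = 0.05 * (4 / t) := by ring
  have x5 : 3.5 / t = 0.875 * (4 / t) := by ring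
  have x6 : 0 < 4 / t := by positivity
  rw [x5]
  rw [x2] at u1
  rw [x3] at u3
  rw [x4] at x1
  nlinarith only [u1, u3, u4, v1, v3, v4, w1, x1, x6, k1, k2]

end

theorem xiReal_two_le : xiReal 2 ≤ 0.21 := by
  have h := hasSum_re_LSeries_vonMangoldt (σ := 2) (by norm_num) 0
  have h1 := sum_le_hasSum {2, 3, 4, 5, 7} (fun n _ => by
    simp only [zero_mul, Real.cos_zero, mul_one]
    exact mul_nonneg vonMangoldt_nonneg (by positivity)) h
  have e4 : vonMangoldt 4 = Real.log 2 := by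
    rw [show 4 = 2 ^ 2 by norm_num, vonMangoldt_apply_pow (by norm_num),
      vonMangoldt_apply_prime Nat.prime_two]
    norm_num
  rw [Finset.sum_insert (by simp), Finset.sum_insert (by simp), Finset.sum_insert (by simp),
    Finset.sum_insert (by simp), Finset.sum_singleton, e4, vonMangoldt_apply_prime Nat.prime_two,
    vonMangoldt_apply_prime Nat.prime_three, vonMangoldt_apply_prime Nat.prime_five,
    vonMangoldt_apply_prime (by norm_num : Nat.Prime 7)] at h1
  have e : ((2 : ℝ) + (0 : ℝ) * I : ℂ) = 2 := by simp
  rw [e] at h1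
  simp only [zero_mul, Real.cos_zero, mul_one, Real.rpow_neg (Nat.cast_nonneg _)] at h1
  norm_num at h1
  rw [xiReal_eq (by simp)]
  norm_num [re_digamma_two]
  have l2 := Real.log_two_gt_d9
  have key : ∀ m k a : ℕ, 0 < a → 2 ^ m ≤ a ^ k → m * Real.log 2 ≤ k * Real.log a :=
    fun m k a _ h => by
      rw [← Real.log_pow, ← Real.log_pow]
      exact Real.log_le_log (by positivity) (by exact_mod_cast h)
  have l3 := key 19 12 3 (by norm_num) (by norm_num)
  have l5 := key 16 7 5 (by norm_num) (by norm_num)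
  have l7 := key 14 5 7 (by norm_num) (by norm_num)
  push_cast at l3 l5 l7
  have := log_pi_ge
  have := eulerMascheroniConstant_ge
  linarith

theorem five_lt_abs_im {a : ℂ} (ha : xiHalf a = 0) (h : 0 < a.re) : 5 < |a.im| := by
  by_contra! hγ
  have hre := abs_re_lt_of_xiHalf_eq_zero ha
  rw [abs_of_pos h] at hre
  have hu : a.im ^ 2 ≤ 25 := by rw [← sq_abs]; nlinarith [abs_nonneg a.im]
  have z1 : xiHalf (conj a) = 0 := by rw [xiHalf_conj, ha, _root_.map_zero]
  have z2 : xiHalf (-conj a) = 0 := by rw [xiHalf_neg, z1]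
  have z3 : xiHalf (-a) = 0 := by rw [xiHalf_neg, ha]
  have n1 : a ≠ -conj a := fun h1 => by
    have := congrArg re h1; simp at this; linarith
  set Z := zeroPair (2 - 1 / 2) a with hZ
  have e : ∀ b : ℂ, b.re ^ 2 = a.re ^ 2 → b.im ^ 2 = a.im ^ 2 → xiHalf b = 0 →
      zeroPair (2 - 1 / 2) b = 3 * (2.25 - a.re ^ 2 + a.im ^ 2) /
        ((2.25 - a.re ^ 2) ^ 2 + a.im ^ 2 * (4.5 + 2 * a.re ^ 2) + a.im ^ 4) := fun b h1 h2 h3 => by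
    have h4 := abs_re_lt_of_xiHalf_eq_zero h3
    rw [zeroPair_eq (by norm_num; linarith), show a.im ^ 4 = (a.im ^ 2) ^ 2 by ring, ← h1, ← h2]
    norm_num
    congr 1 <;> ring
  have hm : ∀ b, xiHalf b = 0 → (1 : ℝ) ≤ xiMult b := fun b hb => by
    exact_mod_cast xiMult_pos hb
  have hZ0 := e a rfl rfl ha
  have c2 : a.re ^ 2 < 1 / 4 := by nlinarith
  set x := a.re ^ 2 with hx
  set u := a.im ^ 2 with hu'
  have hx0 : 0 < x := by positivity
  have hu0 : 0 ≤ u := sq_nonneg _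
  have hu4 : a.im ^ 4 = u ^ 2 := by rw [hu']; ring
  rw [hu4] at e hZ0
  have hden : 0 < (2.25 - x) ^ 2 + u * (4.5 + 2 * x) + u ^ 2 := by
    have : 0 < 2.25 - x := by linarith
    positivity
  have hZpos : 0 < Z := by
    rw [hZ, hZ0]
    have : 0 < 2.25 - x := by linarith
    positivity
  rcases eq_or_ne a.im 0 with h0 | h0
  · have := sum_le_xiReal (s := 2) (by simp) {a, -conj a} (by simp [ha, z2])
    rw [Finset.sum_pair n1, e (-conj a) (by simp [hx]) (by simp [hu']) z2, ← hZ0, ← hZ] at this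
    have h1 : (0.5 : ℝ) ≤ Z := by
      rw [hZ, hZ0, le_div_iff₀ hden, hu', h0]
      nlinarith
    nlinarith [hm a ha, hm _ z2, xiReal_two_le]
  · have n2 : a ≠ conj a := fun h1 => by
      have := congrArg im h1; simp at this; exact h0 (by linarith)
    have n3 : a ≠ -a := fun h1 => by
      have := congrArg re h1; simp at this; linarith
    have n4 : conj a ≠ -conj a := fun h1 => by
      have := congrArg re h1; simp at this; linarith
    have n5 : conj a ≠ -a := fun h1 => by
      have := congrArg re h1; simp at this; linarith
    have n6 : -conj a ≠ -a := fun h1 => n2 (neg_injective h1).symm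
    have := sum_le_xiReal (s := 2) (by simp) {a, conj a, -conj a, -a} (by simp [ha, z1, z2, z3])
    rw [Finset.sum_insert (by simp [n1, n2, n3]), Finset.sum_insert (by simp [n4, n5]),
      Finset.sum_pair n6, e (-conj a) (by simp [hx]) (by simp [hu']) z2,
      e (conj a) (by simp [hx]) (by simp [hu']) z1,
      e (-a) (by simp [hx]) (by simp [hu']) z3, ← hZ0, ← hZ] at this
    have h1 : (0.105 : ℝ) < Z := by
      rw [hZ, hZ0, lt_div_iff₀ hden]
      nlinarith
    nlinarith [hm a ha, hm _ z2, hm _ z1, hm _ z3, xiReal_two_le]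

theorem div_le_log_of_pow_le {p q : ℕ} {x : ℝ} (hq : 0 < q) (hx : 0 < x)
    (h : (2.7182818286 : ℝ) ^ p ≤ x ^ q) : (p : ℝ) / q ≤ Real.log x := by
  rw [div_le_iff₀ (by positivity), mul_comm, ← Real.log_pow, Real.le_log_iff_exp_le (by positivity),
    ← mul_one (p : ℝ), Real.exp_nat_mul]
  exact (pow_le_pow_left₀ (Real.exp_pos 1).le Real.exp_one_lt_d9.le p).trans h

/-- The denominator in the zero-free region. -/
noncomputable def zfLog (γ : ℝ) : ℝ := Real.log (γ / 12 + 6)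

theorem log_three_le : Real.log 3 ≤ 1.0989 := by
  have : Real.log (3 ^ 41) ≤ Real.log (2 ^ 65) := Real.log_le_log (by positivity) (by norm_num)
  rw [Real.log_pow, Real.log_pow] at this
  push_cast at this
  linarith [Real.log_two_lt_d9]

theorem log_le_zfLog_aux {γ m c a : ℝ} (ha : 0 < a) (hγ : a ≤ γ) (hm : 0 < m) (h1 : m ≤ zfLog γ)
    (h2 : c ≤ Real.log (1 + 72 / γ)) (h3 : 9.27 / a + 0.5 / m ≤ c + 0.1317) :
    Real.log γ + 9.27 / γ + 0.5 / zfLog γ ≤ zfLog γ + 2.617 := by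
  have h0 : 0 < γ := ha.trans_le hγ
  have e : zfLog γ = Real.log γ + Real.log (1 + 72 / γ) - Real.log 12 := by
    rw [zfLog, ← Real.log_mul (by positivity) (by positivity),
      ← Real.log_div (by positivity) (by positivity)]
    congr 1
    field_simp
    norm_num
  have e12 : Real.log 12 ≤ 2.4853 := by
    rw [show (12 : ℝ) = 2 ^ 2 * 3 by norm_num, Real.log_mul (by norm_num) (by norm_num),
      Real.log_pow]
    push_cast
    linarith [Real.log_two_lt_d9, log_three_le]
  have h4 : 9.27 / γ ≤ 9.27 / a := by gcongr
  have h5 : 0.5 / zfLog γ ≤ 0.5 / m := by gcongr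
  linarith

theorem le_zfLog {γ a : ℝ} {p q : ℕ} (hq : 0 < q) (ha : 0 ≤ a) (h : a ≤ γ)
    (h1 : (2.7182818286 : ℝ) ^ p ≤ (a / 12 + 6) ^ q) : (p : ℝ) / q ≤ zfLog γ :=
  (div_le_log_of_pow_le hq (by positivity) h1).trans
    (Real.log_le_log (by positivity) (by linarith))

theorem log_le_zfLog {γ : ℝ} (hγ : 5 ≤ γ) :
    Real.log γ + 9.27 / γ + 0.5 / zfLog γ ≤ zfLog γ + 2.617 := by
  have h0 : 0 < γ := by linarith
  have hl : ∀ b : ℝ, γ ≤ b → 144 / (72 + 2 * b) ≤ Real.log (1 + 72 / γ) := fun b hb => by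
    refine le_trans ?_ (Real.le_log_one_add_of_nonneg (by positivity))
    have e : 2 * (72 / γ) / (72 / γ + 2) = 144 / (72 + 2 * γ) := by
      field_simp
      norm_num
    rw [e]
    gcongr
  rcases le_total γ 7 with h | h
  · refine log_le_zfLog_aux (a := 5) (m := 9 / 5) (c := 23 / 10) (by norm_num) hγ (by norm_num)
      ?_ ?_ (by norm_num)
    · exact_mod_cast le_zfLog (p := 9) (q := 5) (by norm_num) (by norm_num) hγ (by norm_num)
    · have h1 := div_le_log_of_pow_le (p := 23) (q := 10) (x := 79 / 7) (by norm_num)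
        (by norm_num) (by norm_num)
      push_cast at h1
      refine h1.trans (Real.log_le_log (by norm_num) ?_)
      rw [← sub_le_iff_le_add', le_div_iff₀ h0]
      linarith
  rcases le_total γ 10 with h' | h'
  · refine log_le_zfLog_aux (a := 7) (m := 9 / 5) (by norm_num) h (by norm_num) ?_ (hl 10 h')
      (by norm_num)
    exact_mod_cast le_zfLog (p := 9) (q := 5) (by norm_num) (by norm_num) h (by norm_num)
  rcases le_total γ 20 with h | h
  · refine log_le_zfLog_aux (a := 10) (m := 9 / 5) (by norm_num) h' (by norm_num) ?_ (hl 20 h)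
      (by norm_num)
    exact_mod_cast le_zfLog (p := 9) (q := 5) (by norm_num) (by norm_num) h' (by norm_num)
  rcases le_total γ 60 with h' | h'
  · refine log_le_zfLog_aux (a := 20) (m := 2 / 1) (by norm_num) h (by norm_num) ?_ (hl 60 h')
      (by norm_num)
    exact_mod_cast le_zfLog (p := 2) (q := 1) (by norm_num) (by norm_num) h (by norm_num)
  rcases le_total γ 200 with h | h
  · refine log_le_zfLog_aux (a := 60) (m := 23 / 10) (by norm_num) h' (by norm_num) ?_ (hl 200 h)
      (by norm_num)
    exact_mod_cast le_zfLog (p := 23) (q := 10) (by norm_num) (by norm_num) h' (by norm_num)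
  rcases le_total γ 600 with h' | h'
  · refine log_le_zfLog_aux (a := 200) (m := 3 / 1) (by norm_num) h (by norm_num) ?_ (hl 600 h')
      (by norm_num)
    exact_mod_cast le_zfLog (p := 3) (q := 1) (by norm_num) (by norm_num) h (by norm_num)
  rcases le_total γ 1800 with h | h
  · refine log_le_zfLog_aux (a := 600) (m := 4 / 1) (by norm_num) h' (by norm_num) ?_ (hl 1800 h)
      (by norm_num)
    exact_mod_cast le_zfLog (p := 4) (q := 1) (by norm_num) (by norm_num) h' (by norm_num)
  · refine log_le_zfLog_aux (a := 1800) (m := 5 / 1) (c := 0) (by norm_num) h (by norm_num) ?_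
      (Real.log_nonneg ?_) (by norm_num)
    · exact_mod_cast le_zfLog (p := 5) (q := 1) (by norm_num) (by norm_num) h (by norm_num)
    · have : 0 ≤ 72 / γ := by positivity
      linarith

theorem zeroPair_neg_conj (w a : ℂ) : zeroPair w (-conj a) = zeroPair w a := by
  unfold zeroPair
  rw [map_neg, conj_conj, sub_neg_eq_add, ← sub_eq_add_neg, add_comm]

set_option maxHeartbeats 1000000 in
theorem zero_free {a : ℂ} (ha : xiHalf a = 0) (hre : 0 < a.re) (him : 5 ≤ a.im) :
    0.1036 / zfLog a.im ≤ 1 / 2 - a.re := by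
  have hr := abs_lt.1 (abs_re_lt_of_xiHalf_eq_zero ha)
  obtain ⟨k1, k2⟩ := one_div_sqrt_five_bounds
  set γ := a.im with hγ
  set β := a.re + 1 / 2 with hβ
  set ℓ := zfLog γ with hℓ
  have hℓ1 : 9 / 5 ≤ ℓ := by
    exact_mod_cast le_zfLog (p := 9) (q := 5) (by norm_num) (by norm_num) him (by norm_num)
  have hkey := log_le_zfLog him
  rw [← hℓ] at hkey
  set σ := 1 + 0.338 / ℓ with hσ
  have hη : 0 < 0.338 / ℓ := by positivity
  have h1 : 1 < σ := by linarith
  have h2 : σ ≤ 1.2 := by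
    have : 0.338 / ℓ ≤ 0.338 / (9 / 5) := by gcongr
    norm_num at this
    linarith
  obtain ⟨b1, b2⟩ := stechkinAbscissa_bounds h1.le h2
  have hF : ∀ t : ℝ, ∀ S : Finset ℂ, (∀ a ∈ S, xiHalf a = 0) → _ := fun t S hS =>
    sum_le_xiReal_sub (s := σ + t * I) (s₁ := stechkinAbscissa σ + t * I)
    (κ := 1 / √5) (by simp; linarith) (by simp; linarith)
    (fun a ha => zeroPair_sub_nonneg h1.le (abs_re_lt_of_xiHalf_eq_zero ha)) S hS
  have z2 : xiHalf (-conj a) = 0 := by rw [xiHalf_neg, xiHalf_conj, ha, _root_.map_zero]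
  have n1 : a ≠ -conj a := fun h1 => by
    have := congrArg re h1; simp at this; linarith
  have f1 := hF γ {a, -conj a} (by simp [ha, z2])
  have f2 := hF (2 * γ) ∅ (by simp)
  have f3 := hF (3 * γ) ∅ (by simp)
  have f4 := hF (4 * γ) ∅ (by simp)
  rw [Finset.sum_empty] at f2 f3 f4
  have ea : a = β - 1 / 2 + γ * I := by
    apply Complex.ext <;> simp [hβ, hγ]
  have p1 := le_zeroPair_sub (t := γ) h1 (by linarith only [hre, hβ] : 1 / 2 < β)
    (by linarith only [hr.2, hβ])
  rw [← ea] at p1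
  have p2 : zeroPair (σ + γ * I - 1 / 2) (-conj a) = zeroPair (σ + γ * I - 1 / 2) a :=
    zeroPair_neg_conj _ _
  have p3 : zeroPair (stechkinAbscissa σ + γ * I - 1 / 2) (-conj a) =
      zeroPair (stechkinAbscissa σ + γ * I - 1 / 2) a := zeroPair_neg_conj _ _
  rw [Finset.sum_pair n1, p2, p3] at f1
  have hm : ∀ b, xiHalf b = 0 → (1 : ℝ) ≤ xiMult b := fun b hb => by
    exact_mod_cast xiMult_pos hb
  have hpos : 0 < 1 / (σ - β) := by
    have : 0 < σ - β := by linarith only [h1, hr.2, hβ]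
    positivity
  have f1' : 1 / (σ - β) ≤ xiReal (σ + γ * I) - 1 / √5 * xiReal (stechkinAbscissa σ + γ * I) := by
    have w1 := hm a ha
    have w2 := hm _ z2
    clear * - f1 p1 hpos w1 w2
    nlinarith
  have d0 := stechkin_zero_le h1 h2
  have d1 := stechkin_le h1 h2 him
  have d2 := stechkin_le h1 h2 (by linarith only [him] : 5 ≤ 2 * γ)
  have d3 := stechkin_le h1 h2 (by linarith only [him] : 5 ≤ 3 * γ)
  have d4 := stechkin_le h1 h2 (by linarith only [him] : 5 ≤ 4 * γ)
  have ht := stechkin_trig_sum_nonneg h1 (by linarith only [b1, b2, h1, h2] : σ ≤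
      stechkinAbscissa σ)
    (by linarith only [k2] : 1 / √5 ≤ 1) γ _ fun t => rfl
  have g0 : γ ≠ 0 := by linarith only [him]
  rw [Real.log_mul (by norm_num) g0] at d2 d3 d4
  rw [show (4 : ℝ) = 2 ^ 2 by norm_num, Real.log_pow, ← show (4 : ℝ) = 2 ^ 2 by norm_num] at d4
  by_contra! hc
  have c1 : ℓ / 0.4416 ≤ 1 / (σ - β) := by
    rw [div_le_div_iff₀ (by norm_num) (by linarith only [h1, hr.2, hβ])]
    have : σ - β ≤ 0.4416 / ℓ := by
      rw [show (0.4416 : ℝ) / ℓ = 0.338 / ℓ + 0.1036 / ℓ by ring]; linarith only [hc, hσ, hβ]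
    rw [le_div_iff₀ (by positivity)] at this
    linarith only [this]
  have e1 : 1 / (σ - 1) = ℓ / 0.338 := by rw [hσ]; field_simp; ring
  rw [e1] at d0
  have q1 : 3.5 / γ = 3.5 * (1 / γ) := by ring
  have q2 : 3.5 / (2 * γ) = 3.5 / 2 * (1 / γ) := by ring
  have q3 : 3.5 / (3 * γ) = 3.5 / 3 * (1 / γ) := by ring
  have q4 : 3.5 / (4 * γ) = 3.5 / 4 * (1 / γ) := by ring
  have q5 : 9.27 / γ = 9.27 * (1 / γ) := by ring
  have q6 : σ - 1 = 0.338 * (1 / ℓ) := by rw [hσ]; ring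
  have q7 : 0.5 / ℓ = 0.5 * (1 / ℓ) := by ring
  rw [q1] at d1
  rw [q2] at d2
  rw [q3] at d3
  rw [q4] at d4
  rw [q5, q7] at hkey
  rw [q6] at d0
  have i1 : 0 < 1 / γ := by positivity
  have i2 : 0 < 1 / ℓ := by positivity
  have l2 := Real.log_two_lt_d9
  have l2' := Real.log_two_gt_d9
  have l3 := log_three_le
  have lπ := log_pi_ge
  set D0 := (LSeries (fun n => (vonMangoldt n : ℂ)) (σ + (0 : ℝ) * I)).re -
      1 / √5 * (LSeries (fun n => (vonMangoldt n : ℂ)) (stechkinAbscissa σ + (0 : ℝ) * I)).re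
  set D1 := (LSeries (fun n => (vonMangoldt n : ℂ)) (σ + γ * I)).re -
      1 / √5 * (LSeries (fun n => (vonMangoldt n : ℂ)) (stechkinAbscissa σ + γ * I)).re
  set D2 := (LSeries (fun n => (vonMangoldt n : ℂ)) (σ + (2 * γ : ℝ) * I)).re -
      1 / √5 * (LSeries (fun n => (vonMangoldt n : ℂ)) (stechkinAbscissa σ + (2 * γ : ℝ) * I)).re
  set D3 := (LSeries (fun n => (vonMangoldt n : ℂ)) (σ + (3 * γ : ℝ) * I)).re -
      1 / √5 * (LSeries (fun n => (vonMangoldt n : ℂ)) (stechkinAbscissa σ + (3 * γ : ℝ) * I)).re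
  set D4 := (LSeries (fun n => (vonMangoldt n : ℂ)) (σ + (4 * γ : ℝ) * I)).re -
      1 / √5 * (LSeries (fun n => (vonMangoldt n : ℂ)) (stechkinAbscissa σ + (4 * γ : ℝ) * I)).re
  clear_value D0 D1 D2 D3 D4
  set X := Real.log γ
  set K := (1 - 1 / √5) / 2 with hK
  have K1 : 0.276393 ≤ K := by rw [hK]; linarith only [k2]
  have K2 : K ≤ 0.2763935 := by rw [hK]; linarith only [k1]
  set U := ℓ + 2.617 - 9.27 * (1 / γ) - 0.5 * (1 / ℓ) with hU
  have hXU : 35.78532 * X + 13.4517 * Real.log 2 + 4.7 * Real.log 3 -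
      35.78532 * (Real.log 2 + Real.log Real.pi) ≤ 35.78532 * U - 51.237 := by
    linarith only [hkey, hU, l2, l2', l3, lπ]
  have hmul := mul_le_mul_of_nonneg_left hXU (by linarith only [K1] : 0 ≤ K)
  have m1 : K * ℓ ≤ 0.2763935 * ℓ := by gcongr
  have m2 : 0.276393 * (1 / γ) ≤ K * (1 / γ) := by gcongr
  have m3 : 0.276393 * (1 / ℓ) ≤ K * (1 / ℓ) := by gcongr
  rw [hU] at hmul
  ring_nf at hmul d0 d1 d2 d3 d4 ht f2 f3 f4 f1' c1 m1 m2 m3 i1 i2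
  linarith

end

section

open Filter Topology Complex Set ComplexConjugate ArithmeticFunction
open MeasureTheory

/-! ### The Hann kernel and the explicit formula -/

/-- The Hann window on `[0, δ]`. -/
noncomputable def hann (δ u : ℝ) : ℝ := if u ∈ Icc 0 δ then Real.sin (Real.pi * u / δ) ^ 2 else 0

/-- The Laplace transform of the Hann window. -/
noncomputable def hannK (δ : ℝ) (s : ℂ) : ℂ := ∫ u, (hann δ u : ℂ) * exp (s * u)

theorem hann_le_one (δ u : ℝ) : hann δ u ≤ 1 := by
  unfold hann
  split_ifs
  · exact Real.sin_sq_le_one _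
  · exact zero_le_one

theorem hann_of_le {δ u : ℝ} (hu : u ≤ 0) : hann δ u = 0 := by
  unfold hann
  split_ifs with h
  · rw [le_antisymm hu h.1]; simp
  · rfl

theorem hann_of_ge {δ u : ℝ} (hδ : 0 < δ) (hu : δ ≤ u) : hann δ u = 0 := by
  unfold hann
  split_ifs with h
  · rw [le_antisymm h.2 hu, mul_div_cancel_right₀ _ hδ.ne']; simp
  · rfl

theorem continuous_hann {δ : ℝ} (hδ : 0 < δ) : Continuous (hann δ) := by
  unfold hann
  refine continuous_if ?_ (by fun_prop) continuous_const.continuousOn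
  intro u hu
  replace hu : u ∈ frontier (Icc 0 δ) := hu
  rw [frontier_Icc hδ.le] at hu
  rcases hu with rfl | rfl
  · simp
  · rw [mul_div_cancel_right₀ _ hδ.ne']; simp

theorem hann_mul_eq_indicator (δ : ℝ) (f : ℝ → ℂ) : (fun u => (hann δ u : ℂ) * f u) =
    indicator (Icc 0 δ) fun u => ((Real.sin (Real.pi * u / δ) ^ 2 : ℝ) : ℂ) * f u := by
  funext u
  unfold hann indicator
  split_ifs <;> simp

theorem integrable_hann_mul (δ : ℝ) {f : ℝ → ℂ} (hf : Continuous f) :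
    Integrable fun u => (hann δ u : ℂ) * f u := by
  rw [hann_mul_eq_indicator, integrable_indicator_iff measurableSet_Icc]
  exact Continuous.integrableOn_Icc (by fun_prop)

theorem hannK_eq {δ : ℝ} (hδ : 0 < δ) (s : ℂ) : hannK δ s =
    ∫ u in (0 : ℝ)..δ, ((Real.sin (Real.pi * u / δ) ^ 2 : ℝ) : ℂ) * exp (s * u) := by
  rw [hannK, hann_mul_eq_indicator δ fun u => exp (s * u), integral_indicator measurableSet_Icc,
    integral_Icc_eq_integral_Ioc, intervalIntegral.integral_of_le hδ.le]

theorem hannK_mul {δ : ℝ} (hδ : 0 < δ) (s : ℂ) :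
    2 * s * (s ^ 2 + (2 * Real.pi / δ : ℝ) ^ 2) * hannK δ s =
      (2 * Real.pi / δ : ℝ) ^ 2 * (exp (s * δ) - 1) := by
  set a : ℝ := 2 * Real.pi / δ with ha
  have had : a * δ = 2 * Real.pi := by rw [ha]; field_simp
  let F : ℝ → ℂ := fun u => exp (s * u) * ((s ^ 2 + a ^ 2) -
    s * (s * Complex.cos (a * u) + a * Complex.sin (a * u)))
  have hF : ∀ u : ℝ, HasDerivAt F (2 * s * (s ^ 2 + a ^ 2) *
      (((Real.sin (Real.pi * u / δ) ^ 2 : ℝ) : ℂ) * exp (s * u))) u := fun u => by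
    have h1 : HasDerivAt (fun z : ℂ => exp (s * z) * ((s ^ 2 + a ^ 2) -
        s * (s * Complex.cos (a * z) + a * Complex.sin (a * z))))
        (exp (s * u) * (s * 1) * ((s ^ 2 + a ^ 2) -
        s * (s * Complex.cos (a * u) + a * Complex.sin (a * u))) + exp (s * u) *
        (0 - s * (s * (-Complex.sin (a * u) * (a * 1)) + a * (Complex.cos (a * u) * (a * 1))))) u :=
      (((hasDerivAt_id _).const_mul s).cexp).mul ((hasDerivAt_const _ _).sub
        (((((hasDerivAt_id _).const_mul (a : ℂ)).ccos.const_mul s).add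
          (((hasDerivAt_id _).const_mul (a : ℂ)).csin.const_mul (a : ℂ))).const_mul s))
    convert h1.comp_ofReal using 1
    have h2 : Real.sin (Real.pi * u / δ) ^ 2 = (1 - Real.cos (a * u)) / 2 := by
      rw [Real.sin_sq_eq_half_sub]
      have : 2 * (Real.pi * u / δ) = a * u := by rw [ha]; ring
      rw [this]; ring
    rw [h2]
    push_cast
    ring
  have h := intervalIntegral.integral_eq_sub_of_hasDerivAt (a := 0) (b := δ) (fun u _ => hF u)
    (Continuous.intervalIntegrable (by fun_prop) _ _)
  rw [hannK_eq hδ, ← intervalIntegral.integral_const_mul, h]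
  have hc : Complex.cos (a * δ) = 1 := by
    rw [← ofReal_mul, had]; push_cast; exact Complex.cos_two_pi
  have hs : Complex.sin (a * δ) = 0 := by
    rw [← ofReal_mul, had]; push_cast; exact Complex.sin_two_pi
  simp only [F, hc, hs]
  simp
  ring

theorem continuous_hannK {δ : ℝ} : Continuous (hannK δ) := by
  have : hannK δ = fun s => ∫ u in Icc 0 δ,
      ((Real.sin (Real.pi * u / δ) ^ 2 : ℝ) : ℂ) * exp (s * u) := by
    funext s
    rw [hannK, hann_mul_eq_indicator δ fun u => exp (s * u), integral_indicator measurableSet_Icc]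
  rw [this]
  exact continuous_parametric_integral_of_continuous (by fun_prop) isCompact_Icc

theorem norm_hannK_le {δ : ℝ} (hδ : 0 < δ) (s : ℂ) :
    ‖hannK δ s‖ ≤ δ / 2 * Real.exp (max s.re 0 * δ) := by
  rw [hannK_eq hδ]
  have e : ∫ u in (0 : ℝ)..δ, Real.sin (Real.pi * u / δ) ^ 2 = δ / 2 := by
    have := integral_sin_sq (a := 0) (b := Real.pi)
    have h2 := intervalIntegral.integral_comp_mul_left (a := 0) (b := δ)
      (fun x => Real.sin x ^ 2) (c := Real.pi / δ) (by positivity)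
    simp only [mul_zero, div_mul_cancel₀ _ hδ.ne', this] at h2
    calc _ = ∫ u in (0 : ℝ)..δ, Real.sin (Real.pi / δ * u) ^ 2 := by
          congr 1; funext u; rw [div_mul_eq_mul_div]
      _ = _ := by
          rw [h2]; simp; field_simp
  calc _ ≤ ∫ u in (0 : ℝ)..δ, Real.sin (Real.pi * u / δ) ^ 2 * Real.exp (max s.re 0 * δ) := by
        refine intervalIntegral.norm_integral_le_of_norm_le hδ.le
            (Eventually.of_forall fun u hu => ?_)
          (Continuous.intervalIntegrable (by fun_prop) _ _)
        rw [norm_mul, norm_real, Real.norm_of_nonneg (by positivity), norm_exp]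
        gcongr
        simp only [mul_re, ofReal_re, ofReal_im, mul_zero, sub_zero]
        calc s.re * u ≤ max s.re 0 * u := by gcongr; exacts [hu.1.le, le_max_left _ _]
          _ ≤ _ := by gcongr; exact hu.2
    _ = _ := by rw [intervalIntegral.integral_mul_const, e]

/-- The point of the line of integration with ordinate `t`. -/
noncomputable def line (t : ℝ) : ℂ := 2 + t * I

theorem continuous_line : Continuous line := by unfold line; fun_prop

@[simp] theorem line_re (t : ℝ) : (line t).re = 2 := by simp [line]

theorem two_le_norm_line (t : ℝ) : 2 ≤ ‖line t‖ := by
  simpa using re_le_norm (line t)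

theorem norm_line_sq (t : ℝ) : ‖line t‖ ^ 2 = 4 + t ^ 2 := by
  rw [← normSq_eq_norm_sq, normSq_apply]; simp [line]; ring

theorem norm_hannK_line_le {δ : ℝ} (hδ : 0 < δ) : ∃ C > 0, ∀ t, ‖hannK δ (line t)‖ ≤
    C / ‖line t‖ ^ 3 := by
  set a : ℝ := 2 * Real.pi / δ with ha
  have ha0 : 0 < a := by positivity
  refine ⟨a ^ 2 * (Real.exp (2 * δ) + 1) * (1 + a / 2) ^ 2 / 2, by positivity, fun t => ?_⟩
  have h := congrArg norm (hannK_mul hδ (line t))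
  rw [← ha] at h
  set s := line t with hs
  have h1 : 2 ≤ ‖s‖ := two_le_norm_line t
  have key : ∀ ε : ℝ, |ε| = 1 → ‖s‖ / (1 + a / 2) ≤ ‖s - ε * a * I‖ := fun ε hε => by
    have h2 : 2 ≤ ‖s - ε * a * I‖ := by
      have := re_le_norm (s - ε * a * I)
      simpa [hs] using this
    have h3 : ‖s‖ ≤ ‖s - ε * a * I‖ + a := by
      have := norm_add_le (s - ε * a * I) (ε * a * I)
      simpa [hε, abs_of_pos ha0] using this
    rw [div_le_iff₀ (by positivity)]
    nlinarith
  have h4 : ‖s‖ ^ 2 / (1 + a / 2) ^ 2 ≤ ‖s ^ 2 + (a : ℂ) ^ 2‖ := by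
    have e : s ^ 2 + (a : ℂ) ^ 2 = (s - (1 : ℝ) * a * I) * (s - (-1 : ℝ) * a * I) := by
      push_cast
      linear_combination (a : ℂ) ^ 2 * I_sq
    rw [e, norm_mul, ← div_pow, sq]
    exact mul_le_mul (key _ (by simp)) (key _ (by simp)) (by positivity) (norm_nonneg _)
  have h5 : ‖exp (s * δ) - 1‖ ≤ Real.exp (2 * δ) + 1 := by
    refine (norm_sub_le _ _).trans ?_
    rw [norm_exp, norm_one]
    simp [hs]
  rw [norm_mul, norm_mul, norm_mul, norm_mul, norm_pow, norm_real, Complex.norm_ofNat,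
    Real.norm_of_nonneg ha0.le] at h
  rw [le_div_iff₀ (by positivity)]
  have h6 : ‖s‖ ^ 2 ≤ ‖s ^ 2 + (a : ℂ) ^ 2‖ * (1 + a / 2) ^ 2 := by
    rwa [div_le_iff₀ (by positivity)] at h4
  calc ‖hannK δ s‖ * ‖s‖ ^ 3 = ‖hannK δ s‖ * ‖s‖ * ‖s‖ ^ 2 := by ring
    _ ≤ ‖hannK δ s‖ * ‖s‖ * (‖s ^ 2 + (a : ℂ) ^ 2‖ * (1 + a / 2) ^ 2) := by gcongr
    _ = a ^ 2 * ‖exp (s * δ) - 1‖ * (1 + a / 2) ^ 2 / 2 := by rw [← h]; ring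
    _ ≤ _ := by gcongr

theorem integrable_norm_line_rpow {r : ℝ} (hr : 1 < r) : Integrable fun t => ‖line t‖ ^ (-r) := by
  refine (integrable_rpow_neg_one_add_norm_sq (E := ℝ) (μ := volume) (r := r) (by simpa)).mono'
    (continuous_line.norm.measurable.pow_const _).aestronglyMeasurable
    (Eventually.of_forall fun t => ?_)
  rw [Real.norm_of_nonneg (by positivity)]
  have h := two_le_norm_line t
  rw [show -r / 2 = (1 / 2) * -r by ring, Real.rpow_mul (by positivity), ← Real.sqrt_eq_rpow]
  refine Real.rpow_le_rpow_of_nonpos (Real.sqrt_pos.2 (by positivity)) ?_ (by linarith)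
  refine Real.sqrt_le_iff.2 ⟨norm_nonneg _, ?_⟩
  rw [norm_line_sq, Real.norm_eq_abs, sq_abs]; linarith

theorem integrable_hannK_line {δ : ℝ} (hδ : 0 < δ) : Integrable fun t => hannK δ (line t) := by
  obtain ⟨C, hC, h⟩ := norm_hannK_line_le hδ
  refine ((integrable_norm_line_rpow (r := 3) (by norm_num)).const_mul C).mono'
    (continuous_hannK.comp continuous_line).aestronglyMeasurable
    (Eventually.of_forall fun t => (h t).trans (le_of_eq ?_))
  rw [Real.rpow_neg (norm_nonneg _), div_eq_mul_inv]
  norm_cast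

open FourierTransform in
theorem hann_eq_integral {δ : ℝ} (hδ : 0 < δ) (v : ℝ) : (hann δ v : ℂ) =
    1 / (2 * Real.pi : ℝ) * ∫ t, hannK δ (line t) * exp (-line t * v) := by
  let f : ℝ → ℂ := fun u => (hann δ u : ℂ) * exp ((2 : ℂ) * u)
  have hf : Continuous f := by
    have := continuous_hann hδ
    fun_prop
  have hfi : Integrable f := integrable_hann_mul δ (by fun_prop)
  have h1 : ∀ ξ : ℝ, 𝓕 f ξ = hannK δ (line (-2 * Real.pi * ξ)) := fun ξ => by
    rw [Real.fourier_real_eq_integral_exp_smul, hannK]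
    congr 1
    funext u
    simp only [f, smul_eq_mul]
    rw [mul_left_comm, ← Complex.exp_add]
    congr 2
    simp [line]
    ring
  have hne : (-2 * Real.pi) ≠ 0 := by have := Real.pi_pos; simp
  have hFi : Integrable (𝓕 f) := by
    have := (integrable_hannK_line hδ).comp_mul_left' hne
    exact this.congr (Eventually.of_forall fun ξ => (h1 ξ).symm)
  have h2 := congrFun (hf.fourierInv_fourier_eq hfi hFi) v
  rw [Real.fourierInv_eq'] at h2
  have h3 : ∀ ξ : ℝ, exp ((2 * Real.pi * inner ℝ ξ v : ℝ) * I) • 𝓕 f ξ =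
      exp ((2 : ℂ) * v) * (fun t => hannK δ (line t) * exp (-line t * v)) (-2 * Real.pi * ξ) :=
          fun ξ => by
    rw [h1, smul_eq_mul]
    simp only
    rw [mul_left_comm, ← Complex.exp_add, mul_comm]
    congr 2
    simp [line]
    ring
  simp_rw [h3] at h2
  rw [integral_const_mul, Measure.integral_comp_mul_left (a := -2 * Real.pi)
    (fun t => hannK δ (line t) * exp (-line t * v))] at h2
  simp only [f] at h2
  rw [mul_comm] at h2
  have h4 := mul_right_cancel₀ (Complex.exp_ne_zero _) h2
  rw [← h4, real_smul, abs_inv, abs_mul, abs_neg, abs_two, abs_of_pos Real.pi_pos, one_div,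
    ofReal_inv]

/-- Integration against the transform of the Hann window along the line `Re s = 2`. -/
noncomputable def hannT (δ L : ℝ) (F : ℂ → ℂ) : ℂ :=
  1 / (2 * Real.pi : ℝ) * ∫ t, hannK δ (line t) * exp (line t * L) * F (line t)

theorem hannT_exp {δ : ℝ} (hδ : 0 < δ) (L v : ℝ) :
    hannT δ L (fun s => exp (-s * v)) = hann δ (v - L) := by
  rw [hann_eq_integral hδ, hannT]
  congr 2
  funext t
  rw [mul_assoc, ← Complex.exp_add]
  congr 2
  push_cast
  ring

theorem hannT_one {δ L : ℝ} (hδ : 0 < δ) (hL : 0 ≤ L) : hannT δ L (fun _ => 1) = 0 := by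
  have := hannT_exp hδ L 0
  simpa [hann_of_le (show 0 - L ≤ 0 by linarith), hann_of_le (show -L ≤ 0 by linarith)] using this

theorem norm_exp_line (t L : ℝ) : ‖exp (line t * L)‖ = Real.exp (2 * L) := by
  rw [norm_exp]; simp

theorem hannT_inv {δ L : ℝ} (hδ : 0 < δ) (hL : 0 ≤ L) {ρ : ℂ} (hρ : ρ.re < 2) :
    hannT δ L (fun s => 1 / (s - ρ)) = exp (ρ * L) * hannK δ ρ := by
  have h1 : ∀ t, 1 / (line t - ρ) = ∫ v : ℝ in Ioi 0, exp (-(line t - ρ) * v) := fun t => by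
    rw [integral_exp_mul_complex_Ioi (by simpa using hρ)]
    rw [ofReal_zero, mul_zero, Complex.exp_zero, neg_div_neg_eq]
  have h2 : Integrable (Function.uncurry fun (t v : ℝ) =>
      hannK δ (line t) * exp (line t * L) * exp (-(line t - ρ) * v))
      (volume.prod (volume.restrict (Ioi (0 : ℝ)))) := by
    have hi : Integrable (fun v : ℝ => Real.exp (-(2 - ρ.re) * v)) (volume.restrict (Ioi
        (0 : ℝ))) :=
      exp_neg_integrableOn_Ioi 0 (by linarith)
    refine (((integrable_hannK_line hδ).norm.mul_const (Real.exp (2 * L))).mul_prod hi).mono' ?_ ?_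
    · refine Continuous.aestronglyMeasurable ?_
      have := continuous_hannK (δ := δ)
      have := continuous_line
      unfold Function.uncurry
      fun_prop
    · refine Eventually.of_forall fun ⟨t, v⟩ => le_of_eq ?_
      simp only [Function.uncurry_apply_pair]
      rw [norm_mul, norm_mul, norm_exp_line, norm_exp]
      simp
  have h3 : ∀ v : ℝ, ∫ t, hannK δ (line t) * exp (line t * L) * exp (-(line t - ρ) * v) =
      (2 * Real.pi : ℝ) * (exp (ρ * v) * hann δ (v - L)) := fun v => by
    rw [hann_eq_integral hδ (v - L), mul_left_comm, ← mul_assoc ((2 * Real.pi : ℝ) : ℂ),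
      mul_one_div_cancel (by simp), one_mul, ← integral_const_mul]
    congr 1
    funext t
    have e : exp (line t * L) * exp (-(line t - ρ) * v) =
        exp (ρ * v) * exp (-line t * (v - L : ℝ)) := by
      rw [← Complex.exp_add, ← Complex.exp_add]
      congr 1
      push_cast
      ring
    linear_combination hannK δ (line t) * e
  have h4 : ∀ t, hannK δ (line t) * exp (line t * L) * (1 / (line t - ρ)) = ∫ v : ℝ in Ioi 0,
      hannK δ (line t) * exp (line t * L) * exp (-(line t - ρ) * v) := fun t => by
    rw [h1, integral_const_mul]
  unfold hannT
  simp_rw [h4]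
  rw [integral_integral_swap h2]
  simp_rw [h3]
  rw [integral_const_mul, ← mul_assoc, one_div_mul_cancel (by simp), one_mul]
  rw [setIntegral_eq_integral_of_forall_compl_eq_zero fun v hv => by
    rw [hann_of_le (by simp at hv; linarith)]; simp]
  rw [← integral_add_right_eq_self _ L, hannK, ← integral_const_mul]
  congr 1
  funext u
  rw [add_sub_cancel_right, ofReal_add, mul_add, Complex.exp_add]
  ring

theorem exists_norm_hannT_le {δ : ℝ} (hδ : 0 < δ) (L : ℝ) : ∃ M > 0, ∀ C t, ∀ z : ℂ,
    ‖z‖ ≤ C * ‖line t‖ ^ (3 / 2 : ℝ) →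
    ‖hannK δ (line t) * exp (line t * L) * z‖ ≤ M * C * ‖line t‖ ^ (-(3 / 2) : ℝ) := by
  obtain ⟨M, hM, h⟩ := norm_hannK_line_le hδ
  refine ⟨M * Real.exp (2 * L), by positivity, fun C t z hz => ?_⟩
  have h0 : 0 < ‖line t‖ := by linarith [two_le_norm_line t]
  rw [norm_mul, norm_mul, norm_exp_line]
  calc _ ≤ M / ‖line t‖ ^ 3 * Real.exp (2 * L) * (C * ‖line t‖ ^ (3 / 2 : ℝ)) := by
        have := h t
        gcongr
    _ = _ := by
        rw [show (-(3 / 2) : ℝ) = 3 / 2 - (3 : ℕ) by norm_num, Real.rpow_sub h0, Real.rpow_natCast]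
        ring

theorem integrable_hannT {δ L C : ℝ} (hδ : 0 < δ) {F : ℂ → ℂ}
    (hF : AEStronglyMeasurable (fun t => F (line t)))
    (hC : ∀ t, ‖F (line t)‖ ≤ C * ‖line t‖ ^ (3 / 2 : ℝ)) :
    Integrable fun t => hannK δ (line t) * exp (line t * L) * F (line t) := by
  obtain ⟨M, hM, h⟩ := exists_norm_hannT_le hδ L
  refine ((integrable_norm_line_rpow (r := 3 / 2) (by norm_num)).const_mul (M * C)).mono'
    (AEStronglyMeasurable.mul ?_ hF) (Eventually.of_forall fun t => h C t _ (hC t))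
  have := continuous_hannK (δ := δ)
  have := continuous_line
  exact Continuous.aestronglyMeasurable (by fun_prop)

theorem tendsto_hannT {δ L C : ℝ} (hδ : 0 < δ) {F : ℕ → ℂ → ℂ} {G : ℂ → ℂ}
    (hF : ∀ n, AEStronglyMeasurable (fun t => F n (line t)))
    (hC : ∀ᶠ n in atTop, ∀ t, ‖F n (line t)‖ ≤ C * ‖line t‖ ^ (3 / 2 : ℝ))
    (hG : ∀ t, Tendsto (fun n => F n (line t)) atTop (𝓝 (G (line t)))) :
    Tendsto (fun n => hannT δ L (F n)) atTop (𝓝 (hannT δ L G)) := by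
  obtain ⟨M, hM, h⟩ := exists_norm_hannT_le hδ L
  refine Tendsto.const_mul _ (tendsto_integral_filter_of_dominated_convergence
    (fun t => M * C * ‖line t‖ ^ (-(3 / 2) : ℝ)) (Eventually.of_forall fun n => ?_)
    (hC.mono fun n hn => Eventually.of_forall fun t => h C t _ (hn t))
    ((integrable_norm_line_rpow (r := 3 / 2) (by norm_num)).const_mul (M * C))
    (Eventually.of_forall fun t => (hG t).const_mul _))
  have := continuous_hannK (δ := δ)
  have := continuous_line
  exact AEStronglyMeasurable.mul (Continuous.aestronglyMeasurable (by fun_prop)) (hF n)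

theorem one_le_norm_line_rpow (t : ℝ) : 1 ≤ ‖line t‖ ^ (3 / 2 : ℝ) :=
  Real.one_le_rpow (by linarith [two_le_norm_line t]) (by norm_num)

theorem norm_line_le_rpow (t : ℝ) : ‖line t‖ ≤ ‖line t‖ ^ (3 / 2 : ℝ) := by
  conv_lhs => rw [← Real.rpow_one ‖line t‖]
  exact Real.rpow_le_rpow_of_exponent_le (by linarith [two_le_norm_line t]) (by norm_num)

theorem hannT_sum {ι : Type*} {δ L C : ℝ} (hδ : 0 < δ) (S : Finset ι) (c : ι → ℂ) (F : ι → ℂ → ℂ)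
    (hF : ∀ i ∈ S, Continuous (fun t => F i (line t)))
    (hC : ∀ i ∈ S, ∀ t, ‖F i (line t)‖ ≤ C) :
    hannT δ L (fun s => ∑ i ∈ S, c i * F i s) = ∑ i ∈ S, c i * hannT δ L (F i) := by
  unfold hannT
  simp_rw [Finset.mul_sum, mul_left_comm _ (c _)]
  rw [integral_finsetSum, Finset.mul_sum]
  · refine Finset.sum_congr rfl fun i _ => ?_
    rw [integral_const_mul]
    ring
  · intro i hi
    refine Integrable.const_mul (integrable_hannT (C := C) hδ (hF i hi).aestronglyMeasurable
      fun t => ?_) _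
    have h0 : 0 ≤ C := (norm_nonneg _).trans (hC i hi t)
    exact (hC i hi t).trans (le_mul_of_one_le_right h0 (one_le_norm_line_rpow t))

theorem continuous_inv_line {ρ : ℂ} (hρ : ρ.re ≤ 1) : Continuous fun t => 1 / (line t - ρ) := by
  refine continuous_const.div (continuous_line.sub continuous_const) fun t h => ?_
  have := congrArg re h
  simp at this
  linarith

theorem norm_inv_line_le {ρ : ℂ} (hρ : ρ.re ≤ 1) (t : ℝ) : ‖1 / (line t - ρ)‖ ≤ 1 := by
  have := re_le_norm (line t - ρ)
  simp at this
  rw [norm_div, norm_one]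
  exact div_le_one_of_le₀ (by linarith) (norm_nonneg _)

theorem tendsto_hannT_LSeries {δ : ℝ} (hδ : 0 < δ) (L : ℝ) :
    Tendsto (fun N : ℕ => ∑ n ∈ Finset.range N, (vonMangoldt n : ℂ) * hann δ (Real.log n - L)) atTop
      (𝓝 (hannT δ L (LSeries fun n => (vonMangoldt n : ℂ)))) := by
  have hs : ∀ t, LSeriesSummable (fun n => (vonMangoldt n : ℂ)) (line t) := fun t =>
    LSeriesSummable_vonMangoldt (by simp)
  have hn : ∀ t n, ‖LSeries.term (fun n => (vonMangoldt n : ℂ)) (line t) n‖ =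
      ‖LSeries.term (fun n => (vonMangoldt n : ℂ)) (line 0) n‖ := fun t n => by
    rw [LSeries.norm_term_eq, LSeries.norm_term_eq]; simp
  have hterm : ∀ n s, LSeries.term (fun n => (vonMangoldt n : ℂ)) s n =
      (vonMangoldt n : ℂ) * exp (-s * Real.log n) := fun n s => by
    rcases eq_or_ne n 0 with rfl | h
    · simp
    · rw [LSeries.term_of_ne_zero h, cpow_def_of_ne_zero (by exact_mod_cast h), neg_mul,
        Complex.exp_neg, div_eq_mul_inv, ← natCast_log, mul_comm s]
  have h1 : ∀ N : ℕ, hannT δ L (fun s => ∑ n ∈ Finset.range N,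
      (vonMangoldt n : ℂ) * (fun s => exp (-s * Real.log n)) s) =
      ∑ n ∈ Finset.range N, (vonMangoldt n : ℂ) * hann δ (Real.log n - L) := fun N => by
    rw [hannT_sum (C := 1) hδ]
    · simp_rw [hannT_exp hδ]
    · intro n _
      have := continuous_line
      fun_prop
    · intro n _ t
      rw [norm_exp]
      refine Real.exp_le_one_iff.2 ?_
      simp only [neg_mul, neg_re, mul_re, line_re, ofReal_re, ofReal_im, mul_zero, sub_zero]
      have := Real.log_natCast_nonneg n
      linarith
  simp_rw [← h1]
  refine tendsto_hannT (C := ∑' n, ‖LSeries.term (fun n => (vonMangoldt n : ℂ)) (line 0) n‖) hδ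
    (fun N => ?_) (Eventually.of_forall fun N t => ?_) fun t => ?_
  · have := continuous_line
    exact Continuous.aestronglyMeasurable (by fun_prop)
  · simp_rw [← hterm]
    calc _ ≤ ∑ n ∈ Finset.range N, ‖LSeries.term (fun n => (vonMangoldt n : ℂ)) (line t) n‖ :=
          norm_sum_le _ _
      _ = ∑ n ∈ Finset.range N, ‖LSeries.term (fun n => (vonMangoldt n : ℂ)) (line 0) n‖ :=
          Finset.sum_congr rfl fun n _ => hn t n
      _ ≤ ∑' n, ‖LSeries.term (fun n => (vonMangoldt n : ℂ)) (line 0) n‖ :=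
          (hs 0).norm.sum_le_tsum _ fun _ _ => norm_nonneg _
      _ ≤ _ := le_mul_of_one_le_right (tsum_nonneg fun _ => norm_nonneg _) (one_le_norm_line_rpow t)
  · simp_rw [← hterm]
    exact (hs t).hasSum.tendsto_sum_nat

theorem xiHalf_line_ne_zero (t : ℝ) : xiHalf (line t - 1 / 2) ≠ 0 := fun h => by
  have := abs_lt.1 (abs_re_lt_of_xiHalf_eq_zero h)
  norm_num at this

theorem exists_norm_sum_xiZeros_le : ∃ C, ∀ᶠ n : ℕ in atTop, ∀ t,
    ‖∑ a ∈ xiZeros n, (xiMult a : ℂ) * (1 / (line t - (a + 1 / 2)))‖ ≤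
      C * ‖line t‖ ^ (3 / 2 : ℝ) := by
  obtain ⟨C, hC, r₀, hr₀, h⟩ := exists_logDeriv_xiHalf_bound
  have h1 : ∀ (r : ℝ) t, r₀ ≤ r →
      ‖∑ a ∈ xiZeros r, (xiMult a : ℂ) / (line t - 1 / 2 - a)‖ ≤ C * (r * √r) := fun r t hr => by
    refine le_trans ((norm_sum_le _ _).trans (Finset.sum_le_sum fun a ha => ?_)) (h r hr).1
    have ha' := (abs_lt.1 (abs_re_lt_of_xiHalf_eq_zero (mem_xiZeros.1 ha).2)).2
    have := norm_inv_line_le (ρ := a + 1 / 2) (by simp; linarith) t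
    rw [sub_sub, add_comm (1 / 2), div_eq_mul_one_div, norm_mul, Complex.norm_natCast]
    exact mul_le_of_le_one_right (by positivity) this
  have hw : ∀ t, ‖line t - 1 / 2‖ ≤ 2 * ‖line t‖ := fun t => by
    have := norm_sub_le (line t) (1 / 2)
    have h2 := two_le_norm_line t
    norm_num at this
    linarith
  have hrp : ∀ t, ‖line t‖ * √‖line t‖ = ‖line t‖ ^ (3 / 2 : ℝ) := fun t => by
    have h0 : 0 < ‖line t‖ := by linarith [two_le_norm_line t]
    rw [show (3 / 2 : ℝ) = 1 + 1 / 2 by norm_num, Real.rpow_add h0, Real.rpow_one,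
        Real.sqrt_eq_rpow]
  have hsc : ∀ (k : ℝ) t, 0 ≤ k →
      (k * ‖line t‖) * √(k * ‖line t‖) = k * √k * ‖line t‖ ^ (3 / 2 : ℝ) := fun k t hk => by
    rw [Real.sqrt_mul hk, ← hrp]; ring
  have h2 : ∀ t, ‖logDeriv xiHalf (line t - 1 / 2)‖ ≤
      (C * (40 * r₀ * √(40 * r₀)) + 2 * C) * ‖line t‖ ^ (3 / 2 : ℝ) := fun t => by
    have hl := two_le_norm_line t
    set r := 40 * r₀ * ‖line t‖ with hr
    have hr0 : r₀ ≤ r := by nlinarith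
    have hr1 : ‖line t - 1 / 2‖ < r / 16 := by have := hw t; nlinarith
    have b := (h r hr0).2 _ hr1 (xiHalf_line_ne_zero t)
    have b1 := h1 r t hr0
    rw [hr, hsc _ t (by positivity), ← hr] at b1
    have b2 : C * ‖line t - 1 / 2‖ / √r ≤ C * (2 * ‖line t‖) / 1 := by
      have := hw t
      gcongr
      exact Real.one_le_sqrt.2 (hr₀.trans hr0)
    have b3 := norm_line_le_rpow t
    have b4 := norm_sub_norm_le (logDeriv xiHalf (line t - 1 / 2))
      (∑ a ∈ xiZeros r, (xiMult a : ℂ) / (line t - 1 / 2 - a))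
    have b5 : C * (2 * ‖line t‖) / 1 ≤ C * (2 * ‖line t‖ ^ (3 / 2 : ℝ)) / 1 := by gcongr
    linarith
  refine ⟨C * (40 * r₀ * √(40 * r₀)) + 2 * C + 2 * C + C * (32 * √32), ?_⟩
  filter_upwards [eventually_ge_atTop ⌈r₀⌉₊] with n hn t
  have hn' : r₀ ≤ n := (Nat.le_ceil _).trans (by exact_mod_cast hn)
  have hp : 0 ≤ ‖line t‖ ^ (3 / 2 : ℝ) := by positivity
  have e : ∑ a ∈ xiZeros n, (xiMult a : ℂ) * (1 / (line t - (a + 1 / 2))) =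
      ∑ a ∈ xiZeros n, (xiMult a : ℂ) / (line t - 1 / 2 - a) :=
    Finset.sum_congr rfl fun a _ => by rw [sub_sub, add_comm a, mul_one_div]
  rw [e]
  have p1 : 0 ≤ C * (40 * r₀ * √(40 * r₀)) * ‖line t‖ ^ (3 / 2 : ℝ) := by positivity
  have p2 : 0 ≤ C * (32 * √32) * ‖line t‖ ^ (3 / 2 : ℝ) := by positivity
  have p3 : 0 ≤ C * ‖line t‖ ^ (3 / 2 : ℝ) := by positivity
  rcases lt_or_ge ‖line t - 1 / 2‖ ((n : ℝ) / 16) with hlt | hge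
  · have b := (h n hn').2 _ hlt (xiHalf_line_ne_zero t)
    have b2 : C * ‖line t - 1 / 2‖ / √n ≤ C * (2 * ‖line t‖ ^ (3 / 2 : ℝ)) / 1 := by
      have := hw t
      have := norm_line_le_rpow t
      have b6 : C * ‖line t - 1 / 2‖ / √n ≤ C * ‖line t - 1 / 2‖ / 1 := by
        gcongr
        exact Real.one_le_sqrt.2 (hr₀.trans hn')
      refine b6.trans ?_
      gcongr
      linarith
    have b4 := norm_sub_norm_le (∑ a ∈ xiZeros n, (xiMult a : ℂ) / (line t - 1 / 2 - a))
      (logDeriv xiHalf (line t - 1 / 2))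
    rw [norm_sub_rev] at b4
    have := h2 t
    linarith
  · have b1 := h1 n t hn'
    have hn3 : (n : ℝ) ≤ 32 * ‖line t‖ := by have := hw t; linarith
    have b2 : C * (n * √n) ≤ C * (32 * √32 * ‖line t‖ ^ (3 / 2 : ℝ)) := by
      rw [← hsc 32 t (by norm_num)]
      gcongr
    linarith

/-- Functions of moderate growth on the line `Re s = 2`. -/
def ModerateOnLine (F : ℂ → ℂ) : Prop :=
  Continuous (fun t => F (line t)) ∧ ∃ C, ∀ t, ‖F (line t)‖ ≤ C * ‖line t‖ ^ (3 / 2 : ℝ)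

theorem ModerateOnLine.add {F G : ℂ → ℂ} (hF : ModerateOnLine F) (hG : ModerateOnLine G) :
    ModerateOnLine fun s => F s + G s := by
  obtain ⟨hF, C, hC⟩ := hF
  obtain ⟨hG, D, hD⟩ := hG
  refine ⟨hF.add hG, C + D, fun t => ?_⟩
  rw [add_mul]
  exact (norm_add_le _ _).trans (add_le_add (hC t) (hD t))

theorem ModerateOnLine.const_mul {F : ℂ → ℂ} (hF : ModerateOnLine F) (c : ℂ) :
    ModerateOnLine fun s => c * F s := by
  obtain ⟨hF, C, hC⟩ := hF
  refine ⟨hF.const_mul c, ‖c‖ * C, fun t => ?_⟩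
  rw [mul_assoc, norm_mul]
  exact mul_le_mul_of_nonneg_left (hC t) (norm_nonneg _)

theorem moderateOnLine_of_norm_le {F : ℂ → ℂ} (hF : Continuous fun t => F (line t)) {C : ℝ}
    (hC : ∀ t, ‖F (line t)‖ ≤ C) : ModerateOnLine F := by
  refine ⟨hF, C, fun t => (hC t).trans ?_⟩
  exact le_mul_of_one_le_right ((norm_nonneg _).trans (hC t)) (one_le_norm_line_rpow t)

theorem moderateOnLine_const (c : ℂ) : ModerateOnLine fun _ => c :=
  moderateOnLine_of_norm_le continuous_const fun _ => le_rfl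

theorem moderateOnLine_inv {ρ : ℂ} (hρ : ρ.re ≤ 1) : ModerateOnLine fun s => 1 / (s - ρ) :=
  moderateOnLine_of_norm_le (continuous_inv_line hρ) (norm_inv_line_le hρ)

theorem moderateOnLine_sum {ι : Type*} (S : Finset ι) {F : ι → ℂ → ℂ}
    (hF : ∀ i ∈ S, ModerateOnLine (F i)) : ModerateOnLine fun s => ∑ i ∈ S, F i s := by
  classical
  induction S using Finset.induction_on with
  | empty => simpa using moderateOnLine_const 0
  | insert i S hi ih =>
    simp_rw [Finset.sum_insert hi]
    exact (hF i (Finset.mem_insert_self i S)).add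
      (ih fun j hj => hF j (Finset.mem_insert_of_mem hj))

theorem hannT_add {δ : ℝ} (hδ : 0 < δ) (L : ℝ) {F G : ℂ → ℂ} (hF : ModerateOnLine F)
    (hG : ModerateOnLine G) :
    hannT δ L (fun s => F s + G s) = hannT δ L F + hannT δ L G := by
  obtain ⟨hF, C, hC⟩ := hF
  obtain ⟨hG, D, hD⟩ := hG
  unfold hannT
  simp_rw [mul_add]
  rw [integral_add (integrable_hannT hδ hF.aestronglyMeasurable hC)
    (integrable_hannT hδ hG.aestronglyMeasurable hD), mul_add]

theorem hannT_const_mul (δ L : ℝ) (c : ℂ) (F : ℂ → ℂ) :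
    hannT δ L (fun s => c * F s) = c * hannT δ L F := by
  unfold hannT
  simp_rw [mul_left_comm _ c]
  rw [integral_const_mul]
  ring

theorem half_sum_digammaTerm {s : ℂ} (hs : 0 < s.re) (n : ℕ) :
    1 / 2 * ∑ k ∈ Finset.range n, digammaTerm (s / 2 + 1) k =
      (1 / 2 * ∑ k ∈ Finset.range n, 1 / ((k : ℂ) + 1)) +
        ∑ k ∈ Finset.range n, (-1) * (1 / (s - (-2 * (k + 1)))) := by
  rw [Finset.mul_sum, Finset.mul_sum, ← Finset.sum_add_distrib]
  refine Finset.sum_congr rfl fun k _ => ?_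
  have h1 := add_natCast_ne_zero (z := s / 2 + 1) (by simp; linarith) k
  have e : s - (-2 * (k + 1)) = 2 * (s / 2 + 1 + k) := by ring
  rw [digammaTerm, e]
  field_simp
  ring

theorem tendsto_explicit {δ L : ℝ} (hδ : 0 < δ) (hL : 0 ≤ L) :
    Tendsto (fun n : ℕ => exp L * hannK δ 1 +
      ∑ k ∈ Finset.range n, (-1) * (exp ((-2 * (k + 1)) * L) * hannK δ (-2 * (k + 1))) +
      ∑ a ∈ xiZeros n, (-(xiMult a : ℂ)) * (exp ((a + 1 / 2) * L) * hannK δ (a + 1 / 2))) atTop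
      (𝓝 (hannT δ L (LSeries fun n => (vonMangoldt n : ℂ)))) := by
  set c : ℕ → ℂ := fun n => -((Real.eulerMascheroniConstant : ℂ) + Real.log Real.pi) / 2 +
    1 / 2 * ∑ k ∈ Finset.range n, 1 / ((k : ℂ) + 1) with hc
  have r1 : ∀ k : ℕ, (-2 * ((k : ℂ) + 1)).re ≤ 1 := fun k => by
    have : (0 : ℝ) ≤ k := k.cast_nonneg
    simp
    linarith
  have r2 : ∀ n : ℕ, ∀ a ∈ xiZeros n, (a + 1 / 2).re ≤ 1 := fun n a ha => by
    have := (abs_lt.1 (abs_re_lt_of_xiHalf_eq_zero (mem_xiZeros.1 ha).2)).2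
    simp
    linarith
  let F₁ : ℕ → ℂ → ℂ := fun n s => 1 / (s - 1) + c n * 1
  let F₂ : ℕ → ℂ → ℂ := fun n s => ∑ k ∈ Finset.range n, (-1) * (1 / (s - (-2 * (k + 1))))
  let F₃ : ℕ → ℂ → ℂ := fun n s => ∑ a ∈ xiZeros n, (-(xiMult a : ℂ)) * (1 / (s - (a + 1 / 2)))
  have m1 : ∀ n, ModerateOnLine (F₁ n) := fun n =>
    (moderateOnLine_inv (by simp)).add ((moderateOnLine_const 1).const_mul _)
  have m2 : ∀ n, ModerateOnLine (F₂ n) := fun n =>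
    moderateOnLine_sum _ fun k _ => (moderateOnLine_inv (r1 k)).const_mul _
  have m3 : ∀ n, ModerateOnLine (F₃ n) := fun n =>
    moderateOnLine_sum _ fun a ha => (moderateOnLine_inv (r2 n a ha)).const_mul _
  have key : ∀ n, exp L * hannK δ 1 +
      ∑ k ∈ Finset.range n, (-1) * (exp ((-2 * (k + 1)) * L) * hannK δ (-2 * (k + 1))) +
      ∑ a ∈ xiZeros n, (-(xiMult a : ℂ)) * (exp ((a + 1 / 2) * L) * hannK δ (a + 1 / 2)) =
      hannT δ L (fun s => F₁ n s + F₂ n s + F₃ n s) := fun n => by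
    rw [hannT_add hδ L ((m1 n).add (m2 n)) (m3 n), hannT_add hδ L (m1 n) (m2 n),
      hannT_add hδ L (moderateOnLine_inv (by simp)) ((moderateOnLine_const 1).const_mul _),
      hannT_const_mul, hannT_one hδ hL, hannT_inv hδ hL (by simp),
      hannT_sum (C := 1) hδ _ _ _ (fun k _ => continuous_inv_line (r1 k))
        (fun k _ => norm_inv_line_le (r1 k)),
      hannT_sum (C := 1) hδ _ _ _ (fun a ha => continuous_inv_line (r2 n a ha))
        (fun a ha => norm_inv_line_le (r2 n a ha)), mul_zero, add_zero, one_mul]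
    have s2 : ∀ k ∈ Finset.range n, (-1 : ℂ) * (exp ((-2 * (k + 1)) * L) * hannK δ (-2 * (k + 1))) =
        (-1) * hannT δ L (fun s => 1 / (s - (-2 * (k + 1)))) := fun k _ => by
      rw [hannT_inv hδ hL ((r1 k).trans_lt (by norm_num))]
    have s3 : ∀ a ∈ xiZeros n,
        (-(xiMult a : ℂ)) * (exp ((a + 1 / 2) * L) * hannK δ (a + 1 / 2)) =
        (-(xiMult a : ℂ)) * hannT δ L (fun s => 1 / (s - (a + 1 / 2))) := fun a ha => by
      rw [hannT_inv hδ hL ((r2 n a ha).trans_lt (by norm_num))]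
    rw [Finset.sum_congr rfl s2, Finset.sum_congr rfl s3]
  have e12 : ∀ n t, F₁ n (line t) + F₂ n (line t) = 1 / (line t - 1) -
      ((Real.eulerMascheroniConstant : ℂ) + Real.log Real.pi) / 2 +
      1 / 2 * ∑ k ∈ Finset.range n, digammaTerm (line t / 2 + 1) k := fun n t => by
    rw [half_sum_digammaTerm (by simp) n]
    simp only [F₁, F₂, hc]
    ring
  have e3 : ∀ n t, F₃ n (line t) = -∑ a ∈ xiZeros n, (xiMult a : ℂ) * (1 / (line t -
      (a + 1 / 2))) :=
    fun n t => by simp only [F₃, neg_mul, Finset.sum_neg_distrib]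
  have hz : ∀ t, 0 < (line t / 2 + 1).re := fun t => by simp
  simp_rw [key]
  obtain ⟨C, hC⟩ := exists_norm_sum_xiZeros_le
  set D := ‖((Real.eulerMascheroniConstant : ℂ) + Real.log Real.pi) / 2‖ with hD
  refine tendsto_hannT (C := 1 + D + 1 + C) hδ
    (fun n => (((m1 n).add (m2 n)).add (m3 n)).1.aestronglyMeasurable) ?_ fun t => ?_
  · filter_upwards [hC, eventually_ge_atTop 1] with n hn hn1 t
    have a1 := norm_inv_line_le (ρ := 1) (by simp) t
    have a2 := hn t
    have a3 : ‖(1 / 2 : ℂ) * ∑ k ∈ Finset.range n, digammaTerm (line t / 2 + 1) k‖ ≤ ‖line t‖ := by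
      set z := line t / 2 + 1 with hz'
      have hzn : ‖z - 1‖ = ‖line t‖ / 2 := by
        rw [hz', add_sub_cancel_right, norm_div]; norm_num
      have b1 := norm_digamma_sub_sum_le (hz t) (N := 1) one_pos
      have b2 := norm_digamma_sub_sum_le (hz t) (N := n) (by omega)
      have b3 := norm_digammaTerm (hz t) 0
      rw [← hz'] at b1 b2 b3
      rw [Finset.sum_range_one] at b1
      have b4 : 1 ≤ ‖z‖ := by
        have := re_le_norm z
        simp [hz'] at this
        linarith
      have b5 : ‖digammaTerm z 0‖ ≤ ‖z - 1‖ := by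
        rw [b3]
        simp only [Nat.cast_zero, zero_add, one_mul, add_zero]
        exact div_le_self (norm_nonneg _) b4
      have b6 : ‖z - 1‖ / n ≤ ‖z - 1‖ := div_le_self (norm_nonneg _) (by exact_mod_cast hn1)
      have b7 := norm_sub_norm_le (∑ k ∈ Finset.range n, digammaTerm z k)
        (digamma z + Real.eulerMascheroniConstant)
      rw [norm_sub_rev] at b7
      have b8 := norm_sub_norm_le (digamma z + Real.eulerMascheroniConstant) (digammaTerm z 0)
      rw [norm_mul]
      norm_num at b1 ⊢
      linarith [norm_nonneg (line t)]
    have a4 := one_le_norm_line_rpow t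
    have a5 := norm_line_le_rpow t
    rw [e12, e3]
    have hD0 : 0 ≤ D := norm_nonneg _
    calc _ ≤ 1 + D + ‖line t‖ + C * ‖line t‖ ^ (3 / 2 : ℝ) := by
          refine (norm_add_le _ _).trans (add_le_add ((norm_add_le _ _).trans
            (add_le_add ((norm_sub_le _ _).trans (add_le_add a1 le_rfl)) a3)) ?_)
          rwa [norm_neg]
      _ ≤ _ := by nlinarith
  · simp_rw [e12, e3]
    have l1 : Tendsto (fun n => ∑ k ∈ Finset.range n, digammaTerm (line t / 2 + 1) k) atTop
        (𝓝 (digamma (line t / 2 + 1) + Real.eulerMascheroniConstant)) := by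
      rw [digamma_eq_tsum (hz t)]
      convert (summable_digammaTerm (hz t)).hasSum.tendsto_sum_nat using 2
      ring
    have l2 := (tendsto_sum_xiZeros (xiHalf_line_ne_zero t)).comp tendsto_natCast_atTop_atTop
    have e4 : LSeries (fun n => (vonMangoldt n : ℂ)) (line t) = 1 / (line t - 1) -
        ((Real.eulerMascheroniConstant : ℂ) + Real.log Real.pi) / 2 +
        1 / 2 * (digamma (line t / 2 + 1) + Real.eulerMascheroniConstant) +
        -logDeriv xiHalf (line t - 1 / 2) := by
      rw [logDeriv_xiHalf (by simp)]
      ring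
    rw [e4]
    refine ((l1.const_mul _).const_add _).add (Tendsto.neg (l2.congr fun n => ?_))
    exact Finset.sum_congr rfl fun a _ => by rw [sub_sub, add_comm (1 / 2), mul_one_div]

/-! ### Sums over the zeros -/

theorem norm_exp_sub_one_le_mul_exp {z : ℂ} (hz : 0 ≤ z.re) : ‖exp z - 1‖ ≤ ‖z‖ * Real.exp z.re :=
    by
  have := Convex.norm_image_sub_le_of_norm_deriv_le (f := Complex.exp) (s := {w : ℂ | w.re ≤ z.re})
    (x := 0) (y := z) (C := Real.exp z.re) (fun w _ => Complex.differentiableAt_exp)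
    (fun w hw => by
      rw [Complex.deriv_exp, norm_exp]
      exact Real.exp_le_exp.2 hw) (convex_halfSpace_re_le _) (by simpa using hz) (le_refl z.re)
  rw [Complex.exp_zero, sub_zero] at this
  linarith

section
variable {δ : ℝ} {s : ℂ}

theorem norm_hannK_le_exp (hδ : 0 < δ) (h1 : s.re ≤ 1) : ‖hannK δ s‖ ≤ δ / 2 * Real.exp δ := by
  refine (norm_hannK_le hδ s).trans ?_
  have : max s.re 0 * δ ≤ δ := mul_le_of_le_one_left hδ.le (max_le h1 zero_le_one)
  gcongr

theorem norm_hannK_mul_le (hδ : 0 < δ) (h1 : s.re ≤ 1) {A : ℝ}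
    (hA : A = 2 * Real.pi / δ) :
    Real.pi * (|s.im| / A) * |(|s.im| / A) ^ 2 - 1| * ‖hannK δ s‖ ≤ δ / 2 * Real.exp δ := by
  have hA0 : 0 < A := by rw [hA]; positivity
  have h := congrArg norm (hannK_mul hδ s)
  rw [← hA] at h
  have key : |s.im ^ 2 - A ^ 2| ≤ ‖s ^ 2 + (A : ℂ) ^ 2‖ := by
    have e : s ^ 2 + (A : ℂ) ^ 2 = (s - A * I) * (s + A * I) := by
      linear_combination (A : ℂ) ^ 2 * I_sq
    have i1 := abs_im_le_norm (s - A * I)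
    have i2 := abs_im_le_norm (s + A * I)
    simp at i1 i2
    rw [e, norm_mul, show s.im ^ 2 - A ^ 2 = (s.im - A) * (s.im + A) by ring, abs_mul]
    gcongr
  have h2 : ‖exp (s * δ) - 1‖ ≤ 2 * Real.exp δ := by
    refine (norm_sub_le _ _).trans ?_
    rw [norm_exp, norm_one]
    have e1 : (s * δ).re = s.re * δ := by simp
    have : Real.exp (s * δ).re ≤ Real.exp δ := Real.exp_le_exp.2 (by rw [e1]; nlinarith)
    have := Real.one_le_exp hδ.le
    linarith
  have h3 : |s.im| ≤ ‖s‖ := abs_im_le_norm s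
  rw [norm_mul, norm_mul, norm_mul, norm_mul, norm_pow, norm_real, Complex.norm_ofNat,
    Real.norm_of_nonneg hA0.le] at h
  have h4 : 2 * |s.im| * |s.im ^ 2 - A ^ 2| * ‖hannK δ s‖ ≤ A ^ 2 * (2 * Real.exp δ) := by
    calc _ ≤ 2 * ‖s‖ * ‖s ^ 2 + (A : ℂ) ^ 2‖ * ‖hannK δ s‖ := by gcongr
      _ ≤ _ := by rw [h]; gcongr
  have e2 : |(|s.im| / A) ^ 2 - 1| = |s.im ^ 2 - A ^ 2| / A ^ 2 := by
    rw [div_pow, sq_abs, ← abs_of_pos (show 0 < A ^ 2 by positivity), ← abs_div,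
      abs_of_pos (show 0 < A ^ 2 by positivity)]
    congr 1
    field_simp
  have e3 : Real.pi = A * δ / 2 := by rw [hA]; field_simp
  rw [e2, e3]
  have : A * δ / 2 * (|s.im| / A) * (|s.im ^ 2 - A ^ 2| / A ^ 2) * ‖hannK δ s‖ =
      (2 * |s.im| * |s.im ^ 2 - A ^ 2| * ‖hannK δ s‖) * (δ / (4 * A ^ 2)) := by
    field_simp; ring
  rw [this]
  calc _ ≤ A ^ 2 * (2 * Real.exp δ) * (δ / (4 * A ^ 2)) := by gcongr
    _ = _ := by field_simp; ring

theorem norm_hannK_mul_add_le (hδ : 0 < δ) (h0 : 0 < s.re) (h1 : s.re ≤ 1) {A : ℝ}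
    (hA : A = 2 * Real.pi / δ) :
    (|s.im| / A) * (1 + |s.im| / A) * ‖hannK δ s‖ ≤ δ / 2 * Real.exp δ := by
  have hA0 : 0 < A := by rw [hA]; positivity
  have h := congrArg norm (hannK_mul hδ s)
  rw [← hA] at h
  have hne : ∀ ε : ℝ, 0 < ‖s + ε * A * I‖ := fun ε => by
    have := re_le_norm (s + ε * A * I)
    simp at this
    linarith
  have h3 : |s.im| ≤ ‖s‖ := abs_im_le_norm s
  have main : ∀ ε : ℝ, (ε = 1 ∨ ε = -1) → |s.im| + A ≤ ‖s + ε * A * I‖ →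
      2 * |s.im| * (|s.im| + A) * ‖hannK δ s‖ ≤ A ^ 2 * (δ * Real.exp δ) := fun ε hε hle => by
    have e : s ^ 2 + (A : ℂ) ^ 2 = (s + (-ε : ℝ) * A * I) * (s + ε * A * I) := by
      have : (ε : ℂ) ^ 2 = 1 := by rcases hε with rfl | rfl <;> simp
      push_cast
      linear_combination (ε : ℂ) ^ 2 * (A : ℂ) ^ 2 * I_sq - (A : ℂ) ^ 2 * this
    have e1 : exp (s * δ) = exp ((s + (-ε : ℝ) * A * I) * δ) := by
      have hAδ : (A : ℂ) * δ = 2 * Real.pi := by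
        rw [← ofReal_mul, hA, div_mul_cancel₀ _ hδ.ne']; push_cast; ring
      have e4 : (s + (-ε : ℝ) * A * I) * δ = s * δ - ε * (2 * Real.pi * I) := by
        rw [← hAδ]; push_cast; ring
      rw [e4]
      rcases hε with rfl | rfl
      · rw [ofReal_one, one_mul, Complex.exp_sub, Complex.exp_two_pi_mul_I, div_one]
      · rw [ofReal_neg, ofReal_one, neg_one_mul, sub_neg_eq_add, Complex.exp_add,
          Complex.exp_two_pi_mul_I, mul_one]
    have h2 : ‖exp (s * δ) - 1‖ ≤ ‖s + (-ε : ℝ) * A * I‖ * (δ * Real.exp δ) := by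
      have e5 : ((s + (-ε : ℝ) * A * I) * δ).re = s.re * δ := by simp
      have := norm_exp_sub_one_le_mul_exp (z := (s + (-ε : ℝ) * A * I) * δ) (by rw [e5]; positivity)
      rw [e1]
      refine this.trans ?_
      rw [e5, norm_mul, norm_real, Real.norm_of_nonneg hδ.le, mul_assoc]
      gcongr
      nlinarith
    rw [e, norm_mul, norm_mul, norm_mul, norm_mul, norm_mul, norm_pow, norm_real,
      Complex.norm_ofNat, Real.norm_of_nonneg hA0.le] at h
    have h5 := hne (-ε)
    refine le_of_mul_le_mul_left ?_ h5
    calc _ = 2 * |s.im| * (‖s + (-ε : ℝ) * A * I‖ * (|s.im| + A)) * ‖hannK δ s‖ := by ring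
      _ ≤ 2 * ‖s‖ * (‖s + (-ε : ℝ) * A * I‖ * ‖s + ε * A * I‖) * ‖hannK δ s‖ := by gcongr
      _ ≤ A ^ 2 * (‖s + (-ε : ℝ) * A * I‖ * (δ * Real.exp δ)) := by rw [h]; gcongr
      _ = _ := by ring
  have h6 : 2 * |s.im| * (|s.im| + A) * ‖hannK δ s‖ ≤ A ^ 2 * (δ * Real.exp δ) := by
    rcases le_total 0 s.im with h7 | h7
    · refine main 1 (Or.inl rfl) ?_
      have := le_trans (le_abs_self _) (abs_im_le_norm (s + (1 : ℝ) * A * I))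
      simpa [abs_of_nonneg h7] using this
    · refine main (-1) (Or.inr rfl) ?_
      have := le_trans (neg_le_abs _) (abs_im_le_norm (s + (-1 : ℝ) * A * I))
      rw [abs_of_nonpos h7]
      refine le_trans (le_of_eq ?_) this
      simp [add_comm]
  have : (|s.im| / A) * (1 + |s.im| / A) * ‖hannK δ s‖ =
      (2 * |s.im| * (|s.im| + A) * ‖hannK δ s‖) * (1 / (2 * A ^ 2)) := by
    field_simp; ring
  rw [this]
  calc _ ≤ A ^ 2 * (δ * Real.exp δ) * (1 / (2 * A ^ 2)) := by gcongr
    _ = _ := by field_simp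

end

theorem kernel_weight_le {k y : ℝ} (hk : 0 ≤ k) (hy : 0 ≤ y) (h0 : k ≤ 1) (h1 : y * (1 + y) * k ≤
    1) :
    k * (1 + y ^ 2 / 1.69) ≤ 1.25 := by
  rcases le_total y 0.64 with h | h
  · have : 1 + y ^ 2 / 1.69 ≤ 1.25 := by
      have : y ^ 2 ≤ 0.64 ^ 2 := by gcongr
      norm_num at this ⊢
      linarith
    nlinarith
  · have : 1 + y ^ 2 / 1.69 ≤ 1.25 * (y * (1 + y)) := by
      have : 0 ≤ (y - 0.64) * y := mul_nonneg (by linarith) hy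
      norm_num at this ⊢
      nlinarith
    nlinarith

theorem kernel_weight_mul_le {k y : ℝ} (hk : 0 ≤ k) (hy : 0 ≤ y) (h1 : y * (1 + y) * k ≤ 1)
    (h2 : Real.pi * y * |y ^ 2 - 1| * k ≤ 1) : y * k * (1 + y ^ 2 / 1.69) ≤ 0.88 := by
  have hyk : 0 ≤ y * k := by positivity
  have h2' : 3.14 * |y ^ 2 - 1| * (y * k) ≤ 1 := by
    have := Real.pi_gt_d2
    have h3 : 3.14 * (y * |y ^ 2 - 1| * k) ≤ Real.pi * (y * |y ^ 2 - 1| * k) := by gcongr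
    nlinarith
  have h1' : (1 + y) * (y * k) ≤ 1 := by nlinarith
  rcases le_total y 0.7 with h | h
  · have : 1 + y ^ 2 / 1.69 ≤ 0.88 * (3.14 * |y ^ 2 - 1|) := by
      have h4 : y ^ 2 ≤ 0.7 ^ 2 := by gcongr
      norm_num at h4
      rw [abs_of_nonpos (by linarith)]
      norm_num
      linarith
    nlinarith
  rcases le_total y 1.325 with h' | h'
  · have : 1 + y ^ 2 / 1.69 ≤ 0.88 * (1 + y) := by
      have : 0 ≤ (y - 0.7) * (1.325 - y) := mul_nonneg (by linarith) (by linarith)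
      norm_num at this ⊢
      nlinarith
    nlinarith
  · have : 1 + y ^ 2 / 1.69 ≤ 0.88 * (3.14 * |y ^ 2 - 1|) := by
      have h4 : 1.325 ^ 2 ≤ y ^ 2 := by gcongr
      norm_num at h4
      rw [abs_of_nonneg (by linarith)]
      norm_num
      linarith
    nlinarith

theorem one_le_mul_zeroPair {Y : ℝ} {a : ℂ} (hY : 1 ≤ Y) (ha : |a.re| < 1 / 2) :
    1 ≤ (1 + a.im ^ 2 / Y ^ 2) * ((Y ^ 2 + 1) / (2 * Y) * zeroPair Y a) := by
  have hα : a.re ^ 2 ≤ 1 / 4 := by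
    rw [← sq_abs]; nlinarith [abs_nonneg a.re]
  rw [zeroPair_eq (by rw [ofReal_re]; linarith), ofReal_re, ofReal_im, zero_sub, neg_sq]
  obtain ⟨h1, h2⟩ := abs_lt.1 ha
  have p1 : 0 < Y - a.re := by linarith
  have p2 : 0 < Y + a.re := by linarith
  have hY0 : 0 < Y := by linarith
  have e : (1 + a.im ^ 2 / Y ^ 2) * ((Y ^ 2 + 1) / (2 * Y) * (2 * Y *
      (Y ^ 2 - a.re ^ 2 + a.im ^ 2) /
      (((Y - a.re) ^ 2 + a.im ^ 2) * ((Y + a.re) ^ 2 + a.im ^ 2)))) =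
      ((Y ^ 2 + a.im ^ 2) * (Y ^ 2 + 1) * (Y ^ 2 - a.re ^ 2 + a.im ^ 2)) /
      (Y ^ 2 * (((Y - a.re) ^ 2 + a.im ^ 2) * ((Y + a.re) ^ 2 + a.im ^ 2))) := by
    field_simp
  rw [e, one_le_div (by positivity)]
  set u := a.im ^ 2 with hu
  have hu0 : 0 ≤ u := sq_nonneg _
  set b := a.re ^ 2 with hb
  have hb0 : 0 ≤ b := sq_nonneg _
  have e2 : ((Y - a.re) ^ 2 + u) * ((Y + a.re) ^ 2 + u) = (Y ^ 2 + u + b) ^ 2 - 4 * Y ^ 2 * b := by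
    rw [hb]; ring
  rw [e2]
  have hYY : 1 ≤ Y ^ 2 := one_le_pow₀ hY
  have k1 : (Y ^ 2 + u + b) ^ 2 - 4 * Y ^ 2 * b ≤ (Y ^ 2 + u - b) * (Y ^ 2 + u + 1) := by
    nlinarith [mul_nonneg (add_nonneg (sq_nonneg Y) hu0) (show 0 ≤ 1 - 3 * b by linarith)]
  have k2 : Y ^ 2 * (Y ^ 2 + u + 1) ≤ (Y ^ 2 + u) * (Y ^ 2 + 1) := by nlinarith
  have k3 : 0 ≤ Y ^ 2 + u - b := by linarith
  calc _ ≤ Y ^ 2 * ((Y ^ 2 + u - b) * (Y ^ 2 + u + 1)) := by gcongr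
    _ = (Y ^ 2 * (Y ^ 2 + u + 1)) * (Y ^ 2 + u - b) := by ring
    _ ≤ ((Y ^ 2 + u) * (Y ^ 2 + 1)) * (Y ^ 2 + u - b) := by gcongr
    _ = _ := by ring

theorem xiReal_half_add_le {Y : ℝ} (hY : 1 / 2 < Y) :
    xiReal (1 / 2 + Y) ≤ 1 / (Y - 1 / 2) + Real.log ((Y + 5 / 2) / (2 * Real.pi)) / 2 := by
  have hs : 1 < (1 / 2 + Y : ℂ).re := by norm_num; linarith
  rw [xiReal_eq hs]
  have e1 : (1 / 2 + Y : ℂ) - 1 = (Y - 1 / 2 : ℝ) := by push_cast; ring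
  have e2 : (1 / 2 + Y : ℂ) / 2 + 1 = ((Y + 5 / 2) / 2 : ℝ) := by push_cast; ring
  have e3 : (1 / 2 + Y : ℂ) = (1 / 2 + Y : ℝ) + (0 : ℝ) * I := by push_cast; ring
  have h3 : 0 ≤ (LSeries (fun n => (vonMangoldt n : ℂ)) (1 / 2 + Y)).re := by
    rw [e3]
    refine (hasSum_re_LSeries_vonMangoldt (by linarith) 0).nonneg fun n => ?_
    rw [zero_mul, Real.cos_zero, mul_one]
    have := vonMangoldt_nonneg (n := n)
    positivity
  have h2 := deriv_log_Gamma_le_log (x := (Y + 5 / 2) / 2) (by linarith)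
  have e4 : (1 / ((Y - 1 / 2 : ℝ) : ℂ)).re = 1 / (Y - 1 / 2) := by
    rw [← ofReal_one, ← ofReal_div, ofReal_re]
  rw [e1, e2, e4, digamma_ofReal _ (by linarith), ofReal_re, ← div_div, Real.log_div
      (by linarith) Real.pi_ne_zero]
  linarith

theorem sum_zeroPair_right_le {Y : ℝ} (hY : 1 ≤ Y) (r : ℝ) :
    ∑ a ∈ xiZeros r, (xiMult a : ℝ) * (if 0 < a.re then zeroPair Y a else 0) ≤
      xiReal (1 / 2 + Y) := by
  have hs : 1 ≤ (1 / 2 + Y : ℂ).re := by norm_num; linarith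
  have h := sum_le_xiReal hs (xiZeros r) fun a ha => (mem_xiZeros.1 ha).2
  rw [add_sub_cancel_left] at h
  refine le_trans ?_ h
  set φ : ℂ → ℝ := fun a => if 0 < a.re then zeroPair Y a else 0 with hφ
  have e : ∑ a ∈ xiZeros r, (xiMult a : ℝ) * φ (-conj a) =
      ∑ a ∈ xiZeros r, (xiMult a : ℝ) * φ a := by
    rw [← sum_xiZeros_neg φ r]
    exact sum_xiZeros_conj (fun a => φ (-a)) r
  have e2 : ∑ a ∈ xiZeros r, (xiMult a : ℝ) * φ a =
      ∑ a ∈ xiZeros r, (xiMult a : ℝ) * ((φ a + φ (-conj a)) / 2) := by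
    simp only [mul_div_assoc', mul_add, ← Finset.sum_div, Finset.sum_add_distrib, e]
    ring
  change ∑ a ∈ xiZeros r, (xiMult a : ℝ) * φ a ≤ _
  rw [e2]
  refine Finset.sum_le_sum fun a ha => ?_
  have hz : 0 ≤ zeroPair Y a := zeroPair_nonneg (by rw [ofReal_re]; linarith)
    (abs_re_lt_of_xiHalf_eq_zero (mem_xiZeros.1 ha).2)
  gcongr
  simp only [hφ, zeroPair_neg_conj, neg_re, conj_re]
  split_ifs <;> linarith

theorem sum_zeroPair_le {Y : ℝ} (hY : 1 ≤ Y) (r : ℝ) :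
    ∑ a ∈ xiZeros r, (xiMult a : ℝ) * zeroPair Y a ≤ 2 * xiReal (1 / 2 + Y) := by
  have hs : 1 ≤ (1 / 2 + Y : ℂ).re := by norm_num; linarith
  have h := sum_le_xiReal hs (xiZeros r) fun a ha => (mem_xiZeros.1 ha).2
  rw [add_sub_cancel_left] at h
  simp only [mul_div_assoc', ← Finset.sum_div] at h
  linarith

theorem exp_neg_mul_le {a : ℂ} (ha : xiHalf a = 0) (hre : 0 < a.re) {L : ℝ} (hL : 0 ≤ L) :
    Real.exp ((a.re - 1 / 2) * L) ≤ Real.exp (-2 * √(0.1036 * L)) * (|a.im| / 12 + 6) := by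
  have h5 := five_lt_abs_im ha hre
  have key : 0.1036 / zfLog |a.im| ≤ 1 / 2 - a.re := by
    rcases le_total 0 a.im with h | h
    · rw [abs_of_nonneg h] at h5 ⊢
      exact zero_free ha hre h5.le
    · rw [abs_of_nonpos h] at h5 ⊢
      have := zero_free (a := conj a) (by rw [xiHalf_conj, ha, _root_.map_zero])
        (by rwa [conj_re]) (by rw [conj_im]; exact h5.le)
      rwa [conj_re, conj_im] at this
  have hl : 0 < zfLog |a.im| := Real.log_pos (by linarith)
  have e : |a.im| / 12 + 6 = Real.exp (zfLog |a.im|) := (Real.exp_log (by positivity)).symm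
  rw [e, ← Real.exp_add, Real.exp_le_exp]
  set l := zfLog |a.im|
  have h1 := Real.mul_self_sqrt (show 0 ≤ 0.1036 * L by positivity)
  have h2 : 0.1036 / l * L ≤ (1 / 2 - a.re) * L := by gcongr
  have h3 : 2 * √(0.1036 * L) ≤ 0.1036 / l * L + l := by
    have : 0.1036 / l * L + l = (0.1036 * L + l * l) / l := by field_simp
    rw [this, le_div_iff₀ hl]
    nlinarith only [sq_nonneg (√(0.1036 * L) - l), h1]
  linarith

section
variable {δ Y : ℝ} {s : ℂ}

theorem one_add_sq_div_le {A : ℝ} (hA : 0 < A) (hY : 1.3 * A ≤ Y) (t : ℝ) :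
    1 + t ^ 2 / Y ^ 2 ≤ 1 + (|t| / A) ^ 2 / 1.69 := by
  rw [div_pow, sq_abs, div_div]
  have : A ^ 2 * 1.69 ≤ Y ^ 2 := by
    calc A ^ 2 * 1.69 = (1.3 * A) ^ 2 := by ring
      _ ≤ Y ^ 2 := by gcongr
  gcongr

theorem norm_hannK_weight_le (hδ : 0 < δ) (h0 : 0 < s.re) (h1 : s.re ≤ 1)
    (hY : 1.3 * (2 * Real.pi / δ) ≤ Y) :
    ‖hannK δ s‖ * (1 + s.im ^ 2 / Y ^ 2) ≤ 1.25 * (δ / 2 * Real.exp δ) := by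
  set A := 2 * Real.pi / δ with hA
  have hA0 : 0 < A := by positivity
  have hC : 0 < δ / 2 * Real.exp δ := by positivity
  have k := kernel_weight_le (k := ‖hannK δ s‖ / (δ / 2 * Real.exp δ)) (y := |s.im| / A)
    (by positivity) (by positivity) ((div_le_one hC).2 (norm_hannK_le_exp hδ h1))
    (by rw [mul_div_assoc', div_le_one hC]; exact norm_hannK_mul_add_le hδ h0 h1 hA)
  rw [div_mul_eq_mul_div, div_le_iff₀ hC] at k
  exact (mul_le_mul_of_nonneg_left (one_add_sq_div_le hA0 hY _) (by positivity)).trans k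

theorem abs_im_mul_norm_hannK_le (hδ : 0 < δ) (h0 : 0 < s.re) (h1 : s.re ≤ 1)
    (hY : 1.3 * (2 * Real.pi / δ) ≤ Y) :
    |s.im| * ‖hannK δ s‖ * (1 + s.im ^ 2 / Y ^ 2) ≤
      0.88 * (2 * Real.pi / δ) * (δ / 2 * Real.exp δ) := by
  set A := 2 * Real.pi / δ with hA
  have hA0 : 0 < A := by positivity
  have hC : 0 < δ / 2 * Real.exp δ := by positivity
  have k := kernel_weight_mul_le (k := ‖hannK δ s‖ / (δ / 2 * Real.exp δ)) (y := |s.im| / A)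
    (by positivity) (by positivity)
    (by rw [mul_div_assoc', div_le_one hC]; exact norm_hannK_mul_add_le hδ h0 h1 hA)
    (by rw [mul_div_assoc', div_le_one hC]; exact norm_hannK_mul_le hδ h1 hA)
  rw [div_mul_div_comm, div_mul_eq_mul_div, div_le_iff₀ (by positivity), ← mul_assoc] at k
  exact (mul_le_mul_of_nonneg_left (one_add_sq_div_le hA0 hY _) (by positivity)).trans k

end

section
variable {δ Y L : ℝ} {a : ℂ}

theorem norm_exp_add_half_mul (a : ℂ) (L : ℝ) (K : ℂ) :
    ‖exp ((a + 1 / 2) * L) * K‖ = Real.exp ((a.re - 1 / 2) * L) * Real.exp L * ‖K‖ := by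
  rw [norm_mul, norm_exp, ← Real.exp_add]
  congr 2
  simp
  ring

theorem norm_zero_term_right_le (hδ : 0 < δ) (hY1 : 1 ≤ Y) (hY : 1.3 * (2 * Real.pi / δ) ≤ Y)
    (hL : 0 ≤ L) (ha : xiHalf a = 0) (hre : 0 < a.re) :
    ‖exp ((a + 1 / 2) * L) * hannK δ (a + 1 / 2)‖ ≤ Real.exp L * (δ / 2 * Real.exp δ) *
      (Real.exp (-2 * √(0.1036 * L)) * (0.88 * (2 * Real.pi / δ) / 12 + 7.5)) *
      ((Y ^ 2 + 1) / (2 * Y) * zeroPair Y a) := by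
  have hr := abs_re_lt_of_xiHalf_eq_zero ha
  obtain ⟨r1, r2⟩ := abs_lt.1 hr
  have s0 : 0 < (a + 1 / 2).re := by simp; linarith
  have s1 : (a + 1 / 2).re ≤ 1 := by norm_num; linarith
  have si : (a + 1 / 2).im = a.im := by simp
  have w1 := norm_hannK_weight_le hδ s0 s1 hY
  have w2 := abs_im_mul_norm_hannK_le hδ s0 s1 hY
  rw [si] at w1 w2
  set K := ‖hannK δ (a + 1 / 2)‖
  set W := 1 + a.im ^ 2 / Y ^ 2
  set Z := (Y ^ 2 + 1) / (2 * Y) * zeroPair Y a with hZ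
  have hZ0 : 0 ≤ Z := by
    have := zeroPair_nonneg (w := Y) (by rw [ofReal_re]; linarith) hr
    positivity
  have hZW : 1 ≤ W * Z := one_le_mul_zeroPair hY1 hr
  rw [norm_exp_add_half_mul]
  have hE := exp_neg_mul_le ha hre hL
  have hK : (|a.im| / 12 + 6) * K ≤
      (0.88 * (2 * Real.pi / δ) / 12 + 7.5) * (δ / 2 * Real.exp δ) * Z := by
    calc _ ≤ (|a.im| / 12 + 6) * K * (W * Z) := le_mul_of_one_le_right (by positivity) hZW
      _ = (|a.im| * K * W / 12 + 6 * (K * W)) * Z := by ring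
      _ ≤ (0.88 * (2 * Real.pi / δ) * (δ / 2 * Real.exp δ) / 12 +
          6 * (1.25 * (δ / 2 * Real.exp δ))) * Z := by gcongr
      _ = _ := by ring
  calc _ ≤ Real.exp (-2 * √(0.1036 * L)) * (|a.im| / 12 + 6) * Real.exp L * K := by gcongr
    _ = Real.exp (-2 * √(0.1036 * L)) * Real.exp L * ((|a.im| / 12 + 6) * K) := by ring
    _ ≤ Real.exp (-2 * √(0.1036 * L)) * Real.exp L *
      ((0.88 * (2 * Real.pi / δ) / 12 + 7.5) * (δ / 2 * Real.exp δ) * Z) := by gcongr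
    _ = _ := by ring

theorem norm_zero_term_left_le (hδ : 0 < δ) (hY1 : 1 ≤ Y) (hY : 1.3 * (2 * Real.pi / δ) ≤ Y)
    (hL : 0 ≤ L) (ha : xiHalf a = 0) (hre : a.re ≤ 0) :
    ‖exp ((a + 1 / 2) * L) * hannK δ (a + 1 / 2)‖ ≤ Real.exp L * (δ / 2 * Real.exp δ) *
      (1.25 * Real.exp (-L / 2)) * ((Y ^ 2 + 1) / (2 * Y) * zeroPair Y a) := by
  have hr := abs_re_lt_of_xiHalf_eq_zero ha
  obtain ⟨r1, r2⟩ := abs_lt.1 hr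
  have s0 : 0 < (a + 1 / 2).re := by simp; linarith
  have s1 : (a + 1 / 2).re ≤ 1 := by norm_num; linarith
  have si : (a + 1 / 2).im = a.im := by simp
  have w1 := norm_hannK_weight_le hδ s0 s1 hY
  rw [si] at w1
  set K := ‖hannK δ (a + 1 / 2)‖
  set W := 1 + a.im ^ 2 / Y ^ 2
  set Z := (Y ^ 2 + 1) / (2 * Y) * zeroPair Y a with hZ
  have hZ0 : 0 ≤ Z := by
    have := zeroPair_nonneg (w := Y) (by rw [ofReal_re]; linarith) hr
    positivity
  have hZW : 1 ≤ W * Z := one_le_mul_zeroPair hY1 hr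
  rw [norm_exp_add_half_mul]
  have hE : Real.exp ((a.re - 1 / 2) * L) ≤ Real.exp (-L / 2) := by
    rw [Real.exp_le_exp]; nlinarith
  calc _ ≤ Real.exp (-L / 2) * Real.exp L * K := by gcongr
    _ ≤ Real.exp (-L / 2) * Real.exp L * (K * (W * Z)) := by
      gcongr
      exact le_mul_of_one_le_right (by positivity) hZW
    _ = Real.exp (-L / 2) * Real.exp L * ((K * W) * Z) := by ring
    _ ≤ Real.exp (-L / 2) * Real.exp L * ((1.25 * (δ / 2 * Real.exp δ)) * Z) := by gcongr
    _ = _ := by ring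

theorem norm_sum_zero_terms_le (hδ : 0 < δ) (hY1 : 1 ≤ Y) (hY : 1.3 * (2 * Real.pi / δ) ≤ Y)
    (hL : 0 ≤ L) (r : ℝ) :
    ‖∑ a ∈ xiZeros r, (-(xiMult a : ℂ)) * (exp ((a + 1 / 2) * L) * hannK δ (a + 1 / 2))‖ ≤
      Real.exp L * (δ / 2) * (Real.exp δ * ((Y ^ 2 + 1) / (2 * Y)) * xiReal (1 / 2 + Y) *
        (Real.exp (-2 * √(0.1036 * L)) * (0.88 * (2 * Real.pi / δ) / 12 + 7.5) +
          2.5 * Real.exp (-L / 2))) := by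
  set C := Real.exp L * (δ / 2 * Real.exp δ) with hC
  set D := Real.exp (-2 * √(0.1036 * L)) * (0.88 * (2 * Real.pi / δ) / 12 + 7.5) with hD
  have hC0 : 0 ≤ C := by positivity
  have hD0 : 0 ≤ D := by positivity
  set V := (Y ^ 2 + 1) / (2 * Y) with hV
  have hV0 : 0 ≤ V := by positivity
  have term : ∀ a ∈ xiZeros r,
      ‖(-(xiMult a : ℂ)) * (exp ((a + 1 / 2) * L) * hannK δ (a + 1 / 2))‖ ≤
      C * D * V * ((xiMult a : ℝ) * (if 0 < a.re then zeroPair Y a else 0)) +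
      C * (1.25 * Real.exp (-L / 2)) * V * ((xiMult a : ℝ) * zeroPair Y a) := fun a ha => by
    have hz := (mem_xiZeros.1 ha).2
    have hZ := zeroPair_nonneg (w := Y) (by rw [ofReal_re]; linarith)
      (abs_re_lt_of_xiHalf_eq_zero hz)
    rw [norm_mul, norm_neg, norm_natCast]
    split_ifs with h
    · have := norm_zero_term_right_le hδ hY1 hY hL hz h
      calc _ ≤ (xiMult a : ℝ) * (C * D * (V * zeroPair Y a)) := by gcongr
        _ = C * D * V * ((xiMult a : ℝ) * zeroPair Y a) + 0 := by ring
        _ ≤ _ := by gcongr; positivity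
    · have := norm_zero_term_left_le hδ hY1 hY hL hz (not_lt.1 h)
      calc _ ≤ (xiMult a : ℝ) * (C * (1.25 * Real.exp (-L / 2)) * (V * zeroPair Y a)) := by gcongr
        _ = _ := by ring
  refine (norm_sum_le_of_le _ term).trans ?_
  rw [Finset.sum_add_distrib, ← Finset.mul_sum, ← Finset.mul_sum]
  calc _ ≤ C * D * V * xiReal (1 / 2 + Y) +
        C * (1.25 * Real.exp (-L / 2)) * V * (2 * xiReal (1 / 2 + Y)) := by
        gcongr
        · exact sum_zeroPair_right_le hY1 r
        · exact sum_zeroPair_le hY1 r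
    _ = _ := by rw [hC]; ring

end

theorem log_le_of_pow_le_two_pow {x : ℝ} (hx : 0 < x) {a b : ℕ} (ha : 0 < a) (h : x ^ a ≤ 2 ^ b) :
    Real.log x ≤ b / a * 0.6931471808 := by
  have h1 := Real.log_le_log (by positivity) h
  rw [Real.log_pow, Real.log_pow] at h1
  have h2 := Real.log_two_lt_d9
  have h3 : (b : ℝ) * Real.log 2 ≤ b * 0.6931471808 := by gcongr
  rw [div_mul_eq_mul_div, le_div_iff₀ (by positivity)]
  linarith

theorem xiReal_nonneg {s : ℂ} (hs : 1 ≤ s.re) : 0 ≤ xiReal s := by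
  simpa using sum_le_xiReal hs ∅ (by simp)

theorem exp_ge : (1528600 : ℝ) ≤ Real.exp 14.24 := by
  have h1 : Real.exp 14.24 = Real.exp 1 ^ 14 * Real.exp 0.24 := by
    rw [← Real.exp_nat_mul, ← Real.exp_add]; norm_num
  have h2 : (1.2711 : ℝ) ≤ Real.exp 0.24 := by
    have := Real.sum_le_exp_of_nonneg (show (0 : ℝ) ≤ 0.24 by norm_num) 4
    norm_num [Finset.sum_range_succ, Nat.factorial] at this ⊢
    linarith
  have h3 : (2.7182818283 : ℝ) ^ 14 ≤ Real.exp 1 ^ 14 :=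
    pow_le_pow_left₀ (by norm_num) Real.exp_one_gt_d9.le _
  rw [h1]
  calc (1528600 : ℝ) ≤ 2.7182818283 ^ 14 * 1.2711 := by norm_num
    _ ≤ _ := by gcongr

theorem zero_factor_le {L δ : ℝ} (hL : 490 ≤ L) (hδ : δ = Real.log (1 + 1 / (L - 1.1))) :
    Real.exp δ * (((2.6 * Real.pi * L) ^ 2 + 1) / (2 * (2.6 * Real.pi * L))) *
      xiReal (1 / 2 + (2.6 * Real.pi * L : ℝ)) *
        (Real.exp (-2 * √(0.1036 * L)) * (0.88 * (2 * Real.pi / δ) / 12 + 7.5) +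
          2.5 * Real.exp (-L / 2)) ≤ 0.99 := by
  have hp1 := Real.pi_gt_d4
  have hp2 := Real.pi_lt_d4
  have hL1 : 0 < L - 1.1 := by linarith
  have hexpδ : Real.exp δ ≤ 1.00205 := by
    rw [hδ, Real.exp_log (by positivity)]
    have : 1 / (L - 1.1) ≤ 0.00205 := by
      rw [div_le_iff₀ hL1]; linarith
    linarith
  have hδL : 1 / L ≤ δ := by
    have := Real.one_sub_inv_le_log_of_pos (show 0 < 1 + 1 / (L - 1.1) by positivity)
    rw [hδ]
    refine le_trans ?_ this
    have e : 1 - (1 + 1 / (L - 1.1))⁻¹ = 1 / (L - 0.1) := by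
      have : L - 0.1 ≠ 0 := by linarith
      have : L - 1.1 ≠ 0 := by linarith
      have : 1 + 1 / (L - 1.1) = (L - 0.1) / (L - 1.1) := by field_simp; ring
      rw [this]
      field_simp
      ring
    rw [e]
    apply one_div_le_one_div_of_le <;> linarith
  have hL0 : 0 < L := by linarith
  have hδ0 : 0 < δ := lt_of_lt_of_le (by positivity) hδL
  set Y := 2.6 * Real.pi * L with hY
  have hY1 : 8.1679 * L ≤ Y := by rw [hY]; gcongr; linarith
  have hY2 : Y ≤ 8.1682 * L := by rw [hY]; gcongr; linarith
  have hV : (Y ^ 2 + 1) / (2 * Y) ≤ 4.0842 * L := by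
    rw [div_le_iff₀ (by linarith)]
    nlinarith
  set v := √(L / 490) with hv
  have hv1 : 1 ≤ v := by rw [hv, Real.one_le_sqrt]; linarith
  have hvL : L = 490 * v ^ 2 := by rw [hv, Real.sq_sqrt (by positivity)]; ring
  have hX : xiReal (1 / 2 + (Y : ℝ)) ≤ 3.2292 * Real.exp (v - 1) := by
    have h1 := xiReal_half_add_le (Y := Y) (by linarith)
    have h2 : 1 / (Y - 1 / 2) ≤ 0.00026 := by
      rw [div_le_iff₀ (by linarith)]; linarith
    have h3 : (Y + 5 / 2) / (2 * Real.pi) ≤ 637.5 * v ^ 2 := by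
      rw [div_le_iff₀ (by positivity), hY]
      have : 1.301 * L ≤ 637.5 * v ^ 2 := by rw [hvL]; nlinarith only [sq_nonneg v]
      nlinarith only [this, Real.pi_gt_d2, mul_le_mul_of_nonneg_right this Real.pi_pos.le, hL0,
          hvL, hv1]
    have h4 : Real.log ((Y + 5 / 2) / (2 * Real.pi)) ≤ 6.4577 + 2 * (v - 1) := by
      have h5 := log_le_of_pow_le_two_pow (x := 637.5) (a := 79) (b := 736) (by norm_num)
        (by norm_num) (by rw [show 736 = 184 * 4 by norm_num, pow_mul]; norm_num)
      have h6 := Real.log_le_sub_one_of_pos (show 0 < v by linarith)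
      refine (Real.log_le_log (by positivity) h3).trans ?_
      rw [Real.log_mul (by norm_num) (by positivity), Real.log_pow]
      norm_num at h5 ⊢
      linarith
    have := Real.add_one_le_exp (v - 1)
    nlinarith
  have hX0 : 0 ≤ xiReal (1 / 2 + (Y : ℝ)) := xiReal_nonneg (by norm_num; linarith)
  have hE : Real.exp (-2 * √(0.1036 * L)) ≤ Real.exp (-14.24 * v) := by
    rw [Real.exp_le_exp]
    have : 7.12 * v ≤ √(0.1036 * L) := by
      rw [hvL]
      refine Real.le_sqrt_of_sq_le ?_
      nlinarith only [sq_nonneg v]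
    linarith only [this]
  have hE2 : Real.exp (-L / 2) ≤ Real.exp (-14.24 * v) * 0.005 := by
    have h1 : Real.exp (-L / 2) = Real.exp (-14.24 * v) * Real.exp (14.24 * v - L / 2) := by
      rw [← Real.exp_add]; ring_nf
    have h2 : Real.exp (14.24 * v - L / 2) ≤ 0.005 := by
      have h3 : 14.24 * v - L / 2 ≤ -230 := by rw [hvL]; nlinarith only [hv1]
      have h4 := Real.add_one_le_exp (230 : ℝ)
      refine (Real.exp_le_exp.2 h3).trans ?_
      rw [Real.exp_neg]
      refine (inv_anti₀ (by norm_num) h4).trans (by norm_num)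
    rw [h1]
    gcongr
  have hB : 0.88 * (2 * Real.pi / δ) / 12 + 7.5 ≤ 0.4761 * L := by
    have : 2 * Real.pi / δ ≤ 6.2832 * L := by
      rw [div_le_iff₀ hδ0]
      have : 1 ≤ L * δ := by rwa [div_le_iff₀ hL0, mul_comm] at hδL
      nlinarith only [this, Real.pi_lt_d6, hL0]
    linarith only [this, hL]
  have hB0 : 0 ≤ 0.88 * (2 * Real.pi / δ) / 12 + 7.5 := by positivity
  have hsum : Real.exp (-2 * √(0.1036 * L)) * (0.88 * (2 * Real.pi / δ) / 12 + 7.5) +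
      2.5 * Real.exp (-L / 2) ≤ Real.exp (-14.24 * v) * (0.4762 * L) := by
    have h1 := mul_le_mul hE hB hB0 (Real.exp_pos _).le
    have h2 := Real.exp_pos (-14.24 * v)
    linarith only [h1, h2, hE2, mul_le_mul_of_nonneg_left hL h2.le]
  calc _ ≤ 1.00205 * (4.0842 * L) * (3.2292 * Real.exp (v - 1)) *
        (Real.exp (-14.24 * v) * (0.4762 * L)) := by gcongr
    _ = (1.00205 * 4.0842 * 3.2292 * 0.4762 * 490 ^ 2) *
        (Real.exp (v - 1) * Real.exp (-14.24 * v) * v ^ 4) := by rw [hvL]; ring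
    _ ≤ (1.00205 * 4.0842 * 3.2292 * 0.4762 * 490 ^ 2) *
        (Real.exp (v - 1) * Real.exp (-14.24 * v) * Real.exp (v - 1) ^ 4) := by
        gcongr
        linarith [Real.add_one_le_exp (v - 1)]
    _ = (1.00205 * 4.0842 * 3.2292 * 0.4762 * 490 ^ 2) *
        Real.exp (-14.24 - 9.24 * (v - 1)) := by
        rw [← Real.exp_nat_mul, ← Real.exp_add, ← Real.exp_add]
        congr 2
        push_cast
        ring
    _ ≤ (1.00205 * 4.0842 * 3.2292 * 0.4762 * 490 ^ 2) * Real.exp (-14.24) := by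
        gcongr
        linarith
    _ ≤ (1.00205 * 4.0842 * 3.2292 * 0.4762 * 490 ^ 2) * (1528600)⁻¹ := by
        rw [Real.exp_neg]
        gcongr
        exact exp_ge
    _ ≤ 0.99 := by norm_num

/-! ### Prime gaps beyond the computed range -/

theorem half_le_re_hannK_one {δ : ℝ} (hδ : 0 < δ) (h1 : δ ≤ 1) : δ / 2 ≤ (hannK δ 1).re := by
  have h := hannK_mul hδ 1
  set A := 2 * Real.pi / δ with hA
  have e : (2 : ℂ) * 1 * (1 ^ 2 + (A : ℂ) ^ 2) = (2 * (1 + A ^ 2) : ℝ) := by push_cast; ring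
  have e2 : (A : ℂ) ^ 2 * (exp (1 * δ) - 1) = (A ^ 2 * (Real.exp δ - 1) : ℝ) := by
    push_cast; rw [one_mul]
  rw [e, e2] at h
  have h2 := congrArg re h
  rw [re_ofReal_mul, ofReal_re] at h2
  have h3 := Real.quadratic_le_exp_of_nonneg hδ.le
  have h4 : 1 ≤ A ^ 2 * δ / 2 := by
    have : A ^ 2 * δ / 2 = 2 * Real.pi ^ 2 / δ := by rw [hA]; field_simp
    rw [this, one_le_div hδ]
    nlinarith [Real.pi_gt_three]
  have h5 : A ^ 2 * (δ + δ ^ 2 / 2) ≤ A ^ 2 * (Real.exp δ - 1) := by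
    gcongr; linarith
  have h6 : 0 < 2 * (1 + A ^ 2) := by positivity
  refine le_of_mul_le_mul_left ?_ h6
  rw [h2]
  nlinarith

theorem norm_trivial_zero_terms_le {δ L : ℝ} (hδ : 0 < δ) (hL : 1 ≤ L) (n : ℕ) :
    ‖∑ k ∈ Finset.range n,
      (-1) * (exp ((-2 * ((k : ℂ) + 1)) * L) * hannK δ (-2 * ((k : ℂ) + 1)))‖ ≤ δ / 2 := by
  have term : ∀ k ∈ Finset.range n,
      ‖(-1) * (exp ((-2 * ((k : ℂ) + 1)) * L) * hannK δ (-2 * ((k : ℂ) + 1)))‖ ≤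
        (1 / 2) ^ k * (1 / 2) * (δ / 2) := fun k _ => by
    have hk : (0 : ℝ) ≤ k := k.cast_nonneg
    have e : ((-2 * ((k : ℂ) + 1))).re = -2 * (k + 1) := by simp
    have e2 : ((-2 * ((k : ℂ) + 1)) * L).re = ((k + 1 : ℕ) : ℝ) * (-2 * L) := by
      simp; ring
    rw [norm_mul, norm_neg, norm_one, one_mul, norm_mul, norm_exp, e2, Real.exp_nat_mul,
      ← pow_succ]
    have h1 := norm_hannK_le hδ (-2 * ((k : ℂ) + 1))
    rw [e, max_eq_right (by linarith), zero_mul, Real.exp_zero, mul_one] at h1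
    have h2 : Real.exp (-2 * L) ≤ 1 / 2 := by
      have := Real.add_one_le_exp (1 : ℝ)
      have h3 : Real.exp (-2 * L) ≤ Real.exp (-1) := by rw [Real.exp_le_exp]; linarith
      refine h3.trans ?_
      rw [Real.exp_neg, one_div]
      exact inv_anti₀ (by norm_num) (by linarith)
    gcongr
  refine (norm_sum_le_of_le _ term).trans ?_
  rw [← Finset.sum_mul, ← Finset.sum_mul]
  have := Summable.sum_le_tsum (f := fun k : ℕ => (1 / 2 : ℝ) ^ k) (Finset.range n)
    (fun _ _ => by positivity) summable_geometric_two
  rw [tsum_geometric_two] at this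
  nlinarith

theorem le_re_hannT {L δ : ℝ} (hL : 490 ≤ L) (hδ : δ = Real.log (1 + 1 / (L - 1.1))) :
    (0.01 * Real.exp L - 1) / (2 * L) ≤
      (hannT δ L (LSeries fun n => (vonMangoldt n : ℂ))).re := by
  have hL1 : 0 < L - 1.1 := by linarith
  have hL0 : 0 < L := by linarith
  have hδL : 1 / L ≤ δ := by
    have := Real.one_sub_inv_le_log_of_pos (show 0 < 1 + 1 / (L - 1.1) by positivity)
    rw [hδ]
    refine le_trans ?_ this
    have e : 1 - (1 + 1 / (L - 1.1))⁻¹ = 1 / (L - 0.1) := by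
      have : L - 0.1 ≠ 0 := by linarith
      have : L - 1.1 ≠ 0 := by linarith
      have : 1 + 1 / (L - 1.1) = (L - 0.1) / (L - 1.1) := by field_simp; ring
      rw [this]
      field_simp
      ring
    rw [e]
    apply one_div_le_one_div_of_le <;> linarith
  have hδ1 : δ ≤ 1 := by
    have h1 := Real.log_le_sub_one_of_pos (show 0 < 1 + 1 / (L - 1.1) by positivity)
    have h2 : 1 / (L - 1.1) ≤ 1 := by rw [div_le_one hL1]; linarith
    linarith
  have hδ0 : 0 < δ := lt_of_lt_of_le (by positivity) hδL
  have hY : 1.3 * (2 * Real.pi / δ) ≤ 2.6 * Real.pi * L := by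
    have : 2 * Real.pi / δ ≤ 2 * Real.pi * L := by
      rw [div_le_iff₀ hδ0]
      have : 1 ≤ L * δ := by rwa [div_le_iff₀ hL0, mul_comm] at hδL
      nlinarith [Real.pi_pos]
    linarith
  have hY1 : 1 ≤ 2.6 * Real.pi * L := by nlinarith [Real.pi_gt_three]
  refine ge_of_tendsto (continuous_re.continuousAt.tendsto.comp (tendsto_explicit hδ0 hL0.le))
    (Eventually.of_forall fun n => ?_)
  have t1 := norm_trivial_zero_terms_le hδ0 (show 1 ≤ L by linarith) n
  have t2 := norm_sum_zero_terms_le hδ0 hY1 hY hL0.le n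
  have t3 := zero_factor_le hL hδ
  have t4 := half_le_re_hannK_one hδ0 hδ1
  have t5 := (neg_le_abs _).trans ((abs_re_le_norm _).trans t1)
  have t6 := (neg_le_abs _).trans ((abs_re_le_norm _).trans
    (t2.trans (mul_le_mul_of_nonneg_left t3 (by positivity))))
  have e : (exp (L : ℂ) * hannK δ 1).re = Real.exp L * (hannK δ 1).re := by
    rw [← ofReal_exp, re_ofReal_mul]
  have t7 : Real.exp L * (δ / 2) ≤ Real.exp L * (hannK δ 1).re := by gcongr
  have t8 : (0.01 * Real.exp L - 1) / (2 * L) ≤ (0.01 * Real.exp L - 1) * (δ / 2) := by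
    have := Real.add_one_le_exp L
    rw [show (0.01 * Real.exp L - 1) / (2 * L) = (0.01 * Real.exp L - 1) * (1 / L / 2) by ring]
    gcongr
    linarith
  simp only [Function.comp, add_re]
  rw [e]
  nlinarith

theorem sum_vonMangoldt_not_prime_le {N : ℕ} (hN : 1 ≤ N) (S : Finset ℕ)
    (hS : ∀ n ∈ S, 0 < n ∧ n ≤ N ∧ ¬ n.Prime) :
    ∑ n ∈ S, vonMangoldt n ≤ 2 * √(N : ℝ) * Real.log N := by
  refine le_trans ?_ (Chebyshev.psi_sub_theta_le (x := N) (by exact_mod_cast hN))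
  rw [Chebyshev.psi, Chebyshev.theta, Nat.floor_natCast, Finset.sum_filter,
      ← Finset.sum_sub_distrib]
  have h0 : ∀ n, 0 ≤ vonMangoldt n - (if n.Prime then Real.log n else 0) := fun n => by
    split_ifs with h
    · rw [vonMangoldt_apply_prime h, sub_self]
    · rw [sub_zero]; exact vonMangoldt_nonneg
  refine le_trans (le_of_eq (Finset.sum_congr rfl fun n hn => ?_))
    (Finset.sum_le_sum_of_subset_of_nonneg (fun n hn => ?_) fun n _ _ => h0 n)
  · rw [if_neg (hS n hn).2.2, sub_zero]
  · obtain ⟨h1, h2, -⟩ := hS n hn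
    exact Finset.mem_Ioc.2 ⟨h1, h2⟩

theorem exists_prime_of_le_log {p : ℕ} (hp : 490 ≤ Real.log p) :
    ∃ r : ℕ, r.Prime ∧ p < r ∧ (r : ℝ) < p + p / (Real.log p - 1.1) := by
  by_contra! hno
  set L := Real.log p with hL
  set δ := Real.log (1 + 1 / (L - 1.1)) with hδ
  have hL1 : 0 < L - 1.1 := by linarith
  have hp0 : 0 < (p : ℝ) := by
    rcases Nat.eq_zero_or_pos p with h | h
    · rw [hL, h] at hp; norm_num at hp
    · exact_mod_cast h
  have hpL : Real.exp L = p := Real.exp_log hp0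
  have hp1 : 1 ≤ p := by exact_mod_cast hp0
  have hδ0 : 0 < δ := Real.log_pos (by have : 0 < 1 / (L - 1.1) := by positivity
                                       linarith)
  have hz : ∀ n : ℕ, (n = 0 ∨ 2 * p < n ∨ n.Prime) → vonMangoldt n * hann δ (Real.log n - L) = 0 :=
      by
    intro n hn
    rcases Nat.eq_zero_or_pos n with rfl | hn0
    · simp
    have hn1 : (0 : ℝ) < n := by exact_mod_cast hn0
    by_cases h1 : n ≤ p
    · have : Real.log n ≤ L := Real.log_le_log hn1 (by exact_mod_cast h1)
      rw [hann_of_le (by linarith), mul_zero]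
    push Not at h1
    have key : (p : ℝ) + p / (L - 1.1) ≤ n := by
      rcases hn with h | h | h
      · omega
      · have : (2 * p : ℝ) < n := by exact_mod_cast h
        have h2 : (p : ℝ) / (L - 1.1) ≤ p := div_le_self hp0.le (by linarith)
        linarith
      · exact hno n h h1
    have : δ ≤ Real.log n - L := by
      rw [hδ, le_sub_iff_add_le, hL, ← Real.log_mul (by positivity) hp0.ne']
      refine Real.log_le_log (by positivity) ?_
      rw [add_mul, one_mul, one_div_mul_eq_div]
      exact key
    rw [hann_of_ge hδ0 this, mul_zero]
  have hup : (hannT δ L (LSeries fun n => (vonMangoldt n : ℂ))).re ≤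
      2 * √((2 * p : ℕ) : ℝ) * Real.log ((2 * p : ℕ) : ℝ) := by
    refine le_of_tendsto (continuous_re.continuousAt.tendsto.comp (tendsto_hannT_LSeries hδ0 L))
      (Eventually.of_forall fun N => ?_)
    rw [Function.comp, re_sum]
    refine le_trans ?_ (sum_vonMangoldt_not_prime_le (N := 2 * p) (by omega)
      ((Finset.range N).filter fun n => 0 < n ∧ n ≤ 2 * p ∧ ¬ n.Prime)
      fun n hn => (Finset.mem_filter.1 hn).2)
    rw [Finset.sum_filter]
    refine Finset.sum_le_sum fun n _ => ?_
    rw [← ofReal_mul, ofReal_re]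
    split_ifs with h
    · exact mul_le_of_le_one_right vonMangoldt_nonneg (hann_le_one _ _)
    · refine (hz n ?_).le
      by_contra! h2
      exact h ⟨Nat.pos_of_ne_zero h2.1, h2.2.1, h2.2.2⟩
  have hlow := (le_re_hannT hp hδ).trans hup
  push_cast at hlow
  set w := Real.exp (L / 2) with hw
  have hww : Real.exp L = w ^ 2 := by rw [hw, ← Real.exp_nat_mul]; congr 1; push_cast; ring
  have hs : √(2 * p : ℝ) ≤ 2 * w := by
    rw [← hpL, hww]
    refine Real.sqrt_le_iff.2 ⟨by positivity, ?_⟩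
    nlinarith [sq_nonneg w]
  have hl : Real.log (2 * p) ≤ 2 * L := by
    rw [Real.log_mul (by norm_num) hp0.ne']
    linarith [Real.log_two_lt_d9]
  have hl0 : 0 ≤ Real.log (2 * p : ℝ) := Real.log_nonneg (by
    have : (1 : ℝ) ≤ p := by exact_mod_cast hp1
    linarith)
  have hw1 : 10000 * L ^ 2 ≤ w := by
    have h1 := Real.pow_div_factorial_le_exp (L / 2) (by linarith) 6
    have h2 : (490 : ℝ) ^ 4 ≤ L ^ 4 := by gcongr
    norm_num [Nat.factorial] at h1 h2
    rw [← hw] at h1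
    have h3 : L ^ 2 * 57648010000 ≤ L ^ 2 * L ^ 4 := by gcongr
    nlinarith [sq_nonneg L]
  have h9 : 0.01 * Real.exp L - 1 ≤ 16 * L ^ 2 * w := by
    rw [div_le_iff₀ (by linarith)] at hlow
    refine hlow.trans ?_
    calc _ ≤ 2 * (2 * w) * (2 * L) * (2 * L) := by gcongr
      _ = _ := by ring
  rw [hww] at h9
  have hw2 : 1000 ≤ w := by nlinarith
  have h10 : 16 * L ^ 2 * w ≤ 0.0016 * w * w :=
    mul_le_mul_of_nonneg_right (by linarith) (by linarith)
  nlinarith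

end

/-! ### Chains of Proth primes, evaluated by the kernel -/

/-- Apply `f` to `x` after `x` has been evaluated to a literal. -/
noncomputable def force {α : Type} (x : ℕ) (f : ℕ → α) : α :=
  Nat.rec (motive := fun _ => α) (f x) (fun m _ => f m) (Nat.add x 1)

/-- `x ^ 512 * 3 ^ d` modulo `p`. -/
noncomputable def appendDigit (p x d : ℕ) : ℕ :=
  Nat.mod (Nat.mul (Nat.pow (Nat.mod (Nat.pow (Nat.mod (Nat.pow x 8) p) 8) p) 8) (Nat.pow 3 d)) p

/-- `3 ^ (k / 2 ^ (27 * (j - i)))` modulo `p`. -/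
noncomputable def threePow (p k j i : ℕ) : ℕ :=
  Nat.rec (motive := fun _ => ℕ) (Nat.pow 3 (Nat.shiftRight k (Nat.mul 27 j)))
    (fun i ih => force (Nat.shiftRight k (Nat.mul 27 (Nat.sub j (Nat.succ i)))) fun d =>
      appendDigit p (appendDigit p (appendDigit p ih (Nat.mod (Nat.shiftRight d 18) 512))
        (Nat.mod (Nat.shiftRight d 9) 512)) (Nat.mod d 512)) i

/-- `x ^ (2 ^ j)` modulo `p`. -/
noncomputable def sqPow (p x j : ℕ) : ℕ :=
  Nat.rec (motive := fun _ => ℕ) x (fun _ ih => Nat.mod (Nat.pow ih 2) p) j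

/-- `x ^ (2 ^ (24 * j))` modulo `p`. -/
noncomputable def octPow (p x j : ℕ) : ℕ :=
  Nat.rec (motive := fun _ => ℕ) x (fun _ ih =>
    Nat.mod (Nat.pow (Nat.mod (Nat.pow (Nat.mod (Nat.pow (Nat.mod (Nat.pow
    (Nat.mod (Nat.pow (Nat.mod (Nat.pow (Nat.mod (Nat.pow (Nat.mod (Nat.pow
      ih 8) p) 8) p) 8) p) 8) p) 8) p) 8) p) 8) p) 8) p) j

/-- Proth's test to base `3` for `p = k * 2 ^ n + 1`, where `n = 24 * q + s + 1`. -/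
noncomputable def prothTest (j q s p k : ℕ) : Bool :=
  force (octPow p (sqPow p (threePow p k j j) s) q) fun x => Nat.beq (Nat.succ x) p

/-- An upper bound for `100 * (log x - 1.1)` when `x < 2 ^ T`. -/
noncomputable def logBound (T : ℕ) : ℕ :=
  Nat.sub (Nat.div (Nat.mul 6931472 T) 100000) 109

/-- The first `v` among `u, u - 3, …, u - 3 * (r - 1)` for which `v * N + 1` passes the test, where
`N = M * 2 ^ (24 * q + s + 1)`, or `0` if there is none. -/
noncomputable def firstPassing (M N j q s r : ℕ) : ℕ → ℕ :=
  Nat.rec (motive := fun _ => ℕ → ℕ) (fun _ => 0) (fun _ ih u =>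
    Bool.rec (motive := fun _ => ℕ) (force (Nat.sub u 3) ih) u
      (force (Nat.succ (Nat.mul u N)) fun p => force (Nat.mul u M) fun k =>
        prothTest j q s p k)) r

/-- Follow a chain of multipliers `t` of `N` until `t * N` reaches `2 ^ e`, where `N = M * P` and
`P = 2 ^ n`. The base `B` digits of `D` tell where to look for the next `t` for which `t * N + 1`
passes the test. -/
noncomputable def run (M N P j q s B W r e fuel : ℕ) : ℕ → ℕ → ℕ → Bool :=
  Nat.rec (motive := fun _ => ℕ → ℕ → ℕ → Bool) (fun _ _ _ => false) (fun _ ih T t D =>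
    Bool.rec (motive := fun _ => Bool)
      (force (firstPassing M N j q s r (Nat.add t (Nat.mul 3 (Nat.sub
          (Nat.div (Nat.mul t 100) (Nat.mul (logBound T) 3))
          (Nat.mod (Nat.mul (Nat.mod D B) t) W))))) fun u =>
        Bool.rec (motive := fun _ => Bool) false (force (Nat.div D B) fun D' => ih T u D')
          (Nat.ble (Nat.succ (Nat.mul u M)) P))
      (Bool.rec (motive := fun _ => Bool) (force (Nat.succ T) fun T' => ih T' t D) true
        (Nat.ble e T))
      (Nat.ble (Nat.pow 2 T) (Nat.mul t N))) fuel

/-- Start the chain at `t * (M * 2 ^ n) ≤ 2 ^ T`, where `n = 24 * q + s + 1`. -/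
noncomputable def certify (M j q s B W r T e fuel t D : ℕ) : Bool :=
  force (Nat.pow 2 (Nat.succ (Nat.add (Nat.mul 24 q) s))) fun P =>
    force (Nat.mul M P) fun N =>
      Bool.rec (motive := fun _ => Bool) false (run M N P j q s B W r e fuel T t D)
        (Nat.ble (Nat.mul t N) (Nat.pow 2 T))

theorem appendDigit_modEq {p x m : ℕ} (d : ℕ) (h : x ≡ 3 ^ m [MOD p]) :
    appendDigit p x d ≡ 3 ^ (512 * m + d) [MOD p] := by
  have step : ∀ {y : ℕ} {i : ℕ}, y ≡ 3 ^ i [MOD p] → y ^ 8 % p ≡ 3 ^ (8 * i) [MOD p] := by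
    intro y i hy
    refine (Nat.mod_modEq _ _).trans ?_
    rw [mul_comm, pow_mul]
    exact hy.pow 8
  have h1 := ((step (step h)).pow 8).mul_right (3 ^ d)
  refine (Nat.mod_modEq _ _).trans (h1.trans ?_)
  rw [← pow_mul, ← pow_add]
  rw [show 8 * (8 * m) * 8 + d = 512 * m + d by ring]

theorem threePow_modEq (p k j : ℕ) {i : ℕ} (hi : i ≤ j) :
    threePow p k j i ≡ 3 ^ (k >>> (27 * (j - i))) [MOD p] := by
  induction i with
  | zero => exact Nat.ModEq.refl _
  | succ i ih =>
    have h := ih (by omega)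
    have hs : k >>> (27 * (j - i)) = (k >>> (27 * (j - (i + 1)))) >>> 27 := by
      rw [← Nat.shiftRight_add]
      congr 1
      omega
    rw [hs] at h
    generalize hd : k >>> (27 * (j - (i + 1))) = d at h ⊢
    have h1 := appendDigit_modEq (d % 512) (appendDigit_modEq ((d >>> 9) % 512)
      (appendDigit_modEq ((d >>> 18) % 512) h))
    have he : 512 * (512 * (512 * (d >>> 27) + (d >>> 18) % 512) + (d >>> 9) % 512) + d % 512 =
        d := by
      simp only [Nat.shiftRight_eq_div_pow]
      omega
    rw [he] at h1
    rw [← hd] at h1 ⊢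
    exact h1

theorem sqPow_modEq (p x j : ℕ) : sqPow p x j ≡ x ^ 2 ^ j [MOD p] := by
  induction j with
  | zero => exact (pow_one x).symm ▸ Nat.ModEq.refl x
  | succ j ih =>
    refine (Nat.mod_modEq _ _).trans ((ih.pow 2).trans ?_)
    rw [← pow_mul, pow_succ]

theorem octPow_modEq (p x j : ℕ) : octPow p x j ≡ x ^ 2 ^ (24 * j) [MOD p] := by
  induction j with
  | zero => exact (pow_one x).symm ▸ Nat.ModEq.refl x
  | succ j ih =>
    have step : ∀ {y : ℕ} {i : ℕ}, y ≡ x ^ 2 ^ i [MOD p] → y ^ 8 % p ≡ x ^ 2 ^ (i + 3) [MOD p] := by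
      intro y i hy
      refine (Nat.mod_modEq _ _).trans ?_
      rw [pow_add, pow_mul]
      exact hy.pow 8
    exact step (step (step (step (step (step (step (step ih)))))))

/-- Proth's theorem, with `3` as witness. -/
theorem prime_of_proth {k n x : ℕ} (hk0 : 0 < k) (hk : k < 2 ^ (n + 1))
    (hx : x + 1 = k * 2 ^ (n + 1) + 1) (h : x ≡ 3 ^ (k * 2 ^ n) [MOD k * 2 ^ (n + 1) + 1]) :
    (k * 2 ^ (n + 1) + 1).Prime := by
  set p := k * 2 ^ (n + 1) + 1 with hp
  have hpos : 0 < k * 2 ^ (n + 1) := by positivity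
  by_contra hnp
  have hsq := Nat.minFac_sq_le_self (by omega) hnp
  have hℓ : p.minFac.Prime := Nat.minFac_prime (by omega)
  have hdvd := Nat.minFac_dvd p
  set ℓ := p.minFac
  have := Fact.mk hℓ
  have hne2 : ℓ ≠ 2 := by
    intro h2
    rw [h2] at hdvd
    rw [hp, pow_succ, ← mul_assoc] at hdvd
    omega
  have hneg : ((3 : ZMod ℓ) ^ k) ^ 2 ^ n = -1 := by
    have h1 : (x : ZMod ℓ) = ((3 ^ (k * 2 ^ n) : ℕ) : ZMod ℓ) :=
      (ZMod.natCast_eq_natCast_iff _ _ _).2 (h.of_dvd hdvd)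
    have h2 : ((x + 1 : ℕ) : ZMod ℓ) = 0 := by
      rw [hx]
      exact (ZMod.natCast_eq_zero_iff _ _).2 hdvd
    push_cast at h1 h2
    rw [← pow_mul, ← h1]
    linear_combination h2
  have : Fact (2 < ℓ) := ⟨lt_of_le_of_ne hℓ.two_le hne2.symm⟩
  have hord : orderOf ((3 : ZMod ℓ) ^ k) = 2 ^ (n + 1) := by
    refine orderOf_eq_prime_pow ?_ ?_
    · rw [hneg]
      exact ZMod.neg_one_ne_one
    · rw [pow_succ, pow_mul, hneg]
      ring
  have h0 : (3 : ZMod ℓ) ^ k ≠ 0 := by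
    intro h0
    rw [h0, zero_pow (by positivity)] at hneg
    exact neg_ne_zero.2 one_ne_zero hneg.symm
  have hle := Nat.le_of_dvd (by have := hℓ.two_le; omega) (hord ▸ ZMod.orderOf_dvd_card_sub_one h0)
  have h3 : 2 ^ (n + 1) + 1 ≤ ℓ := by have := hℓ.two_le; omega
  nlinarith [Nat.pow_le_pow_left h3 2]

theorem prime_of_prothTest {j q s k p : ℕ} (h : prothTest j q s p k = true)
    (hp : p = k * 2 ^ (24 * q + s + 1) + 1) (hk0 : 0 < k) (hk : k < 2 ^ (24 * q + s + 1)) :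
    p.Prime := by
  have hx : octPow p (sqPow p (threePow p k j j) s) q + 1 = p := Nat.eq_of_beq_eq_true h
  have h1 := threePow_modEq p k j le_rfl
  rw [Nat.sub_self, mul_zero, Nat.shiftRight_zero] at h1
  have h2 := (octPow_modEq p (sqPow p (threePow p k j j) s) q).trans
    (((sqPow_modEq p _ s).trans (h1.pow _)).pow _)
  rw [← pow_mul, ← pow_mul, ← pow_add, add_comm s] at h2
  subst hp
  exact prime_of_proth hk0 hk hx h2

/-- There is a prime not far after `m`. -/
def HasCloseNextPrime (m : ℕ) : Prop :=
  ∃ r : ℕ, r.Prime ∧ m < r ∧ ((r : ℝ) - m) * (Real.log m - 1.1) < m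

theorem log_lt_logBound {x T : ℕ} (hx : 0 < x) (hT : x < 2 ^ T) :
    100 * (Real.log x - 1.1) < logBound T := by
  have h1 : Real.log x ≤ T * Real.log 2 := by
    rw [← Real.log_pow]
    exact Real.log_le_log (by exact_mod_cast hx) (by exact_mod_cast hT.le)
  have h2 : (T : ℝ) * Real.log 2 ≤ T * 0.6931472 :=
    mul_le_mul_of_nonneg_left (Real.log_two_lt_d9.le.trans (by norm_num)) T.cast_nonneg
  have h3 : 6931472 * T < 100000 * (logBound T + 110) := by
    change 6931472 * T < 100000 * (6931472 * T / 100000 - 109 + 110)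
    omega
  have h4 : (6931472 * T : ℝ) < 100000 * (logBound T + 110) := by exact_mod_cast h3
  linarith

theorem mul_log_sub_lt {a m δ T : ℕ} (ha : 0 < a) (ham : a ≤ m) (hT : a < 2 ^ T) (hδa : δ ≤ a)
    (hδ : δ * logBound T ≤ 100 * a) : (δ : ℝ) * (Real.log m - 1.1) < m := by
  have ha' : (0 : ℝ) < a := by exact_mod_cast ha
  have ham' : (a : ℝ) ≤ m := by exact_mod_cast ham
  have hm : (0 : ℝ) < m := ha'.trans_le ham'
  rcases Nat.eq_zero_or_pos δ with h0 | h0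
  · simpa [h0] using hm
  have hδ0 : (0 : ℝ) < δ := by exact_mod_cast h0
  have hδa' : (δ : ℝ) ≤ a := by exact_mod_cast hδa
  have hδ' : (δ : ℝ) * logBound T ≤ 100 * a := by exact_mod_cast hδ
  have hlog : Real.log m ≤ Real.log a + (m / a - 1) := by
    have := Real.log_le_sub_one_of_pos (div_pos hm ha')
    rw [Real.log_div hm.ne' ha'.ne'] at this
    linarith
  have h1 : (δ : ℝ) * (m / a - 1) ≤ m - a := by
    have h2 : (0 : ℝ) ≤ m / a - 1 := sub_nonneg.2 ((one_le_div ha').2 ham')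
    calc (δ : ℝ) * (m / a - 1) ≤ a * (m / a - 1) := mul_le_mul_of_nonneg_right hδa' h2
      _ = m - a := by field_simp
  have h3 := mul_lt_mul_of_pos_left (log_lt_logBound ha hT) hδ0
  have h4 := mul_le_mul_of_nonneg_left hlog hδ0.le
  linarith

theorem hasCloseNextPrime_of_le {a m r δ T : ℕ} (hr : r.Prime) (hmr : m < r) (hrm : r ≤ m + δ)
    (ha : 0 < a) (ham : a ≤ m) (hT : a < 2 ^ T) (hδa : δ ≤ a)
    (hδ : δ * logBound T ≤ 100 * a) : HasCloseNextPrime m := by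
  refine ⟨r, hr, hmr, ?_⟩
  have h := mul_log_sub_lt ha ham hT hδa hδ
  have hm : (0 : ℝ) < m := by exact_mod_cast ha.trans_le ham
  have h1 : (r : ℝ) - m ≤ δ := by
    have : (r : ℝ) ≤ m + δ := by exact_mod_cast hrm
    linarith
  have h2 : (0 : ℝ) < r - m := sub_pos.2 (by exact_mod_cast hmr)
  rcases le_total 0 (Real.log m - 1.1) with h3 | h3
  · exact (mul_le_mul_of_nonneg_right h1 h3).trans_lt h
  · exact (mul_nonpos_of_nonneg_of_nonpos h2.le h3).trans_lt hm

/-- Every number in `(2 ^ a, 2 ^ b]` has a prime not far after it. -/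
def CloseNextPrimeOn (a b : ℕ) : Prop :=
  ∀ m : ℕ, 2 ^ a < m → m ≤ 2 ^ b → HasCloseNextPrime m

theorem CloseNextPrimeOn.trans {a b c : ℕ} (h : CloseNextPrimeOn a b) (h' : CloseNextPrimeOn b c) :
    CloseNextPrimeOn a c := fun m ha hc =>
  (le_or_gt m (2 ^ b)).elim (h m ha) fun hb => h' m hb hc

theorem logBound_ge {T : ℕ} (hT : 4 ≤ T) : 100 ≤ logBound T := by
  change 100 ≤ 6931472 * T / 100000 - 109
  omega

theorem firstPassing_spec {M N j q s r u v : ℕ} (h : firstPassing M N j q s r u = v) :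
    v = 0 ∨ v ≤ u ∧ prothTest j q s (v * N + 1) (v * M) = true := by
  induction r generalizing u with
  | zero => exact Or.inl h.symm
  | succ r ih =>
    change Bool.rec (motive := fun _ => ℕ) (firstPassing M N j q s r (u - 3)) u
      (prothTest j q s (u * N + 1) (u * M)) = v at h
    cases ht : prothTest j q s (u * N + 1) (u * M) with
    | true =>
      rw [ht] at h
      exact Or.inr ⟨h.ge, (show u = v from h) ▸ ht⟩
    | false =>
      rw [ht] at h
      exact (ih h).imp_right fun h' => ⟨by omega, h'.2⟩

theorem hasCloseNextPrime_of_run {M N P j q s B W r e : ℕ} (hP : P = 2 ^ (24 * q + s + 1))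
    (hN : N = M * P) (fuel : ℕ) : ∀ {T t D : ℕ}, 4 ≤ T →
    run M N P j q s B W r e fuel T t D = true → ∀ m, t * N < m → m ≤ 2 ^ e →
    HasCloseNextPrime m := by
  induction fuel with
  | zero => intro T t D _ h; exact absurd h Bool.false_ne_true
  | succ fuel ih =>
    intro T t D hT h m hm hme
    change Bool.rec (motive := fun _ => Bool) _ _ (Nat.ble (2 ^ T) (t * N)) = true at h
    cases hb : Nat.ble (2 ^ T) (t * N) with
    | true =>
      rw [hb] at h
      have hTt := Nat.le_of_ble_eq_true hb
      change Bool.rec (motive := fun _ => Bool) _ _ (Nat.ble e T) = true at h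
      cases he : Nat.ble e T with
      | true =>
        have h1 := Nat.pow_le_pow_right two_pos (Nat.le_of_ble_eq_true he)
        omega
      | false =>
        rw [he] at h
        exact ih (hT.trans T.le_succ) h m hm hme
    | false =>
      rw [hb] at h
      have hTt : t * N < 2 ^ T := by
        by_contra hc
        rw [Nat.ble_eq_true_of_le (not_lt.1 hc)] at hb
        exact Bool.false_ne_true hb.symm
      obtain ⟨u, hu⟩ : ∃ u, firstPassing M N j q s r
        (t + 3 * (t * 100 / (logBound T * 3) - D % B * t % W)) = u := ⟨_, rfl⟩
      change Bool.rec (motive := fun _ => Bool) false (run M N P j q s B W r e fuel T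
        (firstPassing M N j q s r (t + 3 * (t * 100 / (logBound T * 3) - D % B * t % W))) (D / B))
        (Nat.ble (firstPassing M N j q s r
          (t + 3 * (t * 100 / (logBound T * 3) - D % B * t % W)) * M + 1) P) = true at h
      rw [hu] at h
      cases hk : Nat.ble (u * M + 1) P with
      | false => rw [hk] at h; exact absurd h Bool.false_ne_true
      | true =>
        rw [hk] at h
        rcases lt_or_ge (u * N) m with hmu | hmu
        · exact ih hT h m hmu hme
        have htu : t < u := lt_of_mul_lt_mul_right (hm.trans_le hmu) N.zero_le
        obtain ⟨hut, hpr⟩ := (firstPassing_spec hu).resolve_left (by omega)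
        have hk' := Nat.le_of_ble_eq_true hk
        have hk0 : 0 < u * M := by
          refine Nat.pos_of_ne_zero fun h0 => ?_
          rw [hN, ← mul_assoc, h0] at hmu
          omega
        have hprime : (u * N + 1).Prime :=
          prime_of_prothTest hpr (by rw [hN, hP, mul_assoc]) hk0 (by omega)
        have hL := logBound_ge hT
        have hδ : (u - t) * logBound T ≤ 100 * t := by
          have h1 := Nat.div_mul_le_self (t * 100) (logBound T * 3)
          have h2 : u - t ≤ 3 * (t * 100 / (logBound T * 3)) := by omega
          calc (u - t) * logBound T ≤ 3 * (t * 100 / (logBound T * 3)) * logBound T :=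
                Nat.mul_le_mul_right _ h2
            _ = t * 100 / (logBound T * 3) * (logBound T * 3) := by ring
            _ ≤ 100 * t := by omega
        have hδt : u - t ≤ t := by nlinarith
        have ha : 0 < t * N := by
          refine Nat.mul_pos (by omega) (Nat.pos_of_ne_zero ?_)
          rintro rfl
          omega
        refine hasCloseNextPrime_of_le (a := t * N) (δ := (u - t) * N) (T := T) hprime (by omega)
          ?_ ha hm.le hTt (Nat.mul_le_mul_right _ hδt) ?_
        · rw [Nat.sub_mul]
          have := Nat.mul_le_mul_right N htu.le
          omega
        · calc (u - t) * N * logBound T = (u - t) * logBound T * N := by ring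
            _ ≤ 100 * t * N := Nat.mul_le_mul_right _ hδ
            _ = 100 * (t * N) := by ring

theorem closeNextPrimeOn_of_certify (M j q s B W r T e fuel t D : ℕ) (hT : 4 ≤ T)
    (h : certify M j q s B W r T e fuel t D = true) : CloseNextPrimeOn T e := by
  intro m hm hme
  change Bool.rec (motive := fun _ => Bool) false _
    (Nat.ble (t * (M * 2 ^ (24 * q + s + 1))) (2 ^ T)) = true at h
  cases hb : Nat.ble (t * (M * 2 ^ (24 * q + s + 1))) (2 ^ T) with
  | false => rw [hb] at h; exact absurd h Bool.false_ne_true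
  | true =>
    rw [hb] at h
    exact hasCloseNextPrime_of_run rfl rfl fuel hT h m ((Nat.le_of_ble_eq_true hb).trans_lt hm) hme

/-- `b` is close enough to `a` to serve as the next prime for everything in `[a, b)`. -/
def CloseTo (a b : ℕ) : Prop :=
  b - a ≤ a ∧ (b - a) * logBound (a.log2 + 1) ≤ 100 * a

noncomputable instance : DecidableRel CloseTo := fun a b =>
  inferInstanceAs (Decidable (b - a ≤ a ∧ (b - a) * logBound (a.log2 + 1) ≤ 100 * a))

theorem hasCloseNextPrime_of_isChain {l : List ℕ} : ∀ {a : ℕ}, 0 < a →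
    List.IsChain CloseTo (a :: l) → (∀ r ∈ l, r.Prime) → ∀ m, a ≤ m →
    m < (a :: l).getLast (List.cons_ne_nil a l) → HasCloseNextPrime m := by
  induction l with
  | nil => intro a _ _ _ m ham hm; exact absurd hm (not_lt.2 ham)
  | cons b l ih =>
    intro a ha hc hl m ham hm
    rw [List.isChain_cons_cons] at hc
    have hb := hl b List.mem_cons_self
    rcases le_or_gt b m with h | h
    · exact ih hb.pos hc.2 (fun r hr => hl r (List.mem_cons_of_mem b hr)) m h hm
    · exact hasCloseNextPrime_of_le hb h (by omega) ha ham Nat.lt_log2_self hc.1.1 hc.1.2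

/-- A chain of primes in which each is close to its predecessor. -/
def smallPrimes : List ℕ :=
  [7, 13, 19, 23, 31, 43, 53, 67, 83, 103, 127, 157, 191, 233, 283, 337, 401, 479, 571, 661,
    773, 887, 1033, 1187, 1367, 1571, 1811, 2087, 2371, 2699, 3067, 3491, 3967, 4513, 5081,
    5717, 6427, 7237, 8147, 9173, 10223, 11399, 12721, 14197, 15823, 17659, 19553, 21649, 23971,
    26539, 29389, 32537, 36017, 39607, 43543, 47881, 52667, 57923, 63709, 70079, 76631, 83791,
    91621, 100189, 109547, 119783, 130987, 143239, 155821, 169501, 184369, 200569, 218191,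
    237361, 258211, 280897, 304169, 329347, 356621, 386161, 418129, 452759, 490267, 530869,
    572437, 617257, 665591, 717697, 773897, 834497, 899831, 970279, 1046257, 1128181, 1211983,
    1302019, 1398737, 1502651, 1614289, 1734203, 1863041, 2001451, 2150131, 2302067, 2464757,
    2638931, 2825423, 3025079, 3238861, 3467743, 3712801, 3975173, 4256101, 4542697, 4848601,
    5175103, 5523571, 5895523, 6292519, 6716257, 7168517, 7651219, 8166451, 8716373, 9277267,
    9874247, 10509649, 11185931, 11905727, 12671861, 13487293, 14355167, 15278909, 16262093,
    17308559]

set_option maxRecDepth 4000 in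
theorem prime_of_mem_smallPrimes : ∀ r ∈ smallPrimes, r.Prime := by
  simp only [smallPrimes, List.forall_mem_cons]
  norm_num

theorem hasCloseNextPrime_of_le_two_pow {m : ℕ} (h5 : 5 ≤ m) (hm : m ≤ 2 ^ 24) :
    HasCloseNextPrime m :=
  hasCloseNextPrime_of_isChain (by norm_num)
    (by decide +kernel : List.IsChain CloseTo (5 :: smallPrimes)) prime_of_mem_smallPrimes m h5
    (hm.trans_lt (by decide +kernel))

theorem closeNextPrimeOn_24_27 : CloseNextPrimeOn 24 27 :=
  closeNextPrimeOn_of_certify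
    0x1
    1 0 13 19 19 1 _ _ 47 1024
    0x12f7d5e9f76a09a5ba50c84ebff0be162c29527d60c0
    (by norm_num) (by decide +kernel)

theorem closeNextPrimeOn_27_31 : CloseNextPrimeOn 27 31 :=
  closeNextPrimeOn_of_certify
    0x1
    1 0 15 22 31 1 _ _ 71 2044
    0x8cd8df902a4dfd721f76d82bd02c5ff46664e2c18354b9d5065d6df41e0b57c11e69cbff
    (by norm_num) (by decide +kernel)

theorem closeNextPrimeOn_31_37 : CloseNextPrimeOn 31 37 :=
  closeNextPrimeOn_of_certify
    0x1
    1 0 19 21 31 1 _ _ 117 2047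
    0x443ce09580c4d129624d7b33a58c8c1f1c12193b3f9394b293fc1df1198552148d459d6bd8e22c683afdf873ce2c8706287a30b4174a4e0c6cf7aaf0
    (by norm_num) (by decide +kernel)

theorem closeNextPrimeOn_37_45 : CloseNextPrimeOn 37 45 :=
  closeNextPrimeOn_of_certify
    0x1
    1 0 23 15 67 1 _ _ 175 8191
    0x6808c234fefdea518ca2f5e80174576577320fb76ac3692b9b9e72888c2aa7f1c36e6780d8633b061401432d8fc9d6db0eee50e299d545ea6ca343b8cd9e60160e4391b39c25b41e5f99e6db1051b70d3
    (by norm_num) (by decide +kernel)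

theorem closeNextPrimeOn_45_57 : CloseNextPrimeOn 45 57 :=
  closeNextPrimeOn_of_certify
    0x1
    2 1 5 16 127 1 _ _ 312 32767
    0xa2e515b020d4958c9b19a3aa5b9127c00a88b08a7f70098574154f2d03b25520aec2fd5da7c14beb2a2ef6571598260a7aa9a114c485652610013f6cdbbb3c04946c9f1601e27d24c7501dbcc227a3a503123d6b233a1612069906f928e8cda38bd3c4455405514de13f045adf51a9a22184200083e023e6612c1959c857c222d3bb65e21043b6204e14948a30e05fe55152e08e42
    (by norm_num) (by decide +kernel)

theorem closeNextPrimeOn_57_71 : CloseNextPrimeOn 57 71 :=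
  closeNextPrimeOn_of_certify
    0x1
    2 1 11 20 251 1 _ _ 445 2097148
    0x34c203962f3f90792dcdc1fcecbb22fda1913b425d1bd29173122af21ff73f266eae110cd977a17433006a22e4eaace0ef78f6b12bff5766217152a4b1b0caddaac3c799d774751b202df31b7b873f50602a01cee1e64126125ba43dd0d014ea61f5ade6505d2ceb8001752bc0cdb763e7400324c435164cf2185de672cd2d5895bcda412bdb2eb4b6feefc65d5536fa332c6c77f67b009f749ad1e06e301461e31af9bb9f5f70886f49a01036f346c802cec7951648a496b22caeb368707c48a70ef4a946d3b4f063f0436f028178da83011c17d4234fa20997ec4fad6062db016be08dc3a48d2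
    (by norm_num) (by decide +kernel)

theorem closeNextPrimeOn_71_87 : CloseNextPrimeOn 71 87 :=
  closeNextPrimeOn_of_certify
    0x1
    2 1 21 23 1021 1 _ _ 623 33554422
    0xb2e0ebfe5faf482c0f4372815253a35e1730582540f06b8220c47a4562e37ae3de477740764fbffafb341fa8991e3864f72eb787ec71cb0420e4e4b5f8aa7e27ba100b56b41c99a9536a31d9690c28a96ca7f476e68ca41ca8de7c82a3c5ce10aee0e8baa5a475ee754e820ad24ee13fccc3ac2e3a6312fd35620a4db938e73bb8ba47164fa82debdfd54ed7fa751ce5355541f381a24314abe9ac677e890ac86f148528e696352708a97be1e4103e35d7361ba14cb0e1ad07e185713261baf303fee959db4601e1a9ac151715306bb2bc4d7fe4174391271de97a63fa30049eb53de42155aaf34a347316c660f4bd60ab96e236d0dd3994768dc5545dedb87ae83eb8ca9c15646ca31ef482cc07e50ec356a2b5fd2a2a4eab3b3bf2e6f63b55c86b2a290403c88b25a2801e117b801a40d6043dc2f894efca0959e19fafa759b10608f38c9aa173375e58e03134ddcbad434ec773d5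
    (by norm_num) (by decide +kernel)

theorem closeNextPrimeOn_87_103 : CloseNextPrimeOn 87 103 :=
  closeNextPrimeOn_of_certify
    0x181
    2 2 3 17 2039 1 _ _ 746 89246071
    0x6c6d051207837d22e102631190499133e241e73a916fc92d23490d08e2536863f783e7020587d686f90f088cc47f88b27accc602b31186244a2a4d45639b4bcfdfd5d6aa2736113f5c12391a4898c721ee743245c1ad02701930c524e5971dd1ddb846057b69fd579259ab804c82d845daf118ad9a621125d29f834a801224f44c12d3338ef6877b526dc5e46064b5c5cf1e37a88da46a1440232cdd90b5b68a313c297951c782479f24baf91c9a43ce0111bb348e5383b37e38bd18f72e684656d5002dbc60ed546d2f12471bc24d76774d122b7b0f3af4a554d80c4cb23b783cb248090cc8679ceb01cb3b202fe5fab91e73e0e49f899b1f670402d480a1c24b4f76f30b2c3f0e810de5705f57929c34ec76bc35dbbb9611435b5aeaa8bcebd61cedfe129852027de18f91202ae45c8683549994b8bd70e38a11545250ff1c5c7d6d2c9b6514c42d83ca7fd80feb67a0f6cbbcf41d7de402fb22453a6efa4b807f1aebe3020a4cd0684d02025f1ac8d4587df1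
    (by norm_num) (by decide +kernel)

theorem closeNextPrimeOn_103_119 : CloseNextPrimeOn 103 119 :=
  closeNextPrimeOn_of_certify
    0x138d
    3 2 11 3 4093 8 _ _ 869 1757461129
    0x14762ae7808dafe671c9b194e00d0aad097a766d375435e130e1cfa281db164ebbad56f46d2a88ffd9c16698da46b16900f8c8157db642431019db7ce7aa38382be20fff216f26c746730a3d77eb03b434f7d23bfabd4b2281f6b140f7649605d00a3ca7c823786ee490b238ec8c122099c41a95f420280efb66b8988c8fb324a190de90f22275d97644c8ac995e75688c44c67db2e36e055bf56fa43a99ef3dd398be3b5fbfd9d1b6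
    (by norm_num) (by decide +kernel)

theorem closeNextPrimeOn_119_135 : CloseNextPrimeOn 119 135 :=
  closeNextPrimeOn_of_certify
    0x18aae7
    3 2 20 3 4093 8 _ _ 992 696455188
    0x36df5026c52e06e94ee88509240e026986d64b9ece6bab0e4743d054e39a970522b8043c5085594f6c81aaeb3251dc798449a281417c3498a25dd69c04c5d0776becb04c3d7b0f859b6ea4c6c6355151ccca98611adeb33735438204901b212853715564e554e8d00cfc30ec86a6ad19e91561d4ad904a0d9a665548b050c47200f10c208e1abf016a2b6bb3949c5203dc789ae64118d669e1b938bc3bd3e623936eaed45385ed1e06a036690920d59c904b01156aa847fb585524c6668903185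
    (by norm_num) (by decide +kernel)

theorem closeNextPrimeOn_135_151 : CloseNextPrimeOn 135 151 :=
  closeNextPrimeOn_of_certify
    0x2375ac1
    3 3 5 3 4093 8 _ _ 1115 3875924533
    0xc8dbdb7e9edeb3460600ca7406f699a94d0128f4bc5d454f83a6cd111a0d403d04fbe2e4117edf7357b0cccf24470edcdd38068c43c4b2d423fb10fd3f84b594d0d559de870caf3eebcf531ed91963608b8d4e286713c6e277f128e6a3756f29ab655b7791cb817a337f5a08221eb86967cd4240e9c5d6331f6c6403e16e30029433dca00235acc0a4a7f5074f9451d67f75dbc406266d7da37071a8e46f5c88767670b456405a71aac70eb440e4fd701430d1fd2caff2dfea82ca78f3e7256a0fd1da34c07d7620da407a3e8acd7d5bb6827ba7cd28424d60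
    (by norm_num) (by decide +kernel)

theorem closeNextPrimeOn_151_167 : CloseNextPrimeOn 151 167 :=
  closeNextPrimeOn_of_certify
    0x7c863b3c3
    4 3 12 3 4093 8 _ _ 1238 2207423083
    0xf86dac8b270a2a74ca9b93e9553db542a70a8c6c1c738565795c678147be7c19a97123f758817fb29ebb1c3471ad0c0450493b083263c169ca06e9ec2f3b81235b3b430a950ca8f1d190ae312ef32452e792b9ab4dcf3a0bcc0407628261b4e11097425b75842fa958bcc9035fedcfa424d85a932c356d0b545a5c333e16695282786dace0c18d094e4e1605dcbe715722ec35dc88428605c66bc34cf300bddcfc4bacb495624fc533ab302c283d519a82b27140275641f6993a07336e43b9e4997d79f5d1551a2683f6b25cc6a1c82e8650a316b410a9fc6be5bc3cc9dbc6e1739465c752859009d2a4ccd160484656904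
    (by norm_num) (by decide +kernel)

theorem closeNextPrimeOn_167_183 : CloseNextPrimeOn 167 183 :=
  closeNextPrimeOn_of_certify
    0x2e1e76d03a87
    4 3 19 4 4093 8 _ _ 1361 745023475
    0x2422a190480f19b115ace4ef147a083d44e5333d901428442305c62194b0218612f030429441baaa1b10c7745462060a0104125270014054051a9030133323e9349beda150333b4c72d13950b20590001904cda0e1460108204060a46018f57151e271df7000101fc40ec6a9816185677680014015611043b471305105045af4029504984a0061008094201383124c01a8140600ac0410850684c8f05d9e0832c6a9034528a508332b32d269d44f950a78203c43c0c62e4d39a0a62790050f8e489328ca419742b99f35941074045180da89c905e9d6d12c3c54d1114620815487c0f6c4a8a11753f00c035460b4112f1bc3af57b5c100681309cdc80d3dd3d09d204c2b09d914413f0d71e661c456458230985b0c01066251c07d50a50584924ade7adcdc0824e204a15203e596ca01804c181518740400ea1805b5cec9b64521004f5453b8bb46007a4a90ab94152e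
    (by norm_num) (by decide +kernel)

theorem closeNextPrimeOn_183_199 : CloseNextPrimeOn 183 199 :=
  closeNextPrimeOn_of_certify
    0x7bf1df4f9d4ad
    4 4 3 4 4093 8 _ _ 1484 4435488643
    0x4286b091811989f0814575894d37048544b3d8429f0612675200643185478d0530835a6a30550f242001808c503904fca65549e8083d6185c96d98d191103dd31c80f025c107260d540f148de4ac292810437354fd736fb254a4ccc120cb10e2cb9fd7c51cd352279ea6a155435bc7e6004227201ca239b0d17660a5a840aca60544168144550c951ea003a86468939d172c6f168256e1c8d650ae0902ee42fe0002011352b1340021442aef44041d4802a2bc7d985a25942800dc1113052fdde3d50c051905d534dc84e447d8240041334827222cdf888463204621554ef2511c6430c2de7e536049c3114ec910856875d620e872395f045ff6022ebd0d1f81b2030480150689b0484279c10cc2a684b362c704481030a8c27824a1c7b9c31e705c726b474158cb180890b0b840c6784b146201810c8a598ec49034259944a0628099a90bce05d500085bbf1041865271184c943b41e52180eec751ec42720a9d9199104c0d020444d8030b5b6ed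
    (by norm_num) (by decide +kernel)

theorem closeNextPrimeOn_199_215 : CloseNextPrimeOn 199 215 :=
  closeNextPrimeOn_of_certify
    0x4b60a87ebaf86f5f
    4 4 11 4 4093 8 _ _ 1607 455835040
    0x1c3d024fd02d375e273ce4772395c3e04d87ccb690816e02026549b108653ff71101045c1dc19c4d91900fe2884c55c580f651ab861f8f132d402708a0bba4d7938a440e066f1198b3fc08c0758b015551d953b05304e341b549f44a9dca22d755076c0e82afe0c049f4849d49c41b078b14341d4d300d4465d65578354614d8b8c29040447b5c47600750a491010092f06624a0dd4933331979d50dd051bf4e1235794148796155e61040636af2b820918ca000b9e80264964b150e59038e971493c3c1925e519c14411e90540ccf6880972699051d60ca8d99e90a37b6002f13a10eae47d7b275b296b2530992cf88081b2986c0459dc46144052b413d5fd12f54bb03e64c9556c9f274474472d83b58142334171119208c205753719fb4fc53380512e8de130258157726107339593c550d22639ee22a4e4c454506807efe753901b219488b90128dbb172c454b6021586c04c800f81c0628499988c2803924c505bea8780cd002d1eb2d8c96561c24cb8d2fc6d103d4b38913126605c04151fa12015481b2083cc34010746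
    (by norm_num) (by decide +kernel)

theorem closeNextPrimeOn_215_231 : CloseNextPrimeOn 215 231 :=
  closeNextPrimeOn_of_certify
    0x115f46d5351741aae5
    5 4 20 7 4093 4 _ _ 1730 988930258
    0x9c3dad448e4c31b3d6f5fda6394afc41ae139e120093dad854bbb730b9c59a496c694bff7f34f288a8497f2d04084579cb23f4bedac7ff56544618095ddf3701ede4418e0ef9e3796a52767440c83a54a01c636c459139a3757604d7f15a84c9c60fcd7c0eeec41ba10b694b42f03366b0f7e0bf4bf0c202717e96eb91a63833b05216f77cbe1173f6b1d8acae19eec8a44057ceffcb16bd93eddb47bf6cd723b082e99150e8e892340de2529d61b83387ea8f296cc2767160d7e90e6f62cd9d1b418d6826ac78970936d8e1947982d78f09125622cbe2806a2c81e54301a52d98a5bd57bdb093c6433bb1cf9f588f9f4960486ff382a557355c74a33bff29594e066c762914cf6d2e5985aa6042bb7814084d0bad3ea633f1fe054e17ea2b1b46b9b41396b61155bae209126ff0120b122434e33eff1433c452d5645bfee048d6415af614852008d9dc3013fb03b5184ea56c39f403153e7b4d6887ac7f4a3ec19d79e273ad5e7aaf809125fa953f1e967b84f7c878d8777437f9913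d50c4e6d3c6cff16ae798b541bd3ca6fa70ad3ec3576105869607a5b14db43ecab0e1a8ba77e3ed3937653c191f1fdc27458b6650105d34a83a31e65678b8d2ce4d67f1836b3bb988c9e22e8fcf1bd70ba1e56e0f7ddbf64528b7185217baac7b624d0f14490c2321be14b19a507af006cad09fdb130cde59c758b62d0667c4b2ca9d0dff3723efd9b3151010c588c77414b8db9b35578d21da1b490d0e86a46e0936d44d13be70671e2e6b96203cf9cfe27f2db50a75ad131a2998df3d48846fb95c481925761c67bb9bea83c6ea028ed0307d5504170724e657b2d
    (by norm_num) (by decide +kernel)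

theorem closeNextPrimeOn_231_247 : CloseNextPrimeOn 231 247 :=
  closeNextPrimeOn_of_certify
    0x423b3e0cda68aa5b891
    5 5 4 7 4093 4 _ _ 1853 4150264708
    0x16a943f656d51104219887e30897449f87c4eceb8414e6fd7935f0ca4149a2bcd83020c5f448cc9c4704da342dfa747d1a569ec1ae7ec13f56f0831f74c629ea7979a1382da1ccda3b603fbd7535427d265a44c6f892544f02e835560bbdd97a9f54b4152b2850f06a5593203fe5ed68d891ab7d398765c37f264fe4b2d48d84ed5ae264673da2adee28484d78e88a4c595ebef96fcfaac9561ec3796bffb303dff6c521c1e7467c723644632a3333ebb77845d06278f36bbfc9421c915311d1b0e3442350304a1b51dd059647ec3ff6aefebbd9a6f4ee24aa02847f4c5c73054a54bbaf02a76fee37ed297332eee017a38f18a365c03bb5194f920f4fb32cd84cadfb9714c60378b5c78255d9e8b55eb69360b8bce3b00f1c57883346d0a14cb0264418189bbac3e51836eabbe1d6d33d07142bf561c3b742284f8f5a77eeb9bd65a0174986b596b0ebe02b07eb96d6b6ac6addfc98c9e878b58bbeb5f81edca403929ad86c5a45637bc3feebb9912761de0c0feaf34b2c4d862a1e48dcf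d2062a23b9bd97e9f95943d9aa5040cf92746d35c722299578c5eccfc3fdc5ff604fb9e367416e26bce6021889a87b325dd9d3d49fa868a734c1e025cb5bbcac14c10248c9342f5bec824660228eb7abd23a9117d3cef41d79d975c46ccc84aab3b412563e518d9113424cd1acf2806087f24f8355fff29419dfb83f23b2d862a082316dcdc9d9c44917ec103eaf8e491be3ab211581c8810907c7cb60c49422692ba2bcb3b1304cea873f94bb036df04bbcecc4d54b8d13eee3e04266a2ea661417c624f095d5ddeca605b59f8a79baca2e74a262d489958fffaeacef89f19d3dcfaf90e98576c47df1439922b55cffbbcd4f8f0a1700bac82727d48946d099abedb4bf643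
    (by norm_num) (by decide +kernel)

theorem closeNextPrimeOn_247_263 : CloseNextPrimeOn 247 263 :=
  closeNextPrimeOn_of_certify
    0x4ceb6d804d67ae596e9e65
    5 5 11 7 4093 4 _ _ 1976 446696548
    0x15334795a8f47423a5d105fbadb4998e8e1111337cf87493800094e482386f7d2e549eded188ac814dac769d8d5e184ca0ec6f93328e9e57cd910d41d815bfe49e74efe4b1e8eb6118e44c18be797e788e93956002d79fdf3d6acd4cc5ce7d70b908d35e0973a1bad1c3f7e16801b82a24d6e7569ebde8979afcd0dfb0a585b77e12adfe3c11442c4b4c5c1b9cf1a52d08e1675c732bdaa6ac4b721714a4af7ab659381be92b04703559e7b9bf7aaca1a9d8eca34485db771f87b2eac636bf9b9fa37346fe5fee34e2c0babd63022a52e5aeec96acec1e8b419a4eb5cb71d01e12e42460626c54126dca8972471a0f77c7f3ed8d7d46e915a05364655af2789322f818bb1fdb8bcd998ba528eeac0d261c7ff954b276207e7628e30bb767837b5f3a104dc91cdc00fddcafb5cf97d15fb8ac5968acba6b29ffb8bc331de3345d326750c762712d161d1de553299ba9857d717eb5127101fff9d0cfbabecb08bc3bffb74e6ec5250f07adc4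89b385bf40ac50724ad17a2395606da744a893a0a6d926683e5d66868929087c0c9ff3474d7309d357010c7d64db5e355bb9b77272d1eaf4fed8a7c40aceeccd878face933d4cdf7bee6e0bad4c080e5fc501aa0f69941ddf4ef14449c6933e71c0ea0a75aa340ca24a9a4c378f4867055feba87951ed55baf41bb25818d7b5442237456da9c6833786dcf557aea98492cde5f6ba977120220d4aef71cc5900c3570cce77aa4b6bfc2ec3f759096bac937acfd1405b74db1544aff6709183a47f53fc9de2fc63ec7134463089f4c722883a34d0731aa76ad7107ad97059219da2c51357b48eb1cb2f46246110cde25dd184efa81820309551cf398ecf606ac713b9cdc03d51dc6dee3a78e1d6353e98dd19b34ac70810bd2bb064e41b128cfe60ebf8f8cb69f6e06f437172e8495e0605c448a45ccfede0a3797566c43e932fef817fb33c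
    (by norm_num) (by decide +kernel)

theorem closeNextPrimeOn_263_279 : CloseNextPrimeOn 263 279 :=
  closeNextPrimeOn_of_certify
    0x15ef2239961290b7808b2acd
    6 5 19 8 4093 4 _ _ 2099 1566497503
    0x2e4f6766a84f4dbb576c9401ed85592c906142a99b24988114e7a0505b055bc6b71c6914e3017e549159c6c974224f3021995be708e848272d802120037d380662602122a44d9a37c2c980d45a39b1c3d710418f2c685e692371d610fbe97ad41b1b1dd9539af70528545feba023b00e8d3392e3dc59e848c3aa449ee1545ceeea36af0c3a754812d47c7c6648e69c412b67cee00003841c75521da52a9d92bff3e42f0a43b1dd6c53004eece1c7d22f5f27e8103c980480b8e17a92bc0a1e8eb42d25def7c241bc71af8657ff0ac21a05d9b209e0d930536c0981d406e833ea2ec5de801b8da7578af197118ba06714f48ea9111d2d1c8b63a46506b2a79867703bcc1a00b1ebb5f22ea2906c4809ac340cbfb5eadbc05cae51810faba15db3be02b84c5d15eb0a46a519c5051985540852c06130ed19f61291e6e98200285585241f214362a823fc5633e80f81c6e795c85e855bedd7bd24171e1419395c5e3319388690368e0297f1bbba33668d49c4257291e074a188af1a178bf7a396d8e5da9a80fa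71c745edb3c2148af0978ab382723a3d56f06d37827cd50229bde373e16b5b70bb631660873d1a8e060fb8c5b1e622d18ba2c4ddc2a89e52263e65a659917d15be10f244cac91815432897096b181c152db506ab42f0adb267b70ddc73e28a11b662d225261f85b2616c251d0d5e9b45754530d56b77cb150cc8d8871cd7064feddfe15b28612a0b064a6ea8aa30034d7979c8c9a053ded4d6395edbcc81a6aa41242ba39a1c924784dbcc1a158c1cf081b017eaaddc50fb70a3aebfa12dcca5703831a10f083b5be1c89907e475a709c1a1a536ecd5b45e1562fa6b8043b1489e96e7886192904872290407eb0aa40c203fe2e360c7cab09084ee4ec40d3cefb7c128e0b532b984ec0199d422411d50023ade1764ef65527c8e64a42cf98caa0435a12cbc7a51079300911f3ad14bef172d8b38ed0f2a53d65114280b78584a7ce61053cb5da2121256b06c7e06064a53150812e82856d0e0c59cc04dca78266617278a1810669879325ad20112ebff18996c4ee49a0ae278b57dd80764766092c190f0b10160d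
    (by norm_num) (by decide +kernel)

theorem closeNextPrimeOn_279_295 : CloseNextPrimeOn 279 295 :=
  closeNextPrimeOn_of_certify
    0x6c4cb8fc54fbaa8a0aaf23543
    6 6 3 8 4093 4 _ _ 2222 5076245134
    0x6fd82d3c2e0c0c9d2d08697ecae10115fbf0e625d8ea183bd681b540b17083c0bf794b6112af66c9965f6eb30c1e9e459ea222bbd6e39b38297251a8b7164c137cc15e8ac33575d6b37af0ac8940b66716c7540ece3c2002af3cb05cd02feeeb84ce00101fb302bcfbeb1eb17b8361e5b8790d8295c435319c880d838104314a58363d2d81bf44d215da6e7bb0fc33f6407055d07018af2c9448a169f5efb6f60931c48918887118d70eeb76d2e38710c299e5c0e4630f4318d5587e8eb64cbb30d887456996cc699b65839b5a485528a766ad96b4450abe5b29901bf91ce5e9b8514013e825673acc1c8d49ec085f6a5f29950a04fcacef351a2c13eb1ce8950bbe5289d776780bc132241f079b272815b383390a4009db24803c055641a012a01772155e5db7018c818ea028e3b01672162a0d9c42e2a28f96cd4034860a109d5fd644ae96cfcd3891ba832ac5410528851f161ea199a1117c91c608d313a0265a73c11260b031b0222c34c36afb689b3caacd0b9aba61565a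1bdd5ba45c8dd229ab8fd194c8c1c40eb48db58384cec67074508ebc8bfa6cef148c076a33760cf21197268e6a2a0f9d6874d6702c6b4d18d6ea50e83cb971b6031d41d0952b680896802b7bddab8cc0b62a0c02810c44ac643ea510485b5467334003e5316d3390aa07e856dbd6b02c1bb325d7e54d420d6a7610717073d4b7c97788518197805dbf8cdcebaa37762fabc304f0e3e29083ff7c455519cbbda1143745ba7c079c5366d813007b81681901d8cf80c58023baa420962cc0ac80d697e451015d71de6508032411dcb4cc3fa2e1a26e3367940c7af008171a44d0c8c2e850899d29e2d8121207161e2d1296b7dde2b390560e6b2a32e49b10804311cbf041b295a27f787e8031d53be9f54226f1f251db2216d310648591ff09011e88fb5cc9928b46c0364750cd814e478eda5e0b3230823a4bdd023c218d8d5c7312610262137d836d7954c778e66f6b9662fb5b00b65d8e28307240968944bb85ec38366eeb34df80188e01b781ce20b4102c104e597b3d690c4375b644e50249e08873f9476715ad372f1e987094b523d10b60265a8db43d3c8b90bd89a264d9f3c4ea7f1d4ad23dd05766974e479eea70ed9206f31bc96cffbb1f71b0d9ac223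
    (by norm_num) (by decide +kernel)

theorem closeNextPrimeOn_295_311 : CloseNextPrimeOn 295 311 :=
  closeNextPrimeOn_of_certify
    0x231cdff9cf8d984ac176c8744b9
    6 6 12 8 4093 4 _ _ 2345 7828426234
    0xcdf43c90195e17f34695420a28023f972b4ea465a9e8e6f89bec17d39287034be85379bdac3af615b2c362d0be480537be3e757a0351bb2ade5e26c2f6203eb45caccd9016051422b06930200410a74a103930d3668396d2201f725481b991c003273f86d460fed0429c0ebd63621ff0275ea748622ca662c8fe5539625e70cf4112b2bb1320b5e4d58e93cbf3da075f968447276a478a2c02b37caf0911066bb111167caa57941d9994230f15f7d58f88b7956bafa5f28a0a2633f4c257f0d8cc1e351480dd25f1c6bba80c1aea223021f207052a03e878075ca86a627651ba370d1a034f74a253125aa4869554fcb01d3a4e7bee16ccaf7652537457e020d723d50138a91069092aa5080a341fc0a59d7c4800cc03c2a53987acd2d089e4863115d50471250a8590c031d26a24ad10ce90341adee4996d165f006acfdce395ab73f1a747bc8d5da91302e24f740537c1d1a204a227614d885ab0e7be3b8a18797c6a7cfd7542104b49f292aaca3166733f4b56e43e776f041804844b2025a8f23423b4f35599d00dd57d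c03f63e2c84f3e465af03d3f6f85a8bec8e38de48a5185866d89fb5885e2ed75ded13eaa4d9d0b112efc9273b601cc24aced56430110036a401e0346750f7c6ba885057a8b012325dd27a132d2d22544a66c04a8175991f4c122adb919a0b95e188e66af1bee92f8c34afcad35df8ab39b001ef06892a0817ed740df3b30b221e1341e6ab863bf874a59d32f0c191d48b69a3a03a162de10240ab9b12349e53131fd4dbd3e7889b267ca08853783545b38b634f4f26a25ccb44dc1a17125dca2d79d9d0281b233ec228feb7cb40850ee268d4754b3370bf42d06ee7c66a680526f2537f4248e8b264be12241152d5a67ec99f83b1e0606370f68cc0f02203bba004ed819221c27118570a341228bb173dd21e66516bbea2e89f3825397358cb83b2ad94ed88c43d06c31dffd8db9ff2834876406890b589bcad3322847c11af74fad4b6edd1399ec38e31169ce4edf5bf282b76fdb374ae72de9f250a6bbb5b81df9f01913c251c6a948c62c5f33800a00d4356e76095d784ca389a1c1be7da853a9237f15af3b6391af902fefd9488626ad5af0716a17f524581087c00a9d49197e73900eca047fcbab60b9ae760398b07e24391daec44fc6c47fc08bcd6fa4c9a0aa6dc4ece6dceae3daec2b66e6864bd1ad0925c93102a9c3398bb0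2
    (by norm_num) (by decide +kernel)

theorem closeNextPrimeOn_311_327 : CloseNextPrimeOn 311 327 :=
  closeNextPrimeOn_of_certify
    0x4a018bd0f483df4b0f61eadd9c82b1
    7 6 19 8 4093 4 _ _ 2468 464282890
    0x11f9ceba6a278a7b3050760cc991caa66c42e3768937e89168110db05762825bbbb5ebfd8f6593175f582e0a8926ab8048a81582ca4a6d0934560ea18624489eb5a7fc9d60fb9b37d38f762b41ba284e1a6490d04077d8be5617039f2e4f4f56eaada8ce7682aa293183223daa13cf9b1a4188549e93d1bebedf90e03534d38c0fb233475cfb03cd58f6d417c95bc75f5d3ce34c336e3d7cfed51084470d383e7b081e8d94115fdbe23305c681ed081066f4ade2cb41aa2bb46a43994e0935323ea4d0d4b82f42d6a6df3b618b4fb482976234f1c1dbcc3b87a20dcab4c3f71a651780428972753f49c8cdee6fdb28b06d6166246eaee08dce414dda6a13b49f159af0f174c474e698b6a804283f610a155800e79cb92419f59ef71a4ae7a5c0d03b8d2c084770380317ff2e1de5eac70896b4e901da6cb13dc63fe4aaeb833d0b450b675924af10b51106e3e99920ac118f8d9970a5295a7ab8e0f25ad6e605df423006305703ebb4a2877d3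fddf23479dc92f22bd9f0c60538e350f16c11baa5d839b5fed56ad96e806d4ef3eeff5738dfcb1ba720731a18060760cad21583e03814553fc8356363f0c608851d9b514835ada041982148d1d95db694d4a2188ae0cb70a23441f8b2b5b6eb7f42b63127949b2267227cad948eb9c05bdb8e49f66cc20a66f4c04f115d9cfa0827d18a6187933e0162824cb3078007ca010abdfd2b6bed07f24b800618f7e8f61b6bd83ad9a54bcd343f9c03b291404b4bf2c54df54b20396938cc4dc9a873425a5c7cbc58566881355b666060ceb8046a691be01d037a2a86e9bb4e78482ff790e3c65e8a366b6395dd5aadb79aec4da082bfa5e46c01848bd910041a1058d1b6d99fd729342a7036ff88881151af07a0e6a78f55246d976416e727c1b14160d23e9dff48e4d3e34503b92c04fd89d92b44c5ba5f91d9a92cb40088c2e0e4fd33df18c79415ff73bf3f0874bdea597c1088059ad684539fe102e98f84717462b1d3ad26a2e38ae9e3136d59e03a5304fa8983fad47a2826b9db1d68b555e4bd092afde6af1b977d2faa5b3115fa54167d1ed6abb5f68cbce02206ced60deae2dc3f301ba9d16996072e8b9134f313d675c667f41690a9f671368b5818e680883eef1c292db1b4101caeee52ca24d948a4eec7690bb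9f16932a34964a89a0717dcc20c8c54eac0627e5b9808377a8555484373296f339dc82409ce917e6ddacefe6c44e8115bcd1f07ccbb45c5ea57b8be270f2329564ae826310099d1a2e00931b4ae22b49e8fb3c089
    (by norm_num) (by decide +kernel)

theorem closeNextPrimeOn_327_343 : CloseNextPrimeOn 327 343 :=
  closeNextPrimeOn_of_certify
    0x1d329c29707807189d11a1a96ebf8fd5
    7 7 4 9 4093 4 _ _ 2591 588398116
    0x65a2abfd79261295e5e559517f1425a85911e15a7f37132df09eb8288e0c61188ccd45571d2f75375ab97736bcf74df27f26bb24c9179d0e37552fedee763d19ea2e2e68231823e9568e777028c625e41b5be8cdba80fb56a82d03005a40354be09c6a902adbef66d7dcd7c71c5e3e580d12aaa2dce374ed13b7c1b67747697c8a3d3cab1039f67b774f0cb74cea10a1b495840a3496dcad32a26c97da12f701b9e1b8d9aafb6f35eab2f1231887266f976e578781f0e3e1d2535bd5c15616c362b8371bb954144c4103955ed5a06b9333b9a3dd8725930ad575a8cf5af457fc76e90d08c01fe269d6134c94f83d1ba619f584ad186bca29d7b9eedec4f4b581ecce9845b68123839a70400642bd572291e8264ad002fb0929280932e15de885585fb4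2b3e3007a9eb5c95a2b6afb869384a6d2d30a956713c2817b8b4682c509e9298b273d6287322a9e9f1c7518a8e5d81aefde6a237fcb7ef0b66fec2f4672c085f3e2b22e3498581901f5be6a4edde3709fac59a7b091b0b97beade7acfbb325a668168346e2dbe08e330045d0cfb6628607ba84ea1e8b118e89c2df520744e75f1ca02b9e013bf9e741c56a3324b7de301d85d560b42c8b48bb43a92768b42eb61239f1f8acf45a43fc5a43235e1eca15508f12240a40b1517086e5044f96c8c3d85ba7b788b891814e3425e7fb30c6d83b4ce8a2c4bee9fce17fbbe4d78c7f5dbd2ca7fbd75869b091b65ea03fda5dca05b26ae3bb3d140e68bf0d2036c844943813df75ee71ca4105006eef8cd65aca4d9f3220b1d3d51d5acfd02109061ec4ea03635a34a74e32dccddf5b1fa0e24da019ddcee365b5bad86f373398118f6d960066a8a8ac89e605977b63f9228ad486923a96ced1c7b177e9c75932607cb136eb3b8b815177db1ed3041188400760d3c3bee69449d5e5ff6dc0310e564b0b0f9e3889b8cc4f8696c5fa3e588fd0e337a489bc21bd3b2f40e1af82c24d1b97c43fbb2242a562dbf137bf283dc0bc796086eba164c1f4234dff9ec482e0edcf9119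47e6d95be8e0b2731b5696fd6462c32614b1f1882f7ce298f2666b6aa9cf51fd6add062dd9b43f7a81ff47c8d012d9e892be93069e4b657ded3864fbb20aec5daebf07b534d2d9d6fd706d61ec4cfa8255b7ab81e6634b380dd86fc9be74a7db669e8841aafb3ea3f10c5f58d454844c8209fac3d12fb552b4b0f4c8a9952b071f075461316725cc2cc6e562caefefdd315a64df0cbfa21f5743619f982b0c35ed58f4a486f417157e3ed99d2eb1ede8a35b7b3b0e821210ea88d899de7eb22302bd865e9a1485006e92a9bfb4561d381ce447cd4a4c139777d94db1bcd4378c008075a4e12978c29a186ed0d0545589e873eddb8f1b072b6fcece56655733b1b2d637339edba461abef0dc2541c49257c3789cc6723f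
    (by norm_num) (by decide +kernel)

theorem closeNextPrimeOn_343_359 : CloseNextPrimeOn 343 359 :=
  closeNextPrimeOn_of_certify
    0xbbf5cd4ac404adae732180b2b8f12deb3
    7 7 12 9 4093 4 _ _ 2714 1462426390
    0x1bf64dc55ee6478004e64cf4d6d58bc6b1f147cc863e56701050478bf6a918fddc46942e9a8f13128c8e94e6eb03471199d7dfa68932d1c35d05e13081f378826b7f444724c723a7f76aa6cb46e71f58bf96edfb481a38f23df50d30cbef4e563c58f3da8bfb47a85c71cff583918c30cada16227272cc73a4a60c81c5ec59236b2a3bb27de5c8cf5dd5307b718c1d02bc9ef0dca9e61cf46bd7d64c8b858e2d3b92344010eab9858cb3ee35c72d84b820cb6a5f46a25255cf3033157b095bbe32ad5cc338078fede7e5089e46ff5109108962707e85a742522bffffdaa327fe67363d130bfbd90e7fd1788336264f068c9a7f078192db09c97048841d6341d911939a61a18b3c16337763aa8952449550fe0e8f2c80b8e0542f55f06e2152f60b9269023238f3ecdaa6c08ff43d124c16e034de6a0f3f74a6bb46321129294e1d06f85a56b5c32cf8a61d5343f10edd8910b3eb8081464c82a7d145a19ce727dda4869d91a406f08c654f6998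42d383af83aa2fd9e7680c5737bab7dfcba6c7524e327b3280c5985a905f247b0ddd7b5daaaa3fea63b9e4a41bbf599dd614dd8b44124172bdbbf4d08d6bf95defa01cab8593158c23d9edd5eb44293d4eb805fe368680757d5742e345af5dfdfce19c0607691a21a413a0da4db5422f0b8f5ba3c921be1ce5e34d93dbce97486b021bacebec38353f6a214cde7369d55c3d94f75a7001b795ff4c834ed37a45c9863e634c4991a7859c001d868145a1988112d71fc0b4f5ee1c3d4d3a3ecacf7ef533e381e9d28f7433de0e4dd7a90cab327bf06b61e483553ee2516d0f81dd9386e7770b9984c1a2336fdd8a52caea47f6862978ea7ab80b5d7f821e94daadc8641325d7af01ef035ff5f73ec614dcccb849764914583cae4079f10a313bfa24851bf2d4476636ad7f6b6e433aa18004258d402445e6fd18fc0e97d8eb69d924613df01d7ca45a7a8e11b48e8fb5d5eb504f61ba2bace6137733ca1670436100580a56e26232799837c10fa10e1f770edfbc6245587e553724cc5c1ce77fe683f064c8aaa0f4ae173816cb51050eae83064d54ed85afdd8933e0231870af32ab4a5d9f56bedd32bed3e19e79e3ebedce3642a90a2ec0789ec938cbfcdf10d5e37dc37b37d29a0997018189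fdbf1a3efcc561e044eee71e7192f8c526e9afa9fa135d08e5385fbd117193b6d8196119a684df5c8ca54c370a3af3be8254e8db568832a59486e5d5da20c4a9732f1965a8b4902bed362eb4c2a855868d1b5202c880276beae942caacaada259944228f39130f09582cef5ed60181e107fd9adb1d95564d500fc8737fd9b0556dac943eb76903c6ec58216c47e0144e6e9b4b00b43989f2cabcf969a1e51324121408fa450d2994db5e7bdce6231d7ae3201d2e670309ab011b4fbb183eea15ff18aa545699aa9f1d9f2543f0ec11402052368121163266b3adc4804f51e6550ba7c6a7ee2f186072690235b3392624eff8207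
    (by norm_num) (by decide +kernel)

theorem closeNextPrimeOn_359_375 : CloseNextPrimeOn 359 375 :=
  closeNextPrimeOn_of_certify
    0x4e8fbcce3fedf497ea1f00cab34cce314d1
    7 7 19 9 4093 4 _ _ 2837 6997778683
    0x1dedd93cf59522ff595861a1cf6009da622b7f8eaedda3f824f4d2f47f9d7205b5007d11904ceafc6ae8897498be81a531e592e97f429b322187c77a6d9ff69f515f7794485861761037d26a468dcd7a97401e1660ab15cea64f9d23759571d2940e43843b5925d8ccb0668761d275f3d35922380656c0d079e8b714f0ae11985c44f63f200bbd8e1e5f69e5b21b9409d84608159cb04e437dd5ba571025207f86da3db41f432d4127a2e782a9eedf95fbf11cca459a64b50f64d7f0e573fcea36613da820c03bb13d8e43e73ad757103b42b2027ca970284eb71e4f452642dc16bc8e4ebfe5347a289b924cbd0b1f90953f5e5697587ee1f4176dc4f03b11b35476f96ed1a9da9be30ca2cab9fdc57e51f9c7ba4781385da2db95e48a7b9ef1b8773ed5695bc2c9d3cc57991ce7ef4688cb7fc12e931cc72f171ef069c940682e5fc947e9bccf8eba15a23a3fe893c4addb599e28ec2f09fc0e174b69f2388f0543b0a7af42a4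a1b2d58198bc0186018d75c7ff4771f0f755283da6d61cc473e048ab8f1beb330f21ab70f28f1efddb8bb3c9fa336c93acb81f5fd52b412f7b99e0264da5867988db469338911c6ff1abe4b82fe62a844663f890ff503350260ca1c76bf8cb5bcb7df5fd588644dfb190bafb4e98fd4c4b52d282c6cff405349d00e427da9e8c37bf32afa63af0d5419fbeb7e691308e316852babd3399a13125d41b1d880c061767406246ef5820c9d60ca3042d62d1948f76b86c3489d06240501247ae0499916f8981cfd2944c94bec987964f4526704f7631d7e711df0d9ae860c603a84730c2c5f53e6c7d34095cc99c9c3c4aa5552c7c755df202b5787b3284d7f4bb56ce7bda3c222ecf53150e78e59118e828e648fbf1c0485af0dd438bee1a37c7f152710c800870a469337832d7c85733975b3d02dbd3c2230d8fe4298e171505e7d1cd50ea55aca4aaed88c9a90b22278dd4fd5a0690ac9ecc7749a0ea8248096e6027017e8b791526ac793ebe2ddd6f6bd33ca1feef97684e00d4d4c8653b05a90731ec1244a13f86184941ba2db1371ca774d3ee76fc410c6bf7ecc96f5445e7a97da6ede17fa1091107d71c3439c026c3f16d7b55e275f7c667ef44b513782654c9607dab01b220312a67295ff4cc95efe31b5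4eb903aa94f0638053f0618742a7976e0847e9eae1e2b36eaf9831cabd80da48429410e85e96904e2f9192b07118eff60e6b5fd2f5a2ba22b0be0b690303e06bd4e71ac8e92e465ab9e8a6a8e899267b49c1371f15b5661bff5725298428a2e024d1ee8ca6b50f2705cde9ef0f12c1b983248e5a9cbd8e1ee163acdc17de84a46c4c38c35006589caca197c7fc3d98fa305cb37f0dbe4ceb38e18aaa3d596b6e4c6872e675e6e9b6faf4ee8ba31e7455b3f01175020c8de9955d5288f7ac4ad47d9307d7bb15c95167f0835037c4c187d9a55f9f6b4c8039fc6c5e2f301db1a681fa5189c6b7137cc560906d78eef01b327b3e42c55ae285d6fca4ddd37f9892d26517d8c5531049e1b932086c666dac8233c5efdb1b6a17176a4bf1fa633d103e7a4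
    (by norm_num) (by decide +kernel)

theorem closeNextPrimeOn_375_391 : CloseNextPrimeOn 375 391 :=
  closeNextPrimeOn_of_certify
    0x21733363d1385124aeaf33564e57b3cafdcfd
    8 8 3 10 4093 4 _ _ 2960 16435149961
    0x1e52be9f17e4acd27ea82cc66e0adae89a5b2917f704c8e912ad8b267951b4de5c3f9ebd48b5fb05e2d39e2a7784b29493e0aa96b3b2d9ef792834c02ef6116814c0a61970dfa25db33c62286c679d39ce4205bfa1c5551dea70e5badbca1272e1f24e0cf370210faf462a136da048eae51be08ead2a3793ab47ecc3f48ed99f02559a59d0a4e491fac4340aef956269ba521985375f07cc3fab9532961796efe8a6c93f592e57fc4d10d02d3345a6c62702e5e5c166b1d4509a2c6b6e2e91c6d794cbe066597a4318273f187104a95d95f2e882f3c65d85fc745bd0ed6e645c3c5063ccdfc2d3e643d5b92bb193593e759f2e326ab60e7254abd8a33de9c0fc8d8bef2000cae6aaa59235b1c5982e9673f80f0b9b95d1424164e8708fa2563f98342cedebb8802982dbff16f335cba1f0a557ef81214fa254930896f951a3757d35694470c648cbd1611a1879a66e683a492d25b8f1f40450a101f165bd9089d0758fb293034936d38c137d5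653e467368196b696fc40bcf8259e425c402e8930a6a59f2b29658ed2499244380afebfe1e2903aa9c1b5ba6e5800ee5caa3fc6b694ed4641ce2378266928b4526f60a324350ed22398b114fda829cc0fff3c0d1ccc30461cac68df8b1f8219ed7949c10d59c8050606595d0fca1d1c9ff0c51aee2e81c1bf5a8e1a86a3e7f971e24130261bc5b323b484aa3749bb125bb4e80218c92c2a1d003520013ae1097c41bc8a3f63f8f41a8b8b8ab6b33b9dbd14501a2eb4e30d0089ade239588e7944558ebdb6d68ea9854fb1bd67476a99547995a40e170b12a67c660c2364f6d84b7607609e3ed434a53298fca64557bb58e61789c9d21251d9776975189312b41ea94b5295ae02f4a79ba027159590d0c92418eb55acf2f53076c28aae41cfa8ce13882c01cbfcd8b681e130f78efc495397516c2c128873e59fa55d45a9b5dfa17925a83da17a2f74ab1012b02d2af138c99588885648cae22c94a0d44c84ceb036b3451962274f9dbc9fa1a5a08a2c5e3d2cb82a37f4669fb0ab983fc13a2121df1ce6427f469c2f90e55590953d402ee90a7750bd34a37b3b1f92cc5ee5c8ee9ce1d50ced722ac469373808f1113d9a66dd573dec86184bec72863adbe76e22be9f17d9bfcf0580ed97c8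65e2c10692b142cb201168c1c4872cda40879ca7343d0a528dec2c91a7ad40e35d2037bec66fbcf0261dba47277ad12634912729a3f6f104c57558774be7b81d8a3bb93fa76e562a3a3ed983746b70477406d217830e7f1d95088b666813a63a13fdd95bebca9fbd7b08e61d74e858b02d51c436128dce5afbcb18a7d170c7b720d262fbdb5753c4de5f3c058cf5ff768afd82668732fa7ddf631c5c2c897517744c941b79d179b7375cb2010bb8417b77563c8e1d584e91197e24a3862a5929bc08a0941cba190f797dd171473a525964a2ad56909f9dac3f95a415f2ffcfeb641285e73a0a7a58b1903901308ae29b5cf4ca4d6358721908c78a58301b4edb6079df5e82dc43cd0905fbb546168a933c439f927827d50e956e73b0283e7a1e8c953514fb1b29dc46134271712f0734808843c100927460586ffb894b8e35092b7ba52066ba529ba7079743f3d614cf4e442ef89721e81e0a969e0c8ee03eb25ed448ac0014bc14b5013be1002cd072e0313f8eb91881e532b8a3dbbe39ffce121232177a36b86f896ee195e446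
    (by norm_num) (by decide +kernel)

theorem closeNextPrimeOn_391_407 : CloseNextPrimeOn 391 407 :=
  closeNextPrimeOn_of_certify
    0xec3d9af0f59dbd1311b55a91894b65c9a08bad
    8 8 12 10 4093 4 _ _ 3083 18616807036
    0x1a2fb1838481a61004b846bd641d8ac0cff2cbadb154aee654e9266edede513020cda28be3bfd8f65860133cc7e71b03cc286991d5b95d8c963841f52c4f85943630ef6a8ba28c53892545f949252f2ce16d54af6eed2fa98489746c4d2e3f9067e0108922deead3f57f47397ccc42dc996bb5d874f9dc5ce5fc578c00cb076a2d2b08c52f5920959c1f42565338157b297ab39780ae018537fb1bba68e84894c31d13d47e659e646e69524545f2f5178ce589e86e09051bacd2e76c13665a7dca3611bc9a3e1d1780976a2f933933ad2631663d2e1405ca943560dab4c5558efdeaf5a54a49089cab0390f2cad8b3ef60ff515192cce96053fdd4b2fa50fb300cd0264c9a070e3cda6152560ed691c4097d7e571ad7f6cc1b9780d8062c2437d50fd62e68264afe7cb6a3d2dc216066b6c95be09b570341c28133cd4806096837ae4a5b8792a760858f72a9c39cede0a675ad7f87ef29dad0d43116c6e6b72c2f5089d6c3be9ec9792377c2f0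c52f478a67be5189428d8604b43221930d904c4eb2119ed55f6e34c04952e1d64e00d7ea44b6ab26b72cc1e4a64ae683ae8bbf6a5f4b49472133a86e155310957aabf9b2b798aff038259e0d28ca6e806004ae038b1513baa6133681cda9467be2e7fa35dbde4bf4d67872d149f159ae5563d059ee815295775beec67eb9bd46730e912e06ee6c1fdb4b45c43cb1febd0ac318ffbe74a6a44433883069dd0e1e34037ba41c3211fc697ce71efdd2740e7d5ceba995e5782922772e626f309c348d28be4722effa03dce62bd1391d6b356d3b9046da0fff0ac7485c1bc05fbcc67119861bf05d4341f093a9b3299b099a089fcf40db3de25c6c3ec41748d1eca0d479f00be30de9afab4ce3e05e11599abdfebb04a0804dad1116e015077a678e0d34c863b4e6c807e2c8d50b9e537363b2f4217fdd1f45a39ba4bee723d04d7a70e0c00ac3c456cee8adf6fe72911506fb6913cb23ecdbfb914ce099adc2d46ad33c54b4a7350342ad82475e5aeefc87ced5f5e9ee68bed5cbb35430d60b5f358f5e716c750a1100822714e343997b8956376ee190fd090608f9d7fe085c31088a0dd02a81a980934f2094b28bd42fbefa71ad04be58ed1b7c62894d764a42fb1f77ad08ffb6a322d2bfdbb0da3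d791345913266203ebd74f01c6b9315a44437e684b0acdd7080b4676b55ae085bdfcc0db1803c03be2d425c0cfe1d26359bf4c7e150ef61533218def099c6981dd290e11428c388176fca942f854188e0dddd0be2f384e290c43784c4a8b629f47f35f02cfa8f8917f7f603ae121f5a43704bcaeaf2a2d294b724aa04d2170bd4d39929598280b9f55fe9aff04218fe8ce296702b563e11de3da671254798199954242b905cddfdc08de6854afa4a747fa57f0a2a633fc644537cc219fc9e7a1aa7d36609b50a0aa9b5580136c3762256ce12b873a3faba3e73f69d7925596b734be3597dfc70a64fa05880f71d8b78fafcf0e7831831079cac51ac98592e368261777e19c55837752e3f956e5a7998c1bc50759efe39e1ff09d9825b4960e2a1b7109cc6eb12f0014f09de94e9d5fa3a87012d4fd591fc17cb7c7db2ef74e56c5fd8572cb992fd7d5e2fa37827842dcad8b29d998702316353e6080ffeb9d7d4fef410b1b85acab248aede96b60c35e5a8466d820b85d2d9cebc5d51f8653bc29c946cf891a1c21347685fb75b6006c978b95776b2cec34ba52b6ceace5ad99e006c7462b100e00ef95d889e8b47721c5eb74c5825fb0dbf80fa23b9af59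
    (by norm_num) (by decide +kernel)

theorem closeNextPrimeOn_407_423 : CloseNextPrimeOn 407 423 :=
  closeNextPrimeOn_of_certify
    0x3bf8df9e5d8a2c28a045d6dee42788f600669549f9
    8 8 19 37 4093 1 _ _ 3207 572928124
    0xa8bf09e648efba6d046cb75b498a99db5487ae8a21ed1231db1fcbb59aeb4693d6598310a6a11ab97287461cd5dd4999dfaadd4492e5b2301c4959f35619b2efb034cb171d1e2a9b2768d51b49d4d13d89c59e7fd55e9ad87c3deb00103d14701e0e89ebb24b43ffbf5e262e1144872fa57ee776bc733a00c0ad8de1b0551724690189c7343c77ce6283bad8238ef3a536c080ae274220875dc0017e993a6ef0fccaae53b0dfad057f3dfab666169aeb594d8eca3f9c5d914d3fe5882c6e893a0fe212ff999ba67f79602c26bf31b4815f6dec7b726eafaaf70063387bb1336ddcffdabddf5891eb161e453dea96e27417132915f0bc7e73a06e354d358028e66e0b820705251ce57e086bd18019ed616bff6ad1de0413d99bf63f311876acf50a5849ede25adbb6524e99857c359d0278e503d46e7a87a863ffc1c0e46281cbc45494fed104555d388fe336a9a3b5d0341304c44ac5c83922c6f4d07d1d6e1c8453fa88429b60c3e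5e127f9d35e95b5d876c08326f72fe2ac758f91eee3d54a174420bb3324bc3c62336b00c8e3c2aa91f6b2e87c38fb676ee73ac1e21dc22b7a4b2043f57521af23b76604b4a47445eb5592851dfa46adebc82b5f4b5b93bbb3e79a256294687b25007149486c478d6025d43f58f3a579304bb57ccca15f26126eb8f58caa9a211c623155ce1afe5a7a183b0494015824c27d63b283ececb9cdf8f4d733fda52e06274be86c7c6c00eb8f3c3820a30135245bd36df1a21eb9d8fed5db3666483ffccfe0d9dfbd02cc1386da614b9d0e02abbe01a7d90597976f2be3bfe476df7c08bdf6b96974187a07a251defeeffd1bfef5cbc4fe8a81fb43d6018dd0b5fb189b17ff5f4c21177dbacda5223a5299b66132d3cecc6f484e80b3c52ae81a6b00dc433ab8bd158d96b511c79b4989c99f7a21073c489ae77bd15ec197a7a50047d3a7e7552ee9c92f0ad810c2ad4184c577ec4fd585352c6166068cf2c4821442a86cf59ab313eaef5f09a96bde9b70a510289f71afa9d1bd01a0e681dfdfd709df94e802de0e283b52a231dcd79c2b3286a8cb3cb9634a74a6385a8c6120515d9a8a944cb313bc092178812175333fe7f17cbcffa6a68c37515903c962730f93d76c7b45a2968b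8db37aa7082f470fb23701aad8c5abcc99ad7682da1c0caddcc3302fd1629453a6266a15db13cd28587fde1bcf6d37ba3e81d9c966aabe887ad07cecf66f727891f1175ae57877dc20e18a319801efacb15d4b26ea22273693f707f96653467204b53f0d1f87acd66b5b6f110a39981dafb35191b7dcb4b1bdcc04d8e9e04b286332ef6507d1ea25607845bee3b371a854cd4bf1ea11441588b08b663c373f9d26dc040b718169e27eb49660f69b1ad9c62bd5fe7daa636fce942a3431d966e9eb5c8943544c08099f969f7e94f33293dd04ee15404a923a7bb064752700b2fa92071d0e192e58e9efbcdd33958f6b27d1b67f6a354981cb22eeef913f7c42f02ea38e768970a122fe736d0dec07007c6f76a790b2240ebb66c42edc6dd32a0ec6752f49f5f5ee75517308f9824fabd2516e3c61670126b726a4ef7341052a04da0aa808971618122224f00b6ce0a8b28739c516d9d8bc6b5082b4344e5ad24c80a790db493f83830a0549b30228652673eea5f5e1616ef20d2da06c4b23d4385d5413d1337a8395786c21641d794f1d2a2932ca7fcff850e3439be4dc6f320548fc3271447ce5e1cbe87aeef6e7ccbb58357eac426e08460333a5162ec24e970587785a678484ce395ebc257f50f830bb3ba37b9c1e5cdf8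cef3066e404b189db0691a3421cceeb7dddfca646b0ea975f8b00ed8be2659394065b85339c61acf596d92f0f0a879e7236f0030c7b09a6a992b65006923b2f5af5fc7f745dd01a475da8060c2f4e9bfa1ad350b499cdd8d209697f15cb1d5ff1fc7c96ce713eb0cc573edeabea2d3cd7c4f9059bb9006736743fbfc70fe9b7ac1a0f3380b33da1a2bb08dbea7c4a71109fc735a4b131ab890d239d83254d60ea049cf61adde3610a1a5c140c74e3f75ab54b0c46d655bd57a6e540ef94e8d5fceabacf7e38c6c4e6f218a70f290091c59b3828bffc86f4da208e31e8cec4a51f62a2aee7ce933bd090b61b66e7742479dd8dd002407d846743f3b1101ff56e40c0dc9ed42f4ec00b5446de5633ae56c3bfdaa48a2e11af092a8bac8ff80e3d22e92e2b9433be5ce23f8d0c6f06ec59311edd0443ae153e90cc4644c6908ec01794acdaa293c40f0244f435a7120962c6a402a93cdf8bcc76954b0a51897946169f22d713c42442a0356670d5318ccc8f985620b35ff9762145b2ea508c14f9f8fe1b825c752d5f125464aad5f249572ad05c14a2730eca23739bc46aba89472b8730319fce6e7664d7474946e5f098485714544c1e96a6ea26d69383cd981dce9f8d71df4a88e6dac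4f12190f70196466e587508bea5eec8cf9c84f44e0579a7243941b52388ff2554e2dd5556a1b740cdb6e0d8788c64d94b65ecb5ac5c4fe8ec50bd7fd991ddd38142c6042472545e73f8451f05755c40dd9e823c4353844daf9b41689264cde512f5334f4e8f3e021a42f9d5d7994f74f8d7c4086db2b24831fb2d13bab15db6701be387f97f02f2d3402f5edce23f99fd448c14401264549b4375b03b3070dcc13eaaa0affc4e929f4ca66884e1be50c75af3c988ff9d3795dbea6b4310e71ba0e6a40f0a95f3df5dac0fc1ec2af001796a336fe7ef5dd8a76b41367fb79b4111964c6eb456984ea507a177a02e3ef7adb1b04adfcdccfd9e22c46dfeb0962c4480971b9fe8a79221c0052539017c053bcb24f4cf6282ae2a31d9b1e190990a56ebf92907a725ebc43df108e43e2e388c2b0d140286295c2f1d48accc791c4afe75cc27cd5eec726f896a4bd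
    (by norm_num) (by decide +kernel)

theorem closeNextPrimeOn_423_439 : CloseNextPrimeOn 423 439 :=
  closeNextPrimeOn_of_certify
    0x20182fabc00ef1a1bdc55ffd4819284ba636e5e49641
    9 9 4 38 4093 1 _ _ 3330 535290460
    0x206c3f8e37102048a0847a4ecdd6699cdab92dcccd1cae713682157accdb561af5abc69cef7e48738213146528e939359aa09d218dad063b9b558a96fb4c072dc0d292ff32dc6d75683562d88d73b65698b2381d9342106c813ea26681e30c0dbf42a2d5dc07ed0af06317b8bd7465b48e84d8b8ae49d33ca82ac0cbf213348d0186798f1591066a53723183fb335e2faed07780f53e48ec2679e9460fd1f84534b16f34e3138cc74fd50c966fe8f2c41757bf1e6ddd90f2936bf166b9c33d07514f7cd7de9514a39cb9374a6c15874d153838a5d496b62d618ba836ca0e3649227a3c2998bfc3c2e4927295580777ddd546d5ef44416b652a6be803888d927d2134686d746ebe45a861aa8c799b01d863243f385f16c526d32aa7fc55fe651328dbd6a9d51c78e5b0081b51d92304d0884fbd09c5f342db2652b6471baf5f19c6d167df27860fa1c2b1acc3eadd8de8475c3c4cffe30e780d8eebbfacc8112de328359cb8fce16fec46f29416a8a7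4b4d8885738812c9f6d18fa330d554a49aaaf6be45082b172db52889a65b386d49e7fe1bc0a34d8508d3e1f340a3b1835dcd5855775e4cb3eb60b3615c9bdeebc669a87661c168b3b55b8fd243f6fc899b7acb0c627da9b6889586bc2681b42ec2e78a6e4d333d12b741cb841fe1fbc36e4b30727633859944905cc07cfd90dd515d0caa3a8a68795b9791f7193ad5eedbdb9ef97b7527c9bbb2a24f13cb73148c315260f5d6bbdbea2e338d55c6d11b4dbbea062600f08ad0543d4dafcd31a30860db81deae0eccb35c43f3b5403f9dd4b08f1c63e1d95f5c1b41e23068f4d09b4cd6ae3a5d75ca96f54d5ed621519496a24b0c154c29857969a9e1dbd87e832674684351a852b1b98dbc37a51439fcea5b06fb8cf09366feb878dd4ee71d0fe1863cc1a885b3872d66d628caddbc379b1758ec5eabec5478f9b92ea4ddf3906d13a58eb39e0377ed2e14511c684818de600df2e753f5182c020327728310f7cada110ad4d1a8c1c0eb4c97187b27f55afb6c68506937ecbb05a6aa869f460c73ce87d0352c5cbfa2caffdd8fe36ed5632389474f37f188fead434bffc5bf6715d918e98e15756db675d305612696fd0ebe59c5bd09d254cf44da83ebd3b792857e3a29b2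73340460109ec8779281257d632c1088f784c655b35fe97e393e97df323a4a549e44c2044eb8e2bc413bb920fa6e11722642f67a11ed974949b2de5d27350b94b17040fe3115c26be29df39b0f6ab7402959b69e463e709e88fe4b0f2b194dd5a7175e56d9b0fb2ae718104622bef383eb76f5260c533d7001ce06bcb49583e19bb366bf555bfa730b2daaa12df040faabd858cdfc80a8132dc3287422dc801f7214f761494895e9f7f6e821c6eaf1ce6dc57b79ec3c82abb4d226f66ef5c7c85e189b8a1ca669c385c08facf046374f75e5cbb17ef77ce309ab4cbeb98857ff617dba799fef081a224101e8060079d3aec9d5e1ac4ec3a2990d83f3a8e4bcd621e7e6093bb6629d6c57aea4bedf82a3ec50800db2f5a1bf1bf1479a7aeedbaccb256d808ed6b35d8add94146fd033a4d6876fb9707c61ef5cf3c0826fe8d2c56f260fc1a20f59c8f3055b496e9c06b41f82ee70139802688ce38e71a76130224ea5302892e67df9a92bb97b14fb6c76d2c9111267c80fed5235ac51ff322d431505a96459ea9c3be6d7307f91db865deb0c70b37680f25a0858cfe410eda23de3fc67492799313936c714a171a6361674ae1cdacfd10929e517465ba09e58cdb8a9744289addc88b5e07c0253d34d905c8521f5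337bcb4b74bf625b3ffbbc51356025b0b3eac3e4f269787ff3c19edad372cf6b3dfc3b5d7bff3376f82b1267f3346c7f8452187dcab8352b41851029b1846bf83c61a8bd0cdfb18bbf2b7defc4eaa09d12a76609fecd945e544eaea014409cf1fd6c35b5df03b492a1ae65fe6ed5d7696d3c850be480c043e1d926cd0b0a1c6cfba1a1e4f570e0f2c316031af864cc73cc29a3585138bd4131c97bd02619a047a515757434ba43d66e801b638fdd1faf1d89a3695da3c2192b5ab0130b46f69c860c95dc5dfbb67ef7c734f3b2d783a23d553f9dcd3b488fdc135671091c8c0a4decd9167ccd62610c23feb3a6d319213a8998af78e000b401ed3b34f88365626a7b65b496d3cec18494b4d4b975c55df8d5ecb96fe535cec4721ff2b8f2ff4a54eea529eedcd577525a6bcad98e97b3619d78556b2b1ba28c769e621ff4b8b6f3036a00861cb153dd7fa8ef48795d2027402b8602ccd640148e3de72a806744847f230c87eba95fcd7eda0e64043afb53613e52fa2f0cfc27b2c784ccbd5de6ee7ebe51881efb6610d975b8244042c2e041ad8ed2db6e30bdc0e04fd48aad724dbb7b4b6cbfc00e41a646b34c2d4e8e168d7639d76be8ae240985c4640ba98d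a134673ffea8705373325a46589ba59f3994c7d74f2429c8f9f4713ed33e85144b5fc279e26103ab3fef74ec074faa792f44104f3b517195b151cce96e5bb956b5989a0246c571cf11dbe229381a966fa9f1eeec17e30c151f32dcaaedf23b6339c6908005981d70fb5c72a9d9bb936c8712c72c41b127d21b724d358dae5d6acbeb1071afaaef5198432fdb66705728878a87910a176d14c2e0630aa24b2a39d6485c2d3cd07ca61e2c811d4797fa7dbb1fe8401b9fff4e3f88d8cc92abe581557ab7e02b23c03deeb25e0cae4f90ed5bf4c04adcbea4f8b9a94e798d501d6e2d7261c4548e4c5e081b4585d32f7af93cb1cb3617dad1efa01cb12f59fa3a292cc605ea603d4b09b10b9e501f6c9d6ff9b9bc3bee8e925710f6170c308eea9c59d71307686524cfa42618da1234952ff9736c305fadcf295a61c5d7eecdf9aa99015d2dd0bff0598f5378c3b43f81affdbab45b77da8320c3cde2a8bcc0b517de66fe8f7060a5c6e21772b26fa1a47e036d51fdcb5f5c188ec1f0e90a7c5a773a165b58ee0b4ed9de9f2f56c3fd176b5920c053f8c5a72f5225bf47939247eec6387b858e032e5061749a072f27bd82a0704e6c8d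
    (by norm_num) (by decide +kernel)

theorem closeNextPrimeOn_439_455 : CloseNextPrimeOn 439 455 :=
  closeNextPrimeOn_of_certify
    0x116d21e241481d32d20a2b1e8625a8e1133fced31d954b
    9 9 12 39 4093 1 _ _ 3452 985858768
    0x18b5f2b0467a629925c030e2aff738900610eac360d1469dec12d9cc8aa3c8929dedd83792f8a6b8ed39a66b51e99ef491a322071ff37351471308afeb4aa469544c72f5b0873eb6fea3dce46c1c3e5c92c7f26a556ff2f1ee6ffeade670bcbc5210a211e78e27c9cbe7957d0b385f242c68a2c811194be5a9fee1e50e3ca3906860319644db53c6bece2ab6feba347bb0632a02f6e08442c828c18137502bfa1be9c1bbfa7f3c90536a1837dd835c45b680a67e97e43178e41aa8a59ce9e784eddc94355edc0766345ca3c00c35f719ac5493c15305f7e067d29d13580e03eb9c0e3193dd06dbb16323ccd9fc1d573ed89df27e0adcc46260c1de8a38e582ecb777b6a62e9e7c210327eed4a7670feab1a92064dee5c151e8db88b3090099f95a5697e1b3c27e14cff20464dd37293a362cc4a76aafdf15ac39c12ec1700c823fda6608101ca0b22ef5222343b369d6fd973092b74360269a201e9344d90e880b4fa04f381b3271464a3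2fd8aef186a3d65397316c4183d9b3b6d90432b389681f3f88a53b02ee25c11791e2ab68ce42cde19f7ae6c31946ff7f4357e8deaa4a6eb73beeda7ab8a37cbaf6239a1d88bb4a4f4b54f4a953dd2e07fedaa56b6b364ff1d58cffa3ba467cb4dd9127d9f9ac207fd6a30d87ba85690a889affab0c10bbf4c97c4adbe124bbae1cd8e0bed8e501e9e85441800e69a4a52b7b210045cf42a5b0582a66d553d219c7c913760dc96f483720fdd1560756ea27d1d648316b5adf39e2c16e8318a4a9e3945df75dd5d1f890aee167f78f32d2fac8e253385e709535d6503c50d1bb3883224808f3c37494703fdf344b3b9a2b5fa724ffc880ac6be7990063e06ea78f1f626b2958789e87eea66741100278a5e2d7140d0ba1e1ff3cd810ea06a8d4b56ca1e6e73481ab2a6830dd19789e1d3ecb393bdfc041aea264e657dbeb7cfc84fa09b26877f444f2de92b1599e66e06915a1f649caf481a1918240bf4db6d09359f16d3af7684a457ee262956be6cba8a671f7c1851b9f37ab5002957ccd75f4b03e9d1e316e86fb4a128ed033b2815b8ad8b3d64d7140b16f0de395db305639274d1ddbcc4793890da1dce74cb9f644c3e339133165fe8d8546f0a56494d232ab8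e59e48a02d4e91ff1d961d8a956c27f87f3800115c0dadbdf4fad148ce6f653609f9501a00c20f87ab483249a99080c059c34966a683699f636957ff1dec1898e7440cae0fdafb6116c7f5cf984adad25edc27ba63d34fd79d5d5fe64abe7465becca2e2e388eef388801d604ba5532594b6fc7dc401e1e9eced3483faa4ad254462abe5de64336557fb974e13a21a83e9c07049da3f806d614ad11d0d41ed3a0a99836cc79266866163b2620cf596de55a8d75ad94185ad6679ec39e7f28694474934f04e67c09f8501d1a639b94aefc6edad89a5bbb6420ebcbcbcd921d09d4931ac00578747b2ef4dfbcabca2ab36a3462f80699d986d82c708814abd7df578481de173055a115fc8180c2698a60973568012a5f503bb652c9c699449d833daae318feb88a5f28a73dc52fe67b601caae17389674be25e0c359145fa03c617901dc419c3ee3c4ad148fe726676d94f169b496747de2aba790ae357bced78fefc4912858b7de9b7fa36e3ac4b0793d11ba14afe868a5220970b1a25275b34e9c4fdbd38d27f401b75364d094c675e5657d0ae8b067937963b108908433e55640b208669bb93d166029caecb245237a30ea4e3e181b86cf381a066790752759851e01af085954bea0be83e9f82552baff3623a4f992d3f591c808014ade524629d3b8fc90e044d390c2589e53754c201c3b954a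a603514b401c7e1e128de9921b2a1e7a05de6c7c50560a2b3372e4a903f844eb2cb37eff6ecab73296b00a9d1448b5a17a6274d8aaeeae90374524202072d4693de9a9b13172020a88d575d43e6d224f93148fa526c50297dfb8e7598d6c93f914cc09c5c48aa9d827cba0bb4c9308cfd5a0c76ffde3b393a62be5aa4a25598a055860924eb29e6815e4130cbb25564842edbc1c4008565559894090d52b2386401e225d7ee8868bb918d74bd9fe9f50efc2f035e99dc970f891a1143e7f54f5d97b0295df9f4be92674bb9cd0574d577df9b906bf5d9282ab649ced412d5615e686d51392b8e677029a5853066e6cefae464d86089b2fa350e3d6ec8838c73864f64e3364487fbb4a91d29fff539d174d79ed34e591f35a80f848b739f40d1d972b2e12c71373feba29d05bafde9fa890052b53138a82efd36d106b341d66aa27eaffd6ee5e3e6011986af5cf0767bd9bbf2db800c4931d9863f49f70bbf509c0b0f0b773af3318241e37c26b4cb1b01708981f941e41abe898d471d4156fcba401f9c2334b8f7220718f8a4b671f8184d8a447b7185726007745689c667de261313506bc9b36e032d1945a2396d0c319d8a37a11377dc01ba73e41a5b6f48e0db5befa813c8581971f0c0c8eed7298a6c7def85c393f0ae3ab7fa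34787eaff77445f0848288df4f8ac823d9ff579c05ae3fa0b1fd13d50a6e1e64cef0fdbe4531b19b9c959bcc44e6e00279374cadf2ca908fe802f7f549d91566c986ac19ef983a326f99ac51b12cab8e8b905d7e4a2dfd172b8039769cb5de479c6827402ed83fe4bb29024e08be8f2f126eec0b968df991c3c4d489d6331f1b5f960d7aefc65bb0c0d53e9a55c7b64253ecc2b30efba0c342bfa14e2e8dde3dc11f2d18b6e5aec1f64f77eacde8ac535a5c3c8bf0181f4288b2344ea17b9c50740152dc3a5230d4023c4910b35d4555573e5e0064113c584b4e4bc78490cdbddbdebd5aad2923878093071e68a0727972fbfd348e1a167e8c4192469b12306226a603f3157a4b0f2b66abe71c2eaf5f91d454738140e4f5eb27195886b6e15e06d1e47697c08f8ee23a5d4b7baa8349411ccb5cc899b5f7430b017ac4aa99a8ab001f27d1f2edf19383bc468b27b0a5528fefcbbda62bb8b514cb5ebfae72d4bf3f67f2a80428bce3304f77fe8b73bf9e8ebff79196d84793c8ef9204a59c4e312f7c32eaf8fb535775fe7bec69e4ac545f19e46cf5f5053302b324fa2139787edf1b4dfdbf7914e4e37330d9b6666003b49c1f5bcc5cc684018e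3b7114d7e8cdb53dbf2b1cd963b8e1cf4cd5b5573b23fda02ffb81a60fe84e570fc121b3991d2
    (by norm_num) (by decide +kernel)

theorem closeNextPrimeOn_455_471 : CloseNextPrimeOn 455 471 :=
  closeNextPrimeOn_of_certify
    0xa2484b8affef8fe943feb18c413eb4b00342360e037e4a7
    9 9 19 41 4093 1 _ _ 3575 3387648946
    0xf8aa3f09f41a15b05b2ee7fa39fad55e9f2aae31460dfe80b8a1592febc59b23a606669a46ec17d1497acc962c0c97a5cf3639de41279a038b0ea6bef5780f99c22d70b461e90500de651f599437a42517b8014473edcd459a09fbffeb34b1441a8b371dd9cb29ead878456d0692b6e2a7de79fde0a8fe597addbd7f482fe45d9d67039ef34560e82eeb8ad98899879748d44ee8cab23ea8ea2bf72ccb81a70878425b2e25edd0d2606f9ca30f6be5defdcd49265f7d6625b372462ea46f7e8213236cfcbc1658928da3dc2f1d119845cac4bff50c8a89010cdbed9268a8af1c086faef8cdf95b2424ed2365d4daaada57060dd87581ba713af4cd896c5cec8415be70135e7959fc6ee6aa80e7b8c6387dfa7487a13eaa4c1a98b848351af3387ba8bcd3f863a40cde0a2dc003a0b8577533f0bdd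c8d88c40cdb4816fa6d68ee1235bcc75d712262ec81280819d6244eeed456ca4637fae126374429b68a666ebdcf4eec97fd063f62784a5a6f76b578e116287c00d934cfc32333b6c87500a99f70915864482f6b73762ea3ef074ce702acd573815f281eef0bf7fa520cbe4140022af65666582822eaba742a289be9f357d1169b651b0916a5c89251511047f72c8e86405997cc93a5b7359580f4260e0988874c6ec49586465749183b4a4b8af8d705310ba4509e9527eb594c9321924d8afaaf0e7747dbd9719a2bb27d288bcd2b2075959230dde6231fa85ee9a305d0c264bb82f013114295ab83e9c2804305b11e2cb83b34cd12c04e47919fcf9d0912168ee9b74f6bcb1292a883b011fa35493c6a95214bce9547ac1c893e734c8376dc665714d197ab9d97c4f6a77f04fe478ed8c1297995924248fa7ef9a11ae24f312b6e28b1b117cdcafd04ce014640a92375b1d4b04d54c63c9c0ff264378a76b0053cefb03a0a75706689606f97f5236de9bddbc211082d5074964660dd6e26afd85278cd0c35159f2a3cc82711fe4733227ccd1f038cc8aed64acbccbe10c8796f19527a9681a9e065ca7725dc1fbb31512f08d48c9faf9d495a623d7324b8e7309670f34c87bf2d129b93aa32c66bdf89eed1cc76d4807f3ab16fa8b68a2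0fcf7c6aaa75060a02a11d7aa5424eedf8ac87f4de5d342115ff266d68a182208ca890c26fd8860864d8e87edd9bafec089fb96e8a7cbf4fcb8787d30316c3aacfa4a1f52f82e4656e20c345f2035b98ce40c1234de72d5375939ac634e9fbace664286da15ebd7ed0811360436d46e87aeef433e0ed6ee39f486f65f334a6d5443e4bac9651eafe099ca31856ff8ff799fb8bc4b2e4a408d01f8445a06eede405be472de65c3d6f3395336803d92eb5a32bf26cf68f5749f9537e5283f1509b275db40dd6628485c43478dc9bb019fc53b5e507054425960c99e425559cd3cda28925b92eb410446854869c3662a897fcb3acc739cc6fa1da5884f54976e0810713aac732e8175316f44fa42eeaac38e6e2449925a225c3767256c24c99e59e41cff04aa831d83c42a2b378fa3489e897d54d59f9405b7d57df2a458da814e118ac138187d7c9db354dcb7e4f406d375de6cc8942a9a537c78a092c1547856eadf7ffff687d0762826075f4a088f39b12737f8c33b240a1649d3512a474fd932f5c8431704088deeff72deee48c28e38e693f9a900baf091656c0bf1c73a8bc7d435eca9fedae32d0b93175381bcd7356d6f3c17878a567b22dd59fde4ddbc1be45db10ca62d8e1fb719b332fafad9d3fe798945b108e61e7fb85da329e9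1483bf7adaf0bdc7fdc9a4948d5958c8c7e33cab77aaf15e96710483edb22e4b82dfadc9168146e507bf3327044d6b4623577a1b86258ef5af471895cde44621c2abe7c02c07ff0167677c076cc68889f52629a0459e9e3a22052686d26ff68a3ff8eb9ea8f415c7fe6e40a847ae799866cc3f529a285e4b6f6431f13c21529038cc14b0883fa143674e2ccf9d27a5cba191ebf8bad5733ea9a9bc9ae28d99c32a2a51504c2ea25bfbaa06c8361d7ebae428b4172f903aabdbc782a3b3c4439ec1e051a0eee3af3015d7eb582575080004b32e9c71dbd7887260246c15655698839b2ad2765065a68ea3d903de3f9fad7876f268b62864d2488d2771259299376823825dd3a2302e1417fdf4d85a5903f8f56d3c583c1cbbca6c0685c866f1cb7920bf1c54601018e671b7f5f0eca608c0b37c12cfde6f3649e4548a6a1f00378bd41b9c662529604707ca5530233bd0f5ad2d6c6205db02bf5652a86f34d4fdba6f5107d75b7e9eda95ed2b940bac049245fb3c567215a395f6de6de7c7689c3053b182c88d833df892daa1f735c0dae37f95d64b146367dbcfbadb92981405a4a81edf00902b9fdb1af2f44ae0ddc7b65c3bcf29bbc0be6089381cb1f7ad36a8ea09aaf1444517959e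49871ab68982caf32172a7d559e4a7efdb6d4515aed13b3157915864ac1a67a2c15b8ba622acbb65860ef4fcd83a8fee6575f306cf17e63adeae0f7c32e2dbb29d224828e0973d69a5bd435fe6538bebec20f9334b0512de353126e04655e0aaca839f172659e83057b88ca43a92dc54b750c40979deae160291dd5c01836f62dd4bce72b12cfff6d4bd727e272201bd1eaef8edc19f0767f9b2fdbc75bb3f8cedc2bfda30c4a5b9e257730320640266fb7064529210f2d81e061f32874d222f60783ce0f998894f12bfe9bcf21663d2ca9677765ab487236c1b12a57bf9f25b6eacdd47792d66e09b5c082ed0ccdfa3024781fb299f6b22fb0889da577e8427b842fa1435196ac335aa1c06cdc3c1ac5e4396b04304b5be96fd8d362467dc4915d7451b6e68702f34fa137e930353b55cdc183b32a385b8836484b3c95d4d0c079d09475fe3ce683b446946b0310f6b30931e34eb94cb72354e45a7d67dbacb78cb6a8465f49d0cb5c5ca665637fb167fad369622826b9eed041877043a627522fd83b70f69c6f525d2944e4033e3a737d69e6b5474c1da4d48c8578d9ee54a4793c5a60405ac3c6018abbcd83e2d0e12876a84ba0d965b0c3cd9e3828c4c3be78fec59bc5279f2553fa58c0d89b1781d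f8d1ca9a192997b5cd186ef4f8224fc4f4d7590314498cfe53f2d709f61e2d201365c0360b5c7e314fe3f4cdbb37975064ce9ea7e22eadad20a1eb6d8009cf63d4008de7b34baec565d8d44bae3ac0ff21bd31f76583652308f8d0bc230dc685ad011f50bd77c021a56fc20f097b529a0548080542dc0ffe76a257518659d59a98734c9b5ba0edd9ad657c933b49d342b3337b7f2490a7926e817f2a9701bd4fb79c7f7e89e6e346f60f9d872f446a8c188ff2fb1b46bad9c75171d42af7bb6b8c7e
    (by norm_num) (by decide +kernel)

theorem closeNextPrimeOn_471_487 : CloseNextPrimeOn 471 487 :=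
  closeNextPrimeOn_of_certify
    0x5fb8a48efcf64de2971b3ab9ba7bfc93d1ec0de2440f7de81
    10 10 3 42 4093 1 _ _ 3698 5743298899
    0x60e5d9d94e12a4ec4c5a8ca21adb7087e6b513119c760eebddb8dd825a384d594d95cb912aa379b2f53a20a6dd27cf486d31f4f7dc2552ad47874de63fcb03fb0d38323d687f1bf2ae48515253b3a59c219581fd37036a8938d63de29998ec1f1517c44900c47491f133218191fee318c9461ed9729d20eba3732b6f9f426070cd8ce82ccdef671f48e031ed2b13c580ed6a8bdb372b5db1980980c5336ab080eb04864683e33e65c7db0d7a4f6e1fdceed56bf01385e877b4238709dff2c7581588feece1e1aaf4a05ed8febea82a1510ddde083866581d5979aa49bba0fb15efd3566ee23354cf2f90f63c0bf22188c7a8cfaaa628a9e218ad4a22efe9c16190cfc26ae1bda0553e77a4414506e6939da29bd085428d19e96c6ff2f651cdc3fbbaa5977c664d96767b6867fde776c78122b5b5c128516bca6e430fdd8e1d2b1f9d3f1a1f5ae47c2104ccb5423dab9ce466f823fe406c4adefa2100f5ba215cb2e3a320c9c822a43ffaa809ccc2c025066796b05681209deccd13bc35eeec416133bc3715f1514c5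ff9cb6827a64737ef5d82471f9569ac155e59247975978c9fd87bc2352583f3141d37de42ee0cbf61f436b9ab274133bdd9b3bdd2b9366d549e198982325dc8c25a4c94a11cd23ec7825bfa873c2606e4bf3216a24dad0b42e768f42f529acc21691075d73a733abeada2962622d6d3677c5bdfab08f354bd37ef3ccf1681fa993fc45dfaaefb52309aadad27d5f37b2d2c110e8bdd2f4c161bb8c034ef3e8d41e898b66caa554445c2c2f80da714948360c676f6641d487a93e0a7fa1678733dd214ae66c0d7439ff415651d61eba778f797d2da87de854851bd4dcdd42afd855bfcd3f1ea5aa033cec78f9a86043161da673914dd67913e368f9725682dcafc6203ece5588f0e6509a8e1ee65dc33e10f1d9ac65ece7d886f12b9996a2a779fd0aa2c2281f4266406015ace48b57e4729af4f751dcccf229851aa14cf7cbb588fe123a0f1a647f9fa1c280b77929dae532f28a6698bb4085d791d95f2f085852564148cac1dae69209475be725e91395fe2e6f4c4860e4f4e763b15a4950f54bf987d207b87e064b79017d34557296ed7d7141ca058872b9975d7d0c4e7c70a7056b0e6c90e7a23c0a83215917f25b990dcaa69585b8ac8b1caf1a1b5dcaa25794621771cb715af90d34d71f8224b13d9c4817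0f1af5322935eac7a74ff3b5015d023fdcd0ffd0dfaad9667f92ab6009fc7f5c92d684cf9545d69a46b6dc9d2e5ad462299791f144ab4825708a0f9df1b53bd663c03c0eabaff3b2ecea2f8a9e9e99b825598052c68444996db769a09632aba2e4f8468087be0ad491d468cbca475e4449fd26c37a554cffb957b3f49aa5b10e19c721f8c87f73967fd86510699e7ba6426e7866a7ab03c395d4a1589ae7c2f00fd163ac4e70399c2b4907118ff2ebf134cede6a462fc0267264cdd1f277e6f4a3c9574e4cc64c36067ec417ea0e3f0db81ee9f056729773222b82269505373e6782764873ecb43f65fa214a3ec8e192926518145a4472963dfdcfd2d30c3c4e3f0d1e1918d6c5ee97f8861baa6ab27faf67b9c98538b0b48a9427ad552f092c62fa15f30051c17eb60b69581dc89b51b176a80955c29bf9b55717d69c57e4363a49b92729e785aa5f6838269dd7606790b6e5a05bdf7ec270de0210df9cfaa7bca795089433063d4f6c78f1df31d8c37ab8742ee9a8cbb2d90129b6b9ec488d770f5b0220f801bb629bd271a26c40ad6842b3ab52c9d8e131459d5c62c6afc10d98761736cb19b13fc352e03a3a65ba7551858df1c918dddb3e1db8ab8f78a69e7fa41f449b9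aad00cd30cbe1ac7f79d20d75cec4cdbe2e927bd9a98b8b65a4e78f521d2191bb5ead07bd450d84619e99c44a12c1abb800a60f04e9b63158f3b5d488cb6065696ee03e9d6ae9dbb56db679ae16f7f7908c25c9d4fb8bd8fe85749b46d8a7b1c7adb295ffcef468641f441bb9bf6331b059180bb56d1da2c1f8f5b5a6dc8b0d676c61f5e7d83d7e6bd8a6d83b4737132b998c64e55a46e0aa8fa89b800e5a1ac668d6ef5523262fe67cd0612b340a7efaddbe5cd3e3cd448809989e3acd3e0b21f2360df6ab0ffffb092d9c493a6d98d92e7105443ed67e6b3a2bd7e7335cf4f5d7efa56136a78a689837cc9efdf7fd0511cc79e6b469e7cb86ae7a0342c74c19ee8d124e64ef1087c2f97b0af2bc26e65a1b00c9f7e762baff4a3286c3681e73d6d1ad2648ccd0625b1fd3ac617baae6f9d28dfdb09859260108860a0048ffb04486b5f81089434cdb5ebc12e0eb2bb49ce5a29226e18a3cae773a277784991b4135549845082e1e9fb9e5f410e87a0c0596d14d3a678bf3c310d8f65bfcf3a8dcddb91f991a99e1f0fb13997aa2adc1fb9f6bebe2067a8ec0a7946f97b0796b0b622ed8287acd3297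a0207de9ab3ad9ebd8fc62fdddad50f263e0bd4afdd57ffdbc026feb18997bb353c82c22101f098d020b9949998c031219d7d0fe234037d7b92cfa2224a4d6971b6b2b752b80fbb143a9b707e78aedf818976053679ac54ba40a71f001481054daa1b8162b07c3aba4e7a689c9f6e70d5523cf882bb5f8c7920f048964cfbe6288c6eb146c24264752d4b5e609a006ad766cc1d3173ddf538bd3e3dc72eb43e6e36b911146ad342791fd88806d5bef12cce23e1ab213bf8c25f8eff95db185c49b8dc7c3b5a8987d59123c90b7f81b949ba0b5e04aefbc72e4d26b6d0f34fa9966ab97ef24bb76b929862252abc00cadc87b600da71811674a21113a73225bd51b3b0da708173eaffa6f41499c989c257b2ac859c137801673d6f8be6e18b44265d15eaa3c8eca9e1ac5b3afb6bac15c28e514b255879076f9210003feda0ca3581295806b17267802bc5f2d169f20cfff8141cd7b624b20cdad3660e58e496917e06eae8b23a737116a8bdfbcdd8c6b236909eb1c5b9c43f0a65f5cf49347701cb2cf7a94e74c0f8eb8ef5117e8fcab3eb6c4d7ba793b415b4b5243285955b791a833f6a7a40c09a2fd94f80aa1f85d1b0b65e11ce1995fdc63d001c65bad7f4945a0aaf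79df325b8dfed27fb3d9b88875a76d67c0a941dc9d8cdd654adfa2bf4240a270c01450a2a8c5c76a891721c6fb50e3e1252b9bfb3838095712c65b123ccf820b5ce46a388384285b5a59df8a5927fb8e46e53f3642643300fe8daef93ad46962736ed8baaa8f6f7ac125b32d689cd8d538cbd5556cf2458c930bb80913102c706f4e02c90707b95ac19c0e3dff5b042949e038a28e985507590429c7f6f4e0bb51757888927103b3610cfffe220f4fdc5948808f99701c72e84181b72db5a4190c1feca1c1e17c1fe80f39093701130ac2003a7f0f3382d1c3e72d663fa7837d76be0fdf61b3e2cd90a39504b06f06423535a3b387eb4deef19b3963be2d73031f09c9a4991caa756e90129c7aac571b70d755a51ef0ea25f3c38ee2c880e47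
    (by norm_num) (by decide +kernel)

theorem closeNextPrimeOn_487_503 : CloseNextPrimeOn 487 503 :=
  closeNextPrimeOn_of_certify
    0x3ab43cebb1230dc3f6abb303e75e09e6a7bdc483c3bd803751d
    10 10 11 43 4093 1 _ _ 3821 9364869556
    0xee60688c369c51a5d6f171ac353eba1f0c043ab89583bbb9a15e870f3e3cfbfdadfb7e0c364446e8696a22751c0b55190055bfc952c825652e407445ca390d513f69a84efd2bf849248a0505d8c7ae0e686deca73c130e9e6b8912e1406dff20a38f22371f2abf5b39d7e9398032ed65d1b6cbfb08a9341f098437213c5cf430de43c2dca3ce57b771953786ee862c59703f63baac6f8b9cf662cf0f3ed02fb62745e4b9b08101175ba722679e88a54eb2dddcd0ea634e5b8a81dcfd4355442eee8623646fa44b3b0a6db0595c8cebb2bb22122e6adecd7c94a55ff20ca5aa3102b6240844a4eaef95e093c8a330265a7de38afbd0d83a0bced4cafa18ccce4723389ca705793fececd581c88ae55adff799dd0feb9026099fbab25b55bb39e5ad1c7f7c6c8bafd6253da4695dc51bdb7b69232b9324980f754f81f9a283d5a6fd59f262375345df62f69a08b42fbe3dba931d06434da038d42ffe37a37b43a607e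c4e3453611602c962579850a0ec37f7b51b4fd2004cff266f4fbb276b9471e22a461895e826363cf16b343cd7724113d03370e13087d8abc3a2fbb63bfafcf6c16810164c67c116d15ffabf11ec76a69ce3cf02f05654177b2bce95504c9a770e8e192a0d34f3ad098907b908f04c061bf1b770c3d1f0975130314e48d18028885f47ed2c46b3e7c3ea5d9e0a21f0695b3f7698cd6c1b82239756530f14f531d5cd076fd410ee3432ea4f3abc52179a6f6f8851759966ae07d1c6ec9d01dad7f6056482b0db340624f275341b926780cbfe3651fd6b6293b2217edec3295ff555a83b418e005191df4ebf855fe9a15d5a74d475bd98d28e1b5cd515dfbdd16fd91a338f64fcf51d0097147f1e82057190c574deb2187155e1dfe0467ae6a3e081ad7b97b642589f2fda7f511b42f63bf283bf19490c425b4a0408cb5ff8e9a619c4fb1159a8afa7abcf20fad87903a49295b876e00fe53a165aceeb9e244429f91888d674a1e642624ba700a15ae6da49b0133cbc561d34781914eb926d89a446a3d9c0c1edc8887e1b80f1feec3ad37f9b8a0f8b30f4f709cca1a01849cfe8b95f3b1586d289ac34d6d18a3e885e3292e842409d8da8da0aff5c7edfdee3ca5d20563e83fa0894dada0d0259df9d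f1a90b979201717112662e581da80e29df8fc3733af9af2429b37013660fb1f40421686489297399f6df9d4bd0c747e26638acde93c46f232cf7cbc56248ac2ef6df10acdbd129d13dc6e761fea73e1e159403259abc593a864a552e132cc0d8c11d56d07a2a43c980f443b18ce58a7587ad114c0cc1be809876cb748c3c42e5a4dcdb2bb6b970ce0ebdc1f99566679c84c394685b1758b13839375c066dd545b64a0a6e4ea79f17b2abe7ff6fa8e0e35c0959272e4e8da6f744d62211b8c29c82b0f08d4231d488f560c1750227d294e457d96b5c3e20d06d6a1d694d912716832eacabcb4ac741b47ed87ca4a74e48e1d752e27f9468beaea2176f4936bd38300c3deedb159234ae2201ee3a79bdf689995a78cb5da06f7d9f3992d891f7f2ded1f1793a66aa5772616b75608854c0077176c393dabbcb6a1df3e85ab206f0743dc345c028cd3d6f6656c0e85ae66a6426c6f005e68f6fc02377488686d882bd0c0d433f583812a25cdb18625f8c656e8258939530a998b360623e31e79e8c90374cb7f5b4bf9ab01f041254908b97d9549f17c5ba000cd65a576506222c71032846665efe2bf7c527e0e96842378814908ecf6e6a49bd1b75cede085f52ec9f1d94c362d89174cb69469c526379cb1cea9b544707d9aab3d2f45e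c378669f6e00ba1ecca7b030964b74a6f305fde7f7515e38626f357136619e2d5389a9671ee9cb6a4c6f82db25fd5e0d3e68e55cf3d031f1f835c4ccbb89407c7bbf974e61cf03f937ef042c435070370e7fb8d9abcf559fee96b6a762d84af87722109d0b38a28c87b5c836651b64a8b99af6139ebb9614e7455543947b5409a51878b85a0bf82f47b8c7377320a575eaa8ebccb8b378fd2dbc18831832b3eefd05bb666d7f27d1cfb77ec4e0869c9bd72a59100159fca1b350d1bc13fb097cdc81baccda961eb5cfdc40ed5b66d56b8da65d70df7c1df5345489c6a5b6c166dae464f8a123daeed254d5cd29539fafebd0394da6e9c1fa172367d4e265fe52109369b9cc7b402f6cc925adb2052ecc65d61b0bd3ed067d8ffe9d8f4a5a8343ab395c53d2de4df1bd9a46fd8471b1b5b21ca639e07dd96d41cbd2f9a2318798abce9ab05d8002ac0f67a76aa40d26206e66689d3550a7d38ca88fdf17fdbc17f2609762f920d0cd2ca24be095f450bb9eb223dbd72ee322c3d9e00a303e7bd2c35565d20ccca0ffc1b18386d8c04c2eeabc22a77db4edd1836adf610565f232435b56b6f7233bafc027adb47a5074ad0f9c29a74d837490c7dfc9a9df98b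12856ca27d46c0ea71d399c4e26fc9f37ee172e0b6a4f0b9401c499c9b85c46c8e224816f24aa8f0548494fd74d02c470ff3d6d424c6a7f8569fd596dc061f7afef7179d5ccca0783218d4bb0a579551bb2f787befa281ebd008860d97e2d180e6030f593754c90e958035f629b96022829e90a2cd961b6157be309b2068871800aa691f772f4d1e58659edec75ad396adb249d50e44e6f72537aa96104af446cadeb88dba5ccfe7c27ee1f38dfa064e581dd00ad0c54b65c2036893071979b1df2321d3718800e9a9b57c3d6f9613d1d1da2788db1f783f72543489da619757a2e6109f1bc9c534c31f9f92709343c3618c363878a3f8dcc3262d1bcb175b6159cb5cead90e916e6a102b8bda7e8ead0d29ecde3fc825aa450b14d052b66605e92e2c0b38a75d1ec37c1c939ed25b4e5e4895e9f6203a999631afc248728c7ff2590402866c4971748787b716d879d638a6934bd7260772ad8d4ff7fe4b4bb8d0776d2d1d3c0783bad5c4a03bb4e64cd2d614bb8075841d4d22d5384d2ccb01ecf1bfb3d7e689f6686e08950277c3b27d537466ba1b859b73f52d222ede45dab1bc1f4a606500a5ce2292c8f1d2210b25af4552011e76c37f1eb6401beea8c4e0510695aa9f35b10b88a15d3fb4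0dc20dea6731f4bb79604185b01a65f2d79fffea1f8331400eb4fe9746fc0ad2bfaee81825a0259970064476a72e717375907b7abac3569b95172c432659a94560ccb6e45b3a4fbc3b644c377b53c0d59f26332cd890139ea130f64406869e77c10092a963a7b37baa457277242ea4fc9bc2f91d18ed391383e043bee6461460c9dc021f33224b34592362642b3124102a99fac93f901a41b087762059a9f53639a2fc5c9aa0741ae87d5b12175294b43fe2197e02045eb91cbf0fc427dbe92adff19b756ec3a9a142d3f21017329c95ba21a9326f850ee5b114cb1f372289b8e5eaacd61b3ca609b4461bf7fb4eb555b396489644d60603d4a699f55038d0768d402d0088e8c26ffe8bc347cbe1840230233c04b73861044f2cbef6edb7de7a07ae5bb940494d6b785d509fe63428617433968260e3e178a6cf5e3136943c4034e462dccbb98cbf2b0aa79b7201e3dc2ffefca4f116a5daa42caeed37ae77a2ecfac12b7abc5e34bd823e6867d03a77952c9779b170ff4430e256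
    (by norm_num) (by decide +kernel)

theorem closeNextPrimeOn_503_519 : CloseNextPrimeOn 503 519 :=
  closeNextPrimeOn_of_certify
    0x2560c2ca11c951c3c60f52fb7c50e04ddccdd41fe5a1a8a339177
    10 10 19 44 4093 1 _ _ 3944 14708015992
    0x57313da8ed63188827d0edf2822a521eee6c379faab52f81e187fbe3e356762bc7a6f87c2b1f160f292f6f2bd07110ead4255f36080a2f0adcbc76b6009cea9bf359c331fe7b73852aff2fda57fa9c668ad357752e742fc48266e8c961dcacc1d4e5eba8a3444d6f4f5b58dff10657667f37674d3342f4b91c30cb2fe73010c4b64a2d708ef9a23c1ce90859a5c232bf80cb6cd57e66315bd370b721e98ac92e817a32297d899e6a739d280bfe3f137d01c257174322a4edd5294171e738aa14fac542d5569ce13b322d920b39c58b0c1fe8a98a0bd355b3f27f69dea8e170e51bf3e5fab6a1d610a6a078feb9e035ff8a1fa8a323c2fbb3168f162d2f6c80bcf3a8e21737a48008d76206c5678c1e7915fe858fa7bc13a251e86cc633816bae83312282ace72a07592ff326ab19ce486b48b6523b9049c5ae3026976263996868359c5a21b2e36bbd3b81eadbd82de6be26a71f3ff7715701e8598f239f7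4e9f8c6f2b33e3151566c4bf4c47cd8b40e7f15551b807fb89bcabe145a48bb2b3e39faf02d40114997880e5c4b4a4fc6a19a9aa5ce1a74566990ace00d4e835138265882a4ae2a46b33fa1e83974eb475fcbf2441b2f1dfddf2db847772c8ec19c714f60b06cf2effcfb5bb9d76c49cacec513b27cfce933d12c08fee7c8936213c08bbdea4b37491fdcae4da4cc11f98e807d5eeeeae8b46ca25324e6de1a8668f9b36dfe47cae333b3f2909a46e51c50bc1d62b8f971d39527fe446d5a31b4b773974028a1bae719c7819005f10d455c3f5a7a0171ad507787d31d19372ca39c5dccc76ed659b866b3b9e53a505019724a07066bdab7e7430a461016c008458c683319ec69a1327bf37667ad1821b45457306c5c7b3dc2488b62b497269b74cbf49395b5b5cba0df18445e027ecb972b87773e4031cb8174da359c0d7c0ebd4f2292b16dcbf7d90bad2d0545ed4afb80443a7437b911590117d64f3cb2d3f867ebcb113d5e9874785396977eb4ffbb67393a05cd0b6109c8dbbd4418fec4d5fe1585cd9656dc0e3960ee8f89e9df5c5e5b93ce3ecb0460ea85d47cc8dda112da77b10bb3f9507253f6559a1e5303dcde6c3213a3f2dae255237ed379fff764d3d106f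e2a82b14859d191d4568a77190451ec48dcb8594367b324637e6c1efdd76178dd30362a20d12f015264a9a641fc50aaaef2e02004240928b266fcbbb51b669ad1d85992b17777a6a94012e5224a4d654a7139d26a24a067497eaa70a1af2e06daa102a4ee56f5b98dbd64ee4a4ad07c53a787e88da3d3b9af8932bef7039635e396f9d09f567d87be045125cb3474f1aafffa99949514ead4ada5c1fbd7b4257d7075866aa27a0fc70f20c68a0ca27d2587f3bc627cefdff81174ac21bec0be1a84fa2b180cc85aa2e4d5ea2390042dc5e1d45589f6af342b7c3bd04aee56d7c166c8c4bcd79c3ae9a6d4a39c1e2c29bffbb3140ba19c377bfaa8a8d29c53cc981cacd4360c833c4c6ba6b6375b5b4a4fc6f9caf559602d19af2a9227846936b29a43770c7a2135228ef8489bb4dd08c5f8f52c8a1e1e8c9f04c4aad375eff7aafa9e6e4d3db751a7b725e6efceb78f52d8292efb398d6bea9d27b55e42a8484850596d2bc1e277c17fcfee31c86c00659b5bce2d9a55d3a3494e5eb6a9477d3c08daee05dd1576a71ea173d697cb62fee92e99b37e00fd0a442772cabc47e35ecb7123aeb396f79befdb9b977f1de71b0458c18648d155e6bce735345bcdff84f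dd815f6e3294c5cedd0964e09110289ff9aacf6f964936544050dbb65c2ad2fa96ee29ecded79839ba6cb49f343de3358e18069ae72b16fd0e05a8b79616bec5e3bdbe22aa1e8bb283baaddb3f35ed875efb559044ab0b0df09273c5b5372f8cf5c4a6fad5ed198d52540980fc12da8bc4d86ec30d32c8b0f3596dc7f04a204eecdbfc4cb5f77a004a3ade18e1460ae21f118dfa006eb9acf68bbc50662bae7d2584f594bbb55ac06602ef3aa2a71df73d0669a47adb188d334288d09867e7c4f61e1092fa3fd9efefb318e99ebdbaf61cd8230fe116f3c7f7150a314f7cfdbe07aef8fafbecbdf9ca6b7f152047ad72d66c155d0b5d26593833730c091761c3f156bbf1df974e9c171e3504e5a2487c1bed6e018f76d9e48cea2eda3758da0f879b6ea38ee9d07b7555e44cf81e94b8ca1b5a813bba43843bbaf761fc0ccddd8d13c9da34f2c855b91c9b6e4a415ad759cc3764e63ea847aa3283bc1fcf8bc183823dec7753b33f1e2bf717d26a14b20ab6b5b1de1c44832a0b52463c26c396e6890f3e18972632a917117fd999d0446b26a76a52e1f4ae5397eef79c99f35b8d8b9c8605289b51def08cb8fb046956a6ffbcc948e5c71d704ee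13a4781448f2dafb509ee1040fe2d18fa442c7f1416f27d5f61148eeb5d8911c5c25526f354d329140ab7f0ed6f80f8198e3d101a17a4e4183c19b3a8288515ddb3b870b1acbad72e104c37570267ed2a68685275bd469f00a37e7273e6ce1a39cc15b9d3c8b019329fed05bbe92298298e40927268a0ae9ec076b045a06bde3c46b100fc8f10050eff629b923a501164bd6dbcafff89ceaa5f5a0ba204636fe956d4b50540e96d7750cf69480646c1f1801f1d541957ab97bf138a8e23e5b2b4e915fd8f3a83b3525e55be5a1e92abfc837a6b4b898a0273fdf9735319ff7e0193172b8b05618980bb78fd4050b22644dea01b5c78e4e109e2bc15c5c63ddf60be4cd2a87f797e97d1e50bf99c30840b63dd21d5d733b1a063999d202a9a41f31097e0b19ba9a98b658bc60b20c6052a547fd866a4697b45b647ea710a9c03fbceaf16575615aa99576db37d9f7fe9079331ad18e6f9f452533510b4eb3d0c47d0303cb577d69558fc3f65eca6ddecbcc255035ac348f9f599b8cccef6ce1186177752d32863ab890b782d9914f9d89606c0ddd4f7451e43f75c4c542c4cca56f5ec9b0876d2ba313f650da4007d3730de1668abbdcbbd035217330410e79d6a54d081f359888ff75cb7db5572fc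7c83dc9eb2794ac3bbf625ab81a860598f9fb526aa7ab29acaf9d06a63faa6b6acd567432b7cea78f20dc58c1b222c32d5ddbc711909779c23891191ace0d95ae198331f1366661556d7ff6d9593c1a7d2351246b39b3206818818f1709512266414255a6313a8e7974d5887c107010b3341ef48b015ed4c668fb0c33870b3be23a8a60714759da75bdb14e3ce4f7125c7a84f2589968d6b6251f125fe5ca195f21d2b296c74b6218beae47d373bdac9c016b2400b1e0b98bd9fcaacc57b863b11fb6606384fc7ca1cef91f1ffaeb43ae618d117b5e15f18502f3e0aa627fc524094a5278af5f582393ca9998f75acf06d5ab2a668513500df8baa4f32f2ff30232b068a2a566bac6ed51e17d49f557a9b24dcd7ddf34aedd5333263ba8efb061de9e1ffc8a60df36b98e872293283a255159749a2dd0793629e5722bb2bac86fafc233b5a47199024b5028ada50b6c6bf6afa01461460edf903bf5e66bc514c17341ae7df95f377df4cf5f29744e19ec2e603ad7303b353ce606ee32c6677e77f01d631789b2c705bd49b91891e57645158f0cfa945986e96cefd71820b7374339076cbbcede2d65c58b361af113d7a04fbde4039521ca9bd95afee2ec965b6eab36e6e9190c386cabc557d05e860c777a78a7eee816a86484cd7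8fb4a0990b8f948ad53052706c0619866d82d9c6dbb3e1651c876d41fd876f0a49a152719c2e29fc9a1172eaddcfb9b
    (by norm_num) (by decide +kernel)

theorem closeNextPrimeOn_519_535 : CloseNextPrimeOn 519 535 :=
  closeNextPrimeOn_of_certify
    0x18621f11d19a5456b633ff220e18c252cb0a4560cecc75027a3e4a1
    10 11 4 45 4093 1 _ _ 4067 11273209849
    0x13f4feb6e7571d95ac53a2882d7b2612d3c2cd155af2ac82bd3fbf9668dab95cde39be055b357d4408ca4db030f2de7dba1ca1b4919fcbde82fddc00f21d8119e186d7cbf1134881d10e1d7cfb0162b4beb3865ba286f1350f104592e116527c89ae01b8c9518f6e3c4216b4c6406ba4d19d14020fd9925595fe1e6286fe9c9ec9fc24d8131162a389b4a7807f4a2609047498b4fc19eb7bd12befaee1d3042937199d4df617615d2440d45226d940d41aba2a2a2265e040250fbaed55e5a262ec2a5fc5073666813bd301f56ea4e85da39f3621ca031e8172ec7bca4bd6e6a7eaf8c40fab3ff993d3ea304b55c07f8c0351c9918d1df4ae4f34c01e69356feecf54e822b67ccfac5b6c1d2ea07661a09749af6ebec07f62a083d293eacf7dcff8bc51eed60c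7a7ea4a9820da9f5bb66db706737f022fabeddbdb9459be3d20432c20f6180a991bd9a71907348f0917e89a134f56dc44472d7c9eb572863455334a2b49fb60b76239c10e8c49db629ee4b4443b879ddeb34e443a2feb9ef39cb828cdf67522686a2b0b233a8d45e38ef1c53db55b77fce1b6ecbb67ffe6e4adca250ae86e77c9a8ff6ef73d5c0e08ed8f8159176fbac50a9df7af15c3198a75396e2f2c615f501b57540cc567b538d81a00c0f4fa337d4bd86204084d45d985cf656d415f9db7accb535a924b78b6a10314f7c5ecb586d62c0cb533ce78de5962f8c026a77643d02b98e74a70502a5750d042e0ff17ac5f651633af81b6d51f5de90e15f77501f4d2d92d7f3f20b8f5dd6a5f64c272706a002967277bf645258703a5b983e18c53df07a991155d7c071f47d092a7f75573bd71f79d4991b38a717071e877a4701e98826bf7eb1f6910a0d44dc6ce31d8fa3d68332ddbf5843a153f56817fa23a176879d55a74c8229a6364d693e2165323c24f59cb1cfc29839aeefd06fbcf10870c1f23d8ac6f7c19cdb52808f50d5b72d0c26b8dbcccec85f128befc1c8f2c61b738ea049981a9cf8d2e65ab46100b7f3e7bc0db73ec084a5f7c1228848961348287bfd01e30e364d57f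5073625cf2121e9dd7805db557086d857bdbe9cb40fd6d3b85227bb821ed690b42c1101ab4d405743857a308c297aca8b3a4ba73cbd7ff77b83854f6ca87dd8955201c07ce5440242437cf920d397e10eee3b251448c4cd74fe6717b4922358a9628b41e68ee941134ad299557d59fc49800e762ef5abe87dd78aaa2add04875895227b13eeed43ec0a86d4dbb7ef1ec14465ef0861b77acb6bb981763a4910eeab40822e43e49e243a4a7f9f9937d997b6a3f9a921f0511df358b630dc6e4624a4606af70401ed4de672c4ee664be498c9fda36e9e3f5950f734064914605c4389c5886167ac11b0ccc912276b236394f33985d7f0a164266bee261d90ad42653096e5341a830e90528908b01a83d8f7d535e1da8d18a178f72636610d400382c36ae84a6fe88758875597526969ef06eddc893432b710dba376bfb1a6ba0a44d3e2315a20fa51eb73938f63c09726ce016fcede2b2487db7ac013ab926bae5217135f66b45c03bff93524badab04b52d086b3c66b9d3931b413a1698fda1d008fd75f5b73254a9a282772928fe814fd04798b8702fc40d16596849440dfff85ad679a244aecb433d468768ee653105c98c45735fb8a235e6f33e1a38af857bbd69bd77209659a39186528b2468cda300c3eb64872a852fdbdbcb4e990a252870a84f4b79695c1f27cfe9787f9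54b91101dfc5d95a3cfd9135164da4920651827b7a14fe4567cbcface03c88ab79044c91e4c3b47ee9a287a8c44565c8f3d4939924ce63fe46bbc37267d630b3effdd2bf68a4e29a13a22cf9c7e3c71e9b8ff2dd1e40698fb489d2bb3e0be1c3bd4820ceac5b92e4e12b60f504c9eec16198ddab63008ec33f312bb25fdcef20d5d5d05735b24e60b8034c378219c3b476128ea3bc91c3c38c74fdc36d3d2c515011ecedcb5f640bd881be205750ffc5ebe1f4b8163526c270d7d7f66213bedc866ee044aa7a2fa20baa2d9e0140d67e221493691da6182261477b7e7539ebb0b1125e1cbba5cd9338a71df35ee8f9fa8b09beeb0cf371e5c1af10ed00c8d9cc22b659abad2c3780dc7f66b4fc829ded060020dccf721c002ab0e0669ef180ea8e9308a3cce5f4619274cedf06caff277a9db4b42ce8e8970e7b0e115343fcd6684e27b1d4f18494f88a72100c6e97141b162e64b12adbf1967e44f4dac14ae68b9bc4825166f80e9a2767855db3a86eb71021a25fbe2389d13bd9183e7c7e03def4e0cac8accf5168edde7842a60b75bf56a95b487871b3f1ca4e660e4f96215e95339939ee2f29cf2543cedc31f39b5e189269cd263b7c0871f38bcd9a4de585b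d2fcc37e035f27976a142ef34107f1351a9df22b57f6d8812ef22813211396a70425895a29016c1d92374008a551d2fb7153d7ae9ed30287145dc23f4afa3361387dbf00abe7b440e0f95feb3e529ecd114713a37abace2d20421f0b24bd3c45ae2249371a19a34952d42832cca3b6d0d0e6f7a47b23f0e7bd94861c9523f949187ddf615ae1095d86b05bc21462a55cd1473f6643caaf40cbada7e5d724e96514b670eed38522bb97aacc6d761c618084495779838c3c707f1057a6d600d54e59e5e1ca7815582c58380bee885a4272968bf0e4e4572a12912d9e7ba45fe81559c3c85199345e2d74423063c7abca2aec47356e6bb21d0be7ac2bae973bcd09f57848759480761f4132e3d604372244ace14a03b9fb11f06015b4a12dcaa1251098fbd126c4d00e1fb9eaf8961b3565e5e7f79f6d42904a4f12e6ac374f28a413d25ff7a6e2d9767c8293722a575f401dfa059872e6bc8bcc9e030ce9c5b0c4c139891fd90d7a864a141726fe638df26a8f238aedd7e1a6c6bbe15e53919d5a9c4f188f61b6c05c4dfce96d971eef7b4a51374ab7e81750666b5d4c7a0d1fbb79fa9d5a5c552939241cb59a0fde6f33c301ef4c7948261896a98e7c6107ec0921b1c788780e779114582e2ce773e0b2ed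a4838b3de61ba59b6e73c4f22b469374e4747ef9f2386c75a3770bdd936d87a26fc87fc4485d5d7aa6dff4ed0419ae61a3e1da04ce67a515350a1594b969ef736f7d608bd6822d7fbe0805d9d80c0d4a5832434c93ff7be79a4840d712a2dafa65ad8759aef7fca68cc1c890274e604e9996c5a7a560b8615f619463170e88ee34c82a39fd2353889ad0f893137b84a0026d6b571bdf6183de0d32b9c4afcd0904372b088ad63c41d5bbf54956c45934a3dd0e0f6fd27d6b1721488fb90a561c07075ea3f7dad47e9cc486d5286ce8037fc89e2e6319bdde6be47806fdc0a4213a1b6d161542d62863ddc98060c7ac91deaf13cb559e478f9e1357abc0531907f1626a1a61c842408413c7b7c30cd1fe44e78bc378b9faccca964d94b97e3d4e021db0ef15fb59649d23830190133a8e4c137e9bf17a1603cc509171d61e92de28fb8d24a5e334acb851fc742ac7c5c99e086e08c116f82da7981a5a1ee423a5767baa0c30862a047d1bcb441fd9beaaeedadc8e8d8186091c7c782e91cf49fa676b1e57e093209e5f5dc3be47473dc1b98208f92cb8f242e469caf2f60d3a22f03af73e9e840ffc91b0539d5de94662c8fbb49c0d15cbe11cd127c0ca9d7287881e811316c75ec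7153bf9c41fdff2b7015f54f06782c894dcc1916c523e76bf055fbec0a544df5c8cd26316909471db7127a67cbdc9debef3b23764130712be771da083b02b3b7fd04c68b369d28f2fcd3f3e3c68cbfef18fe00bbc3dcc00963211f8420e43d284930ff19b9e09fd4238eb6b6c3554b4da38e1a3610dfc163e4a382cb701dad0b91dbaa46a2e8c9be77b3a1c3ada21a37a7e4f9997faea5cbfd1563cecf921a8411cb25
    (by norm_num) (by decide +kernel)

theorem closeNextPrimeOn_535_551 : CloseNextPrimeOn 535 551 :=
  closeNextPrimeOn_of_certify
    0x107a4eff0aa54afe9921236a0386bb51f335f0e26bc02b12ac9c180cd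
    11 11 11 46 4093 1 _ _ 4190 33363488140
    0x104e54ac5d1c32dbba3a1a3aeb74e4623b84e659f449b55ab5e2c6bdfc79e06531ef6792823658c622ba154d1e56b25d4062f79fef5bde8542a53db285e4ef369e5509ad3cfba4f1d5b87fcb0712944c1595f33473d28f5b923a2b7efaed9a75a26c70ae49bc6aba0520a0d15ab10433e114ab210dc71d53d32cdefeb6592ab6267929c68c0771621b42abe5b2e849841d43216e3e30f95787ebf3922da4b2be849c3a957c54f888f99f0f3b08bad9ceaf0ff7817d3a0da623f1674783311f08041172ad32c6f70604d812bb8f44037be2aef20f6dcf253a80b86affdedeb6fb24df36de19ad0de9678b2fa1cddf6d88a19c5606df61800051441906279f0d930495560e01e11fb49790ba50398f63c7c26f237b4aa7f1bbb6837249713cfed9d38af5232b92348159f0cc2a4a42bc422f13376c58baec2a90390434a983fc4cef55ddca99d5b12869cbcf8c3dfc6367483464ad5bf06203d890a9f9ff5644a286a2656649c7ca12698f810786d4fa58024a005042fc59e8503bf6e6c399c5502821bd85cc8298cb86903fb1a23739d48d9c2b0162cd708cc7d1a5f586d9dc4ad32252db995cce0da64d9660c283956d268b060c2385f27fb4e0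67d01a79ba54dce0dacc490eb836f9565e3fb20277b07be77c9fbdbcd662ac34ccf09a96dd1567cba9afa444f5d6ddfacb55f31ec43dd2285ea5955727106e0f7f6d6ee1cf7731ca6e738889e45112a1bf1ad24281d61571d110072fb648edbfd36d68b0aa7922b3f97a5e9aab2a6b46dddfe0025f31378507f41c854c7f411faf1166d66ee59324e2fae8592ea916c9ebe3548ccb081b0063538b6adea1631ed098a1d6e3a62d39f0ecf2ea5c413974785733eeb378e44a1dc6d7a3b36024231b74b5bf528333e43d7ef8904491e6da998fa46223c2513306e4449c389eab62c9d68bb298d4bd5f5d70e0ad7eca3103135efaaf78fda072fbe3f5225bdcc01f62a86f2aeac7fcc8fad4129a0836deebb37be54f9f1460a50c5e772deaeabc2795c8c95df1746a26bf91ad90c2ec4dc5030d5afe459db26a13150a25aa0ec77a1824e77fc520ad8f775c5df29d9a6a5d1fc0b189990d175d0d3ecbcb862bf55313b17c66904f686e01d06d7bd404d0c927f5808abb2e3df30d4e739184382976196f793b976b22514b491f9627758f4f3586ed4397b4c90aa2c1d6f4d37967e8866717f418d380f82910fec81d20be5070cc1156b45bb8972da2fff1b67a8aed0554cd921807460cf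a93104140adb0e507a700d32c6706ac248fb9963ca8461671a14d25b9990d48ef85befa22812f7eb032e59e8e8ed4865646159299869bd3ddc42bd92e39bc7c2edfa844450df3ae955a5f569bd12d81c0e5d1ed6abee8a1f2d18d14c357f5e881113c61fed5b9a3fff87662d5d73d50cd21c31aad707d27e435f771154c0714bcad2fc3f7243e44b8c76445013d64ef0794d96d0393b12c0e4ef74f73b19d12e0f6ed49c8736e9d425e86f9ef7925b602513914d3fef93d988e6d7af3b084fb43b4f178fdcfa19b984847109bea74865caa91f634e48cbef2a5f1e677bde000ad796f95350cec7125927cece0338ebe95ad22f5883a7ed97befcb82d486d84736b841ff24e70ac1c6225b42f51bb807a2c7ab473317fac8981dfdfa128de65f94363ef401784c8e56034951529173873127c6e6407d7767462bf848704efc8faa819939dbe178e02d81b5c628916f8ad1ce1d3ae5fde0b8caa2dbdf3c539ca6538563af7d5f53d76146b68d9743f66ab406ee8d54bf56ef7c590dbc9d59a62fa4d769a4414ed1793f3d975862bfdb6a474db609f76c173106697f490ea8d80851076c9a6285ad7619a56e7e5aa80db740c2972f791e0ab1eafba0badbc5547fa598fda9a1eb5e9954adf4bec061c9b9360c2ac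ed6eb4be80ab69f9b8c41030cf9ecbdd51db965be983a9aefa35e7749133bfe1d4c11e4cc1bc8ee3aa69f2daed555d8e0a7e0094f4bd1458bb41725b6ab7802bcf997d6f145665ec17eba66e96ffd696895164828563642066aaf98452f369937af5eaceebb205550ffcd95a43db5490407a80df7aa0c20ecada606969adbf77fb0c824fc1b517c8baec01f19eb9064d6796f555d4ea7c4a5b07032c781aa3b39340fb259bf797b2c7d4819371ebe9fdea78059bd2404c6bc69b340c16a6192abf0547466eec80fce7f60a73c8a05d1f39815017b64076d4b3f4ee5cef52be51d194fa5d7df02d97abdd6bcd576546d19621f78debfbcafab472595a638eec1de057e7d34f9dfde062e24b07b8716fc3fd6e6fc12867d2f950e15cc1c4fac1227e0a5031c29e3668667da3e45ac8adf719ea9cad07e9bf8783ef15107b3fc683a2508a67680c63a2463d3a46e0edc4daf04a97f4e95776ca14b978b9c0c9cb730f83ac6565c63cc5df7bd20a66b17879caa0e19fa2e8716dd849d07bbe6fa8a49ecc935dda21adcf310750baa585159ad63ffa8f6f060f022b2b619ad12497267cb74d1d28143ba7b27f181a61595e004109ef11aceef1a6679b3707192b072ae2ef6981ed4d0c573bed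6cf26f332ae527736756c569a04670d06ecd069750fd01d113ce0c84cf0181e740c606c0149048b291965f5e9afecfe9f9cef50c6e6a88bd6836023a9e194f77871fcce626ad96b9d476d458183ebb3951bf76dc90da5d3df8abf7ea9e0a7db01d5c27b85e505d97705b96a920aa0c77297b8e0f79c6393d8b3ae14cf36fae6197dffbf9bda52abb70c537814861c84de25c95d95cf4da48680fc015a99ca3fa6747b4dde8b5210bd7e4b506eb38413b18a5f05e7dd0ee54d3e4ffcd5bc935c4951023a1f94aea07b2851ee5c361ff4cf2da87a2b5fb3d00df3df1ecdb7e9e9ae8372bfcd3df8002982f5007bd771b9f0fa18eec2fcc5261657a73add452b37289582eea404e723e04fd86e3374c97aea5113f87f5018af98a0f970f36a690c726c5883b047e89e9547678b3da85dbaa21b842c3fe3af69afc66ea61baa4c779c9c16227d9cc3a289801613ff524b2a0e92ff48f6915d514c6e70f6cc861a7dd2439e0c8a646d141784cdaee1ef052762fc1d664764ed28ab35686a17113b9fa3199e9b473bd2ced4acd6db8d9e8d4d8e85685141ab6560467c9cf21bd5827f1f8ba76b9bed6aa3b252e40a37ac3ce94de77fe44739befa4c766559aa0aacf97b610afa255e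0ffffebd447708d052de5d4d135b438435aa7896a009b410818afe42e0990c90f9bfa142584b26174a68ff0e75db3892a422ac6ecdf69e16065526b2e1677ae9754d031fbee9156c81244a96793f885a2d9f6ce731f81228adfc7a093f340783137ca2cc09d7b46af7a6cf76fe97b52995a880f8a77b2cf90b97d5331d41ebe22f79c8cc6078b09e540d12d108bd5e603e6531e6d6f5838d53bbd717a016a043d089493fbcaf74fb132c4bcfcb6d19ba6d7e65d72e814753b32f140ce3ab734be2bfc4b92b5364fa905b3b1f9697d9eba7b6f72384902d68f03a0d73c80dbda1f66526f016d9ca982a4d7923e4b2539f4f3d36de0819270067bbb636810d8d87ce4e19a2a5deed2121d347804fcc5ac0a31cf2bd1e8de3675acae91dd37b5d5be9a9b7db5142070379c6042a109650fcbfcdf2fd566385ce7549622f02c375d66f5c2458977247369bf857d408b6b9c24615f2fa10cf8c216d08e1a6eefc1d1c6dd2ebe29c306e604ec6bc19921cdcb3fcc0f24c2b50a5c1d613914556b1080fd3eda97ce924f58f17f2756dc7222d241f92da3a5e5b079c4d2a5517d4c3f85a8b89f294db6afb52e99c140f6d14b57dac0ef1a2684ec624a3c2005958984c8daea2d3c8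b4bf199eb4471d0197ea572ff49d9a612a5e296cd641a4b99df170860ff27645e7c839de160bc219fe3331168224ffc1740a952413df97a44e19c544cbf2c2dec5646931b4486f03eedc589f7504edbc9280d004c23fc17f98f03e04d5f7318c32dee3c75f580144cb15c06527988dd4b71b9b7c11f9568161751cb7cb698f4e8d85aa3dad62b14ad277473d45c3a4336f969f28e0ad0816
    (by norm_num) (by decide +kernel)

theorem closeNextPrimeOn_551_567 : CloseNextPrimeOn 551 567 :=
  closeNextPrimeOn_of_certify
    0xb85853c5471937005122bc3207734fa4d0eb76e51575e1e0eb124d0f57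
    11 11 20 47 4093 1 _ _ 4313 23857689859
    0xa9a021f52938460eb8401bb1180d7b7e2ad2a385d0730187a41b43ea8633e2b977e5e9f98d5e337be92b49869962c519b42e1aaf19ec8e3168224058601c0799b1fc773352fe8d5a7dec505cba5aa218b8a3b5d23b553f041f21863bab79ba8d51d2dfa45fe1edd41d89f3fd52b1782e140be31fe9890975731b4bbcc1d97d197963f8eaceab8a2bca2625a2cc3d438e40626f546fc764e5068a8a97b395daa892e94407e9b158be68571871feba90353b90f199848a86493b6682543ca76aaebe10ba7667bcb6e0c642cfb2881798a386771c817f753f8c5229fe9d703a2254f327d4bb06ae35c462a98a2c3a533bcfe4dfe38160cfb6a22e907cf4c4b8cfe57b26800e3d1d8868262b3251825564117359500422dfc88565825a2128d8935faa6ca58b18818f0e0ac5dab5389c96b38fa052b480681819c38c916e794e4e5f8e6c89c064a6f2514e9e2fe92c132b89cab8fe1019c402b9414895879de23db74a191675d964a168f3e589229781a189c4921058e70fd541ce2fac9025995ee75e5b41279a4fef29f15811acddc686bd377269d7cd9ab395a0dbea4856316a62849438e77191096661e5cdc8d77c3775416ddd0c9534e61b88de460e80553868a2ab45c2da64fb0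84769ad2c948576cf8dbb1c8a295a3de629f43549ad8d3f14a680b9e0baf78abde40e74a065a30052f265089b5806b63152d081bf8ab75e6a7a4b50338cd922395e64f1bc24a423e247f999e82ae082e2d6bd5c6c94220aa824913da7e564288964849cacffe3bb7fbcb545588d3dbb10610962c96788ac5fffc488a515d5cd30a4baa597d11eee904bf90e740708fc802d68411b3d1383a733ba6196db1a0fb5af39383f1bec64b022b0e6dfc2d018da076c16946f1844d74737de682c20c5a0ee6d3a0a3f26bf50a5fd16f6948db0dc8693e8791ab2a803f5b1f1c8306f85124758dbfe8e6829d7454a2158ebfa30aea6769e29d0f701854d8c774efe5cf1238df94b05c13df825b8b8134221e96efda1d33f89e936bf4bb2728d42107018348bf6bfd938c68aad71face43e13fa1c253502d3771f9e12c8023d7a5ba656674accce24c0e2bb3d6d252ac2526b0df8dcfb933ba02eac04bc8ae98650b66fd158c88d1decc6b159f01745a7f9b30c1bfcb49fcaaaa2d54cceda3ed2d9e1b7ce6e3bc3a53c5a6b028ee401684e32b9fb9dd346fb06d9e6474824e06fc81ffd2de43d1cca7d06fe75131c24fc73671890b5af85aca760211a09f712a1e2846d4a9ce83b1229b7fcb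5f195e4735188b645eca899a90fc3b6e69c1dca72f28e0219fc86bc3e6e7d3a6c8d68af4bbb43debec799d624cc6b4cf1ec4bc9f23a84fa7c75f204698db953ef7ea636668ce1795dc9178d94462e5e8d658f540d527fcba05bf3102a138c92258d18fe9842f1444ccbdf104543d1a04b8c36c3b8f11815af72aa3a05128bfd8e9ee9e30b48616ad1a209d8a365d7c9def17e8b799990228f0f3ca404367ce7edc3922dac4122b513a0667ca5014bf6dbe3113ccac5c6103f3dbe579dc881a2677e378cb5a14a47f4f74a10d0cbecce8275484b6c11d8f5285adbfa72681a33e96e4b9e5ffa355d466fbce0c77a4db45bb046c46c9ab6757fa1743d14e5439be1d5161cceafc7617754c1b8e09700bcf3fcb54694a9f613aea2919f1caca21eb494f639fe653ea3b8dd4dbec9a3e1a72d0213d3d5eb5c1928c871e4c648ddafa70bcc1164052fb5fe89e013233658e1d698a534eb6928eb53d018f8577f3d378c14f961dbdc71254114cdf4aff9b3f09678b792174e238dcbdfa9589682d69a059cbd750cad7bacd924542a67dd0057cfc7c040fd55cb414a9178be3f54fdaa96d115d7a775268ca7a5088c61f7fcda1cb729eac87722dd2c3c3a3062faaf70066644f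2d7dd075f8e3fed9922afeef85543f35ad4c4d1c42b066a41b6d4a1b9719a6f519d080d226455c677b3d7839475beccaeee28c54e96730583feeb24686bc87d4134b15e1fa064b714e7ed20a0e2eafeb7f14467073998145199d9b394760cf64b94c1473bb8c9b40fc8f84887bce40675a5ac533d2cb3118de00b7fad1f10b24c47e98565c0e04fc201ceb60be04be17147c7d5740d7561a698bef108171068598711cf84b0db4db27f14f39e043740774bfd6c1df2fb8c1c14bc715d30b45a9aa71a6ce57b708bd069a88149e81c6f5e1224691eda3f4c92b0101f84ad0c803c5aba221109f8495cc7d92447603411c4a74f1e5d66ff5ddb2765976cdaeaf496c04b1f25638e809fee2227db606d0c6b1acbca8cc14d7016e80b36c4d8445b6f5381869c3a890656d40bb23d427ea65a269e5bdbb7d43316b141589a19714aad7c0abc7a8fd3c67b48aca1b59c9dbb7ea129e585ad19b8c0bacd0c3cde270228d11486d598afa51f680b92c463353a65cb313d724b122aa5f323f8dab34b3a07b734489e1bd1575e6c932a699920d5c6c6c99b90848a9f60c3e8c054075079d4eb4676e687dedb2b99069799604a8f666288b3767d22aa0acf15b62a0b3c34ed9d1da300ff3d159e5a0bb8bf0479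6f901626f673386e77229da60b6e55d373c6feb9f472799bc31346905987c78332e77688fdbba70a002687ab106bd9f5ce046cab2e74d239f015f459286b9e7e963daab29c23b0be3a76ed54d978a76c5fa2c1965557c885ee8fedb787472ca7017a4d7f71da46efec91173ca5210a23ef37528b940d44b3f8687dcbbf79a0a08c897e0e2297d87db596acf09559fb2f592d5c217b12d38e245893dc17d615485b8c3bbdd8e33bc31e01347f1c500bafaec78d33ad1dfb76be9f96dee51f54ba96926326a798153cb9e6a088c015c2118296b05f75d2068e8631208372c178b8027a6b4e0d1268f60c9fdec16b9e97c11da110e6ac0415f32565c8c15bc351bdf92318ca2027062784fa613de412754f095cf7c88bf9ab1f997fcdaf02d54264885b1386820b6b6921d0838df0f2b7adb76dd227f97cef9bf0b8ea8d50c02a5cb1b31227768d66e8e718e0f4394577688fa5efa2c5cba82ab57739413703e76a3fe8767fc49bf0c7ce907cd851d5cf870b29ec63ef59a85e910fb1c963aeccba9d9fd223e906d73fba228cd02ae94cabf3eb42ba3e17c8d8bee91412f3484a6c0e4025f59cc9dd600d4bfe66477ddb580ccb6c37180e5f06c52c8ff628d7b1a06b022ec3e14af253ad626cf2768fbb54c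033b0b30947e0f7a15680992269657cf783f3fb0922bfca602f75c965c0371471700f07b967a286dd70f7ca3701b11479d1ab3d07becb303b8a74057e1e005cf8235aaf13f64477f7557a0530e6991f6c9897b278e80e6943d03af773242903cbf7d584c68f40975cc0b626d63f0435170df0d644ccb3b8f796b96fe7a1712cdf9a3825f19b18b78be33ff416d52f27b6cdcee16aaa7ebf740166f20e1ce4fe9b25333ca7e458c4792ce39932676e07d1452463a8905aa52913b1a3d239dd69b6c699ea89b95a34f3d8fcc0748d1218ad3df3fe7f9b52d6e00660a9f6c325ab9952feedece4b9f82cded1d1347f594bd207cdcd25e66c7a40bfbd14c7d97fb45570a0deec9ccf87e8458adbe809a0ab15ebb9822f6908a9f2e1b0da020b5b54753d57249db0b7ee8c78aa618d4db2a379abb617d3f2cca1625211a2a17c0c037b304e85ef5c8db94ae18e9b12b20a0c8058c429eff954a22417a0f87a6924a45e6faca4b85c06a584faf5b600e0d7a09a9121a77b0f52a33fb22cb7372dc6ce497e864599f2797165db2992de9d6ff69edaf60731f477713034a370dc29d8c0599d3d1ca79e5e9938f90402562d0889e83fc17ac9c7eea385f71f6bc4afdff9de8c5f96ca7c3600427a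69452fe69527755ad0e66ffef5b2470d1945b3372fcc528c0684e71a6bd6cc77acbfbcbd8a5b842a982082a29662226b70d6a8dc200c3427d888b23ea78c276dffdcebfaefa7587def4c114740303d23108eec19e4f5124f4a15e8f668d32df3bd3a10bd3031e9b2353f1453b68e85f42eca658e28cdab0172e7c6b4bc9ddb0b142bdd5ba8aafef349d703a8590a8118d72a8b84e2575fd5e2971484736d6afd279f2b86fafee4027e4e94bac09767faec5d5c852a914bd89bdd3ea06e067421cd467e8f8e9c6b8f378ea0dc8601f89601b6e78f105f9aadbe16a7686ce423cc504885cb7cb7d8fd915afc3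
    (by norm_num) (by decide +kernel)

theorem closeNextPrimeOn_567_583 : CloseNextPrimeOn 567 583 :=
  closeNextPrimeOn_of_certify
    0x613e7ff8a1f85a1687cccdbc781420f4564125d0ea29162e50a0c06c6689bd
    11 12 3 48 4093 1 _ _ 4438 353334784
    0x166b43baa5887d0466417441fcfbb8becd5306090d394a05c64ca942f2b89572fd577695771dfea232d85b9d1fc49050ac282e5f0059e55ec1d884b86da35d1eb6ab28971d7de8bf3511dd0677fab6c3f56cfa0947735708c1ec34b197c576f77c0e512f1260455d2fbae9ec0a7d1f528b070217a4cfa61ce5611e87fe25f83a79b69131698c349ac25e770c2454e751bcd526d5d572ec3ab96e141a5469c3f62275f6042430d6bf06ae08ee62dec63964dd63412eba4998b655c1e6b4a93c6aee4d636407b9d9e8ee37199006c45461648f8392ebb615ae692b2e2a34c7fbf8b64a3193bb62de327c96fc7eedad74c6d8ae4e83b73e63cda03f9b1e2a724ef49b29a137720fe119b6dde6f497fc2ede3d4eec19b9913ab884eece628d42db83f7e7f823eea63c84f4fbc66a9f1cfe45e12939307d0f2b0f7e7e7ed8de8bd3017b691820252f72e594565b4e15d94275247491a8df1427edd461cf0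5636228251738583e8488b57ee4e8fea224e125ca0a3ed1477c36de91cc747cf437e5e0ff188d9e06a258f9b32f0b1dade1ea97027c023587f210ba033306d10554ec61dfdade67bbd0bb9b6d2abad0fb12a4d7d35c773365688d33dd2e3561d03624153256b5b625bf9f88a49357da342a7073ac551f5c7d0f92500d7bb1f1ca7fa2a119cf776df59dcaf6d558081f8a37ecb2e8fa4e3a92b93c0b9ed1bc426abfded0521327b6d981c8bdc73e3e65f012a6bc7e7ef7f0831c451780980e8fceaefdc39eac545ba287f1c7fac068aafb52493a720febeb081eb6289f6c29f1f1435b6bc1704cb514488a6d125ffb41de0b51ec77a46e6d4d42fc2c3279eb4f6fee1aabe5445e0f60b425e397a90eb39c648b132a4e1a11eb45d5fa0df3e3dc31172799e83963020ca6f1cfbe5ac0998b7e6825b77ddb0bc88aefd18e9692ceb3be120ec4101941f137b9d1e43279d8cc8b7afdee1511d44e4bff2aa6d590b0744086e86524d4d0a537bc6668c72a631f9136a78dc9f1063fec7f6aac0606ee5e9b0dc4564722bff8a908bfd72e54abde637fa30120ebf629b8c0e08299391df60f735aa02eadee237ba0850115566ecdacb8fe8ade64c03df3a98f5d8f21c3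7f0b1b9e15141e7613089caa4b5344fb13d38f059f6502997cf3d0f1027f58491b09a24c6daf0d11ccb7f947127a7d22c891ad808db85dabe9f1e05de2c45b6159e6eace7214a20bcafc26f2e23ec5d9c63eed4fef741cb4e6a261b777fc1be2ce6ee522bc0e6c001033da1671c4a4e286b1307b2d7f72a198e7a0c194fb1c7479ae7dfdf9fac4bea7723e9d913687185f58d7a5c9e9257e2680972aa09dd7dd046a02dc338c10c017b8a4506e06a2a5aada4909d870fdbf441ac0cc5c922778786774f7dfe81856d766612cad7161f84241e9500527fc32c3f428e954c545e66092bc36e787b89fe4a926a8db58338d243768777ae21d462194880df391f99689afd0bb3efdc7e165e5ccaade10d605767ebb58504267132b789af0589af00c9b3a6726aafe047297b8d862e8e2cc4d6a6df9d315ae0b4e2bc091315c962e49dcb663d2d843281a04eab0abe278ec18f8e44940488658d4968d1c89cf58388d6ca8ddb744cc42e8e289f1f8690f82e0298b8037921343c9b48124704e1d3d82ec4bfe479640f5045add9631c5c65551c2515d35621693806b70e7ab94c7d0245fcbfd357a94fe9c44aa2087a9c5e29c7efe3a5460a3d6222dc4fe7526c2a07ff6419ad3926eb9de194737649b4e6d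48da3f07ff809d1e99ef14ff355b698e7cd513f2ee45d9e4130ef3d437056fff85832efceef9330811f0d2410871a6e1ea193118f41eda29d8d9266d6eef6a95420a8e05ffba55d05c2170f1d307a91de9671a23d94c65db63d78bf3d76d4e87d26aef79e644aa3f59e753d8151944c403778e32374c608efd14fdda494d4fc3ecc4db135d9feb69602840727fe830e7bea544e81bf5bae227d2d01ef670cab24878487202a5f303b6712593a24b9314e4acaf27d083d4abd796983d25ef2d1e144c4701200a1f85069ffe3090d71309d0ab2ac412a49e2f98daba5e47483bfecfd272aa4f43e409649bb4b07bd2c3c8f376c560bed9eece58f50f14f0df78afc886aed2987f04c4157011e72c2976cb46f65bdfdcd60c82f32bcff16b0732b9d138c15556de5f2d3cd9ba140a2b5bba3967a3b1a4128301ec0869571f46269cbd495825519dbdf786f64c44f17b1b1540a0b90ad084ff816bf9c71e61fa4c9ede27be8e54b2bade76e3caace9fbfde0eb5f187bc927c8955dcefa2a7aa0bf2909e2de956fd4fcc0c2e5adb050c1ea09e64073418db3193590a4922f6cfcad43f5a9baf88fc5d51f73fda99afaf0d5d046fd19bee00bca49f24b13c4af64a600c9555936b6a6afa4041b6dabfd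aef2be3fc47cd8aebbba33423fcaba1f5eb56955286878f0c2318d2f747cb966842f94ac7cad85c4423430016b03cde8fe3280c47d67e0b3dfd29069ec44bf1dbc6c880315c5c556eb7e6b3103ac1fef6303d2acb4ddb9b87fdf535e4711b55bb09b691ec4ef4e344e9fcc0bb8b050c92af0c9ea52b931236392a9f013f716995882efcbe36fe8474e88188a882aab726ea092e081ced3ad9c6715a8165eab427bc1f44da0ef8963686436fd3acda5281447e5e4c1d23faadd3b9ea2057bb1c2163023240f5417edd98e2b6752afbaadaf6a231ce5e84e2ef20990d50188a2f95bc0dc2ce9252c4df4f436e636102ac590722b3dca0794709c51456299639622c787dca7c23b64194a4ff15f5ef21c6321e9f0e3049ff6ee0a2f96773c799d9c43b2a66f5f5e6c430a6a7b6ac9bb5dab1c9ed0021fdcc79c78378730f4cd8fe1124b733ecaafe4e427afdbf4f9d45bd34ad662f4c6f8975870e96545247eebde4eb580775ded3e389ec3de7158eaa8f2e43df5434592319084f7ea6dd56ba916ff78a9462cbda4b4fe11317a533457c321dff271a036725812a4081c4942491dd4a52ecc815ec2dc60f662175cec3f420124aed93accd35cec35e1aafa2ff207179e0efc07b69623d3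df5579d4a804fd5d4169ef7e4b24713824b78b73913b96863536e2e56115ca868cb75522e6989dc41193f3532b75b0e9d4d7093d57c576adef9e1f89f0dc32ce0a1af1b3b6a75c511dc1aaaf38924ebf20143ac35d716aa87fc5e10d6823637302debeeee2d86aebd2773845619880e557c9344a6cdb3c879c12914f3d39708f1ad8c1d1a223ccbf10c0abf8960eb11098410ae488ef27779cded91426ef67b64b48f74a3a7d6b5e95682d1d7381c0cacd6492595fac03dda437e1dc2f01d195f6c718fcf6b032c09a0cc3cf54ecff0740d89e1513e9e723bf0e5b2a53ec835af896091a8a655c02117438e7c74e92300359e6281090a0998e9a2dcc6176ecd7750f37a1b04426d978d9436e035e244d81bdde8093a54181a28175602c93e3b2f43eb79057bbd18c437fec01ae5bf6e388fd48bc9c144a551b708b5d4c05af884023a356ce72286cdaf0374648131206cf3d370dd5268bfda8ce1a88aa58ff6977c54718d01bc186c6df885c044dadee21b72c9f2e2ab255309d00375e52bc0a2b9f46aa72feb37943ae41dcfbd877e54b34285dd2b11092e2e7047ae3abd1e1b38793e27e8427a2b220e1b6ccda78928ae05b684b9a35bc0a593f0f8c23b9230472916a02c21b82e192aa3b84c4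a3ad3503067a33adad9814438dbcb7c38d23cb3277c4b80b20a30298114e59e9c16d022a3cfc45d17f02ce869a82881bea76d6686e1eb80f4f7fe68176cfb230dca13e2740fa5e5aec2d105322e576e382864c5b41bd8bbc9f16c8f8d5236f9627064ff55e1cf15fc54736ca7c9b7b90822b3337bf904c6ff1bf72ba22e149c1c2771ca11d5c05fdecfaf1c157e788bd06c888d2cf6a62c5fd397ca50334fbd2a19428074c42fd0dc8dec499199a8fe8c79f2e8442314e2a5c9f5e85445a02af260931a6c077cfdac0960895fc8184af2a34fff8756010988849d998780ba0719d2fc30e942abfe079db46bf7bb514aed18198dc19738c6a0a53d7acec92dbaff82d0e56e50da8973340230715f8576e8895574ff7094cca5934f95e18b5a64dddb27339d583284fbf745a4dca8440c131fc512ccbe1a9d4f591a1b96cd366bc2dabfa058b96ab51bee40f852f3c279eb831d3a1d2dd1a49f5da6348a8d6c1e8fa3de8850d053075a2c2c32bf0d39c1a2238a7166e0bbc6c61ab08d6a0a037daa7f7e3bc3499c8bcb64ad845e557a86190b36179a5af2848ce8a17322a929074cfb1e5af0f070cf6e3825b43c40f7344bfa64b1cf0784cc02bc2a4da8c8f4b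9f
    (by norm_num) (by decide +kernel)

theorem closeNextPrimeOn_583_599 : CloseNextPrimeOn 583 599 :=
  closeNextPrimeOn_of_certify
    0x49501e7a721c3beafc61671b16872cd835071d828088f9b8eac93111b94dd77d
    12 12 11 49 4093 1 _ _ 4561 468672055
    0x72055e310db31b5af71c52eec020bbab7929df291c2cb0e1ce5233cef68185a3632212fdc15c4d5c048345ac64c3705d6b6c13f78f5efa20e4d2bf223a4328bab1bb4a8d5845881acfdd45dbbb852c77bce672994cbeecf13afd362df73d6834bd313b23f47c22f3c162b8cfcd068674b0a62bae53d0173f6a504bc10c1e236095e7116e78028f50fe7b781d6c1a735ff83a68be40fea5560ebad7ab94262ff11f49bee3b0bb250cf1da13b54eaa76f25322e3727a0c802c7432070ca3d14780c4ab50f81ef3af73ed2e62f672f92decd24843c279025cbca815f346a25031e50633460b19979cb96daa02db015cc10a2ea3e0b0d68b246200b8df7d838a7d5a9bf4378c1fb0e65f3baa4cbd94c611a26a91e8e5c6d4c9b6e6eb400a0bbfead8785b1a925838708b5771897338ccd58465ce015bf7edfbd57505b6c0ebbfcf3d31385ed476931dbc37124f4b9d103e81e7c6f6f6875de77b19ba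4e8251cfb35db499cfb23e1bd52c65a5cf97606a811ff51fcc2007d7ab0b3b5f1efa982d2e983b09196d6c635eb6fcf055ce36a60a27e94cfd1ad8029b516eff593e1531e2098b5455723030ca6adbd3fcc60edf3dd9ebe57869e8e4ad510e7c3ab1a2bf575bcf09c658ed2a8a7ce8d3d83427c3e7901649bdbfb0e8d1692a87566268b87ad9dc3a72a773096bb848b4dedbea81df0ca229f5caa458c7292024734b42e2dd679f07cebc3639c8c0da5c573ad98928ce8a6eb3d73f57a3387a4cbbf3a24b06beb04c14b93954c60ee02c512f54c168a1c9c465360567cbd925c98f2ecf153bf6d04345fe542a03d7e47d245aa2b9f2926e4d0055a0399b751c5f79e8b1f401904660ebe2c98477f09c5b23b45b3f4a1907a13e647ff58c4cc0d3734639bc385d84fdb20ba5f7531ebd41762ea6d0736a2aac5f2f711a220670d596f8444a5092be8c72660ad7269f8ac3fb0567592fdcc0fc251f9d4ccfbf2589e6c674fad98cb39a0fa228d83333a727c979c42d0f24baff3cf86187e36a1d456d0ecf5ffb3418b10a7f09788e7fa03d187736f9a05add3e468f51da40ebbc7debd08ad20902af85edf3f97d8a8cd284102c55f8f9d1d5c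9c4f0ba6e20fc5dea133bf27daa8be94352ea583af4f2bb87e4e3dcc4ebe4cc0b6bc18d3c8610611f46d789234dc3f4ac8af016e40225b3b78643eeefc2c555514c0220a537a4495f4fb0e759bbf93d8ae146b42c5236670b2adfbfa70dcda110b64ef1568d0f3062f3a0b0ff09306c772406087b7c432f360ff90a5c4d72338a5336c681010e1b3e373dba6a3d3413a5d6335f9e0bbd9f2d410fcdab9f7ac82fc38b66c4842758583a89edf672ef686f5e32f6731ab2828212b1a0dddec067628942a8e061bbe63e1373e6764cfb81790e82af71e88c7357a57d03cad422b0a81082d77fd63eada21cefdf5632eb256b1c501fa43e649fe79a9806ba0f576705d6a5487f3c5788a5b5f0e58879214e76f4aed474457ae0cc13ef403142b645a3ecbbddac6d08586bfed832ce7dc33cf9c949bfff10f5e216b743b9d694d5b3cff36d5e7136355921fe79fd9ee333bb544b513d3e21ce78aca8314cefa6673f1f7bd4ae05cd49a2ee9126273b87bf0d0d00832858fdd73d3e0ce8699792c749aaf3babee3411f6c965b9d6b3235b7f4d8dcc7296e3a4c9981ae3764684cb0138e86549f1406d4e88f43f02e8b61bc87587c1fba34ae026abe69c0d23ccf01d3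efb10a3de74b912df75d2408367cf788f5b9ed5fe1cfc755d1c3efe339b8a4aeba7295ea5ca211bc67cf8aa4d0e1b3b83bc8a72766eba4f4bc0f630004156530eaa332f1ddc239ec8168ccf6403bd0d559bfdf7c3785f875217f9b3482a42656cdc771ba719703beb19a0eba6945adce6472b5c4fce02f611174651db6a65d5dc8cda475ac61958e190246243630f0501f62f223bd8fbb505a4ac64656c705af067605e8783f076030065ded9623b18c3f538a5ce596be3bb7440dff2859df073f0c18382a5ae5bcccd2bc6a34656bbd96d7958370bb5b341b28d8725160d3b53a59325e90821745959c47e79d79f69de034033d63772caf3092a1217b0de2888978e26c60ee23fdf846ce5b71b0706e6a0e324bfcbc7fb41df0b1964ce15cea6f350089d626e36ba14e99bfe53285bfc42cfeacedb219319670b65fc7c2096efa2300084e6932b87ac1dff9373275acb5ed4614b9a525264db8094eb8bcd493b69fb511ae2952335cf4366bcec4872349e61b22542367e10e9e30cd467edebedf2cb2227d1571a2b6b250c12ef3777234da4abd4e95f677f17f8b822ea0e3ead7d077502d06bebcc3b9bd53196ddda6635a1e8693a8425362aa6da7733b2804380ea2a5abfdc0a6a5f0e09336f48b2f85eb82f8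2aef49c80f0e1d59d9a12b7ebfc5eb67f23bf85ebc2d8252de562918a616ddb8db58d4da1e9d6debf56266d7e7529fae6787ce677fa364ea50df0136f1811c1cbdb318b7ed0463988f67dd15dcdf9ffd61d62e0c84dbac963b328a2b232301642a2613c7f494f43ff26bccd22b88947bd06ebc74a55edb444426596df408a45a9e52dc453bc3a6d664b8af60672e38a4c579f6c6b9853aaeea2d2e0d99dfb49b0567dc36d85debe2f3f4d704bf6787f570cb94022077018f7a9190f12f29f54e1a47a3fc3ed40368f96e1136d55efeee4031e7746d8a102749f95adcf70e3163e8075021b8c367df164c6cc5edbe8c7ea7cea315efde63476b22a2c6c7cc75b348e5a822972f3603ebe7df7351dff3f8af80c15c182232fa7a2b897ad266bb61066be76704d9216fa2fc7869acd93102f5a7ae325d02bb0c84b0942e80f6b2da2c1b5080602ec80360f1ea17b1c568a1ee70a62946d14b463578b9ed13e0855c9a70804615414cd13411381ba91f836c3ca56ea927d7a75fcc185f5f7aa87f8f1041e1a9a310c338fd17ca5faceb870a19319495b72e4b90a88cf974a6b262a59ab1c05b418f07f881229cc72aaec9b2c9637952890e5ab9f6c2abdbbda1160c5409db51b40f42d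589d25cd4ddacd5a8728e1e192426cc24b68156f7a319d0cbb9ed547c2d37e53601bc320ca7bcbe970d825f6cfdc271b52e968e57e04ece548808e8233d641a739cf6a4dd8cffee35c44c16962c9211f08c31a69a529c89724b15dcb5b17c798641a7aeae12cb0b8a4704c55690c6144f74925f8aedf93454e3b321dc69772c90157873532b8bd7692c05922e684aff2fc9c310a2ad03809f9b66f6b50da0936344fdb28865ed776c01add8c76d4a4efa89c3b4c1a2ee793725a0b6560d022e4ba1b8d87a776a40f9bd8b114d8037a2695e84e418c7c23569fb80244d8cd2138c81d901e088bb40c92903ac4440b69a083f706a7cc5922fb9f4014e0f0afb5dfea8abe8fddef8137a25dca06c5a4233d74c0b060cf965885fa57eda6bb5c6a84738de119113ca6a7c599a804ac7caecd463810ebab1ac5077117d67bd6bd34de276b3183afb65bdac31a39148ce63b6d29866cadc81439403612939f0c2b863e78a5438399a5d2c205d5aad7bf371b90d2871baeeaa2f46459ec8d12761c7e2bc310a39d94433a9161dbf0d5e44a80aae2e89f45db4430da2aaf2912d117907ee732f233dc75ebc0fe03af30474dfd471721eca2220110bbf6194fe61bea0d55cee3fa4ebe8f286dbf03147cbd6e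b35dae1d58db6abfae7004a19cf8c45b0edc6bce34a56f5988c5ef65c0f51bde2675b48a4542233d3d10947db749ccc4f83429ae7c230cec948259fdf9a51447b20d95a3c6165644290f00851f9b5baafbd56e5c183ea5767d50cae5b82487dd2f67f35b61ce6e4cddc0cb3d88c8af42b2f909de71b476df894a3a5bf0a1a7fa0f8469470296c91fe03f099ccf95b303aa73e483fa8592c271cc45358d20f3dbdd76119ee3ee0f79f319a5298a694a7aa3068d8694d3e334e5d80859aea477146365678cd7d561b5fc187b7582446b282f37265b10d5b9bee7865cf169496933d1fbe021a7ca39cc29df160e1d9c1917082946d54543822df0d59d6652ac4980dbc53750df00773b021227c1306ebeda68758f1623e10fb2da4db432354efba155d995a68b07b59b8855830ae08f2657d6b6c74224317b15a3c4159464d8cfb61107e3370b70996982475b278fa6032a8e93cde0ed47ca8f52a7f41c8e32628fc8025af7171e995e80aca72d4b9b6ac5ec5fd35619e5159fbc4ed2e7e3c3f833e3c66785eb7b8a3054f117b9c9d869cf82307d0d77b82556edc6c4affb880a209cdc9bcfa3fbf51b80e7cfd3fbd121d269f151d4032908526903e33bc269283b947239ce469dffcf2062870dfb64f68835afcd437b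89439cae005e553017de1778d4aa28b51d7c10a28821b367644e343557d847ecb7bd0e46d157a47c9cdc8a862ff00dd45c0d141de403a5c78547bf5a23e66f71d4a9db90fe783d969f1a87b8412c70ecc27028a3c8e1c91fbdb257c1288d3237941035b66b
    (by norm_num) (by decide +kernel)

theorem closeNextPrimeOn_599_615 : CloseNextPrimeOn 599 615 :=
  closeNextPrimeOn_of_certify
    0x386aa77439cfba1bd436f457d856058260ce79b56ce9682b4cacd2c2a398e6d331
    12 12 20 50 4093 1 _ _ 4685 304517878
    0x5bb322575ff4d73a06b22e1219c81fb06fca05e9a148545c2d2381cc088795afe7d014d2a708565e49db1eb2faa20cfad6f8678be016d9ad7831b5dbfd71058e4e469186c5e719420dbb5d08d65f7966228235c001d3da09590d8425700ec2e7641e675e4cfabe5c52e74e69fcb32d9e790e3f4a6902259988a2d1263a462e521faad5b4764de1b2e548e5e1eb2fb5b9756599ee9316f4755fe8fe32dd006652ed0546450751fc57e67c8f68de8ca766ec2c2ed2f8f58353467083b17be4ec149e331c438818fbb7a4ace87f4214a86eed4b56687eaf986be91e3fd6658a87154d6a5fe371b3b17e96352830c44f53eea4b31ff35fdbf8636bb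e1bf8ba3902ebc8ca692bcf723771a94ddda19242d6a6cce210d1b9f513f17173d2d521c2b0556d0ca0422e4a68f979db31a85b2aaa134e4479cedce2096533a9e5b6a8ac2377c973a3ee50fdfe5f03044465fafdd4c032108cb45d527f79a2f00b43ea47c367389ca2e1c354ec33c269ce09432e7cec223d32175098b895d06bc2da8ff409fa835ea9d710d30e215d042b2de3e205a1da80f9db6abd3ad5bff0c61b7383b00d0cd2beca6ab9f821bd80598ab5fd36960762e33c21adee5bbf18842213ced9757f298b8e6431d92723ff3b11fe2ddd4093d8748db2a0035cb6914bb1475b47db0aee2402974eb7b31f2cc72f2529b595e703380757ad5ee935de5d07651a6e339a77681471793978c9fd0bddb70182e9cb2288c6922ada899bd594f3d8bee4d2f96b2a155b4456e7b84a2ca0330b7f86480b6958af076e1e0ef0a0532f62b48f826261341abba335d7ce3889930b7bfa8220b69dee875b659b48af14b6c74c793ab756a320def90b95d202d1a08d6d7b2d2809e7460e9f19b014e79ee99af8b88f62e85f768033c42c17d4fe6ff895a78c63cd5eb59e2d8c5df9b38682c6fe8ddfc3e790444230ce48573971d1bb74c40ac0e3610ed4235d5c7012926544bfda262653649b05a3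0d6180062cf2933e2fc8abfbc8526a76dd7c86166198e6151a950168c3d98b4cb3ca97c1e763ee03a0fba724c59de9266c00690a8a7c4932d34df913ac2fb1e2b4bd0a0375a114dea9c8d031e3939697379673c168b0f50dd7792b2d3d001443decb0ba678cff287b4126cfe8507be2872a113967e3ebd943b0acaf6576c42ff806f64b727d75280d94868408ff7c5912ea7dfadb12405075cb7effb0f778d5d783e30ce622d93c3d6dbfc1ee840d326f77c5117b60af7f04822935ee6fbdc863857107163b5ec44b51a701db168ad7b6f7733bcdcaaac3c6403d30cdab0b94945daadbc9cc31dcc6794500bbfb43e91a0b0c3d3ff0965b1168a759ea788ead24ea8fb2ca51b54d863305f18aeab8fe165497f35356a8dafe94bcc85bf0548c6e575fecba83e88aa99d85e91cf55f2a41a29f13d13c22fd0cb2c9938703c1fe3879291741ebff4da06941a7936978e456976780dfc69cb617a2ab368c1753f2e0ad1d865667c2b74545b9ab258e4c1d1638d595f243bb09abbb276f40a7764d66eb2da05537142b82ade5839c6ef5c1edc81a80d43d14dd4993dce557a6ba75f99a8326fdb530aa61d7f0d71c5fdc0f9cfdd563f08e96c00184aec53b72512f45808ce143b4660f9349006b0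d867a9aa2e42bcccb0357cac0f13cb6b11bfdc4018bdc8634871bdecd23491331c2c3d08e085f6f9a3585d54dd6298e5bef46b4d0290c89871a9a459329b9fb6afb79b77a1939e1a38ea4313378d3bea26fb01de4eb5e77c6e2a90dedcc7a0668b082901a26eae226b610ae96ec09924cb0693cb0477b5ca9cb13c9b6cfc3a794db4ef4c732431c6c2b4065097e3e5faf549a419cfe26b2a401336407d9101eca7a0bbf9ee1db29595f225ad3a009556cd0a0f947ed3e956d5e4388a2caa79b2b8ee822ea8439e82191463010f2c73846b79a21dee71af7e4fffe1819aebdb388b25a2522326ba3e290aa9c442b1dc951719a41a7ba1d7b20e83ece6e211eac3482a38e83e162710e302ea418c32b42cf5462594b6ef2e21c5480c2fee1e35d9eb2191f95a9f937ff0fb5b6ab4e7fd8ee2b09719a5b36eed8870b214ad4252b88a907b6f93dcd82f3cf1c0597004994065b6e4195965341e7735526b2ced7a8863deb053a540f14f42b5ccc8ef363048761f9f719e83ec57136032bcc07e8c3ebe82bece293668c641272c0bc32e4ed1d5811f2d495bcb8fd49c219b4a8ed8c0ae08d5f6290ee4216e6091b48e63fc51781899ff6523a0c59fa62a2683254b2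d0707bed5e033966699bc137350af0612cc0acac2983e56acf47c852462eea4c511abf68d949f9531bfe8924294deead1fcbb39b91a3daf2f456e6d262944decd6815521376f32fc79f16570c66aa427d08f0920cb1738e9b14576abbe27a410ebf0d6ef7b9933b6326bc5f13422d67d52bef25b2c1680864ffa238d3f95383d87a87abefdfc0fd49a6e37db8e32d8ac1d436597a1f75337c599e48ac69d84bc2dce9e31989acb3e389dad1f52de0fea6466911b92f498443f26fccfd2d5b28f29a340b8cfb487036d755e4d6c15ae8944a73827d86849399e7c4f7eba653588b38df752b88607b29d5e74f6369f4cabd197b50c81ada08ec195c14b9897c9fce55e49b315434df2d8c35bd621435ad05aca4de54dca0b23653bce80ee66dd250f6229c3db6117cb53df8d65ea1a83b741d5050e66e4ca599fbbd5572eef73d533e953bb52a01fbd9a0dbfd3984bb09272b531da48fa3c17b97dfaa5746686714ac673fa70b1196d4d27855fe1da6ce6ca21e20f2f14f6741cd8eff386d9041f7e5ee7469baa6510e13c7db7048ce652cb05a45a6abe025af109a19e017d5a524e2eab09e01e17cd4bde6b6adbce6d63f749617cb32f115d0ba25b7f6beaeaf909a885f9c82543207c64f2fb8aad2e31e854bd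d23069bd9393b45c67a0185402f15d61dba94c555a35a70187ba21085209e453c45fedfc00db4c9977a3e552867449b49d040befd4c1540aeb9b39f8930ac27ae957c466473410ff21410e8c0e916d7b42d77f6c80be039b1ae9e7163a45a67eacd48f254744b303452c84dbe878bfa1cc1eb9d753b1c8d778c9ca44a61a339f364f0b1d2a485bd03c2c9b901cf57c540986b63248a72005afd096be45e95edd905bebd0da95f6eb5a6365cfe22c89e1d718e245bf5565099b127b1c7728120385fde021abc7f9294fe3a11f43bd0304607a190ecc0aa83d4b46d9844370a69f82e1f686f4a997817a94cb7e99633ad901613ee5bd09e68b1cf2f65e53313e61ba1f8bfe6f6dbf72fd59aa5057bfe778d4798bf2b3f685bb01b5a25cd5f6efd82b5e44fc598dee82eea07e057d48cdc8c4f722da8db6c9d0383dc5d00cbee2b32335609c2852d178ca87b979bb3e345e9b2b579159b85b5470ecc288be211cc59e8bac40081ff52708939c6c766b7e82861f20dc2bdcc72e6f202665abdd5d6e36208e13fdee1f3f434083927b834ff9eee15c4169bfa1bae7e918764c66965339b09131444a2e6516ac8186e60c77c438593837730ad6b76a5e611bd6ee99a62763ae2e0575eac9b909ca857161aaae532d1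ea63a8bb73e8466c1ff2cb76bb2cb15e241d3de89e6e57db2224ef342c8c0bf5af263fdffdd75a39f58460347c2be9a2f47281d1cf114c505a3edd4a8a92da9a7ff692ecd6f0e37f1e3f889dd69ce883c4a7b81223f53f1c3d011860ae4f20353ae70b1e659c4dfb4e0ec486097cc22215d13d3ae92386e57856be3dc33e4d7241b77c0eeeedd4b2380870f37e48626b6751b1b27d99211f53aa7cbcbbee8700878022791fda9b22a8ab50613b19ce2f81a994e35dab8b5c5ef0ff4b02e74cc4f5caab1dfe56782f5368c3dffaf323552291166a9339fdd33e6451abc3e6474e3922bd5d7362a07d75c9a027309c41d9150de55d222aed5394caf9d36852461770df01c870ffd039ffb456c4248c1dc9f7ae698352fab53976b5ed2d35e7a2501f861229d735a9c192dadd7941d6094ce330b76c6f1994ff4b133991b621f658a6050479d5cee86125cc573ee096876ea63f31253f2e426420d193cb786968952339a131cb4a5fa63c27af81fec435084c08a8b6cee2574e48270ac3ab32e3bca437cd9aae7c57b17ba92e0ca211697832af7087106b4e19ce4cdf6cb163ed75b08306399ab950524f367a6eaf6d479fd174c06bb2ba20d6655f28861e7cb0f7ef63c667e486e6b38b2403a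8079d64f37e66aae4376cee16f3807a1314728e4e4772c23bc7435daba490899097419f1bf8d714b4d2971f6b71c6e32bbfb8fe37efb4e607cb6ff5efa39dec0aa60d077dc874cf4d72ce37996689085b26d1920196ed7d8d6fbff9d1d07f0e4b3ac6c3d4a84196c95e6990d71dd156ca2888fdb78d3f7c532d4377a457c0881c30d965298cad29318f08d4c96895d2916457a26cf3e5401134990b77cfadcca62ed53bc1b436349983a3bf117aa76f27fbcf2f07eef66d682866ce0990315093e4bcd1adf09406e9fade9ca9c031a6479e0397219347f471cc7a61f53c8b81defed1ca7bf47fd0b8252592879af562e62c834f1fd10b8a8bfe61c571d5bdad79924f7614a20dd9ffef6b1f74f5a849fdba32905ff876c43e3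
    (by norm_num) (by decide +kernel)

theorem closeNextPrimeOn_615_631 : CloseNextPrimeOn 615 631 :=
  closeNextPrimeOn_of_certify
    0x2bdae82b58f079aba1f6b7f0492ade485940809c07a96ff9a89a57d54d2bdb6e2b17
    12 13 4 51 4093 1 _ _ 4808 391741600
    0x3d39d918d49aa035e551ca3757d10c0a4c7f98d7ec408ca8e639bfe6666b0ceb9ef7b69839168c0eb67f5dd560248317f795f63b55fcea5b2ce1735d93c3e72fabad15da3a9bbf1c17857fa35e1dd491c936329bbdac28d66005dfaf7a2a85b135ef7e9b422ca6b1a68d5118180e7f4d8dbd75382e7d25b45d5fd09e419ef77ddadd5a085f039c2a53a6a052c891b597aa9025da121eeeaf6fcf3b274babc3f75c1f5f54156e74b33fc6a24609771166bd980c81cccb5b2d6c40ebaf7509d9fe6c5ff3a7156ba892fad96243c6bb907745e265d9972d99214152466436fc9e46258792555594a53fca65286bf5349b4fc72872f3fd8847235b1d3c6801d094c6b3c05bc75cdbffd68005816a64b13bb8b772f7ec2a4a536e8647a6ee1e2b0f95922dd8ab22344e978b91660533c896965b05eb3e45cce1943e5c3b1bd92fb9b13b15e6d4db810664329578c2e5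ffbc1f9f56ad919757da7770ff07757e50babca113fcf30271f57e739d3ceec6cd15d0bffe2275707be3bcc7586b656afbf2abb14ff9f993a74905ac2b3412585f02cf6f0a737f72c5b5143777b351b208ee36f1a1e4dd686b2801f014c7db654699f6bbc3f192eba098935d229677fbd31262dc8b980e63d78b30fd57493312363ef9161dc31a2dd9dd1784477670186827b263b01abc81889aced69c58ed531ea7a7ae00c9bccaf34c9dbee1bad9cf73f854652a80d1960dd70cf65614fb8beeb1537922aff9e166818a8ef5b6e4a1b8efaa16d4bf75071ea725fced1e1a22557871ea04d78454b61d5a144272dc7194fd743ca92cdaa36e94ba659bf3d95498dfb634f12ced2b728b993ebab1df2bdee500ff2125c60b3d3c8857d05a679cb0c0dbb84f90eb40c75e0dfeed2391bbea1f007d53583fd89c8ae45a789e396fc16461317fd9c6ce28bac46be255eeea647ca94a5c0857151a2ce38bc41ba97c1ffa46ff587927f4b78da80a63df08c6a54a67d04b61656b5bb02e289af283dba9ecd15e61f6ffdfa990dcb670d58ae90d247ab0337bc386356cbf6b9be247fc975fee77589114fbd7533043d1141ab67ef16b48bbd8bdf7bc85472d8b38ce4d7be39ab42af119fce67f6698a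18a51cf432117d5958c39c963cb70d7d58112c8bef0f2d30422f56a3836d074f2022915a2650f2998ee3dbda0d5ac5f1e3fb2225fbd134ccc60e5778edd016cc0ff028637561aa53af6fb333d19ca823a90edef22a83a6d8bb54315c1f9a536875a3105c342c3e53517be261f2e65b21d440d55f565e2977f6870d5a60b44e933fbc268bd47578beca2576f77ec47461faf7dbe31851186184634d5104645ca959ef93e51c9f71b8c04d4198122df2043af920539d633841f5f92156e92e78bde4499d5217470824aa90e4c847d630dfd2484e0d807ecbf4392be103a2cd613c8756d56cbc7b49f49debd035b1ca819c9ef57d605517051d38e3344012123aec5f6a7295b63e0a3e0835eb76ab8da0381e58fdae79b1a9f5f43f6c9678851906751ae2f6257cfcd73057f92b5e2fc25a62d511da8f4030a700c016de03b4840ee271239ef7cc27ed93080775bf09ad62b86e346cca9fbcfec05e208a1f602e0e1d1565f43e72aef01d660c8882898a4cd3741dba4c49ac9bcc18cac0299f09130e10c834595f31682db977625da3d2ec3f872c819bbd68b0c5bae1755c86f910b1e5a78f0274b182df990c90db8ed121434c38823980a49761adaedf82695c592867f0d1922cbc04f38ae36088b56f729001df453cb44b3b7ea92c44557c62fde0772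fd6f21e276aec01d3f01d7c5afb411280146b89fae054f697805a9f86ec7eb72a3d493c5bc64a02672aaf4973b984f9d1fb0701b5e508aa5649000adc58be3e4e34e21a840a991ca00701ac365224c10dcc11c535355acb518b8f6ba1d83dfa9ba0e2e410c824c0e5aaeef30707d64c98e7d20fd0a1f97c08f6793ba42362b6faaf789a4bbd7cbe337a3669e0012cd6fb00697c22cf0da3942b81f2f8110eedb6aa8d2b2857368ce465485bf84e42508a5d80f9caec6e2208b405fb946c5a1750a7e46b6910709800f5d7c13120d80420306ab3fe03949cba45d4066cc7d88f4eccd589070309ed06cbc87b7fdef74d696392f10571e5d9bf0975a15dffa8f377321ce0c8587d0891ea62fa0bf840e2e17c9ba52392ae3698e0851d92584520f58f9b510aac54bcc8e168de8861d38ac1cf0ca707de58ce8808bc9897d78b4bb9d4ae80502d0a3ea83ce8438c58394e0d04fa61e1fabc797e7d87d8142e40e4751241559c9ed484f39aa9ee365de790492fa1e073a50543d2b52afa5ecf4f67542ad735f29f4a0484116a26e0ba8b8f6d453cc03502cb6827e3eb503cb6fea08aa2e2f774d2fd7e236c90132a5d07c428550181d529c0a9835bab5f817b997832e9d29872bd5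b5fee056720ea2e8e3e8a3865610241e47a2427e52ac39b5273241069fb2912cf5474c8b31d4bd5bb6c564f5cbed3d7743b153ea92181ceff5005d316f3c0a1792f11e8f7f46f15fa6d5aa539048a40103b68b0882e690b6bc6f8a0209a426e06014fdbe174a84d877a59e3d286eccdc3440cded2bd3dba8c4cf0077cf17bb757384f062502d00c3a4df2541d0e89df3c1d24d68fda268819c02648c5f99e4f36d5660d6fccaed0da8ad490fa4d5f634ffde5af7e8045297328c3b27ed332b2dd0837e2cd2f698f02a9844591dcdc7f19f2bfe0200ac070a99d9e0b831cdbafecd03e5f3292e4cfbdee81a54915133bb4069b0a7240a6888481249dc559c4c0c0d844a28e2318feaf8450063de243ff70564df59340bfef45e6bc48455d4e148d71456aefe8739c19a79eb519779b42b9c36112a986014f1449755acc34baf19508bd83abf200510e6499e05eaaf83db1082b7d96a9fbc39291495a91e4b81f402b73dde76b1211a984a49b7c52822a7d7bae7562bae3060de27daa176c6b72a99e1542305dd3e823e41d9e3d492ee2b9a51ab350a0e71845afcd8ab8151ba420670a87ead18a6ba2d6115d5f307d720ce4793b5e83060ffb70d9fcdd1ffb94483c0a0a85e7cae0b1bc4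f7a616dcb89690b7514fd4ea1f2fa1b9db6ebc93b95ac8a16d8bc7fc597577e3f66cdc613df9ec336c8c7f4dd0d458dda0626bb4bd1c0015f4e9e9a2ed18f722d4699a01b1bf081dddd0753839100914846ecedde159aa4ad16bf8a614d8716efc1ecc3c49718e304990d7d1859991cbd8372603c6b24c3bd8e473fad2aa1b19d923f86d6fc5c43cd62bbaaec8637dd71e3ed07d7c0c0fabeda611316c0b23353db5bf679169511aec60bdeb24e5771f8caa8e2fd18326d48f825828b7c9fddb94034afa99dcae2b5fa7f014e2ecef6af7d564081ea2d339029be001cef79b274cbc559abea39d5e4523e451ac792f293bd91904300d440b4968ab42e9d5f042c87286b290231d7983c89339442a7873b1dc0247453509df50f3de007e5a19e950a25ede85ba746f9e76f20ccf8eafcf52ea5643f9e3d828bd0b2ba66ddffb5e5b569d26443dfcd20b7b7a0ebe39f35e07f45a67d0761a765dc87e96bf05d189831877b8fd1855d4e41ae3c2e5c1682d0a27cb9d89ca7a166a3035705eae4319e384ad4d240ad6b03beb9c3a95cdb85c9bedf209baf9c4382665ecce1d6b7736e61f382279e4ca227bbaae38b8106ec755cee850724d71a9e41422cd11fc190b4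3369b568d1c491ebd7fd605e2d6d0d5c4283665200fa11b245a18e7e4d52f0cd4b658f1fc7ac1d35bcf6c5ef235636e80c787de884356f87b74dc8789f8338e88c6129b55e7d48f46fb8fef555a3bd097f3a0fc6186b84d2726235ba94a9260b2142191abfb7bc83817f410919ce5abdc09cd8140fcbcd25fd6ba34874f333c5d276ac9b1ae7ce84d4ba03a452ce11713931936834bea544cf8aebe5a60651d3cc6a3bd3c404dc9877814257391f4c9f55d9040e77422aa9de9a985787a2051978bbf4d7fc4464e8c14d0c3292ab199751331ec4795517379223947442e506abcf3e4ed09b64337264fd6c3e59e5ca3f2ffdc0625d7d5075b13f8bb02e2c1210a3a6464ea9e41a19d02a7b8ac9f1adbbc7b25064a011426454f56bb12ce74e0319969ba11270d07a4a2af0384c5d067f654ae19684a3652950f371dc10f0d726eba5b9f5414c8ead047641b84f05e13234981366a8a2453c697e67913f30547f00a76003f097246f8bd12a661a5ba1a22d117aebd19d008cf58ec3032e4dc863df317c4b9d7b47aad2f7c0c7fcb3b44d5e1c1ffd651d62f616e88ff421900fb48d192b077847f1aceeb30dfc52a0a1a987f441b8849964d00efecb65d846c8218b3282cd6ab8a7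ece3865b980d8fd86cf414c55a047aacf95549df7cc9b9265b0fc74c2d5a130988f6c2a1e5d49b01cb9d846bfc40092791fdc52eb04eed594543bf224263e2c814894e3cc4213e6fd69b26fbba825346b7fa8224d77ac2abdc8c50cbd7d89429c4c6af6c090d2151d5979a7b4d1a42f7d92ecdd2e8a168882aae688cfe318d3a9242ffe723bc4ce1144f9f6613ec5576bab2f0d1bcde62e69776544f751a4dfb23f01ef43fdcb8f5621a889fe7c0c1e8d426ef336c06f50b7cc6f75806ab7dad888edb02ee39ed235d6ee9e3c1b7d8d77f40c1b3054a60836a51fd1439dba3cb221a391f1e67f014379e9c918d4058acbcf85c311052bc73396d4101514e0ba0f4065b091b65ec130a18421e892291fb5b67f5eb8e99c64eae55332f78e375e200d2b1ef640c82f57286d3ab25a5d218d4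
    (by norm_num) (by decide +kernel)

theorem closeNextPrimeOn_631_647 : CloseNextPrimeOn 631 647 :=
  closeNextPrimeOn_of_certify
    0x24256d5bba4e3448767e599b0c4e5535a1902a009a50a74ac5f73664ce9b25dbcd83f5
    12 13 12 52 4093 1 _ _ 4930 475288381
    0x1237b5cbf064aaa707f2b1a1d27bf2808f8a0f2abf2b78d0a616ab220f0789664635ff8264651d04478b61ddcfa3184193877a6706fc1f5f61b5459d6fc6de97e48bbb13299a5acb8a26d22e2659d948519184de18c9230b8278bc8a21ca08d23afa48c2facc3fcdf4ace0df2b9cd84b41d8ce2ee82dddffdd06b97ae74bb3e51f1b127798d9f7a999cc0e7a6c3530aa1ebd11d5248144ec7c1dc99b9f6a91b919efddbbe32b6d08c7394f6bcb7189ea1b30d5c82807885493e1bfdd77ea13ac046429bd1207d5e5c760a0b51b66512f644efdc68f9ae0676a732f52238ef8833c3895bec5b8719cd925d9a239faedbf4f8a3f9bcca6db81d2d8699f2eef3833023555700b860098848ee4a0f00046b00268029d405f84382f4dfb0bb71351b9538063971ebc1e617145741d100e7da2f57b1eb26a1c0ec347a72cf4a98f95d9aed6813c3081110c53bb5dd2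84d02dd38ae499720e6c1a54068e3213a4cb699e793126d4c424698152481847076cb72d28903d378207a69d094f509d74dc28073fe2af7ff7b5266547eb720265c0fa4bb4ca75c493d2ee799178028d0da7358b1022787b1cf985bbb6a12d5fa75a0bd38959b8c6f245b4458544051ede0fe74ee0e4e943310c2b5b99e6f5e021be7f27992c270b1c9212bc30bd43ed660b774354805cd5a4a1db2ea4292f29c9526bef07995f3cf4d907c844db14f88d63cfc35beb7f0fd8c500718e19c54d44925520f2f6f3bb62dd0cee288e9bcd4b882716cfdad91c4110e019f25cf4135e1ee85ccaa33ae4c5c7ba4d8df1a82fb9be02cbfdef9efd5edf6c80a7f27e0a373f9e16ac7a738f187ef07345cf20618b758549faafc76d52ebdf3eb150bcaff79738fb5c3b7aeabb91f550a29fab33b69b9a7702ae680722950346a28ec7ac1d451dd1e8c6a3d1f12960cd95c021c7f367ca360a9b3368acd6e6e8c626ca5bf81ee95b96de0a615c08ea4a9873dbcf664b632e6262d0d9fec3c86fe6c14d86692b2aac035f503e6973123e388c0298d9686bac7f3906d11dc19288a9de5dbb42fdea9c2c24beed4a9fda92aee041fbeecf088552adcef00bcaf792e920511a962275fe0510db0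b8d588fac90b5c02944a2cd48d9847b37bd72ac00d5ecbfae5b53e60441082403277aaf1a88312d58e453cf41d14769f80e148b135da182406789e3eac6f1af37f7047f9c1f7a1bfc170801ddcc502f1e3db3a493d4ac6a029aca015964fb4c855ca194ab38cc4b00777e713bf41ba3c8582db81d9ed99d336674dbbc1a62b46a328b7d1e921af0cc2d984d39b0306261e1896acd5ba1981f84d990359224f04d8c3b65044b59d4579bf1dc715917763204f041b021867936c7f8e9f3fa9c120b9a0b1022a91f03b6d1e8e9444b221fed0d838e7a456f771c532c6bcf34340da6f8d25ae7caa00fe85c64ecb19d8be1574e38db37a92ce5648cb371d0c798958193cdd8386a0a583752aebdf20a0c445f3487e3bd4c9b57578afb78b1e197e87b5b9371e2bf8b5a6a8fe6544e30e08c4e10e3338dd9557b08e8a335f04003bc985a546de9fb89dfc5ffe4253e3dae6785e83f1a744d6e5751bf5af005444821a994bec50ce917cc65ca7e3e654ca0dc2f81604b97f7cbc8ff2edb6fb17fa1f9587d0329ba1766c32b83cf12886f1df025e1a8d85fb8ff2cfb34f1337dd1d1b483cc027f8ddb1cbf9e6e1fe104fa46f87e2a5e6725184bcd4ae99219b4d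fce807e71a7519d9a495b335b6a7e11f1d1c84da619f865d9e73f98e4505149e663857e529dc22d1bf8c6f7c9b0dae562aaffdbac445104eab4d875a07aa3eac6cc2485de57964450ff7bcd55e2f30fcc694f12f97422311b9d47339b3e5e9570b04c082c1964f8c00cb91ff75b15d6895db8d0a3f30bd93dffc615aa5018566f6c6bf59434572d503dffa76799b7b93a71d1f67ab67623c2de856bbaf73640044c4c472db958943e2f73af2002e49b66126f63087583791238438f6c81725d80da494170a15ce3b5efd9b660ce4b5771ef3fc548c87415ce0d4c0819cf6975be0ce8abf5228c35e33f36bb73cf80b1e3d00e0fe69896404c0f12d16d1f260b0fe267b594be56f4ce72f57b8cc099826c9bcd337aea88a4baf50cb445c63b77696a2f78da76d3af4c09d6040f684c2f520bbad9140af323843187982cc534cb4f623cc4456d7ae32fba1eb99eec1089356732a27eb5be5465179d214f40734064423338e8d722c7d77d8674e046e13cfeba234b6f4f924b798219b8efb78748b3c103f68706a03c6de0ba8f045d2ce0c6433306dc5909a94280292486052116121f0719e8cf927e7bb9caf5a94d3f84fc598b8cbdd7d53b5e4beec460a18f1780ac5d7afcff39f62a1349491d74f2bfcc5e4d991b7869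53ead8abb6e7b91374d6337a2e7de8048e24916b1f092555981c0a60fc56b48b0f7b5eec1e93d42da2b25d9641d1d8e7c4c9d7164acde0e3a36cd794340ce3d53757a9ec9be1e0a1b996f373eaccc9f3e3ad2dbe4ccababa147347b890f7104dd325a8a3f5ff2d21d74650a96210c8e792899f1a3aae6f2c694cbd93b5f8e5f4e7dc8d08c92fdeb6ef0ba03bb2aa31919915b09fcf203d0d0b9cdeb1fbcc7d658d7df5a78dfd6bea09728f8dba63d86c4304ab694e858ed52b0eb675b04953da8a766345c075ef69e993e4e444191d7daf885e8803e5a03acaf106cf7a7511b5ae01a0ad96d2a7c9bfab523083e156eedad00ca22f8df2a7bd0f07b31c876fc3f1324c7d6e17ae844438cb7d4a965f39a0a31de9ad550af84e33d807f6ec425eb662451fa159d613242ff00a1bd8111ddbdb3d139a471413b336770ff277d3447410e08750a302213df3125c6f7fa2cb9b8aa7341815fc726a6354177d5d4100ef448ac60a1492e098f3e864d0aa473a6658f5a7cb1df9ffb3b46fad29b46e608b57ea598ff3f4737a9638ced9ce256f57766034d30058f5c9a4b26d3e84e547d4f829193bca3600ccb789f413c27ca03a1ea58bbb2753c8d5c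a482c9fcc135d512cd8db9bd704b3868fe975c1f5832eae06214efe126af6da87e955d823e1e66e9b3f399e3a375026971e54132610a53c7dd3bfe237ce050020a7327fbdae59ae7d7570128d94eb646baf8f10d6ea6af24f74c715078626decc312dfde58a07eec46078c588acc3d496ce24be806b8e89eb0769124c628db5a8b4a91bd81e2631ff978400ca1e9c5672f6b6d6dc2ba436c012b1bd9f895fd93a6aecb45081616d37d436f37d6b595925202a9f850fb43bf7b2bf0c2de0bc93a684e974cd988b9bf6306771c1089365ee72cc8dd1c8aacbbc516621a97344af3dd50585e47f68cce0364090915bd9b3baf523a5ef19bb70e9b84c82f385897da6241e9a4c9445e21af3992e2823e1a2d2e0c5d9ec07cf64289c75b0142e3838ac818ecec69180f3a54e54b5ebf049c2c298a7a6db327e0b6974cb6d67bbf91cb6f2204c0194556820c01919021e6e89f82c6ed097b27fd9a728d9d91c1e7341a034a7b68684760981e8c2dfab46dec92eee8406d985c5bf2d3c869a247a88478d8834fa2b29b223d932f9a14dbbcc58dd187f3d19be1096042d8829ff8b1c0f8788f924ab6cabcc19b2c4df1ed368927358eb16ea69ff323599c60f66addab3535358cbfc1cc215a72ed92206608d59a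c0552432b7e7b44eaf44261a5b0942982af3777b4f1699fb2d8064555a8b4a5fe188e59836e8bfafe86ad2a965facc5506672c3167bb9ee8d8a4be75829873df79a71eeed1255ac05e542c9da761adfc0e5183eba00be45dbcb91921dc07e193e7c05aee4e046443f50dbc625a26fb24a90d60bcdeb377c0e3a7183387ec3d662171fa188a88ec742dbd64a08d271a5dbc9026824e8ec01a3729b45aaf5d3f68cb70ebaa23c919869546ed6fb7be204897d088b43db16bd1a6be1132428e92f092a702baaef1eea88705ff0cda6ebdfc62a15ae774623be8013ac4e2ca0a5cd56e22bf43ef34000677f4c5e601c1064c9448e75a4c6e5f141405530a298ec7f8bb741cdc770713350f46eda6b30b85f3dceb36a16138f0b34daf35999241526e1b69ca6758d9d730d2e72751e8a919eb499e89b7c1e3a7f89e04012d871cbe26317d4f704652b2ec7fd0bf59a88dc77f51e65bbf92290cba270c6e2dee9c2019835f266fe37f49b77495dec1b855cc025b9ed213d692b7de512ba564f6253f59a5c2b4d5c091f04ee0179ccd78d6fc584377690cb0493c85a1bf3f94f3c04e19986c576b48117e295b5e31a806fe34589231ce89481db5bac84dbfb9e3879984b78f183d7f4753535fe80d4856cc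32f4700e5ea05ab99de718811a3a6af7c842125ed865a4c663fac4f11f26b902ff03a310e644fe5696b6c3129d15163f119e10c53b6742c3e4d4abe47932b92809b346feaf9e3f5b14383c84300c792dff4547583d336c8441032c7640555e15f666854770db5772f6089485a3696b6d09b50bfd935b265e5291012b526089d01748a82c770ab44a94facf344876073d959db89a94aa368f5741b146dfd2acf08db23dc3c85efc52d5cadf800aa94d174e7ff0e4c854401b79c5e5068c9d60bca64e01d127e028678f153db8c36f24692f33d5aafc798505587d95e6b36dd08924cd815cb90e311e7807b57ca37ce2964a1985d5e147459c33932d5a51449059935a170e53925aa7ca242237bbfb72fca11c98331533ff0426ff1e2a733ac4619a441727f843ce446546ef17372294b9c51a2acd9e0b25ddbc4e3abe3e9a43f1f2559398e7d1fd407e7f10bfbd7cfa4d83c4541ab936dbadbecccff575cd2816d9cb21d04312ad9d15ee8f3ed0cb72fabe6e457c00701aec39a0b815e1c111a90030170be168e65feccc637b787f2ff441353d727a2a5bbe0ea68e9ef5cb2e68bd3e73d640ae28b4ecf8e6a20181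
    (by norm_num) (by decide +kernel)

theorem closeNextPrimeOn_647_655 : CloseNextPrimeOn 647 655 :=
  closeNextPrimeOn_of_certify
    0x1f7c9a42e74a1f8b1f38100e0fb83c39b7bc9496866c41ba22725861cff925fa7805f26b
    13 13 16 52 4093 1 _ _ 2511 8729960749
    0x1a03b506755e650582d695b208dcadcaf6395e68e5e08a1c312dc26ef773a4251bb8ed513f008e8d1c9e3bf421e67d46b827dddf2a1aee929baaf850c8862c48d97daf301be04bace20b9d8bd6251e57462e25510432a89ea7e577eef635b514a993942445ff7f3f09202e4661da2f5215bc01d0fd2a80a483aabb0b218864f23c0184b5f6d31b94ce3b53486717e8c68c7e2dbd3d0411678872f41f730b718b3e9a0c120214bca666418d20c3c8957450d6f22fffe247bf48f2089ebdafa72aa410203b3e88daf60608c202fb594f6f2740039d63e19c6bd36386e0d07c02cecd0b7df60dd50faaf5e3649e516878cadbb71a37d00adaea7da03cd88f00d13e0143a3aec5dc8571819f4c37b37d22f2ec31099cd3caf4c2f3b404ccb4bc245f6fcbc63cf403d717d890e4af41dd490f66e40dcf77ad1acc0cc8a9cf2061c217b64b3265c7542bb6abe78ed0d1e2cb191080e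975ad84f3258545712e9299e26193fd656a9d30782d15ce23b140ee0d3ea9aa5457bbb179ad34bcabce02c162497ccea1a121c201a01ee0fb3ce1ee2e2f97fb8e146cfa5dd3f0a36292f00bceda56fa82d2f5e1989a1993eb6b8487a50dae542db3628e186d8790a774abc731fa465d1850d4485f63edab33575736064fb338b529150156b562d8e0539eeb6d2c9fcc349481404f3252ec2c09a3e003cf8008961c9129b5084c8fa744accdcf96010bfee44cde3baa00e9f2c07101ae515e7dd3bc7bb7d85e117c2f810c3a0135f594bef02b88e941c12f7b67fe844c702bc3c12a7281109252876b27e3a52fadff5bb05043c01e1515ddda93ef30fb5412f195b373844b79a1e5f55aa722f4e2e5d5e4b308adbb73085c5c1858ee4aa67e70429f12577ebee1866934d4a5beaa715670764775de46f0b5675cab641490f1f38b25bcff7653ff6e6b48ed9d8a366aacd5acf7c67a30130d3076e315796982f15f507a1c5f9f334d85b39425900af3b9af59b27d11670a037d0511491254e1dbe8b6a9b6444879ab2bdc6df4358558f97c926f0dbd4368900de0e70bf4ba251e7b17c1087f899a4fdafc30fc88004ffc78a15c3f2aa3ab57d5c9a01d0d65f759e460788f1b25e5f70d230db042d926c8261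9209f761fb18e92dd89945236df1222dd388f487cce52e8c8daaa88965ea9af0d2ae1c3ca9c9e779b09c7ed274cdcfc7d8cd053f4cfb7f7d22badd245f325ff4bf6608dd431b6617c90b4744706756b079cad22852e217dc8c958c6cea535c2063da3d7b854e88a6816ad580f04adea36cca0a78d27ce4862cffba9b07886c81e795498d0ebebe566d0fae544f8d6f29c32f952c6ec8e7437a397c43097366bf56b8519660188e3bbbbe0058392706cb299d5966e84b66170d1ef06e5184034c51c7901fe05449fa76979b1b74ddc7b8e1c306b24f71e3ce941c953af2422f3ff8cdd543aabcc9fca45dd0a112353faf257244b9e9f5b8e4206d9a02d649634adfab7988c7e93a17c555314b28a6cc143d987aa2b4795ae150521fa0e70b15850446cf5c4e010aa42d9dfe21c174daf28fd0210651f15eb3e91bc3f5683ceae205e32b5d410676d426ec91dc2a10f80b72d4c11a42ec4a312e2c8db508622910ed1d96c2e4025a25c8ec1489410bef9f605a933338721be91490f8764938e6a971a040f6256568dd5d4d3e887da7404e6b0b9f3328c2e966edf8a0b49af01cfb4776d1a897712af3e3cca4e858765495a6642eb79852d6e6f07ea93cde98daa83e858e4789ef3ae96abf3f72841117d050bf0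ee82f37b153aa567166e1b47b5c0b33048027ee9e27ad6e907fc33bb18d8be599ede63902990be23048bc34171ad1dc7c81a8f4d753f18d4b2058aa5598ee2ce3a35d7338d25436b289ae8ce59254a934a443002a19b39a44e610b84f43f43150a479ea4a8129418d3aa87de540236a6866dcc090c0c56879b82a9986ce8247f1d590e790d0b6a2b1a1ec71ebf09df5e4ef1078bfa0dfa855642ba3cfa9e01d005aa3a4df8338bd8bdb3ee6b4cacd00609bbe52e75fad0d0e370f76a0ee60e53a36ed5f05d42ba526b4f583ceb7b70ad903ca77906d0765406150bc44096cf4fbcbec4b640d63845ab620a70db5f05f4f189a28fd6b12eb67d8227e61110730da0ff8ea6d1bc837ef67578a1879010a91bf3f8f50ef0bd136f6c1deaa6f6f215fb123fe44573bf5a993e0dca2c8ff5df5c8f2c1c582934869cf2178c9b275b36cb668d1b3bbe7b041a6bd0499a10c000957856693a5185f477ed3db4cbad7046cd84b510927631b7e0d3ca92eac321d96171fa2adf2c1b62fc0f31e2f99b887e0822577dceb8592a1e36d68d78cf6548f1cdf5b33e1a6aded539e028469b4e830dbc5fde5361a0f625d11378a12fc9af0657016f5bfdaec817a6d9165b3c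34f5ffbb8881f6fa784cbed1714586e31a614c73d9bdb0fc19680d6ec77fdbdef2a6964eb026617cc4a96af3bd8fc73cb530f9a6862c5c43f41f8208d6ada3f54e635
    (by norm_num) (by decide +kernel)

theorem closeNextPrimeOn_655_663 : CloseNextPrimeOn 655 663 :=
  closeNextPrimeOn_of_certify
    0x1beb7cc95316b9f85caeb63c77f05d672dec37c17931fe480c8b645ebb69ecad186d45f4e1
    13 13 19 52 4093 1 _ _ 2543 1230655237
    0x3337e60f390322ee01bc80271efe3d33278135f25581bc338193a5e9284d52176fa1283b25842da5a3df4e58c272496af514b73c10a0160588aad07bc91307be0cbcd611df5a70f187aea75c0fce447f9454b6b75fcf13ee51fada5318f59f031382235c8ae32bad2ad64c7324e89cd36c98f1b390c595c0ae7ac80c6638ae1bcb27aaa648e36583bace360fb58b8cd065bc8f72f51b3604893b1073587c7ae5e0b7f99dfcb9fc88fe39f7420e50dc3d055bf659066582416a575a84a90eb07bb9c549d43949e3c490f8ceb899eca453a60ac0b57d65a767ac04cc43666eac63b67da79a04f8c478ea0f4ca7eebd757da9d1eb3edaab38757525f0ddd21d4e9dbbd975d10b7f167b03a94550e692dfc9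2aeeb71cc40cad8c005a4c7afc405b6cc6a08f3a8cbc7841efc33948cbc2ae32ed86e69a30f92b277aa29daaf3973a44aa7b346f83b75b1b5e52ac7d701bc081a822d8e4815503f04446d8350d86f35bf8254c82ca0fa647cb5be9190dea3f883d6f977d6b454d25ae015eea57c1d99b45fe6ab7b819f14071b72726f4a0da8236a78ecae51ba94998a2e180d3d406dc90f7cd19cc7c061b42a6af9ed902d647a54631e4b248aefa4753f7d03721ea45113647b6d8c42c80459dd1b25bc02b3dc787f888943913d98197ee2d5cb1f9dbf3035a6abe9f166594d94d0d88196db3a94b7769a2e55d39c5da07979f9b2e84ad1f2501e6a62216bfaf797babe3158d57544be204c04cd049eee067ac42f4b055094024701627ed6113ff5f23a9f8462073cb912d65c60800aef65cb31abfcf55fac25aeb186e50407063eef149ed6607d79a04fe69be46b4c21acc98ca5c2ab716bf8495acd364e949afc17152e12d3b2dd532af019b2582408c44fcbfb4390f4db4dcb20e5ee01fbbc7b7ce4816ab463a8a4d4cae7b611fa4363eab7c3ab920942f74f9715f18bb0063da5475cf4999f59667b4097b296c971e6fe9a773b6e87ef8fc3130735650d2eddaf50e7b45eeba63721c8dc2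579868931b637c6bf85ca05babb6c329acb93ca21d2022bcc148e7065adbdadbe0f59e1ec12bb96776114ea9be78a41da1acae1c1b39ecd087454ec6dba26b1c2eedf5e67041fba0b9f631bde99690b2e6cf59738051da150ba7f885416777b3d6fefc8b336adab157e802651bc590cee7f241139f7fa09a15db797210e91fa3036054d8aad5b0ed9083cf313231a605c9c8b3febd5f801862447690604769cde2bc563d28f9655fdde854cb279e9a25d13836b7748944b4d03f934c2398d76e95371ca62beabb1d64245b0de73d7d18cdc7e42b7cfe34381ff7f50f7003baa7db183751b2da2277d6f94ca462f33e2b5ece0d2104779f47e5a38c622131bf4754cddc6a71203941fe7236503636c529f45964069b327bd57da8f946922e8a520974046004e14f297ce5ac78f85324359f40920ffb2239fcc564e8b5ee0f00fab090c63d7244cfda1cab831b9903f464e53d17c4817df81054cf3e0f3549b285874b3ed47b87e8588326c42a05130536add4463ca3c4e9ab51fa4d0a5e3f7c8192ba2d369ed00efe576bd0b898b634d5c8282c30e4234892f6957fa7af81aae6a93e3095b518411be93f0b2fd18659509e7a1da0fcd0836762e585ba4030db90ed5a89eded3ad189b648777e88d18d618db6c39ef403e64c06f96c43728bbbd131e4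a6094ee0df3821128ec881106e1d58d41adb6c77fbef44db1530b94cf74b816af455450afce1fae69b36b801869a76d00d11a3eaec52f0a1e4949f809829e2ecbc54c20d40a53ff56b7c048464ff81ffb10e7e53b2acca027c17abf42b083331f474e1780d0f96e438605659b0380f21961c93dcd4e95f2397e99c4002fd4fea376857fbd300d1ae3601e2362d57ec94cbbf1ac061e37eef8df8a67fc340216a2f133b3efffccddd0f05f5241a0a0eaa560e30bf9d670fd95505d04e53155a169d39c5af38603c850c572a141f71be6cf1a454cc8da9a5be032a9d778db394d2826bec69ae0b4b3563105cc146c5e4afaec6adb01691ec0a406bdfd7c34416ccf825986a921a856e48507f69548de212f63f3928cd50e257420627522ddd82902a15b3b6da482b0c47d30d5c0ea7d516c96dbd23fde3aa2c7d9da3239eafc858f37110928e50cde382d12e09f115060d5391912a2c4224e729815bb55b21f4dc7e149a186bfb42ea1e7398a051ddb3a9e66b70b92e41c912100d69a3c411ee7c98ae2c058735524df42fa590e54f01cfb2fd5b012dca43e8b1ee72df0dfd61abc852fbf9127a72e0ad4d3a05b67490e14752755081e533a1152e1f3f8b8253d7971dbb8367c86984f763fa6085ba51a6626ff25f72373d4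a417e815cde443676bb9f2083d8177fa5db29e086f6c89082a6d5b50f62480ceec76cde97503d70acceb7ce0f4a709a182370785b0698f7709e6270a173ad68b1d5c28165a3838ed45846db9fbaa052f7af54192449aeed1065ed7ffcb5c71c2d1fdad08a0dace6ef71914c0eb6f451b9aea5d491737b825b337ab0d4
    (by norm_num) (by decide +kernel)

theorem closeNextPrimeOn_663_671 : CloseNextPrimeOn 663 671 :=
  closeNextPrimeOn_of_certify
    0x1beb7cc95316b9f85caeb63c77f05d672dec37c17931fe480c8b645ebb69ecad186d45f4e1
    13 13 23 53 4093 1 _ _ 2573 19690484149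
    0x24959f97f18092b05eab038cfa67de29a12a57877f88b4ca4e7510788421c2f9764dade46fdb150de1280e590b7840f0a1ed45e0c81eca26cc3f38abf98366c081f60cf18aadbf1c0abf01027104b60ba6038560c40424984d9eb9b301db6705ae8645607a50624fdccd66abd88f83ac995e201f1293e0ec691ef8ba60a2ee76a69fd437e5850f6b2fd1b115e2b99b85c4b389700b9948e177c13311d185ac95172ffe2b280ea933ca056ab9cf68a11ffcd35c324649d051cbecb58ea08605c7d5d096f14dc8128f50a95de392ab05b678d2fd655cddce86799611fa2f835fba34a2a3591f74c4bab8f1e0fc414317fdce667d70bb6aa199a15f29aa8468eb03ea5014700cb5ad91ba1806c11460813f4ce34e4504ce86bdffdfa7d5c88e043b7f12b6c30297bddcb7245ec6e0fcfc6420c8e9825a83ac66a09a86d0804f6667f7ee6c909abd7b65e046e87db3331cb17acc245e6f1dd78e34a2e3a580f251946f83cf65210192d72c52e419a62935bb7a89b1291d97618c1e68221bdbc140b79edcc12d81c76a958311dcb3b414e3ccfe4f4178da2b7ad60a298b7b5b8cb5fc9a4311dfb25462523f063e1c938a39ea4de4ac04392770b7be37a4eef948e6578e84a44c70bc9cba7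954dc8bec3866befd0201ede08ccfea11d42f7a50e688c8b75f7aac8ac83d6ea14a07b704e0d36744f89fbe25da3cf4d0f7c683e41044b87ea02486d58c11d093e94f5f231f2ae5d6f95bbe6efdf6169eda8a4f9299683f85ceb8214ef59f22d949750a6c2a57b8c1005f8afb53ad4738de65bc6f2d7a8bcb0a64653463738d3c6040086876627abe23583aba3e2f7a47288991e59911d84bb49b42dbd889e75ea2e7eae9fe349477348bef6bc68db42d682f6233f0b67c0d6fe1b6615303f899c99d6cd35fa4803390be76cd1f6643e9257aa5225672365f947ec96134b72db9484d5892eb2e8e6468e751cf15441be1a4bab4f6786b831258aef5270c65ce468af7d33c70b9c0cb7f9a76efd067bd225bbcefc371a7d285c7619b076ec698e2c2f1e64d986a37aa055d3b5795b575e59ce99fdb24478cbf8077d7a27be35699774cb74c05c4a3f29180994d71d363938b102d9eae72dbeab2e3b8c815e8172bf0cea7eccd02442e3d9a74d75caba97fa205a9440d65d5055ad3b12689789b08c639947a6f6db383cf554009fd12aeb6e618f5a371cbbb6f29b2d5c9c6b8c42b2ed473c3f7d317eaa524c03a98964bfa4d13e66fc18493ec013b67fea7017b45438ad87fa934eacc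a8adeb327b73823a817542b01b301e00133ca62bea8021ed75524ef48b6abb1e0c43e9e9ac99648f211fdc133a53ab9fb04648be2ec1e730bf633e67e739c01ab1eef25946ee488cf2d6ca1a164a70d418707c336e0fa07d5c2cfb45f32ec251e290e9c3c4daa61826e44d1acbfbc0d02ca9455ecc4f9771f86298f3ad9c0f0c0ba0c93272b60c46f8246272ae4e891263dd61122e51d01bd6c61b005eda9f4fbda1d9471fcdc10ef8a59d3d9663fc6df761bbd0a9e032580ddee687abeed1adf670dfef9783c6340b930aec4842e21f5d47784a37d6179cff2a5e3d6c5e5f352f2a430bc6daf88739aea0a040c382127b68769fc1002a26376e2abd8f5e93d4fb54bc725a91f614a75e82d45b39b68c6f52a356732df3532665318dd58a184b568b0a957c9b86dcae563377e22c4238d173cd61f0fcff53b7affbc8638a4ffca8921db89a5818fd8ad3d6a754284635d3d43479df3df5f0e92edba682da35ac4ab546413c1053afc7dc837a4446098d3736af450dcfb9258d3a8da85101c1106457897b03a5c5c7b138be755fbafe969911372201fae026610f42b3418f94b4104da5ec54f5a135811f27dc89aec63d241e33d11147b2ee341eefd181d9e506c17b5a3466a2bd89ee04b4d60071140773d976b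8fd412eb0621c891025aa1ed5ec085d4206c3e941ae90d286567931ab79d1355fd3608a6a06433ef054aee8029024c09529b7e7496712f9887bfb95b01c903623b68a8753301f3b2d11cfa24f7e5b7676c2b1470a1011d67f9e8f5c05361c4ea93f551eeeb655eafdf38ddf5b5e12540822d1c6fbe63bff6e99257d09c14accc8c86c559aedc0e827160e511fda232d70e741552389e260883221487eade34632297e7844bc42c062111575d63de779c84021618350693c2a9686f14e6ded6156a6e07e401daa0ba14d0a75121947d9bf2cae54045656a800ad6b42d0ec933edf1a4eef9c03fb7d3d2f1b4970f862c7a1de03c35d58033084c6dc4da5f26d84ee3de4773de8dc1bc9c0c1b72f2f4375e7e116078bc2e528e9b6e7bec9a91128175abeaf098200d17eeb8d0b25f16296994788eb4b7db3b3e56d96dd0c3a13ed2b353c2850f2fecde5fdd6de7d731611fcaf8d84c0379ad0518625970247ca6e87e4664d11e055ab028d28347d57479964b29c79dcdad089c0c18cc645939d91f88df762125b15585830bedd53924737ba761b36831a1f4ffbdabf2569a8360612e1dd2926957a048a417a1d671c442a650af04ab79be3a3cb90a3c115dcd9574f0e11156eae15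
    (by norm_num) (by decide +kernel)

theorem closeNextPrimeOn_671_679 : CloseNextPrimeOn 671 679 :=
  closeNextPrimeOn_of_certify
    0x18f9a6a01753545b2ae84904174a038d4c144de01169b8767338b0c8bda5c0b6d6d9bf940d45
    13 14 3 53 4093 1 _ _ 2604 1375754323
    0x2a9524729dd46371bcb4da7ba667e123636076e0952e2e5fb6490ebb46e391faa1bd4b28be1c9f493415a42c8a12b43bc9840d5138188b65ae06b9401e38bc169a69be9f599b2c5506447a90bd59ecc18ded0eb771c3e4dca89d0cc6b5b5a0057bb9ccf8a99c2a86da1282ad8fe8e01c3ffcd8d1382f30b42da427d0966e5cba8ec4fd4902e1dbbb286c14dc8b786de4fdd37a7fa9f9cab419a7373b681d4dc21225e8126ba244d59352e8d1ca239a587335999b0d46694fe5068bf0be066d42cb1b5cfc8a8baaa18dd6f188f426e1f2bf4563b58d8659eafa0a352aea6be0832c0a72f09bc8f8cca84f9abd538ff6acb937f08269c10b2604a91459493ea687160f79d386ea02883e91bb535d3d014083c6f9f634aa0fa9366264547fa0e58fba326804623cd0eee650c750c43fafd26ed32fee43470b8659e1ece687d9db9c8b851245a1c3f4c12e42a50b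f546ea2e489c17496e260cf38d1151643d3701f5f1b5745cda97a536d375d826e30e86642fd41ebb79786ccc5e9e1ddaeff54e1adf61f2d670b33b618451d5e974525fd3da858f73a5f2b83d52b25756929195d6868c6da0be98a000bad9282294f90c6c620b8b97ea22526e29d312cdbf00bcc75c467667ea42910989dda683f7fea89368d352d61f25fb1ddc54d5e384853327010a2307417c703ce813edfeca15851f30c68a89fa9faaacd2aac3da147bfd5741fe0314e903b5c1b1cff9ec6a9288cf2f726ff361a532a665f1c6fdb394a9020a9dc46fab361b0a8be833b4f4b49ead1d53ec26270cd8361e800405cbbfb0b946769957282540bcb01525803f1edc53afa45f9d3c57846515fee1cdd6c8dcdad9b37cc47d7f03cbe42bdb690d3a54e58fcacbb64ea858e42f647cf051ea6197aff941d81cc92d014fa76ed4d12237773a125a0dc8d64eeaeb0cc126e687156b7ffe9fd0570fae95e51a5b8675a64f056ec551f8a805902172bc7740c2caa7f457e9dcedfd8980f6ea8593b4fd40940ca046110a74aad11baeeb5f0cb8e53025f24e6165f8ab8b95f5148aa5fc98554018c5e3a7eba54919ae8276df969974f7e9000453c35ff0d39c3eb0ab3f9493e81f705c6b7f9f70c9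e1d6fc1f22483b57ab9f245dae299eced26e303bc43ecf5e428acd5482a2f799ccec0d58d6db839fb98ca0b8feca553a47013dde310c4c117d53535392b76860a0364f84ba2f85529b7653b249109e19fa194fd6db064f80ec36ea9ab005431ff4a838b1858bb10005ea03203a63edc9a2b5acc5a65bd9090d4a01dec9d207a861fda131a6172317158508ef121104af0d5194779771d4f64041ac975c9711a81654731629b4720fca95f27668f8030a8c1ca0dd1e4662bb43f5b6f6fdb32ebe0b43ddffd98bc5b8ce5c3f21d9871d06c2880967af7028b8f82e9a6bd9e94a3eb722e8c92965a4a228672e1b966cd74b791b94012d54429b2a6ab161272bbeaf85854d1d790aa357d6b4e5915b010e047e2b62760063949129bcdc7dd3aa1a2a01b302103f2141e5b82dcac8a635824c65b86b37b34b35c4d4a20b5fc096766598cbcbf7627e8ea2950fc98c694d9225b8d26f4f2b50ed875f6640a1332d44461f08b90b348208a525438346ec8ec0cf717543851800ee89890780b6bf3894916c96aaf6b276e69a3500e609619c68fd8c44fdee11f12ed42fe47b1dd6ca531f1ba32438b040e5b399d2637ab4c42c7bea6b151e23dfaf8e9aa8442e66a34bbaf0c153d3a48ff4b5299c6d8ab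65140ffaff983b90f6d56af2a18770ad332a191e11ce5af24832c062c14d38baa94fae31ebd527558f216b6be82aa8ac9feb7b60f8653227e0ebec8d39a00526a8a00450f1fe1e6b52c237d64a65c043e08323300983a2bde77675f40e9d3e2ee8d116f2478a267912ec92fcb2261c83d8792921a2972e1ff24a29fcc462e49c555274c3822185bcb06838769d0084171a4a554521926b8771a35d771276c781717c8e6352bf2d0ded037f344dcbee44588971ba6a3f38976dd86bc907c1406714df129868ca913dbc65e32b43ec66d42b636ec2e68044ef3856a4911638d192075b160dfee6208eb7cce3aefae6a744b4387ffb39be28939a14cc2a196c686043edcab152b3a31865c363e4d009a2b8c4965e3f8b0716ffdb096ac638c408db0fe70681a07619de047e086366f9b7b6229ecce2f48b686a51f4cbaa7fd594596cad3e191acf34effe00003ba07610d0f2ca4e2ac869287a6b4010da3028804ce81a57f178a1f305887158ec22867fc592576da9c47fddedca5adad6b1125e1a4515a35e70e940b45002ec9901fe44251c3aeb38a70eadfc1db276a9de93b50acab230e167dddbfc4fc2d58d52daea848293909c2f41b8040d314db97104beacb695922fe9e4e52d56bcbbbe376d4e7fd6d7f679e3021482ac49e4a640909c9d81b0103f421d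15eff5ee80a15a2444dce49e5988037255a8bec4b92cd42871774dcba4242a717d9d24602da47d2e44f1d4603f7b5f792946855673703d3df679989db83f86a02d65f33aa9f44ae237708eceb720ba47a268f68daa08ab511e30dc77ec9e21a97332fb6616df06d04c66ce3676826e7e89026cd71ecd78
    (by norm_num) (by decide +kernel)

theorem closeNextPrimeOn_679_687 : CloseNextPrimeOn 679 687 :=
  closeNextPrimeOn_of_certify
    0x18f9a6a01753545b2ae84904174a038d4c144de01169b8767338b0c8bda5c0b6d6d9bf940d45
    13 14 7 54 4093 1 _ _ 2634 22012069627
    0xce7e6607e8224a14d53a97a9fa897e9abedb1add598c95a244a11f489413a78166264a107261beddfdadd2f0e678836bd3c8b3f566414e15cda410a48547d996528e9794eba9d3811c3197a2290c9e7a778e2d30bfa87cc6c5216314d566aa5f91464ece7cd414ef8a0ad51b08441c424bb9c1e213abad791258320b67588dd0d836220cbc76788caefcf2b23e1730cec1c3d561e72de4b7023e9d6220ab9db6a5bbfb4c7b82ce0009ab69a94a03b6bd1f5730eb9e3bc8b90e9539013a3e221c2cc1962fe38346f311a94bba30447750628f3e5855ebba972aa878ffbd710916a2a8bc4e3b76e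7af9d4965aa21ba65c11fa745226c9bc88a20e49b2bf7b43df5ad072492b9c07bc39478cd13fba6fb40420472afec916984cb975249936ba998d20fe55750562dc42513a9e06744b2c78ec66fb6c659a118d19a8a9bcbd4807ce049fc2732d173f8795afbb306664e314a20db3b9d8494777866ad34f0feaeea6f22927b21fb32ff454573cb704d821809fa8b607e5b6425b4a0a75e49d6981e278820cd4ab56d037773c3fc03f08ab37c2bca2a3070435bd0aa158f3cfc9c19230df63b70b5d0ecc74903101fe0f47193d2f481021ea5a2ad95349a2e5c01eff9a5e3ef160e5d98ae857e3e3dc495177fc869505858542fcd896bc75db5bc3d4f16ea2a80bf6b9facf7f97ef5d38d1213f6e21f71fe5e47de452504b43a7a9bd8f1f13c56089c6e47c45a62cd65923ae5f887157afb16bdd8f3b378d03f281b12ae88e5f2b2eb25a12573e09b8b854c9709452dd36ebb9cc794367a8ba6162f0473dd5ab6affbd573ec09a4d32e0ad67a574aa1756abc36a60911b7fbec916c3a3c7f9fc163875a389eff92a4f2b8963675f1a555bccdcf84046202d898f698142b57e3e3d6eae3892c672fc6becfe37595587998d09a34eba881021eeee0545fc19a1d5a54cdf04e23478eb9d22e0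3a773404e66fe724a3eb699e10aa446180ff5a9577fe21a5ee63124b12fb43b2a14b6e386d890c53c7e8c339bb9d3a1298cfed59feadd11bc013705fb88b59472533c3e1ade1ae2b7b988b99b628decc1c8710d79c9ca67be0ac95daf209b9091d5ffc3b7b3f27b9a962a0e9f6e43c9dbcda5b4b4badb5150802a7e4ee39dea220d2ae62e79ff9b344f90e31d6f6c87178370da0dff80c88ccb19f47ebbbf4a8d8085164cb968883414fbdb4c43e1aecb2ea9be149b1de7ff20483ada63b64a0a7239a04660f9691f6600fabaeb33b8cbfb486b80f4388565af287f909803b2912d3877e0273eb070f46c8f605f82470f46a158dc97511c77c173fcc797773616cbebed361566cc270036304fd014b23844b65c5e7baf30061803b22899d552f69301205d5faa56a62bfdcc9a2846e37c4e9f3a80b527baf3596de71cfbc142c6bc4c89ccd0c0e96eadfca39414caa2de732e9313a8ced3c94860de0d1ec2037001c4db26f938b751c32a17f273a3d327205be40ec06c53cf5800105a34a86a981f1353e0a41f89de18c8396c8d2b4b0f27ee868943457e3d0a0ffc49a69ad26ce23fe46ae9ab0595b92bd5fc961da5729b4ed18d5992db63ccc72f5b29c2ca19e6e6941b23759d8f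513c83750717ca2869fa9f38ced05042eb57273856aa895ae63b5579191c52f4b365ef7cdd4fef2e398ef0e3b6e9d11942f79f43a3d78344f87af64a785b940fc055fe7bb224afd4058a98d3d54eae3f21339b5cd1fbdde72ec6ba2a73aa090ffcf53e44126c9d78447751e197cc80d08fc3de249e71c8abcd4a2b4104d5d1274f86c127cc099282017ef5a8dc69a901fabcde52a5aca496bd806cc61eb38ec803e58fd2a53ae3c5377d322abe8fe2b7c9c0c10e6a4aa4006bc1f9697a8380e78236ad86da19257fed531ae032a0c844add56a3d7264184a3b8d71d7b8b399821cc492f8a6e3064398787b83a4edebdeb748618e10a02b87dcb3f8aaf56dc748d3a51b6f532fc640ccb2b9812789d8fa4cb2f955611e2f01f9882c24483523192aa1404c6d75ca37f27f916200339a97e4136c123d368a729421e4f69427bf71420f48b4718f6728f81dfb2104d8d7f7e016c6af46072c1a33b6a9620c937777a8181472bc695fcd85584ae328aad69e970f7f710406b423ec91ecd2a2e546cb30f785889aee3e24472dde81042d5d546fbc44d7bf389ea7aeafdb917b84b73fc3dd5a1c5c8b80dacc4d48e5e84f528d51ed5d56fb76ae152ffea497d6c7a2c316afa403ba64e57f8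0f468e8a1c0d9fa4b032cadf9fde3ed362ecc55b07453c5c18f301835a0ceb894e8563b0b467413a94cb5de0eba32d9c9a4bb92d24ba23c287dc055deecaa725d657d4cfa66d114b2ae26dd53ab472de1dd3d0b9a8b1c50029e7bd5fa0159b70b5b8667ce985ef464cd1dd7b4dea0e9a885fe2c92c723e42ca06f5546f6057327e89e6641c245799c444fc2a78892884065a7d1ed73449a13a1e2a7f9ef9115681fd5fc0577d64b07a43601e7c2a3d98e9596897208eb8bbe8b805ff50f2fe802a340919951456c4170fa5c622cf1c28bc0c8d82ef727c4da7a319d6bbd27ff166200d16e8ffdc66a0e031bd2be8e8fa139447d3391b0879a1bbc730325c38274569696417e5e946d86fc040c108e0e20b1699cc02cf0b3022ce877613077a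
    (by norm_num) (by decide +kernel)

theorem closeNextPrimeOn_687_695 : CloseNextPrimeOn 687 695 :=
  closeNextPrimeOn_of_certify
    0x16bb38a7b53ad7c6fa0d6a74b9325d3b9a3e7ae0efd938e3cede98e6b49bdc66698c2f5dc013cd
    13 14 12 55 4093 1 _ _ 2667 755779213
    0x9321dc2506e55a52bae88a3a923a06bea873ead11aeb8cbab47e65912fdae4f287c340993967e66f577927644af66267637ea9f26ee84e7322a914804724c12043ec5f8f996e2f8a107e4398f0bdee2b0388aa7994cfb2a6ad9806923f21b85703ce734cb8b71c10ecd0994ada61adbe8312ed8a84d5255bd9c8437c7b2220c6e91a816993d05d0b2aefbb27f16ba44f95671dbca11fce6ff408822de91b9d4a5a7e8a933ae35b91d44cb3f623e74a47cc0368f5b3805b9d7fdb9dffbc1986fa48f2c25e1188fa8f171600f0b97f2bd1947a64fe471d3ca2f510b1d937b6b09a4cdd10c64108b44fbd2da302e70ded0745991c3af1a21999a317d41c0ca9417b61291087def115f6734887214c36d655f3473f89c2131873f384818a6d1832d2a8409c74331690dfaeccf6643ab0c1d22095a0df8f928a795c167d82e0f99daabe7229a576c03c4270b4ad3f59e2e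a6acc7a4c10a23dcd39a39a5f16266854442fcf0c67bc07d8f5f9a7920e930535875e95a6a2afd3ac24c8ee3d83074182f2b4d0da91084c456052a6c4d7405cfedd85f907963133506f27193dc588e89656757b5ce8521a2c82834c5c66c4aa2b6a0f0b6a8675c3b0f4d074fff57b6ad93a4ea6a709f24959bc6358e81cfb51c348a747b19114826d9e5453882eca2918c0775485302d1e067007953658e55ae44a854ee29e6f1bbfd741b070a1cb01213dbd588570603f6935c3cd3fe14682413d9b590bcdcec4a8f3049779d453ea825a1565eb4ed3a2da8f13f435bfced3a4fe2e5e8846a711cbfb141bfcc698228086a9ed638e21e1a71cd96879980f6c2830d0fc4d822d79a07e70a9404b3bffe29dc07652b3ded8ef70891a489cf28dbd799283f5871f612fcef1e2179edf5ae2b8c00462f348648ac10fb8070c15be68e15c5256ff8f794e54395b49d68030cb854f38e0869c8cc47729c1f0ec3154a12c795d4d6b193f1096269871628219631e24be1af1ba0b57b7ab32feeefd8be7126d6f938476ad2abe1b0120e9152f3e06bc4f4132a3eed28fc491eb796bca947c6c9c18ab10e5eb03c4542932c3db3343368ef7c2c46172a73157c639f731ff93066033bcee499737402002e3984c4558ff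a4c2d639887c014f3aa77633aec267c0e0d0ec17263ebc0c91c66adceb6117f3448e69b4ad329a0246e1ae7040dcb580540101a1399a8dfce782d075ee3bf33d7c03cbfba2456598c3c5d89ca8ad87ee16a92fe0eefac877a5b141ab3d52ea8bc60f8f382ca71b015e7b967831061897dc93c0fcecdbe1eb0b760aa51fa9e5878cd3b26437e573f746e83ac1ddce4a02be87e913e31356a2480fc03fecfde3374485449af594b7a374755b0d6d1159c17f00c1b011fc0ca1842b6b75cf1cae23ad51b2fc66fc232c4c7d736761db3a81baf98c143ceb14e7d40820e754c29164c17f38d5f06aeef6ae38e4589cb32d4ec2a73f297cfa7e424f2addefc99d5f82c229296701de041972f6b79670db1fa162fc2982d566b8eddc10d22aa7cc49edb47bb49e309af475ebfdef546208f9fcd0474b28386dc608d2b9fb8d34ac047c6d91c49162ff885087724c7097877ab6eee2566cc07d68efa621ffa88ef309054a7616acbdd7121b6e344c8aeb41d18c2ad596c6ce14f7a1ab18f43f49ce9c7c1d43bbe2f80d9142a77ee8ae7aacc64bbd8aa190129f532d89376dd53d47f277eb98193220b6d07b4ab30d8c6d21e568f0ffb1f86fd4af47f6d0d87ebd369991f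342605459aa855c5801a62efa52b01c8eef1f48f2a2314487bd56a97783484197fa7d96c9a8ed29e44762c129961c9e2ccc82e19520ff387a05de0542f81041deebb2bd6cb73288f5e119874c687ab9a3312d3095776638f5ff3e3253d5bfc3bb8926f3928331952f542dfa0fe2cd497ec625ce82f7930bceb753f633616d48c7aeea89c673a74eda087c1d1f9f866e5a68afb6e043893dfc4de0c3fd3d0fcd7b42158e0b4f28cbd65aceb5e4bd7549298d62fa3811e25ad61988608c767ba7123931f088e4c6cca9d454aaebc08472f52db72776807196a8fad5e692d5fa20c81e592d5c7950d68ef8c862d0a0b4f59e9f4243f4126bfa44d6ff3e6aac353e04a28b4888ffdd4df6c726804accbb6f31bbb8233a39a75d36f886125d8ee60f5ea3a4d55b2831a1773fc5c7f01b87ca38e70ee46b3c8dbdedc7417a1a031464cb1135960393f6274d93d6970f9f617cb9373a1c2ff72e4f7125ef921867f2e553d514ba01456ae8daf875b05407015d0a53133fddce3690f6374a6aed6dd1bc31b27cf8a4f8ccfe86e661d4fc620f1fb975025892581076e1edffd4c24da447167628e6b2d7facdf7a187501d3c6d9cbd2e5130c939de99874392660194b4084975448083e4c4113a635503ef8e1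9e0700add504f43a9b7802a3dffebd3d783f03a8a07db9111ab50581660fafebef20742f2aecc6d663ded33b1e9e1760e82d8697a0b30f5c8f8ea64dc71b601b77f9f5ed664c4fc9d60e42176a0b992949fd578c8d012c6d065cc0a5577e458917e6d9b1bb3c8fbe5ee0171d984cd55a303b9558131b1525694257917bce6cdc6978dd41ffb4150d97809a4574052298d8f71ce05602d50c80c07427df9b254971bd744d35beb692c606c92097aa553ae8b0d0306047d8e2d3322b239b56fd73d1233f13190842709e276583a8e2bb125
    (by norm_num) (by decide +kernel)

theorem closeNextPrimeOn_695_707 : CloseNextPrimeOn 695 707 :=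
  closeNextPrimeOn_of_certify
    0x16bb38a7b53ad7c6fa0d6a74b9325d3b9a3e7ae0efd938e3cede98e6b49bdc66698c2f5dc013cd
    14 14 18 56 4093 1 _ _ 4054 3023116852
    0x1036b877c7ca298452150b1bf89c44915c40e5dd8b9fce295958077a1f094e97077572060d604c93cb33b03c0759dfcc85ed8648def66390f347719728b1a4b563515ce9943df94acf2d7a6c5262393578e069c8792754a5ca96fa95f2fb10abff4fdbd8f33bf792a6d87c47cf246545277d61afbbe6dc6e661091d252d8373beb10b20788fbc5a20a4b0998b53a2d323651f5dd0ba7c97abed8f42a549bbcdc3499a1ab3ecff620ff7160e546e01b04a4a477995be1eb378fc1e8808bbaf8d0df101173535ca7abd56ab8568e77f9e74a31dbb66ab83bf2c79831763844cbf610191b2f00a9d393d06495fe42eff608a648cfd7cef11accc5b2cb56d72be0b8b3afd1fe5c235b191aea5379bff2f33669b86ea56d868f140d8840211c417dd506b1b51aa76095a7c811377c0a5fa64bb378d2e5272d73564d9e6265eee77cfc16c6298afd86e081aac94232ff5146a4e9da58d8fd594481155437e3c3f9f109907d8120637df5350867ee9c843eb5dc62f64cbc98d4bdb0d235aa5094741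a0782873a39fbdd2c97b509013a208761226ba16d3f0daeff91fc5f5bb4f739549f78cc6241346a59e582b182615133ac3f15a1e3e8aa9085d3a3f306dfbbae8567ea0d0e851d005f2f3e68c7eee4bb4ea7c7af29a77876b2a36dc4f721625f766130fbe5e8f82d839e409ce41f895fe85810c5e73205eca755d528bac7c1d8d55ef7ad2ff0f01089fed9869af1b5167cdf5b6550b97f016407e2ade6da659818a9e2d1720b6f7c22bf32d3436b7f92ff5b68a0dc5a3a4c35a73c7135332dfce6f92fbe6a45659421d6062c61da43b155d0c9e3c41a802eb604d428fcaa22beaa7f112257d640c9e0649d09a5368a34f42a2e301d94bbef0accd4a222747381117fbdee3d15a475d713145391f7cd96f5481faaf83500065a6498f105da89c519b25ba5fb6a7a4f2b75058ed441655d7dcdfc866bab9c2038ac88b7a3a1189f4605ab62d3b30eebd511740df839e292ac57eb64436bb1b1ef38ca9e4ad622d403662f2906c1202eb1b38793300ae1223d0740ca962582021448298fc6a59df46dd1b6b6f7f3a72672c0dcde84563038d590f2d2e7779d3e7257ca0d9980fc296ec7691566bdf084ee7868db73cbdf759975c89babbb66a0a4561068e0fb9bb489a583f467f9b37e8409e0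c309d63226f494449f13fbd89efa52bed02063c0fedda5110a5cd2ea45e83a8a5977c06bbe97a749c266f4b1a168d20591ed7e80d2fbf5fd618cac3c127441315261d1c3b6defdfd354996409444a7e2b6754effe1c72eee315b48296df1b869f20071b1fe29cc572b0bdea2599200f27e1ef494aa9b4d7e7dd173ff881a0b3a0815f2a307b1cad412e6fbc044faa79a2ff577466312c88a44ce30d61d3ea468c1e4fc3e8224110c4510a1ecb9bdcf22ae39073cf77c3e1021ec086c5b6f0c21bdd52a452847dd6fab662a5eb25f5cc972c279df40b592f19ebceaa10c6afade993290765fe74d8417aef15ff1863fe6d20c3f15f4ca7e0c1312dc4e1ba26121728bebebf4220274b40740539ecc40d3f7f3134e527aa0d243e7c2e0d282339d01efd8ccb4cf355f95c746b14dddb8bd3964cd1270b393cf17d8fcc30d737c4d6d5fc1273137e53b2f2acb6a66cf2b954864d925411ee8bcd091810ca86e0f5eecc8e5e06e5455584757a8ab820c8a5cef7ccd503ca4981dcc25a3cf61f194b7045f0e797df78d8f37d8488e8e3abf004fafa3077f77351b8c9cced810d878d26db08abc83a1f21214e601bc7364149176ec9581214ae8cca22839d8d34e834a8a5a23cc9d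534bb9e603d23e0063623fe123c8a4eef7ad07b96d27952507748f172c8028ececacf3245d7b748b79e8e5354897524ed8d4354a0eb7847568f8476315f8000fb543cbfdbc6322af0577d91d8e9a67edfa372a4574e51381b35b7b8befe3c17a206550a53d33b3e8055200b31ea79f4e07947c29a6ccb29a48a7bd8f9cbc69c4f863bb5f415495bf5f77a04839c0dbb9a1a7bee860bd003dd864c1a81b3cbbbb95f5492e20fe81580e9dcf054b082ec0633ae9353e3d761cad8f053e1cdc68e096fd4d840f42df69963a5c11d74f55a7132fb9a7d0d997eac4f5453364558bf70b95021b0e1177e648cd9543c6bc37d082915cd8794238861bcf1ebcee026e037d9d6ecc45f9bad7f9dd30341d7ea163a10683f1386f84f4e438e77622adf8d6bc7c4a656fcfc23b9297c613cf28851be11aab49fe388a561684c7101be05af0c512c609f2e12702efc88a83d35314e3426e2d32067342ed3021b077e4b128ded0f8bd0359eff968e53d0cf84f08c9171f528eb2f566755c96cd21f2023c3ba6c3b9b1ebc484727b13d92c09eb5460e47419567ca6540e0c4de75521063f147912efd6094e11475178e8c8680a0b85c0ccdcf4ae95118a1aab69ca8498b6225759672f95b88a09c79d35b305306089b372a2c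ba8ab98df8c166db38fe35b7222f4b2285a4557718107e736dc6af1b00a3ca14f3c256cac471d385c7a5209d2f4d35fefdc06d7e51cd12690ea409b364cae9b93c7c978cceaf0004bb41bdb23b0cb1c6836b5284cdb1cacbf467761830b84961b3493e1556fbdb28da0afe981799d6fe46493dc712d18d7fadac10aafaad6aedc286143590ca025c52129920b25ad66d92b0697c2a662eb5f5b98dde52a10f000867a1c0b76ec103cee48526db8ab88c54e6e04e2de7db9f7b758f1eebfde605fa7afa38153bf76bdb7e8afb47c4e5cb518f3d00f551762c7424bff87022b08806f3eb665257901acb8a82f6ee00a063b08a9e385e6193e53bc770d6972b65b8c7ebb173b77d0cd57afdfa96e86772d05c92a0d0e7d5a5634925a8cf62777a358a949d615c723db391dea407eaa55c16e901665fdf8e1ea369f49ea4bd362b4586c530882c23eb81c9fd9d37d58d35a8120e7e54459dfa83705ec0f088e9bfef57400636c4c003e9e4842b036178aeaa7fcc0622f87aaa393ceafed16f8cf8a9a888d6773e736f9ca2f4d5a6309d8cbaf8a5b48bb0906ae474b3b278e465d4ff6d09ce92256208164c2950fcaca3569cb26d3bdb8fffd073444e547f8c839a837c722514f23601f246b9f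6f4fe52085b13f024ed202c9982ddbe0c8efe7a58c57b5d0ae389e523e2986506e59913c2df7ca8efde9f17ebbeee6c11cdeaae7b9c89f9954467958a3874a75deead49c26b01490692c16b6d1918e5d7fd082964de9c8d3db33c2ca90f5d6f192af2f64fa71b496a15e28ce042cb8f2e9a267ce762f530f6d34219db91c7b72c82ecde4aeaadac71c9ee267a456255047062faba317c9b0a27ef55a45bd0c657e948854ebdb4080ca93260cc9e61db3f3bf1f62502b3d8f77ed06561c10e4805a20b77967459f97c6e9693bd369592de027a0686c3ecb4fd63554f25bf7ea83e7ba27417b7a7983364c97cf4a7e716d9e8b359bd95d215486817407cfead9e1e9923ed9a3f3c0fc303eae94eda9c82b9f9febb74ef2396f88184ff1e6f424c4a1b27d033a7cbaa7c317521b3f20c949aa12d49faf225a1e17c13d5a84265cebea63e2d456d8a24ca7989140701a4bf4c533f1351229bc952962cf646e6f3ac5d53cf7c62e4de7dec4b4856a3f714dbd09f1ec8861f913ff2126200c136d1086b4e86f62cb1f7aace0c51601caa600272b1dae9cf6c380c1a50be3d4bba6e9f1d0238f8aff45eef43509640ea96936fdcb878adbd02cbf0eca495ec2320ce2719553ee4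afe67a2efe1e5b597ffa7233431af789e3aa4f7b7d768189144ef6a47c9fa25f637b18a75d48302fded82db5d3f6e61f71f7790ce52a6de5fc874ffc9e93706282abcc9d2b173ffd4262985cc280a0ea8fe369fa62ffb2b5f0afe380a3ba24a8c872271da36ebd1f3aecfe9c43536a6681b7c85b9a68b75b783fbfa680573f5da408f3f736042578df829b10d0b02859aaf2754f6a7d578e6bb67bbdfca85e8ca2aed7f262169fdb4a4330e501d98036787138b254d6fdb0fcbd3d11663cf7d11ee12b0b664f5c013e105ba6ba729389a98b0efd83850f2cc28b7821d43f5dcc104fa82aa0f8aa2284d0fb9af15933b4f19ed3c9439db7a3601791320a53dcdda8264cea2e28e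
    (by norm_num) (by decide +kernel)

theorem closeNextPrimeOn_24_707 : CloseNextPrimeOn 24 707 :=
  closeNextPrimeOn_24_27 |>.trans closeNextPrimeOn_27_31
    |>.trans closeNextPrimeOn_31_37 |>.trans closeNextPrimeOn_37_45
    |>.trans closeNextPrimeOn_45_57 |>.trans closeNextPrimeOn_57_71
    |>.trans closeNextPrimeOn_71_87 |>.trans closeNextPrimeOn_87_103
    |>.trans closeNextPrimeOn_103_119 |>.trans closeNextPrimeOn_119_135
    |>.trans closeNextPrimeOn_135_151 |>.trans closeNextPrimeOn_151_167
    |>.trans closeNextPrimeOn_167_183 |>.trans closeNextPrimeOn_183_199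
    |>.trans closeNextPrimeOn_199_215 |>.trans closeNextPrimeOn_215_231
    |>.trans closeNextPrimeOn_231_247 |>.trans closeNextPrimeOn_247_263
    |>.trans closeNextPrimeOn_263_279 |>.trans closeNextPrimeOn_279_295
    |>.trans closeNextPrimeOn_295_311 |>.trans closeNextPrimeOn_311_327
    |>.trans closeNextPrimeOn_327_343 |>.trans closeNextPrimeOn_343_359
    |>.trans closeNextPrimeOn_359_375 |>.trans closeNextPrimeOn_375_391
    |>.trans closeNextPrimeOn_391_407 |>.trans closeNextPrimeOn_407_423
    |>.trans closeNextPrimeOn_423_439 |>.trans closeNextPrimeOn_439_455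
    |>.trans closeNextPrimeOn_455_471 |>.trans closeNextPrimeOn_471_487
    |>.trans closeNextPrimeOn_487_503 |>.trans closeNextPrimeOn_503_519
    |>.trans closeNextPrimeOn_519_535 |>.trans closeNextPrimeOn_535_551
    |>.trans closeNextPrimeOn_551_567 |>.trans closeNextPrimeOn_567_583
    |>.trans closeNextPrimeOn_583_599 |>.trans closeNextPrimeOn_599_615
    |>.trans closeNextPrimeOn_615_631 |>.trans closeNextPrimeOn_631_647
    |>.trans closeNextPrimeOn_647_655 |>.trans closeNextPrimeOn_655_663
    |>.trans closeNextPrimeOn_663_671 |>.trans closeNextPrimeOn_671_679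
    |>.trans closeNextPrimeOn_679_687 |>.trans closeNextPrimeOn_687_695
    |>.trans closeNextPrimeOn_695_707

theorem lt_two_pow_of_log_lt {p : ℕ} (hp0 : 0 < p) (hp : Real.log p < 490) : p ≤ 2 ^ 707 := by
  have h : Real.log p < Real.log ((2 ^ 707 : ℕ) : ℝ) := by
    rw [Nat.cast_pow, Real.log_pow]
    have := Real.log_two_gt_d9
    push_cast
    linarith
  have hp0' : (0 : ℝ) < p := by exact_mod_cast hp0
  exact_mod_cast ((Real.log_lt_log_iff hp0' (by positivity)).1 h).le

theorem one_point_one_lt_log {p : ℕ} (hp : 5 ≤ p) : 1.1 < Real.log p := by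
  have h4 : Real.log 4 ≤ Real.log p :=
    Real.log_le_log (by norm_num) (by exact_mod_cast (by omega : 4 ≤ p))
  have h : Real.log 4 = 2 * Real.log 2 := by
    rw [show (4 : ℝ) = 2 ^ 2 by norm_num, Real.log_pow]
    norm_num
  have := Real.log_two_gt_d9
  linarith

theorem exists_prime_lt_add_div {p : ℕ} (hp : 5 ≤ p) :
    ∃ r : ℕ, r.Prime ∧ p < r ∧ (r : ℝ) < p + p / (Real.log p - 1.1) := by
  rcases le_or_gt 490 (Real.log p) with hlog | hlog
  · exact exists_prime_of_le_log hlog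
  have hclose : HasCloseNextPrime p := by
    rcases le_or_gt p (2 ^ 24) with h | h
    · exact hasCloseNextPrime_of_le_two_pow hp h
    · exact closeNextPrimeOn_24_707 p h (lt_two_pow_of_log_lt (by omega) hlog)
  obtain ⟨r, hr, hpr, h⟩ := hclose
  refine ⟨r, hr, hpr, ?_⟩
  rw [← lt_div_iff₀ (sub_pos.2 (one_point_one_lt_log hp))] at h
  linarith

end PrimeGap

theorem prime_gap_lt_div (p q : ℕ) (hp : p.Prime) (hp5 : 5 ≤ p) (hq : q.Prime)
    (hpq : p < q) (hnext : ∀ r, r.Prime → p < r → q ≤ r) :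
    ((q : ℝ) - p) < p / (Real.log p - 1.1) := by
  obtain ⟨r, hr, hpr, h⟩ := PrimeGap.exists_prime_lt_add_div hp5
  have hqr : (q : ℝ) ≤ r := by exact_mod_cast hnext r hr hpr
  linarith
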